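/- Let n ≥ 3 and let σ be a smooth asymptotically flat Riemannian metric on ℝⁿ. Let u ∈ C^∞(ℝⁿ×(0,∞)) ∩ C⁰(ℝⁿ×[0,∞)) be a uniformly spacelike solution of the graphical mean curvature flow ∂_t u = g^{ij}(σ,∇u)(∇²_σ u)_{ij} such that: there is b : ℝⁿ → (0,∞) with |u(x,t)| ≤ b(x) for all (x,t) and b(x) → 0 as |x| → ∞; and for every multi-index order l ≥ 1, sup over ℝⁿ×[1,∞) of |∂^l_x u| is finite. Then u(·,t) → 0 as t → ∞ uniformly in C^l for every l ∈ ℕ₀; more precisely, for each l ∈ ℕ₀ there exists a function v_l : (0,∞) → ℝ with v_l(t) → 0 as t → ∞ such that ‖u(·,t)‖_{C^l(ℝⁿ)} ≤ v_l(t), where ‖·‖_{C^l} denotes the supremum over ℝⁿ of all partial derivatives up to order l. -/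

import Mathlib

noncomputable section
open Real Set Filter MeasureTheory Metric ENNReal

/-- Partial derivative of `f` at `x` in the `i`-th coordinate direction. -/
def pd {n : ℕ} (i : Fin n) (f : EuclideanSpace ℝ (Fin n) → ℝ) (x : EuclideanSpace ℝ (Fin n)) : ℝ :=
  fderiv ℝ f x (EuclideanSpace.single i 1)

/-- `|∇u|²_σ = σ^{ij} ∂_i u ∂_j u`. -/
def gradSq {n : ℕ} (σ : EuclideanSpace ℝ (Fin n) → Matrix (Fin n) (Fin n) ℝ)
    (u : EuclideanSpace ℝ (Fin n) → ℝ) (x : EuclideanSpace ℝ (Fin n)) : ℝ :=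
  ∑ i, ∑ j, (σ x)⁻¹ i j * pd i u x * pd j u x

/-- Christoffel symbols `Γ^k_{ij}` of the metric `σ`. -/
def christoffel {n : ℕ} (σ : EuclideanSpace ℝ (Fin n) → Matrix (Fin n) (Fin n) ℝ)
    (k i j : Fin n) (x : EuclideanSpace ℝ (Fin n)) : ℝ :=
  (1 / 2) * ∑ l, (σ x)⁻¹ k l *
    (pd j (fun y => σ y l i) x + pd i (fun y => σ y l j) x - pd l (fun y => σ y i j) x)

/-- Covariant Hessian `(∇²_σ u)_{ij} = ∂_i ∂_j u − Γ^k_{ij} ∂_k u`. -/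
def covHess {n : ℕ} (σ : EuclideanSpace ℝ (Fin n) → Matrix (Fin n) (Fin n) ℝ)
    (u : EuclideanSpace ℝ (Fin n) → ℝ) (i j : Fin n) (x : EuclideanSpace ℝ (Fin n)) : ℝ :=
  pd i (fun y => pd j u y) x - ∑ k, christoffel σ k i j x * pd k u x

/-- `g^{ij}(σ,∇u) = σ^{ij} + σ^{ik}σ^{jl}∂_k u ∂_l u/(1 − |∇u|²_σ)`. -/
def ginv {n : ℕ} (σ : EuclideanSpace ℝ (Fin n) → Matrix (Fin n) (Fin n) ℝ)
    (u : EuclideanSpace ℝ (Fin n) → ℝ) (i j : Fin n) (x : EuclideanSpace ℝ (Fin n)) : ℝ :=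
  (σ x)⁻¹ i j + (∑ k, ∑ l, (σ x)⁻¹ i k * (σ x)⁻¹ j l * pd k u x * pd l u x) / (1 - gradSq σ u x)

/-- Graphical mean curvature operator `g^{ij}(σ,∇u)(∇²_σ u)_{ij}`. -/
def mcfOp {n : ℕ} (σ : EuclideanSpace ℝ (Fin n) → Matrix (Fin n) (Fin n) ℝ)
    (u : EuclideanSpace ℝ (Fin n) → ℝ) (x : EuclideanSpace ℝ (Fin n)) : ℝ :=
  ∑ i, ∑ j, ginv σ u i j x * covHess σ u i j x

/-- `σ` is a smooth asymptotically flat Riemannian metric on ℝⁿ with data `(R₀, C, ω)`. -/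
def IsAsympFlat {n : ℕ} (σ : EuclideanSpace ℝ (Fin n) → Matrix (Fin n) (Fin n) ℝ)
    (R₀ C : ℝ) (ω : ℝ → ℝ) : Prop :=
  0 < R₀ ∧ 0 < C ∧
  (∀ i j, ContDiff ℝ (⊤ : ℕ∞) fun x => σ x i j) ∧
  (∀ x, (σ x).PosDef) ∧
  (∃ B, ∀ ξ, R₀ < ξ → 0 < ω ξ ∧ ω ξ ≤ B) ∧
  Tendsto ω atTop (nhds 0) ∧
  ∀ x : EuclideanSpace ℝ (Fin n), R₀ ≤ ‖x‖ →
    (∀ i j, |σ x i j - (1 : Matrix (Fin n) (Fin n) ℝ) i j| ≤ C * ω ‖x‖) ∧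
    (∀ i j k, |pd k (fun y => σ y i j) x| ≤ C * ω ‖x‖ / ‖x‖)

section

open scoped ContDiff Topology
open Finset (sum_congr mul_sum sum_le_sum sum_nonneg sum_add_distrib sum_sub_distrib
  abs_sum_le_sum_abs single_le_sum sum_mul sum_comm sum_neg_distrib sum_const card_univ sum_div
  sum_mul_sum sum_insert sum_eq_zero add_sum_erase)
open Finset.HasAntidiagonal (antidiagonal mem_antidiagonal)
open EuclideanSpace (single)

variable {ι : Type*} {n : ℕ} {a b c d h lam q r s t t₀ t₁ t₂ ta tb ts B C
  K L M N R R₀ S T Z δ ε κ μ ρ τ : ℝ}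

section

/-- Directional derivative. -/
def dd {V : Type*} [NormedAddCommGroup V] [NormedSpace ℝ V] (e : V) (f : V → ℝ) (p : V) : ℝ :=
  fderiv ℝ f p e

section dd
variable {V : Type*} [NormedAddCommGroup V] [NormedSpace ℝ V]

lemma ContDiff.dd {f : V → ℝ} (hf : ContDiff ℝ ∞ f) (e : V) : ContDiff ℝ ∞ (dd e f) :=
  (hf.fderiv_right (by simp)).clm_apply contDiff_const

lemma dd_comm {f : V → ℝ} (hf : ContDiff ℝ ∞ f) (e e' : V) :
    dd e (dd e' f) = dd e' (dd e f) := by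
  have h2 : ContDiff ℝ ∞ (fderiv ℝ f) := hf.fderiv_right (by simp)
  have key : ∀ (a c : V) (p : V), _root_.dd a (_root_.dd c f) p = fderiv ℝ (fderiv ℝ f) p a c := by
    intro a c p
    have hd := (h2.differentiable (by simp)) p
    change fderiv ℝ (fun q => fderiv ℝ f q c) p a = _
    rw [fderiv_clm_apply hd (by fun_prop)]
    simp
  funext p
  rw [key, key]
  exact second_derivative_symmetric (f' := fderiv ℝ f)
    (fun y => ((hf.differentiable (by simp)) y).hasFDerivAt)
    ((h2.differentiable (by simp)) p).hasFDerivAt e e'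

lemma dd_mul {f g : V → ℝ} (hf : ContDiff ℝ ∞ f) (hg : ContDiff ℝ ∞ g) (e p : V) :
    dd e (fun q => f q * g q) p = dd e f p * g p + f p * dd e g p := by
  change fderiv ℝ (fun q => f q * g q) p e = _
  rw [fderiv_fun_mul ((hf.differentiable (by simp)) p) ((hg.differentiable (by simp)) p)]
  simp [dd]
  ring

lemma dd_add {f g : V → ℝ} (hf : ContDiff ℝ ∞ f) (hg : ContDiff ℝ ∞ g) (e p : V) :
    dd e (fun q => f q + g q) p = dd e f p + dd e g p := by
  change fderiv ℝ (fun q => f q + g q) p e = _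
  rw [fderiv_fun_add ((hf.differentiable (by simp)) p) ((hg.differentiable (by simp)) p)]
  simp [dd]

lemma dd_sub {f g : V → ℝ} (hf : ContDiff ℝ ∞ f) (hg : ContDiff ℝ ∞ g) (e p : V) :
    dd e (fun q => f q - g q) p = dd e f p - dd e g p := by
  change fderiv ℝ (fun q => f q - g q) p e = _
  rw [fderiv_fun_sub ((hf.differentiable (by simp)) p) ((hg.differentiable (by simp)) p)]
  simp [dd]

lemma dd_const_mul {f : V → ℝ} (hf : ContDiff ℝ ∞ f) (c : ℝ) (e p : V) :
    dd e (fun q => c * f q) p = c * dd e f p := by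
  change fderiv ℝ (fun q => c * f q) p e = _
  rw [fderiv_const_mul ((hf.differentiable (by simp)) p)]
  simp [dd]

lemma dd_sum (s : Finset ι) {f : ι → V → ℝ} (hf : ∀ i ∈ s, ContDiff ℝ ∞ (f i))
    (e p : V) : dd e (fun q => ∑ i ∈ s, f i q) p = ∑ i ∈ s, dd e (f i) p := by
  change fderiv ℝ (fun q => ∑ i ∈ s, f i q) p e = _
  rw [fderiv_fun_sum (fun i hi => ((hf i hi).differentiable (by simp)) p)]
  simp [dd]

lemma dd_sub_const (f : V → ℝ) (c : ℝ) (e : V) :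
    dd e (fun q => f q - c) = dd e f := by
  funext p
  change fderiv ℝ (fun q => f q - c) p e = _
  rw [fderiv_sub_const]; rfl

lemma dd_eq_zero_of_eventually {f : V → ℝ} {p : V} (h : ∀ᶠ q in 𝓝 p, f q = 0) (e : V) :
    dd e f p = 0 := by
  have : f =ᶠ[𝓝 p] (fun _ => 0) := h
  simp [dd, this.fderiv_eq]

lemma hasDerivAt_line {f : V → ℝ} (hf : ContDiff ℝ ∞ f) (γ : ℝ → V) (γ' : V) (t : ℝ)
    (hγ : HasDerivAt γ γ' t) : HasDerivAt (fun s => f (γ s)) (dd γ' f (γ t)) t :=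
  (((hf.differentiable (by simp)) (γ t)).hasFDerivAt).comp_hasDerivAt t hγ

end dd

abbrev Eu (n : ℕ) := EuclideanSpace ℝ (Fin n)
/-- Space-time. -/
abbrev SpT (n : ℕ) := ℝ × EuclideanSpace ℝ (Fin n)

/-- Time direction. -/
def et : SpT n := (1, 0)
/-- Space directions. -/
def ex (i : Fin n) : SpT n := (0, single i 1)

/-- Smooth functions on space-time vanishing outside a spatial ball. -/
def SmC (f : SpT n → ℝ) : Prop :=
  ContDiff ℝ ∞ f ∧ ∃ R : ℝ, ∀ p : SpT n, R < ‖p.2‖ → f p = 0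

namespace SmC
variable {f g : SpT n → ℝ}

lemma dd (hf : SmC f) (e : SpT n) : SmC (dd e f) := by
  refine ⟨hf.1.dd e, ?_⟩
  obtain ⟨R, hR⟩ := hf.2
  refine ⟨R, fun p hp => dd_eq_zero_of_eventually ?_ e⟩
  have : IsOpen {q : SpT n | R < ‖q.2‖} := isOpen_lt continuous_const (by fun_prop)
  filter_upwards [this.mem_nhds hp] with q hq using hR q hq

lemma mul_left (hf : SmC f) (hg : ContDiff ℝ ∞ g) : SmC (fun p => g p * f p) :=
  ⟨hg.mul hf.1, hf.2.imp fun R hR p hp => by simp [hR p hp]⟩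

lemma add (hf : SmC f) (hg : SmC g) : SmC (fun p => f p + g p) := by
  obtain ⟨R, hR⟩ := hf.2
  obtain ⟨S, hS⟩ := hg.2
  exact ⟨hf.1.add hg.1, max R S, fun p hp => by
    beta_reduce
    rw [hR p (lt_of_le_of_lt (le_max_left _ _) hp), hS p (lt_of_le_of_lt (le_max_right _ _) hp)]
    simp⟩

lemma const_mul (hf : SmC f) (c : ℝ) : SmC (fun p => c * f p) := hf.mul_left contDiff_const

lemma sub (hf : SmC f) (hg : SmC g) : SmC (fun p => f p - g p) := by
  simpa [sub_eq_add_neg] using hf.add (hg.const_mul (-1))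

lemma sum (s : Finset ι) {f : ι → SpT n → ℝ} (hf : ∀ i ∈ s, SmC (f i)) :
    SmC (fun p => ∑ i ∈ s, f i p) := by
  classical
  induction s using Finset.induction_on with
  | empty => exact ⟨by simpa using contDiff_const, 0, by simp⟩
  | insert a s ha ih =>
    simp only [sum_insert ha]
    exact (hf a (by simp)).add (ih fun i hi => hf i (by simp [hi]))

/-- Boundedness on compact time intervals. -/
lemma bound (hf : SmC f) (a b : ℝ) : ∃ M, 0 ≤ M ∧ ∀ p : SpT n, p.1 ∈ Icc a b → |f p| ≤ M := by
  obtain ⟨R, hR⟩ := hf.2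
  have hK : IsCompact (Icc a b ×ˢ closedBall (0 : Eu n) R) := isCompact_Icc.prod (isCompact_closedBall _ _)
  obtain ⟨M, hM⟩ := hK.exists_bound_of_continuousOn hf.1.continuous.continuousOn
  refine ⟨max M 0, le_max_right _ _, fun p hp => ?_⟩
  by_cases h : ‖p.2‖ ≤ R
  · exact (hM p ⟨hp, by simpa using h⟩).trans (le_max_left _ _)
  · rw [hR p (not_le.mp h)]; simp

lemma slice_hasCompactSupport (hf : SmC f) (t : ℝ) : HasCompactSupport (fun x => f (t, x)) := by
  obtain ⟨R, hR⟩ := hf.2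
  refine HasCompactSupport.intro (isCompact_closedBall 0 R) fun x hx => hR _ ?_
  simpa using hx

lemma slice_contDiff (hf : SmC f) (t : ℝ) : ContDiff ℝ ∞ (fun x => f (t, x)) :=
  hf.1.comp (contDiff_const.prodMk contDiff_id)

end SmC

lemma pd_slice {f : SpT n → ℝ} (hf : ContDiff ℝ ∞ f) (i : Fin n) (t : ℝ) (x : Eu n) :
    pd i (fun y => f (t, y)) x = dd (ex i) f (t, x) := by
  have h2 := (((hf.differentiable (by simp)) (t, x)).hasFDerivAt).comp x
      (hasFDerivAt_prodMk_right t x)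
  change fderiv ℝ (f ∘ fun y => (t, y)) x _ = _
  rw [h2.fderiv]
  simp [dd, ex]

end

variable {x y ξ : Eu n} {f w : Eu n → ℝ} {v F U : SpT n → ℝ} {u : ℝ → Eu n → ℝ} {A : Fin n → Fin n → ℝ}
  {W : ℝ → SpT n → ℝ} {σ : Eu n → Matrix (Fin n) (Fin n) ℝ} {Ω : ℝ → ℝ}

section

lemma integrable_gauss (hc : 0 < c) :
    Integrable (fun z : Eu n => exp (-(c * ‖z‖ ^ 2))) := by
  have h := GaussianFourier.integrable_cexp_neg_mul_sq_norm_add_of_euclideanSpace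
    (ι := Fin n) (b := c) (by simpa using hc) 0 0
  refine h.norm.congr (ae_of_all _ fun z => ?_)
  simp only [zero_mul, add_zero, Complex.norm_exp]
  congr 1
  rw [show (-(c : ℂ) * (‖z‖ : ℂ) ^ 2) = ((-(c * ‖z‖ ^ 2) : ℝ) : ℂ) by push_cast; ring]
  exact Complex.ofReal_re _

/-- Self-similar profile of a fundamental solution for `∂_t - A : D²`. -/
structure IsKer (A : Fin n → Fin n → ℝ) (k : Eu n → ℝ) (C c : ℝ) : Prop where
  c_pos : 0 < c
  C_pos : 0 < C
  smooth : ContDiff ℝ ∞ k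
  nonneg : ∀ z, 0 ≤ k z
  grad : ∀ i z, z i * k z = -2 * ∑ j, A i j * dd (single j 1) k z
  bd : ∀ z, k z ≤ C * exp (-(c * ‖z‖ ^ 2))
  bd1 : ∀ i z, |dd (single i 1) k z| ≤ C * exp (-(c * ‖z‖ ^ 2))
  lip : ∀ i z ζ, ‖ζ‖ ≤ 1 → |dd (single i 1) k (z + ζ) -
    dd (single i 1) k z| ≤ C * ‖ζ‖ * exp (-(c * ‖z‖ ^ 2))
  mass : 1 ≤ C * ∫ z, k z

namespace IsKer
variable {k : Eu n → ℝ}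

lemma integrable (hk : IsKer A k C c) : Integrable k :=
  ((integrable_gauss hk.c_pos).const_mul C).mono' hk.smooth.continuous.aestronglyMeasurable
    (ae_of_all _ fun z => by
      rw [norm_eq_abs, abs_of_nonneg (hk.nonneg z)]; exact hk.bd z)

lemma integrable_dd (hk : IsKer A k C c) (i : Fin n) :
    Integrable (dd (single i 1) k) :=
  ((integrable_gauss hk.c_pos).const_mul C).mono' (hk.smooth.dd _).continuous.aestronglyMeasurable
    (ae_of_all _ fun z => by rw [norm_eq_abs]; exact hk.bd1 i z)

lemma integrable_coord_mul (hk : IsKer A k C c) (i : Fin n) :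
    Integrable (fun z => z i * k z) := by
  simp only [hk.grad]
  exact (integrable_finsetSum _ fun j _ => (hk.integrable_dd j).const_mul (A i j)).const_mul _

/-- Integration by parts against a rescaled test function. -/
lemma ibp (hk : IsKer A k C c) {G : SpT n → ℝ} (hG : SmC G) (i : Fin n) (t r : ℝ) (x : Eu n) :
    ∫ z, dd (single i 1) k z * G (t, x - r • z) =
      r * ∫ z, k z * dd (ex i) G (t, x - r • z) := by
  rcases eq_or_ne r 0 with rfl | hr
  · simp only [zero_smul, sub_zero, zero_mul, integral_mul_const]
    have : ∫ z, dd (single i 1) k z = 0 := by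
      have h := integral_mul_fderiv_eq_neg_fderiv_mul_of_integrable (μ := volume)
        (f := fun _ : Eu n => (1:ℝ)) (g := k) (v := single i 1)
        (by simp) (by simp only [one_mul]; exact hk.integrable_dd i) (by simpa using hk.integrable)
        (fun _ _ => by fun_prop) (fun z _ => hk.smooth.differentiable (by simp) z)
      simpa [dd] using h
    rw [this, zero_mul]
  · obtain ⟨R, hR⟩ := hG.2
    set g : Eu n → ℝ := fun z => G (t, x - r • z) with hg
    have hgs : ContDiff ℝ ∞ g := hG.1.comp (by fun_prop)
    have hgc : HasCompactSupport g := by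
      refine HasCompactSupport.intro (isCompact_closedBall (0 : Eu n) ((‖x‖ + |R|) / |r|))
        fun z hz => hR _ ?_
      have : ‖x‖ + |R| < ‖r • z‖ := by
        rw [norm_smul, norm_eq_abs]
        rw [mem_closedBall, dist_zero_right, not_le, div_lt_iff₀ (abs_pos.mpr hr)] at hz
        linarith
      have h2 := norm_sub_norm_le (r • z) x
      rw [norm_sub_rev] at h2
      have := le_abs_self R
      simp only
      linarith
    have hgd : ∀ z, fderiv ℝ g z (single i 1) = - r * dd (ex i) G (t, x - r • z) := by
      intro z
      have h1 : HasDerivAt (fun s : ℝ => ((t, x - r • (z + s • single i (1:ℝ))) : SpT n))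
          (0, - (r • single i (1:ℝ))) 0 := by
        refine (hasDerivAt_const _ _).prodMk ?_
        have : HasDerivAt (fun s : ℝ => z + s • single i (1:ℝ))
            (single i (1:ℝ)) 0 := by
          simpa using ((hasDerivAt_id (0:ℝ)).smul_const (single i (1:ℝ))).const_add z
        exact (this.const_smul r).const_sub x
      have h2 := hasDerivAt_line hG.1 _ _ 0 h1
      have h3 : HasDerivAt (fun s : ℝ => g (z + s • single i (1:ℝ)))
          (fderiv ℝ g z (single i 1)) 0 := by
        have : HasDerivAt (fun s : ℝ => z + s • single i (1:ℝ))
            (single i (1:ℝ)) 0 := by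
          simpa using ((hasDerivAt_id (0:ℝ)).smul_const (single i (1:ℝ))).const_add z
        have h4 := hasDerivAt_line hgs _ _ 0 this
        simpa [dd] using h4
      rw [h3.unique h2]
      simp only [dd, zero_smul, add_zero, ex]
      rw [show ((0, -(r • single i (1:ℝ))) : SpT n) =
        (-r) • ((0, single i (1:ℝ)) : SpT n) by simp, map_smul, smul_eq_mul]
    have hcs : ∀ (a b : Eu n → ℝ), Continuous a → Continuous b → HasCompactSupport b →
        Integrable (fun z => a z * b z) := fun a b ha hb hbs =>
      (ha.mul hb).integrable_of_hasCompactSupport hbs.mul_left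
    have hcd := (ContDiff.dd hgs (single i 1)).continuous
    have h := integral_mul_fderiv_eq_neg_fderiv_mul_of_integrable
       
        (hcs _ _ (hk.smooth.dd _).continuous hgs.continuous hgc)
        (hcs _ _ hk.smooth.continuous hcd (hgc.fderiv_apply ℝ _))
        (hcs _ _ hk.smooth.continuous hgs.continuous hgc)
        (fun z _ => hk.smooth.differentiable (by simp) z)
        (fun z _ => hgs.differentiable (by simp) z)
    simp only [hgd] at h
    have h' : ∫ z, k z * (-r * dd (ex i) G (t, x - r • z)) =
        -r * ∫ z, k z * dd (ex i) G (t, x - r • z) := by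
      rw [← integral_const_mul]; congr 1; ext z; ring
    rw [h'] at h
    simp only [dd] at h ⊢
    linarith

end IsKer

/-- The constant coefficient operator `∂_t - A : D²`. -/
def heatOp (A : Fin n → Fin n → ℝ) (v : SpT n → ℝ) (p : SpT n) : ℝ :=
  dd et v p - ∑ i, ∑ j, A i j * dd (ex j) (dd (ex i) v) p

lemma SmC.heatOp (A : Fin n → Fin n → ℝ) (hv : SmC v) :
    SmC (heatOp A v) :=
  (hv.dd _).sub (SmC.sum _ fun _ _ => SmC.sum _ fun _ _ => ((hv.dd _).dd _).const_mul _)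

namespace IsKer
variable {k : Eu n → ℝ}

/-- Gaussian mean of `v` at time `τ` seen from `(b, x)`. -/
def _root_.kerMean (k : Eu n → ℝ) (v : SpT n → ℝ) (b : ℝ) (x : Eu n) (τ : ℝ) : ℝ :=
  ∫ z, k z * v (τ, x - √(b - τ) • z)

lemma integrable_mul {g : Eu n → ℝ} (hf : Integrable f)
    (hg : Continuous g) (hM : ∀ z, |g z| ≤ M) : Integrable (fun z => f z * g z) :=
  hf.mul_bdd (c := M) hg.aestronglyMeasurable (ae_of_all _ hM)

lemma kerMean_continuousOn (hk : IsKer A k C c) (hv : SmC v) (a b : ℝ)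
    (x : Eu n) : ContinuousOn (kerMean k v b x) (Icc a b) := by
  obtain ⟨M, hM0, hM⟩ := hv.bound a b
  have hvc := hv.1.continuous
  have hkc := hk.smooth.continuous
  refine continuousOn_of_dominated ?_ ?_ (hk.integrable.mul_const M) ?_
  · intro τ _
    exact (by fun_prop : Continuous fun z => k z * v (τ, x - √(b - τ) • z)).aestronglyMeasurable
  · intro τ hτ
    refine ae_of_all _ fun z => ?_
    rw [norm_mul, norm_eq_abs, norm_eq_abs, abs_of_nonneg (hk.nonneg z)]
    exact mul_le_mul_of_nonneg_left (hM _ hτ) (hk.nonneg z)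
  · refine ae_of_all _ fun z => ?_
    exact (by fun_prop : Continuous fun τ => k z * v (τ, x - √(b - τ) • z)).continuousOn

lemma kerMean_hasDerivAt (hk : IsKer A k C c) (hv : SmC v) (b : ℝ)
    (x : Eu n) (hτ : τ < b) :
    HasDerivAt (kerMean k v b x) (kerMean k (heatOp A v) b x τ) τ := by
  have hvc := hv.1.continuous
  have hkc := hk.smooth.continuous
  set ε := (b - τ) / 2 with hε
  have hε0 : 0 < ε := by simp only [hε]; linarith
  have hmem : ∀ s ∈ ball τ ε, s ∈ Icc (τ - ε) b ∧ ε ≤ b - s := by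
    intro s hs
    rw [mem_ball, dist_eq, abs_lt] at hs
    constructor
    · constructor <;> linarith
    · linarith
  obtain ⟨M0, hM00, hM0⟩ := (hv.dd et).bound (τ - ε) b
  have hbi : ∀ i : Fin n, ∃ M, 0 ≤ M ∧ ∀ p : SpT n, p.1 ∈ Icc (τ - ε) b → |dd (ex i) v p| ≤ M :=
    fun i => (hv.dd (ex i)).bound (τ - ε) b
  choose M1 hM10 hM1 using hbi
  obtain ⟨M2, hM20, hM2⟩ := hv.bound (τ - ε) b
  set F' : ℝ → Eu n → ℝ := fun s z => k z * dd et v (s, x - √(b - s) • z) +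
    (1 / (2 * √(b - s))) * ∑ i, (z i * k z) * dd (ex i) v (s, x - √(b - s) • z) with hF'
  have hct : Continuous (dd et v) := (hv.dd et).1.continuous
  have hci : ∀ i : Fin n, Continuous (dd (ex i) v) := fun i => (hv.dd (ex i)).1.continuous
  have key := hasDerivAt_integral_of_dominated_loc_of_deriv_le (μ := volume)
    (F := fun s z => k z * v (s, x - √(b - s) • z)) (F' := F') (x₀ := τ) (s := ball τ ε)
    (bound := fun z => k z * M0 + (1 / (2 * √ε)) * ∑ i, |z i * k z| * M1 i)
    (ball_mem_nhds _ hε0) ?_ ?_ ?_ ?_ ?_ ?_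
  · have h2 := key.2
    suffices hval : (∫ z, F' τ z) = kerMean k (heatOp A v) b x τ by rw [← hval]; exact h2
    unfold kerMean
    have hIi : ∀ i : Fin n, Integrable fun z => (z i * k z) * dd (ex i) v (τ, x - √(b - τ) • z) :=
      fun i => integrable_mul (hk.integrable_coord_mul i) (by fun_prop)
        (fun z => hM1 i _ (hmem τ (mem_ball_self hε0)).1)
    rw [integral_add, integral_const_mul, integral_finsetSum _ (fun i _ => hIi i)]
    · have hsq : 0 < √(b - τ) := sqrt_pos.mpr (by linarith)
      have h3 : ∀ i : Fin n, ∫ z, (z i * k z) * dd (ex i) v (τ, x - √(b - τ) • z) =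
          -2 * √(b - τ) * ∑ j, A i j * ∫ z, k z * dd (ex j) (dd (ex i) v) (τ, x - √(b - τ) • z) := by
        intro i
        simp only [hk.grad]
        have : ∀ z, (-2 * ∑ j, A i j * dd (single j 1) k z) *
            dd (ex i) v (τ, x - √(b - τ) • z) = -2 * ∑ j, A i j *
            (dd (single j 1) k z * dd (ex i) v (τ, x - √(b - τ) • z)) := by
          intro z
          rw [mul_assoc, sum_mul]
          congr 1
          exact sum_congr rfl fun j _ => by ring
        simp only [this]
        rw [integral_const_mul, integral_finsetSum]
        · simp only [integral_const_mul, hk.ibp (hv.dd (ex i)), mul_sum]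
          exact sum_congr rfl fun j _ => by ring
        · intro j _
          exact (integrable_mul (hk.integrable_dd j) (by fun_prop)
            (fun z => hM1 i _ (hmem τ (mem_ball_self hε0)).1)).const_mul _
      simp only [h3]
      have hI2 : ∀ i j : Fin n, Integrable fun z =>
          k z * dd (ex j) (dd (ex i) v) (τ, x - √(b - τ) • z) := by
        intro i j
        obtain ⟨M, _, hM⟩ := ((hv.dd (ex i)).dd (ex j)).bound (τ - ε) b
        have := ((hv.dd (ex i)).dd (ex j)).1.continuous
        exact integrable_mul hk.integrable (by fun_prop)
          (fun z => hM _ (hmem τ (mem_ball_self hε0)).1)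
      have hexp : ∀ z, k z * heatOp A v (τ, x - √(b - τ) • z) =
          k z * dd et v (τ, x - √(b - τ) • z) - ∑ i, ∑ j, A i j *
            (k z * dd (ex j) (dd (ex i) v) (τ, x - √(b - τ) • z)) := by
        intro z
        simp only [heatOp, mul_sub, mul_sum]
        congr 1
        exact sum_congr rfl fun i _ => sum_congr rfl fun j _ => by ring
      simp only [hexp]
      rw [integral_sub, integral_finsetSum]
      · simp only [integral_finsetSum _ (fun j _ => (hI2 _ j).const_mul (A _ j)),
          integral_const_mul]
        have hfin : ∀ S : Fin n → ℝ, 1 / (2 * √(b - τ)) * ∑ i, -2 * √(b - τ) * S i =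
            -∑ i, S i := by
          intro S
          rw [mul_sum, ← sum_neg_distrib]
          refine sum_congr rfl fun i _ => ?_
          field_simp
        rw [hfin, ← sub_eq_add_neg]
      · exact fun i _ => integrable_finsetSum _ fun j _ => (hI2 i j).const_mul _
      · exact integrable_mul hk.integrable (by fun_prop)
          (fun z => hM0 _ (hmem τ (mem_ball_self hε0)).1)
      · exact integrable_finsetSum _ fun i _ => integrable_finsetSum _ fun j _ =>
          (hI2 i j).const_mul _
    · exact integrable_mul hk.integrable (by fun_prop)
          (fun z => hM0 _ (hmem τ (mem_ball_self hε0)).1)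
    · exact (integrable_finsetSum _ fun i _ => hIi i).const_mul _
  · exact Eventually.of_forall fun s =>
      (by fun_prop : Continuous fun z => k z * v (s, x - √(b - s) • z)).aestronglyMeasurable
  · exact integrable_mul hk.integrable (by fun_prop)
      (fun z => hM2 _ (hmem τ (mem_ball_self hε0)).1)
  · exact (by fun_prop : Continuous (F' τ)).aestronglyMeasurable
  · refine ae_of_all _ fun z s hs => ?_
    have hs' := hmem s hs
    have hsq : √ε ≤ √(b - s) := sqrt_le_sqrt hs'.2
    have hsε : 0 < √ε := sqrt_pos.mpr hε0
    refine (norm_add_le _ _).trans (add_le_add ?_ ?_)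
    · rw [norm_mul, norm_eq_abs, norm_eq_abs, abs_of_nonneg (hk.nonneg z)]
      exact mul_le_mul_of_nonneg_left (hM0 _ hs'.1) (hk.nonneg z)
    · rw [norm_mul, norm_eq_abs, abs_of_nonneg (by positivity)]
      refine mul_le_mul ?_ ?_ (norm_nonneg _) (by positivity)
      · exact one_div_le_one_div_of_le (by positivity) (by linarith)
      · refine (norm_sum_le _ _).trans (sum_le_sum fun i _ => ?_)
        rw [norm_mul, norm_eq_abs, norm_eq_abs]
        exact mul_le_mul_of_nonneg_left (hM1 i _ hs'.1) (abs_nonneg _)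
  · exact (hk.integrable.mul_const _).add ((integrable_finsetSum _ fun i _ =>
      (hk.integrable_coord_mul i).abs.mul_const _).const_mul _)
  · refine ae_of_all _ fun z s hs => ?_
    have hs' := hmem s hs
    have hpos : 0 < b - s := lt_of_lt_of_le hε0 hs'.2
    have h1 : HasDerivAt (fun s : ℝ => ((s, x - √(b - s) • z) : SpT n))
        (1, (1 / (2 * √(b - s))) • z) s := by
      refine (hasDerivAt_id s).prodMk ?_
      have h2 : HasDerivAt (fun s : ℝ => √(b - s)) (-1 / (2 * √(b - s))) s :=
        (HasDerivAt.const_sub b (hasDerivAt_id s)).sqrt hpos.ne'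
      have := (h2.smul_const z).const_sub x
      convert this using 1
      rw [← neg_smul]
      congr 1
      ring
    have h3 := (hasDerivAt_line hv.1 _ _ s h1).const_mul (k z)
    suffices hval : F' s z = k z * dd (1, (1 / (2 * √(b - s))) • z) v (s, x - √(b - s) • z) by
      rw [hval]; exact h3
    have hz : ((1, (1 / (2 * √(b - s))) • z) : SpT n) =
        et + (1 / (2 * √(b - s))) • ∑ i, z i • (ex i : SpT n) := by
      have hsum : (∑ i, z i • (ex i : SpT n)) = (0, z) := by
        have : ∀ i, z i • (ex i : SpT n) = ContinuousLinearMap.inr ℝ ℝ (Eu n)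
            (z i • single i 1) := by intro i; simp [ex]
        simp only [this, ← map_sum]
        have hz2 := (EuclideanSpace.basisFun (Fin n) ℝ).sum_repr z
        simp only [EuclideanSpace.basisFun_apply, EuclideanSpace.basisFun_repr] at hz2
        rw [hz2]; rfl
      rw [hsum]; simp [et]
    rw [hz]
    simp only [hF', dd, map_add, map_smul, map_sum, smul_eq_mul, mul_add, mul_sum]
    congr 1
    exact sum_congr rfl fun i _ => by ring

/-- Duhamel's formula. -/
lemma duhamel (hk : IsKer A k C c) (hv : SmC v) (hab : a ≤ b)
    (x : Eu n) :
    (∫ z, k z) * v (b, x) = kerMean k v b x a + ∫ τ in a..b, kerMean k (heatOp A v) b x τ := by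
  have h := intervalIntegral.integral_eq_sub_of_hasDerivAt_of_le hab
    (hk.kerMean_continuousOn hv a b x) (fun τ hτ => hk.kerMean_hasDerivAt hv b x hτ.2)
    ((hk.kerMean_continuousOn (hv.heatOp A) a b x).intervalIntegrable_of_Icc hab)
  rw [h]
  simp [kerMean, integral_mul_const]

end IsKer

end

/-- Parabolic Morrey bound on the time window `[t₁, t₂]`, in rescaled coordinates. -/
def MB (t₁ t₂ : ℝ) (F : SpT n → ℝ) (M : ℝ) : Prop :=
  ∀ (x : Eu n) (r b : ℝ), 0 < r → t₁ ≤ b - r ^ 2 → b ≤ t₂ →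
    ∫⁻ τ in Ioc (b - r ^ 2) b, ∫⁻ z in ball (0 : Eu n) 1, ENNReal.ofReal (F (τ, x - r • z) ^ 2) ≤
      ENNReal.ofReal (M ^ 2 * r)

/-- Gaussian mean of `|F|` at time `τ` seen from `(b, x)`. -/
def gm (c : ℝ) (F : SpT n → ℝ) (b : ℝ) (x : Eu n) (τ : ℝ) : ℝ≥0∞ :=
  ∫⁻ z, ENNReal.ofReal (exp (-(c * ‖z‖ ^ 2))) * ‖F (τ, x - √(b - τ) • z)‖ₑ

lemma lintegral_gauss_lt_top (hc : 0 < c) :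
    ∫⁻ z : Eu n, ENNReal.ofReal (exp (-(c * ‖z‖ ^ 2))) < ⊤ := by
  have h := (integrable_gauss (n := n) hc).lintegral_lt_top
  exact h

lemma lintegral_comp_smul {f : Eu n → ℝ≥0∞} (hf : Measurable f) (hR : 0 < R) :
    ∫⁻ z, f (R • z) = ENNReal.ofReal ((R ^ n)⁻¹) * ∫⁻ z, f z := by
  rw [← lintegral_map hf (measurable_const_smul R), Measure.map_addHaar_smul _ hR.ne',
    lintegral_smul_measure, finrank_euclideanSpace, Fintype.card_fin, abs_of_pos (by positivity),
    smul_eq_mul]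

lemma gm_le_rescale (hc : 0 < c) (hF : Continuous F)
    (hr : 0 < r) (x : Eu n) (hτ : τ ∈ Ioc (b - r ^ 2) (b - r ^ 2 / 4)) :
    gm c F b x τ ≤ ENNReal.ofReal (2 ^ n) *
      ∫⁻ z, ENNReal.ofReal (exp (-(c * ‖z‖ ^ 2))) * ‖F (τ, x - r • z)‖ₑ := by
  set q := √(b - τ) / r with hq
  have hq1 : q ≤ 1 := by
    rw [hq, div_le_one hr]
    exact sqrt_le_iff.2 ⟨hr.le, by linarith [hτ.1]⟩
  have hq2 : 1 / 2 ≤ q := by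
    rw [hq, le_div_iff₀ hr]
    exact le_sqrt_of_sq_le (by nlinarith [hτ.2])
  have hq0 : 0 < q := by linarith
  have hqr : √(b - τ) = r * q := by rw [hq]; field_simp
  set f := fun y =>
    ENNReal.ofReal (exp (-(c * ‖q⁻¹ • y‖ ^ 2))) * ‖F (τ, x - r • y)‖ₑ with hf
  have hfm : Measurable f := by
    have h1 : Continuous fun y : Eu n => exp (-(c * ‖q⁻¹ • y‖ ^ 2)) := by fun_prop
    have h2 : Continuous fun y => F (τ, x - r • y) := by fun_prop
    exact (measurable_ofReal.comp h1.measurable).mul h2.enorm.measurable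
  have : gm c F b x τ = ∫⁻ z, f (q • z) := by
    unfold gm
    refine lintegral_congr fun z => ?_
    simp only [hf]
    rw [hqr, smul_smul, smul_smul, inv_mul_cancel₀ hq0.ne', one_smul]
  rw [this, lintegral_comp_smul hfm hq0]
  refine mul_le_mul' (ofReal_le_ofReal ?_) (lintegral_mono fun y => ?_)
  · rw [← inv_pow]
    exact pow_le_pow_left₀ (by positivity) (by rw [inv_le_comm₀ hq0 (by norm_num)]; linarith) n
  · simp only [hf]
    gcongr
    rw [norm_smul, norm_inv, norm_eq_abs, abs_of_pos hq0]
    have := (one_le_inv₀ hq0).2 hq1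
    nlinarith [norm_nonneg y]

/-- A Gaussian is dominated by a superposition of indicators of unit balls. -/
lemma gauss_le_cover (hc : 0 < c) : ∃ C > 0, ∀ z : Eu n,
    ENNReal.ofReal (exp (-(c * ‖z‖ ^ 2))) ≤ ENNReal.ofReal C *
      ∫⁻ ξ : Eu n, ENNReal.ofReal (exp (-(c / 2 * ‖ξ‖ ^ 2))) *
        (ball ξ 1).indicator 1 z := by
  set V := (volume (ball (0 : Eu n) 1)).toReal with hV
  have hVt : volume (ball (0 : Eu n) 1) ≠ ⊤ := measure_ball_lt_top.ne
  have hV0 : 0 < V := toReal_pos (measure_ball_pos _ _ one_pos).ne' hVt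
  refine ⟨exp c / V, by positivity, fun z => ?_⟩
  have h1 : ENNReal.ofReal (exp (-(c * ‖z‖ ^ 2 + c))) * volume (ball z 1) ≤
      ∫⁻ ξ : Eu n, ENNReal.ofReal (exp (-(c / 2 * ‖ξ‖ ^ 2))) *
        (ball ξ 1).indicator 1 z := by
    rw [← setLIntegral_const, ← lintegral_indicator measurableSet_ball]
    refine lintegral_mono fun ξ => ?_
    by_cases h : ξ ∈ ball z 1
    · rw [indicator_of_mem h, indicator_of_mem (mem_ball_comm.1 h)]
      simp only [Pi.one_apply, mul_one]
      refine ofReal_le_ofReal (exp_le_exp.2 (neg_le_neg ?_))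
      have h2 : ‖ξ‖ ≤ ‖z‖ + 1 := by
        have := norm_sub_norm_le ξ z
        rw [mem_ball, dist_eq_norm] at h
        linarith
      have h3 := pow_le_pow_left₀ (norm_nonneg _) h2 2
      have h4 : ‖ξ‖ ^ 2 ≤ 2 * ‖z‖ ^ 2 + 2 := by nlinarith [sq_nonneg (‖z‖ - 1)]
      nlinarith
    · rw [indicator_of_notMem h]; exact bot_le
  refine le_trans ?_ (mul_le_mul_right h1 _)
  rw [Measure.addHaar_ball_center, ← ofReal_toReal hVt, ← hV,
    ← ofReal_mul (by positivity), ← ofReal_mul (by positivity)]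
  refine ofReal_le_ofReal (le_of_eq ?_)
  rw [neg_add, exp_add, exp_neg c]
  field_simp

lemma MB.ball_L1 (hM : 0 < M)
    (h : MB t₁ t₂ F M) (x : Eu n) (hr : 0 < r) (h1 : t₁ ≤ b - r ^ 2) (h2 : b ≤ t₂) :
    ∫⁻ τ in Ioc (b - r ^ 2) b, ∫⁻ z in ball (0 : Eu n) 1, ‖F (τ, x - r • z)‖ₑ ≤
      ENNReal.ofReal ((1 + (volume (ball (0 : Eu n) 1)).toReal) * M * (r * √r)) := by
  set V := (volume (ball (0 : Eu n) 1)).toReal with hV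
  set lam := √r / M with hlam
  have hlp : 0 < lam := div_pos (sqrt_pos.2 hr) hM
  have key : ∀ a : ℝ, ‖a‖ₑ ≤ ENNReal.ofReal lam * ENNReal.ofReal (a ^ 2) +
      ENNReal.ofReal lam⁻¹ := by
    intro a
    rw [← ofReal_mul hlp.le, ← ofReal_add (by positivity) (by positivity),
      ← ofReal_norm, norm_eq_abs]
    refine ofReal_le_ofReal ?_
    have : 0 ≤ lam⁻¹ * (lam * |a| - 1 / 2) ^ 2 := by positivity
    have e : lam⁻¹ * (lam * |a| - 1 / 2) ^ 2 = lam * |a| ^ 2 - |a| + lam⁻¹ / 4 := by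
      field_simp; ring
    rw [e, sq_abs] at this
    have : 0 < lam⁻¹ := by positivity
    linarith
  calc ∫⁻ τ in Ioc (b - r ^ 2) b, ∫⁻ z in ball 0 1, ‖F (τ, x - r • z)‖ₑ
      ≤ ∫⁻ τ in Ioc (b - r ^ 2) b, (ENNReal.ofReal lam *
          (∫⁻ z in ball 0 1, ENNReal.ofReal (F (τ, x - r • z) ^ 2)) +
            ENNReal.ofReal (lam⁻¹ * V)) := by
        refine lintegral_mono fun τ => ?_
        refine (lintegral_mono fun z => key (F (τ, x - r • z))).trans ?_
        rw [lintegral_add_right _ measurable_const, lintegral_const_mul' _ _ ofReal_ne_top,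
          lintegral_const, Measure.restrict_apply_univ, ofReal_mul (by positivity), hV,
          ofReal_toReal measure_ball_lt_top.ne]
    _ ≤ ENNReal.ofReal lam * ENNReal.ofReal (M ^ 2 * r) + ENNReal.ofReal (lam⁻¹ * V) *
          ENNReal.ofReal (r ^ 2) := by
        rw [lintegral_add_right _ measurable_const, lintegral_const_mul' _ _ ofReal_ne_top,
          lintegral_const, Measure.restrict_apply_univ, volume_Ioc]
        gcongr
        · exact h x r b hr h1 h2
        · linarith
    _ = _ := by
        rw [← ofReal_mul hlp.le, ← ofReal_mul (by positivity),
          ← ofReal_add (by positivity) (by positivity)]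
        congr 1
        have hs := mul_self_sqrt hr.le
        have hs0 := sqrt_pos.2 hr
        have e1 : lam * (M ^ 2 * r) = M * (r * √r) := by rw [hlam]; field_simp
        have e2 : lam⁻¹ * V * r ^ 2 = V * M * (r * √r) := by
          rw [hlam, inv_div, div_mul_eq_mul_div, div_mul_eq_mul_div, div_eq_iff hs0.ne']
          linear_combination (- M * V * r) * hs
        rw [e1, e2]; ring

lemma triple_swap {X : Type*} [MeasurableSpace X] {μ : Measure X} [SFinite μ] {ν : Measure ℝ}
    [SFinite ν] {e : X → ℝ≥0∞} (he : Measurable e) {ind : X → X → ℝ≥0∞}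
    (hi : Measurable (Function.uncurry ind)) {φ : ℝ → X → ℝ≥0∞}
    (hφ : Measurable (Function.uncurry φ)) :
    ∫⁻ τ, ∫⁻ z, ∫⁻ ξ, e ξ * ind ξ z * φ τ z ∂μ ∂μ ∂ν =
      ∫⁻ ξ, ∫⁻ τ, ∫⁻ z, e ξ * ind ξ z * φ τ z ∂μ ∂ν ∂μ := by
  have hg : Measurable fun q : (ℝ × X) × X =>
      e q.1.2 * Function.uncurry ind (q.1.2, q.2) * Function.uncurry φ (q.1.1, q.2) := by fun_prop
  have hg1 : ∀ τ, Measurable fun q : X × X => e q.2 * Function.uncurry ind (q.2, q.1) *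
    Function.uncurry φ (τ, q.1) := by intro τ; fun_prop
  have h1 : ∀ τ, ∫⁻ z, ∫⁻ ξ, e ξ * ind ξ z * φ τ z ∂μ ∂μ =
      ∫⁻ ξ, ∫⁻ z, e ξ * ind ξ z * φ τ z ∂μ ∂μ := fun τ =>
    lintegral_lintegral_swap (hg1 τ).aemeasurable
  simp only [h1]
  exact lintegral_lintegral_swap (hg.lintegral_prod_right').aemeasurable

lemma slab_full (hc : 0 < c) : ∃ K > 0,
    ∀ (t₁ t₂ : ℝ) (F : SpT n → ℝ), Continuous F → ∀ M : ℝ, 0 < M → MB t₁ t₂ F M →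
    ∀ (x : Eu n) (r b : ℝ), 0 < r → t₁ ≤ b - r ^ 2 → b ≤ t₂ →
    ∫⁻ τ in Ioc (b - r ^ 2) (b - r ^ 2 / 4), gm c F b x τ ≤
      ENNReal.ofReal (K * M * (r * √r)) := by
  obtain ⟨C, hC, hcov⟩ := gauss_le_cover (n := n) hc
  set V := (volume (ball (0 : Eu n) 1)).toReal with hV
  have hJt := lintegral_gauss_lt_top (n := n) (half_pos hc)
  set J := (∫⁻ z : Eu n, ENNReal.ofReal (exp (-(c / 2 * ‖z‖ ^ 2)))).toReal with hJ
  refine ⟨2 ^ n * C * J * (1 + V) + 1, by positivity, ?_⟩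
  intro t₁ t₂ F hF M hM h x r b hr h1 h2
  set S := Ioc (b - r ^ 2) (b - r ^ 2 / 4) with hS
  set ind : Eu n → Eu n → ℝ≥0∞ := fun ξ z => (ball ξ 1).indicator 1 z with hind
  set e : Eu n → ℝ≥0∞ := fun ξ => ENNReal.ofReal (exp (-(c / 2 * ‖ξ‖ ^ 2))) with he
  have hem : Measurable e := by
    have h1 : Continuous fun ξ : Eu n => exp (-(c / 2 * ‖ξ‖ ^ 2)) := by fun_prop
    exact measurable_ofReal.comp h1.measurable
  have hindm : Measurable (Function.uncurry ind) := by
    have : Function.uncurry ind = {p : Eu n × Eu n | dist p.2 p.1 < 1}.indicator 1 := by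
      ext p
      simp only [Function.uncurry, hind, indicator, mem_ball, mem_ofPred_eq, Pi.one_apply]
    rw [this]
    exact measurable_one.indicator (isOpen_lt (by fun_prop) continuous_const).measurableSet
  set φ := fun τ z => ‖F (τ, x - r • z)‖ₑ with hφ
  have hφm : Measurable (Function.uncurry φ) := by
    have : Continuous fun p : ℝ × Eu n => F (p.1, x - r • p.2) := by fun_prop
    exact this.enorm.measurable
  calc ∫⁻ τ in S, gm c F b x τ
      ≤ ∫⁻ τ in S, ENNReal.ofReal (2 ^ n) * (ENNReal.ofReal C *
          ∫⁻ z, ∫⁻ ξ, e ξ * ind ξ z * φ τ z) := by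
        refine setLIntegral_mono' measurableSet_Ioc fun τ hτ => ?_
        refine (gm_le_rescale hc hF hr x hτ).trans ?_
        refine mul_le_mul_right ?_ _
        rw [← lintegral_const_mul' _ _ ofReal_ne_top]
        refine lintegral_mono fun z => ?_
        have hm := hem.mul (hindm.of_uncurry_right (y := z))
        have hc' := hcov z
        have e2 : ∫⁻ ξ, e ξ * ind ξ z * φ τ z = (∫⁻ ξ, e ξ * ind ξ z) * φ τ z :=
          lintegral_mul_const _ hm
        rw [e2, ← mul_assoc]
        exact mul_le_mul_left hc' _
    _ = ENNReal.ofReal (2 ^ n * C) * ∫⁻ ξ, ∫⁻ τ in S, ∫⁻ z, e ξ * ind ξ z * φ τ z := by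
        rw [← triple_swap hem hindm hφm, ← lintegral_const_mul' _ _ ofReal_ne_top]
        refine lintegral_congr fun τ => ?_
        rw [← mul_assoc, ← ofReal_mul (by positivity)]
    _ ≤ ENNReal.ofReal (2 ^ n * C) * ∫⁻ ξ, e ξ * ENNReal.ofReal ((1 + V) * M * (r * √r)) := by
        refine mul_le_mul_right (lintegral_mono fun ξ => ?_) _
        have e1 : ∀ τ, ∫⁻ z, e ξ * ind ξ z * φ τ z =
            e ξ * ∫⁻ z in ball 0 1, ‖F (τ, (x - r • ξ) - r • z)‖ₑ := by
          intro τ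
          simp only [mul_assoc]
          rw [lintegral_const_mul' _ _ ofReal_ne_top, ← lintegral_indicator measurableSet_ball,
            ← lintegral_add_right_eq_self _ ξ]
          congr 1
          refine lintegral_congr fun z => ?_
          simp only [hind, hφ]
          by_cases hz : z ∈ ball (0 : Eu n) 1
          · have : z + ξ ∈ ball ξ 1 := by simpa [mem_ball, dist_eq_norm] using hz
            rw [indicator_of_mem hz, indicator_of_mem this, Pi.one_apply, one_mul, smul_add,
              sub_sub, add_comm (r • z)]
          · have : z + ξ ∉ ball ξ 1 := by simpa [mem_ball, dist_eq_norm] using hz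
            rw [indicator_of_notMem hz, indicator_of_notMem this, zero_mul]
        simp only [e1]
        rw [lintegral_const_mul' _ _ ofReal_ne_top]
        refine mul_le_mul_right ?_ _
        have hsub : S ⊆ Ioc (b - r ^ 2) b := Ioc_subset_Ioc_right (by linarith [sq_nonneg r])
        refine le_trans (lintegral_mono_set hsub) ?_
        exact h.ball_L1 hM _ hr h1 h2
    _ = ENNReal.ofReal (2 ^ n * C * J * (1 + V) * M * (r * √r)) := by
        rw [lintegral_mul_const _ hem, ((ofReal_toReal hJt.ne).symm), ← ofReal_mul toReal_nonneg,
          ← ofReal_mul (by positivity)]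
        congr 1; ring
    _ ≤ _ := by
        refine ofReal_le_ofReal ?_
        have : 0 ≤ M * (r * √r) := by positivity
        nlinarith

lemma slab (hc : 0 < c) : ∃ K > 0,
    ∀ (t₁ t₂ : ℝ) (F : SpT n → ℝ), Continuous F → ∀ M : ℝ, 0 < M → MB t₁ t₂ F M →
    ∀ (x : Eu n) (r b : ℝ), 0 < r → b ≤ t₂ →
    ∫⁻ τ in Icc (b - r ^ 2) (b - r ^ 2 / 4) ∩ Ioi t₁, gm c F b x τ ≤
      ENNReal.ofReal (K * M * (r * √r)) := by
  obtain ⟨K, hK, H⟩ := slab_full hc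
  refine ⟨K, hK, fun t₁ t₂ F hF M hM h x r b hr h2 => ?_⟩
  rcases le_or_gt t₁ (b - r ^ 2) with h1 | h1
  · refine (lintegral_mono_set inter_subset_left).trans ?_
    rw [setLIntegral_congr Ioc_ae_eq_Icc.symm]
    exact (H _ _ F hF M hM h x r b hr h1 h2)
  rcases le_or_gt b t₁ with h3 | h3
  · have : Icc (b - r ^ 2) (b - r ^ 2 / 4) ∩ Ioi t₁ = ∅ := by
      ext τ; simp only [mem_inter_iff, mem_Icc, mem_Ioi, mem_empty_iff_false, iff_false]
      rintro ⟨⟨_, a⟩, a'⟩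
      nlinarith [sq_nonneg r]
    rw [this]; simp
  set r' := √(b - t₁) with hr'
  have hr'0 : 0 < r' := sqrt_pos.2 (by linarith)
  have hsq : r' ^ 2 = b - t₁ := sq_sqrt (by linarith)
  have hle : r' ≤ r := sqrt_le_iff.2 ⟨hr.le, by linarith⟩
  refine le_trans (lintegral_mono_set ?_) ((H _ _ F hF M hM h x r' b hr'0 (by linarith) h2).trans
    (ofReal_le_ofReal ?_))
  · rintro τ ⟨⟨_, a⟩, a'⟩
    exact ⟨by rw [hsq]; simpa using a', by rw [hsq]; linarith⟩
  · gcongr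

lemma summable_sqrt_half : Summable fun k : ℕ => (√(1 / 2) : ℝ) ^ k :=
  summable_geometric_of_lt_one (by positivity) (by rw [sqrt_lt' one_pos]; norm_num)

lemma setLIntegral_gm_le_of_slabs {X : ℝ} {S : Set ℝ}
    {φ : ℝ → ℝ} {r w : ℕ → ℝ} (hX : 0 ≤ X) (hw0 : ∀ k, 0 ≤ w k)
    (hS : S ⊆ ⋃ k, (Icc (b - r k ^ 2) (b - r k ^ 2 / 4) ∩ Ioi t₁))
    (H : ∀ k, ∫⁻ τ in Icc (b - r k ^ 2) (b - r k ^ 2 / 4) ∩ Ioi t₁, gm c F b x τ ≤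
      ENNReal.ofReal (K * M * (r k * √(r k))))
    (hφ : ∀ k τ, τ ≤ b - r k ^ 2 / 4 → φ τ ≤ w k)
    (hw : ∀ k, w k * (K * M * (r k * √(r k))) ≤ X * √(1 / 2) ^ k) :
    ∫⁻ τ in S, ENNReal.ofReal (φ τ) * gm c F b x τ ≤ ENNReal.ofReal (X * ∑' k : ℕ, √(1 / 2) ^ k) := by
  rw [← tsum_mul_left, ofReal_tsum_of_nonneg (fun k => by positivity) (summable_sqrt_half.mul_left _)]
  refine (lintegral_mono_set hS).trans ((lintegral_iUnion_le _ _).trans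
    (ENNReal.tsum_le_tsum fun k => ?_))
  calc _ ≤ ∫⁻ τ in Icc (b - r k ^ 2) (b - r k ^ 2 / 4) ∩ Ioi t₁, ENNReal.ofReal (w k) * gm c F b x τ := by
        refine setLIntegral_mono' (measurableSet_Icc.inter measurableSet_Ioi) fun τ hτ => ?_
        gcongr
        exact hφ k τ hτ.1.2
    _ ≤ ENNReal.ofReal (w k) * ENNReal.ofReal (K * M * (r k * √(r k))) := by
        rw [lintegral_const_mul' _ _ ofReal_ne_top]; gcongr; exact H k
    _ ≤ _ := by rw [← ofReal_mul (hw0 k)]; exact ofReal_le_ofReal (hw k)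

/-- Near the vertex, lag weight `lag^{-1/2}`. -/
lemma near_int (hc : 0 < c) : ∃ K > 0,
    ∀ (t₁ t₂ : ℝ) (F : SpT n → ℝ), Continuous F → ∀ M : ℝ, 0 < M → MB t₁ t₂ F M →
    ∀ (x : Eu n) (ρ b : ℝ), 0 < ρ → b ≤ t₂ →
    ∫⁻ τ in Ioo (b - ρ ^ 2) b ∩ Ioi t₁, ENNReal.ofReal (√(b - τ))⁻¹ * gm c F b x τ ≤
      ENNReal.ofReal (K * M * √ρ) := by
  obtain ⟨K, hK, H⟩ := slab (n := n) hc
  have hq : 0 ≤ ∑' k : ℕ, √(1 / 2 : ℝ) ^ k := tsum_nonneg fun k => by positivity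
  refine ⟨2 * K * (∑' k : ℕ, √(1 / 2) ^ k) + 1, by positivity, fun t₁ t₂ F hF M hM h x ρ b hρ h2 => ?_⟩
  have hr0 : ∀ k : ℕ, 0 < ρ * (1 / 2) ^ k := fun k => by positivity
  refine (setLIntegral_gm_le_of_slabs (r := fun k => ρ * (1 / 2) ^ k) (w := fun k => 2 / (ρ * (1 / 2) ^ k))
    (X := 2 * K * M * √ρ) (by positivity) (fun k => by positivity) ?_
    (fun k => H t₁ t₂ F hF M hM h x _ b (hr0 k) h2) (fun k τ hτ => ?_) fun k => ?_).trans
    (ofReal_le_ofReal ?_)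
  · rintro τ ⟨⟨ha, hb⟩, ht⟩
    have hl : 0 < √(b - τ) := sqrt_pos.2 (by linarith)
    have hlρ : √(b - τ) < ρ := (sqrt_lt' hρ).2 (by linarith)
    obtain ⟨k, hk1, hk2⟩ := exists_nat_pow_near_of_lt_one (x := √(b - τ) / ρ) (y := (1 / 2 : ℝ))
      (by positivity) ((div_le_one hρ).2 hlρ.le) (by norm_num) (by norm_num)
    rw [div_le_iff₀ hρ] at hk2
    rw [lt_div_iff₀ hρ, pow_succ] at hk1
    have hsq : √(b - τ) ^ 2 = b - τ := sq_sqrt (by linarith)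
    have e1 := pow_le_pow_left₀ hl.le hk2 2
    have e2 := pow_le_pow_left₀ (by positivity) hk1.le 2
    exact mem_iUnion.2 ⟨k, ⟨by nlinarith, by nlinarith⟩, ht⟩
  · rw [inv_le_comm₀ (sqrt_pos.2 (by nlinarith [sq_pos_of_pos (hr0 k)])) (by positivity), inv_div]
    exact le_sqrt_of_sq_le (by nlinarith)
  · have : √(ρ * (1 / 2) ^ k) = √ρ * √(1 / 2) ^ k := by
      rw [sqrt_mul hρ.le, ← sqrt_sq (pow_nonneg (sqrt_nonneg (1/2)) k), ← pow_mul, mul_comm k 2,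
        pow_mul, sq_sqrt (by norm_num)]
    rw [this]
    have := (hr0 k).ne'
    exact le_of_eq (by field_simp)
  · have : 0 ≤ M * √ρ := by positivity
    nlinarith

/-- Far from the vertex, lag weight `lag^{-1}`. -/
lemma far_int (hc : 0 < c) : ∃ K > 0,
    ∀ (t₁ t₂ : ℝ) (F : SpT n → ℝ), Continuous F → ∀ M : ℝ, 0 < M → MB t₁ t₂ F M →
    ∀ (x : Eu n) (ρ b : ℝ), 0 < ρ → b ≤ t₂ →
    ∫⁻ τ in Iic (b - ρ ^ 2) ∩ Ioi t₁, ENNReal.ofReal (b - τ)⁻¹ * gm c F b x τ ≤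
      ENNReal.ofReal (K * M / √ρ) := by
  obtain ⟨K, hK, H⟩ := slab (n := n) hc
  have hq : 0 ≤ ∑' k : ℕ, √(1 / 2 : ℝ) ^ k := tsum_nonneg fun k => by positivity
  refine ⟨4 * K * (∑' k : ℕ, √(1 / 2) ^ k) + 1, by positivity, fun t₁ t₂ F hF M hM h x ρ b hρ h2 => ?_⟩
  have hr0 : ∀ k : ℕ, 0 < 2 * ρ * 2 ^ k := fun k => by positivity
  refine (setLIntegral_gm_le_of_slabs (r := fun k => 2 * ρ * 2 ^ k) (w := fun k => 4 / (2 * ρ * 2 ^ k) ^ 2)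
    (X := 4 * K * M / √ρ) (by positivity) (fun k => by positivity) ?_
    (fun k => H t₁ t₂ F hF M hM h x _ b (hr0 k) h2) (fun k τ hτ => ?_) fun k => ?_).trans
    (ofReal_le_ofReal ?_)
  · rintro τ ⟨ha, ht⟩
    rw [mem_Iic] at ha
    obtain ⟨k, hk1, hk2⟩ := exists_nat_pow_near (x := √(b - τ) / ρ) (y := (2 : ℝ))
      ((one_le_div hρ).2 (le_sqrt_of_sq_le (by linarith))) (by norm_num)
    rw [le_div_iff₀ hρ] at hk1
    rw [div_lt_iff₀ hρ, pow_succ] at hk2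
    have hsq : √(b - τ) ^ 2 = b - τ := sq_sqrt (by nlinarith)
    have e1 := pow_le_pow_left₀ (sqrt_nonneg _) hk2.le 2
    have e2 := pow_le_pow_left₀ (by positivity) hk1 2
    exact mem_iUnion.2 ⟨k, ⟨by nlinarith, by nlinarith⟩, ht⟩
  · have := sq_pos_of_pos (hr0 k)
    rw [inv_le_comm₀ (by linarith) (by positivity), inv_div]
    linarith
  · have e : √(2 * ρ * 2 ^ k) * √(1 / 2) ^ k = √2 * √ρ := by
      rw [sqrt_mul (by positivity), sqrt_mul (by positivity), mul_assoc, sqrt_div' _ (by norm_num),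
        sqrt_one, one_div, inv_pow, ← sqrt_sq (pow_nonneg (sqrt_nonneg (2 : ℝ)) k), ← pow_mul,
        mul_comm k 2, pow_mul, sq_sqrt (by norm_num), mul_inv_cancel₀ (by positivity), mul_one]
    have h1 : 1 ≤ √(2 : ℝ) := one_le_sqrt.2 (by norm_num)
    have hs := mul_self_sqrt (hr0 k).le
    have hr := sqrt_pos.2 (hr0 k)
    have := sqrt_pos.2 hρ
    rw [div_mul_eq_mul_div, div_mul_eq_mul_div, div_le_div_iff₀ (by positivity) this]
    have := mul_le_mul_of_nonneg_left (le_mul_of_one_le_left this.le h1)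
      (show 0 ≤ 4 * K * M * (2 * ρ * 2 ^ k) * √(2 * ρ * 2 ^ k) by positivity)
    rw [← e] at this
    linear_combination this + 4 * K * M * (2 * ρ * 2 ^ k) * √(1 / 2) ^ k * hs
  · have : 0 ≤ M / √ρ := by positivity
    rw [mul_div_assoc, mul_div_assoc]
    nlinarith

section

lemma abs_integral_le_of_lintegral {f : ℝ → ℝ} {X : ℝ} (hab : a ≤ b) (hX : 0 ≤ X)
    (h : ∫⁻ τ in Ioc a b, ‖f τ‖ₑ ≤ ENNReal.ofReal X) : |∫ τ in a..b, f τ| ≤ X := by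
  rw [intervalIntegral.integral_of_le hab]
  have h1 := (enorm_integral_le_lintegral_enorm f).trans h
  rw [← ofReal_norm, ofReal_le_ofReal_iff hX] at h1
  exact h1

lemma heatOp_dd (A : Fin n → Fin n → ℝ) {w : SpT n → ℝ} (hw : SmC w) (e : SpT n) :
    heatOp A (dd e w) = dd e (heatOp A w) := by
  funext p
  have hs : ∀ i j, ContDiff ℝ ∞ (fun q => A i j * dd (ex j) (dd (ex i) w) q) := fun i j =>
    (((hw.dd _).dd _).const_mul (A i j)).1
  have e1 : dd e (heatOp A w) p = dd e (dd et w) p -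
      ∑ i, ∑ j, A i j * dd e (dd (ex j) (dd (ex i) w)) p := by
    unfold heatOp
    rw [dd_sub (hw.dd _).1 (ContDiff.sum fun i _ => ContDiff.sum fun j _ => hs i j), dd_sum]
    · congr 1
      refine sum_congr rfl fun i _ => ?_
      rw [dd_sum _ fun j _ => hs i j]
      exact sum_congr rfl fun j _ => dd_const_mul ((hw.dd _).dd _).1 _ _ _
    · exact fun i _ => ContDiff.sum fun j _ => hs i j
  rw [e1]
  unfold heatOp
  have c1 : ∀ f, ContDiff ℝ ∞ f → ∀ e', dd e (dd e' f) = dd e' (dd e f) := by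
    exact fun f hf e' => dd_comm hf _ _
  rw [c1 w hw.1 et]
  congr 1
  refine sum_congr rfl fun i _ => sum_congr rfl fun j _ => ?_
  rw [c1 _ (hw.dd _).1, c1 w hw.1]

namespace IsKer
variable {k : Eu n → ℝ}

lemma enorm_integral_gauss_le {g : Eu n → ℝ} (hB : 0 ≤ B)
    (hg : ∀ z, |g z| ≤ B * exp (-(c * ‖z‖ ^ 2))) :
    ‖∫ z, g z * f z‖ₑ ≤ ENNReal.ofReal B *
      ∫⁻ z, ENNReal.ofReal (exp (-(c * ‖z‖ ^ 2))) * ‖f z‖ₑ := by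
  refine (enorm_integral_le_lintegral_enorm _).trans ?_
  rw [← lintegral_const_mul' _ _ ofReal_ne_top]
  refine lintegral_mono fun z => ?_
  rw [enorm_mul, ← mul_assoc, ← ofReal_mul hB]
  gcongr
  rw [← ofReal_norm]
  exact ofReal_le_ofReal (hg z)

lemma kerMean_enorm_le (hk : IsKer A k C c) (F : SpT n → ℝ) (b : ℝ) (x : Eu n) (τ : ℝ) :
    ‖kerMean k F b x τ‖ₑ ≤ ENNReal.ofReal C * gm c F b x τ :=
  enorm_integral_gauss_le hk.C_pos.le fun z => by rw [abs_of_nonneg (hk.nonneg z)]; exact hk.bd z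

lemma kerMean_dd_eq (hk : IsKer A k C c) (hF : SmC F) (i : Fin n)
    (h : τ < b) (x : Eu n) : kerMean k (dd (ex i) F) b x τ =
      (√(b - τ))⁻¹ * ∫ z, dd (single i 1) k z * F (τ, x - √(b - τ) • z) := by
  rw [hk.ibp hF, ← mul_assoc, inv_mul_cancel₀ (sqrt_pos.2 (by linarith)).ne', one_mul]
  rfl

lemma kerMean_dd_enorm_le (hk : IsKer A k C c) (hF : SmC F) (i : Fin n)
    (h : τ < b) (x : Eu n) : ‖kerMean k (dd (ex i) F) b x τ‖ₑ ≤
      ENNReal.ofReal C * (ENNReal.ofReal (√(b - τ))⁻¹ * gm c F b x τ) := by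
  rw [hk.kerMean_dd_eq hF i h, enorm_mul, mul_left_comm, ← ofReal_norm,
    norm_of_nonneg (by positivity)]
  gcongr
  exact enorm_integral_gauss_le hk.C_pos.le (hk.bd1 i)

lemma kerMean_dd_sub_enorm_le (hk : IsKer A k C c) (hF : SmC F) (i : Fin n)
    (h : τ < b) (x d : Eu n) (hd : ‖d‖ ^ 2 ≤ b - τ) :
    ‖kerMean k (dd (ex i) F) b (x + d) τ - kerMean k (dd (ex i) F) b x τ‖ₑ ≤
      ENNReal.ofReal (C * ‖d‖) * (ENNReal.ofReal (b - τ)⁻¹ * gm c F b x τ) := by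
  have hbt : 0 < b - τ := by linarith
  have hl := sqrt_pos.2 hbt
  set r := √(b - τ) with hr
  have hrr := mul_self_sqrt hbt.le
  set e : Eu n := single i 1 with he
  obtain ⟨Mb, hMb0, hMb⟩ := hF.bound τ τ
  have hni : ∀ y : Eu n, Integrable fun z => dd e k z * F (τ, y - r • z) := fun y =>
    IsKer.integrable_mul (hk.integrable_dd i) (by have := hF.1.continuous; fun_prop)
      (fun z => hMb _ ⟨le_rfl, le_rfl⟩)
  have e1 : ∫ z, dd e k z * F (τ, (x + d) - r • z) =
      ∫ z, dd e k (z + r⁻¹ • d) * F (τ, x - r • z) := by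
    rw [← integral_add_right_eq_self _ (r⁻¹ • d)]
    congr 1; ext z
    congr 3
    rw [smul_add, smul_smul, mul_inv_cancel₀ hl.ne', one_smul]
    abel
  have hni2 : Integrable fun z => dd e k (z + r⁻¹ • d) * F (τ, x - r • z) := by
    have := (hni (x + d)).comp_add_right (r⁻¹ • d)
    refine this.congr (ae_of_all _ fun z => ?_)
    simp only
    congr 3
    rw [smul_add, smul_smul, mul_inv_cancel₀ hl.ne', one_smul]
    abel
  rw [hk.kerMean_dd_eq hF i h, hk.kerMean_dd_eq hF i h, ← mul_sub, ← hr, ← he, e1,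
    ← integral_sub hni2 (hni x)]
  simp only [← sub_mul]
  have hζ : ‖r⁻¹ • d‖ = r⁻¹ * ‖d‖ := by
    rw [norm_smul, norm_inv, norm_of_nonneg hl.le]
  have hζ1 : ‖r⁻¹ • d‖ ≤ 1 := by
    rw [hζ, inv_mul_le_iff₀ hl, mul_one]
    exact le_sqrt_of_sq_le hd
  have h2 := enorm_integral_gauss_le (c := c) (B := C * (r⁻¹ * ‖d‖)) (by have := hk.C_pos; positivity)
    (g := fun z => dd e k (z + r⁻¹ • d) - dd e k z) (f := fun z => F (τ, x - r • z))
    (fun z => by rw [← hζ]; exact hk.lip i z _ hζ1)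
  rw [enorm_mul, ← ofReal_norm, norm_of_nonneg (by positivity)]
  refine (mul_le_mul_right h2 _).trans (le_of_eq ?_)
  rw [← mul_assoc, ← ofReal_mul (by positivity),
    ← mul_assoc (ENNReal.ofReal (C * ‖d‖)), ← ofReal_mul (by have := hk.C_pos; positivity)]
  congr 2
  rw [← hrr, mul_inv]; ring

end IsKer

/-- The contribution of times close to the vertex. -/
lemma near_bound (C : ℝ) (hc : 0 < c) (hC : 0 < C) : ∃ K > 0,
    ∀ (A : Fin n → Fin n → ℝ) (k : Eu n → ℝ), IsKer A k C c →
    ∀ (t₁ t₂ : ℝ) (F : SpT n → ℝ), SmC F → ∀ M : ℝ, 0 < M → MB t₁ t₂ F M →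
    ∀ (x : Eu n) (ρ a b : ℝ), 0 < ρ → b ≤ t₂ → t₁ ≤ a → a ≤ b → b - a ≤ ρ ^ 2 →
    (∀ i, |∫ τ in a..b, kerMean k (dd (ex i) F) b x τ| ≤ K * M * √ρ) ∧
    |∫ τ in a..b, kerMean k F b x τ| ≤ K * M * (ρ * √ρ) := by
  obtain ⟨K, hK, H⟩ := near_int hc
  refine ⟨C * K, by positivity, ?_⟩
  intro A k hk t₁ t₂ F hF M hM h x ρ a b hρ hb ha hab hba
  have hsub : Ioo a b ⊆ Ioo (b - ρ ^ 2) b ∩ Ioi t₁ := fun τ hτ =>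
    ⟨⟨by linarith [hτ.1], hτ.2⟩, lt_of_le_of_lt ha hτ.1⟩
  have H' := (lintegral_mono_set hsub).trans (H t₁ t₂ F hF.1.continuous M hM h x ρ b hρ hb)
  constructor
  · intro i
    refine abs_integral_le_of_lintegral hab (by positivity) ?_
    rw [setLIntegral_congr Ioo_ae_eq_Ioc.symm]
    calc _ ≤ ∫⁻ τ in Ioo a b, ENNReal.ofReal C * (ENNReal.ofReal (√(b - τ))⁻¹ * gm c F b x τ) :=
          setLIntegral_mono' measurableSet_Ioo fun τ hτ => hk.kerMean_dd_enorm_le hF i hτ.2 x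
      _ ≤ ENNReal.ofReal C * ENNReal.ofReal (K * M * √ρ) := by
          rw [lintegral_const_mul' _ _ ofReal_ne_top]; gcongr
      _ = _ := by rw [← ofReal_mul hC.le]; congr 1; ring
  · refine abs_integral_le_of_lintegral hab (by positivity) ?_
    rw [setLIntegral_congr Ioo_ae_eq_Ioc.symm]
    calc _ ≤ ∫⁻ τ in Ioo a b, ENNReal.ofReal (C * ρ) *
            (ENNReal.ofReal (√(b - τ))⁻¹ * gm c F b x τ) := by
          refine setLIntegral_mono' measurableSet_Ioo fun τ hτ => ?_
          refine (hk.kerMean_enorm_le F b x τ).trans ?_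
          rw [← mul_assoc, ← ofReal_mul (by positivity)]
          gcongr
          have h1 : 0 < √(b - τ) := sqrt_pos.2 (by linarith [hτ.2])
          have h2 : √(b - τ) ≤ ρ := sqrt_le_iff.2 ⟨hρ.le, by linarith [hτ.1]⟩
          rw [mul_assoc, ← div_eq_mul_inv]
          have := (one_le_div h1).2 h2
          nlinarith
      _ ≤ ENNReal.ofReal (C * ρ) * ENNReal.ofReal (K * M * √ρ) := by
          rw [lintegral_const_mul' _ _ ofReal_ne_top]; gcongr
      _ = _ := by rw [← ofReal_mul (by positivity)]; congr 1; ring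

/-- The difference of contributions of times far from the vertex. -/
lemma far_bound (C : ℝ) (hc : 0 < c) (hC : 0 < C) : ∃ K > 0,
    ∀ (A : Fin n → Fin n → ℝ) (k : Eu n → ℝ), IsKer A k C c →
    ∀ (t₁ t₂ : ℝ) (F : SpT n → ℝ), SmC F → ∀ M : ℝ, 0 < M → MB t₁ t₂ F M →
    ∀ (x d : Eu n) (ρ a b : ℝ), 0 < ρ → b ≤ t₂ → t₁ ≤ a → a ≤ b - ρ ^ 2 → ‖d‖ ≤ ρ →
    ∀ i, |∫ τ in a..(b - ρ ^ 2), (kerMean k (dd (ex i) F) b (x + d) τ -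
      kerMean k (dd (ex i) F) b x τ)| ≤ K * M * √ρ := by
  obtain ⟨K, hK, H⟩ := far_int hc
  refine ⟨C * K, by positivity, ?_⟩
  intro A k hk t₁ t₂ F hF M hM h x d ρ a b hρ hb ha hab hd i
  have hsub : Ioc a (b - ρ ^ 2) ⊆ Iic (b - ρ ^ 2) ∩ Ioi t₁ := fun τ hτ =>
    ⟨hτ.2, lt_of_le_of_lt ha hτ.1⟩
  have H' := (lintegral_mono_set hsub).trans (H t₁ t₂ F hF.1.continuous M hM h x ρ b hρ hb)
  have hρ2 : 0 < ρ ^ 2 := by positivity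
  refine abs_integral_le_of_lintegral hab (by positivity) ?_
  calc _ ≤ ∫⁻ τ in Ioc a (b - ρ ^ 2), ENNReal.ofReal (C * ρ) *
            (ENNReal.ofReal (b - τ)⁻¹ * gm c F b x τ) := by
          refine setLIntegral_mono' measurableSet_Ioc fun τ hτ => ?_
          have h3 := pow_le_pow_left₀ (norm_nonneg _) hd 2
          refine (hk.kerMean_dd_sub_enorm_le hF i (by linarith [hτ.2]) x d
            (by linarith [hτ.2])).trans ?_
          gcongr
    _ ≤ ENNReal.ofReal (C * ρ) * ENNReal.ofReal (K * M / √ρ) := by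
          rw [lintegral_const_mul' _ _ ofReal_ne_top]; gcongr
    _ = _ := by
          rw [← ofReal_mul (by positivity)]; congr 1
          have hs := mul_self_sqrt hρ.le
          have hs0 := sqrt_pos.2 hρ
          rw [mul_div_assoc', div_eq_iff hs0.ne']
          linear_combination (- C * K * M) * hs

lemma IsKer.intervalIntegrable_kerMean {k : Eu n → ℝ}
    (hk : IsKer A k C c) (hv : SmC v) {a' : ℝ} (hab : a ≤ a') (hb : a' ≤ b)
    (x : Eu n) : IntervalIntegrable (kerMean k v b x) volume a a' :=
  ((hk.kerMean_continuousOn hv a b x).mono (Icc_subset_Icc_right hb)).intervalIntegrable_of_Icc hab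

/-- Sup bounds for the constant coefficient problem. -/
lemma clm_sup (C : ℝ) (hc : 0 < c) (hC : 0 < C) : ∃ K > 0,
    ∀ (A : Fin n → Fin n → ℝ) (k : Eu n → ℝ), IsKer A k C c →
    ∀ (t₁ t₂ : ℝ) (w : SpT n → ℝ), SmC w → (∀ x, w (t₁, x) = 0) → ∀ M : ℝ, 0 < M →
    MB t₁ t₂ (heatOp A w) M → ∀ (b ρ : ℝ) (x : Eu n), b ∈ Icc t₁ t₂ → 0 < ρ → t₂ - t₁ ≤ ρ ^ 2 →
    |w (b, x)| ≤ K * M * (ρ * √ρ) ∧ ∀ i, |dd (ex i) w (b, x)| ≤ K * M * √ρ := by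
  obtain ⟨K, hK, H⟩ := near_bound (n := n) C hc hC
  refine ⟨C * K, by positivity, ?_⟩
  intro A k hk t₁ t₂ w hw hw0 M hM h b ρ x hb hρ hT
  obtain ⟨Hd, H0⟩ := H A k hk t₁ t₂ _ (hw.heatOp A) M hM h x ρ t₁ b hρ hb.2 le_rfl hb.1
    (by linarith [hb.2])
  have mass : ∀ y Y : ℝ, |(∫ z, k z) * y| ≤ Y → |y| ≤ C * Y := by
    intro y Y hy
    have hm := hk.mass
    have hm0 : 0 ≤ ∫ z, k z := integral_nonneg hk.nonneg
    rw [abs_mul, abs_of_nonneg hm0] at hy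
    have := mul_le_mul_of_nonneg_left hy hC.le
    nlinarith [abs_nonneg y]
  constructor
  · have hz : kerMean k w b x t₁ = 0 := by simp [kerMean, hw0]
    have := hk.duhamel hw hb.1 x
    rw [hz, zero_add] at this
    rw [← this] at H0
    exact (mass _ _ H0).trans (le_of_eq (by ring))
  · intro i
    have hz : kerMean k (dd (ex i) w) b x t₁ = 0 := by
      have : ∀ y, dd (ex i) w (t₁, y) = 0 := by
        intro y
        rw [← pd_slice hw.1 i t₁ y]
        have : (fun y => w (t₁, y)) = fun _ => 0 := funext hw0
        simp [pd, this]
      simp [kerMean, this]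
    have := hk.duhamel (hw.dd (ex i)) hb.1 x
    rw [hz, zero_add, heatOp_dd A hw] at this
    have H1 := Hd i
    rw [← this] at H1
    exact (mass _ _ H1).trans (le_of_eq (by ring))

lemma clm_holder_space (C : ℝ) (hc : 0 < c) (hC : 0 < C) : ∃ K > 0,
    ∀ (A : Fin n → Fin n → ℝ) (k : Eu n → ℝ), IsKer A k C c →
    ∀ (t₁ t₂ : ℝ) (w : SpT n → ℝ), SmC w → (∀ x, w (t₁, x) = 0) → ∀ M : ℝ, 0 < M →
    MB t₁ t₂ (heatOp A w) M → ∀ (b ρ : ℝ) (x d : Eu n), b ∈ Icc t₁ t₂ → 0 < ρ → ‖d‖ ≤ ρ →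
    ∀ i, |dd (ex i) w (b, x + d) - dd (ex i) w (b, x)| ≤ K * M * √ρ := by
  obtain ⟨K, hK, H⟩ := near_bound (n := n) C hc hC
  obtain ⟨K', hK', H'⟩ := far_bound (n := n) C hc hC
  refine ⟨C * (2 * K + K'), by positivity, ?_⟩
  intro A k hk t₁ t₂ w hw hw0 M hM h b ρ x d hb hρ hd i
  have hm := hk.mass
  have hm0 : 0 ≤ ∫ z, k z := integral_nonneg hk.nonneg
  have mass : ∀ y Y : ℝ, |(∫ z, k z) * y| ≤ Y → |y| ≤ C * Y := by
    intro y Y hy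
    rw [abs_mul, abs_of_nonneg hm0] at hy
    have := mul_le_mul_of_nonneg_left hy hC.le
    nlinarith [abs_nonneg y]
  have hF := hw.heatOp A
  have hrep : ∀ y, (∫ z, k z) * dd (ex i) w (b, y) =
      ∫ τ in t₁..b, kerMean k (dd (ex i) (heatOp A w)) b y τ := by
    intro y
    have hz : kerMean k (dd (ex i) w) b y t₁ = 0 := by
      have : ∀ y, dd (ex i) w (t₁, y) = 0 := by
        intro y
        rw [← pd_slice hw.1 i t₁ y]
        have : (fun y => w (t₁, y)) = fun _ => 0 := funext hw0
        simp [pd, this]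
      simp [kerMean, this]
    have := hk.duhamel (hw.dd (ex i)) hb.1 y
    rwa [hz, zero_add, heatOp_dd A hw] at this
  suffices |(∫ z, k z) * (dd (ex i) w (b, x + d) - dd (ex i) w (b, x))| ≤
      (2 * K + K') * M * √ρ from (mass _ _ this).trans (le_of_eq (by ring))
  rw [mul_sub, hrep, hrep]
  have hpos : 0 ≤ M * √ρ := by positivity
  rcases le_or_gt (b - ρ ^ 2) t₁ with hcase | hcase
  · have h1 := (H A k hk t₁ t₂ _ hF M hM h (x + d) ρ t₁ b hρ hb.2 le_rfl hb.1 (by linarith)).1 i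
    have h2 := (H A k hk t₁ t₂ _ hF M hM h x ρ t₁ b hρ hb.2 le_rfl hb.1 (by linarith)).1 i
    refine (abs_sub _ _).trans ?_
    nlinarith
  · have hρ2 : 0 < ρ ^ 2 := by positivity
    have h1 := (H A k hk t₁ t₂ _ hF M hM h (x + d) ρ (b - ρ ^ 2) b hρ hb.2 hcase.le
      (by linarith) (by linarith)).1 i
    have h2 := (H A k hk t₁ t₂ _ hF M hM h x ρ (b - ρ ^ 2) b hρ hb.2 hcase.le
      (by linarith) (by linarith)).1 i
    have h3 := H' A k hk t₁ t₂ _ hF M hM h x d ρ t₁ b hρ hb.2 le_rfl hcase.le hd i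
    have hI : ∀ y, IntervalIntegrable (kerMean k (dd (ex i) (heatOp A w)) b y) volume t₁
        (b - ρ ^ 2) := fun y => hk.intervalIntegrable_kerMean (hF.dd _) hcase.le (by linarith) y
    have hI2 : ∀ y, IntervalIntegrable (kerMean k (dd (ex i) (heatOp A w)) b y) volume
        (b - ρ ^ 2) b := fun y =>
      hk.intervalIntegrable_kerMean (hF.dd _) (by linarith) le_rfl y
    rw [← intervalIntegral.integral_add_adjacent_intervals (hI (x + d)) (hI2 (x + d)),
      ← intervalIntegral.integral_add_adjacent_intervals (hI x) (hI2 x)]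
    rw [intervalIntegral.integral_sub (hI (x + d)) (hI x)] at h3
    rw [abs_le] at h1 h2 h3 ⊢
    constructor <;> nlinarith

lemma exists_gauss_weight (n : ℕ) (hc : 0 < c) : ∃ J : ℝ, 0 ≤ J ∧
    ∀ g : Eu n → ℝ, (∀ z, |g z| ≤ exp (-(c * ‖z‖ ^ 2)) * (1 + ‖z‖)) → |∫ z, g z| ≤ J := by
  refine ⟨∫ z : Eu n, (2 + 2 / c) * exp (-(c / 2 * ‖z‖ ^ 2)),
    integral_nonneg fun z => by positivity, fun g hg => ?_⟩
  rw [← norm_eq_abs]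
  refine norm_integral_le_of_norm_le ((integrable_gauss (half_pos hc)).const_mul _)
    (ae_of_all _ fun z => (hg z).trans ?_)
  have h1 : 1 + c / 2 * ‖z‖ ^ 2 ≤ exp (c / 2 * ‖z‖ ^ 2) := by
    rw [add_comm]; exact add_one_le_exp _
  have h2 : 1 + ‖z‖ ≤ (2 + 2 / c) * (1 + c / 2 * ‖z‖ ^ 2) := by
    have e : (2 + 2 / c) * (1 + c / 2 * ‖z‖ ^ 2) = 2 + 2 / c + c * ‖z‖ ^ 2 + ‖z‖ ^ 2 := by
      field_simp
      ring
    rw [e]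
    have : 0 < 2 / c := by positivity
    nlinarith [sq_nonneg (‖z‖ - 1)]
  have h3 : exp (-(c / 2 * ‖z‖ ^ 2)) =
      exp (-(c * ‖z‖ ^ 2)) * exp (c / 2 * ‖z‖ ^ 2) := by
    rw [← exp_add]; congr 1; ring
  rw [h3, mul_left_comm]
  gcongr
  exact h2.trans (by gcongr)

/-- Parabolic Hölder bound for the gradient in the constant coefficient problem. -/
lemma clm_holder (C : ℝ) (hc : 0 < c) (hC : 0 < C) : ∃ K > 0,
    ∀ (A : Fin n → Fin n → ℝ) (k : Eu n → ℝ), IsKer A k C c →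
    ∀ (t₁ t₂ : ℝ) (w : SpT n → ℝ), SmC w → (∀ x, w (t₁, x) = 0) → ∀ M : ℝ, 0 < M →
    MB t₁ t₂ (heatOp A w) M → ∀ (a b ρ : ℝ) (x y : Eu n), t₁ ≤ a → a ≤ b → b ≤ t₂ → 0 < ρ →
    b - a ≤ ρ ^ 2 → ‖y - x‖ ≤ ρ →
    ∀ i, |dd (ex i) w (a, y) - dd (ex i) w (b, x)| ≤ K * M * √ρ := by
  obtain ⟨K, hK, H⟩ := near_bound C hc hC
  obtain ⟨K', hK', H'⟩ := clm_holder_space C hc hC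
  obtain ⟨J, hJ, HJ⟩ := exists_gauss_weight n hc
  refine ⟨K' + C * (K + C * K' * J), by positivity, ?_⟩
  intro A k hk t₁ t₂ w hw hw0 M hM h a b ρ x y ha hab hb hρ hba hxy i
  have hm := hk.mass
  have hm0 : 0 ≤ ∫ z, k z := integral_nonneg hk.nonneg
  have hF := hw.heatOp A
  set G := dd (ex i) w
  have hGs : SmC G := hw.dd _
  have h1 := H' A k hk t₁ t₂ w hw hw0 M hM h a ρ x (y - x) ⟨ha, hab.trans hb⟩ hρ hxy i
  rw [add_sub_cancel] at h1
  have h2 := (H A k hk t₁ t₂ _ hF M hM h x ρ a b hρ hb ha hab hba).1 i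
  have h3 := hk.duhamel hGs hab x
  rw [heatOp_dd A hw] at h3
  have hr : √(b - a) ≤ ρ := sqrt_le_iff.2 ⟨hρ.le, hba⟩
  set r := √(b - a)
  have hr0 : 0 ≤ r := sqrt_nonneg _
  have h4 : |kerMean k G b x a - (∫ z, k z) * G (a, x)| ≤ C * K' * J * M * √ρ := by
    obtain ⟨Mb, hMb0, hMb⟩ := hGs.bound a a
    have hGc := hGs.1.continuous
    have i1 : Integrable fun z => k z * G (a, x - r • z) :=
      IsKer.integrable_mul hk.integrable (by fun_prop) (fun z => hMb _ ⟨le_rfl, le_rfl⟩)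
    unfold kerMean
    rw [← integral_mul_const, ← integral_sub i1 (hk.integrable.mul_const _)]
    have hQ : 0 < C * (K' * M * √ρ) := by have := sqrt_pos.2 hρ; positivity
    have := HJ (fun z => (C * (K' * M * √ρ))⁻¹ * (k z * G (a, x - r • z) - k z * G (a, x))) ?_
    · rw [integral_const_mul, abs_mul, abs_of_pos (inv_pos.2 hQ), inv_mul_le_iff₀ hQ] at this
      refine this.trans (le_of_eq (by ring))
    · intro z
      rw [abs_mul, abs_of_pos (inv_pos.2 hQ), inv_mul_le_iff₀ hQ, ← mul_sub, abs_mul,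
        abs_of_nonneg (hk.nonneg z)]
      have hz : 0 < ρ * (1 + ‖z‖) := by positivity
      have h5 := H' A k hk t₁ t₂ w hw hw0 M hM h a (ρ * (1 + ‖z‖)) x (-(r • z))
        ⟨ha, hab.trans hb⟩ hz (by
          rw [norm_neg, norm_smul, norm_of_nonneg hr0]
          have := norm_nonneg z; nlinarith) i
      rw [← sub_eq_add_neg] at h5
      have h6 : √(ρ * (1 + ‖z‖)) ≤ √ρ * (1 + ‖z‖) := by
        rw [sqrt_mul hρ.le]
        gcongr
        exact sqrt_le_iff.2 ⟨by positivity, by nlinarith [norm_nonneg z]⟩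
      calc k z * |G (a, x - r • z) - G (a, x)|
          ≤ (C * exp (-(c * ‖z‖ ^ 2))) * (K' * M * (√ρ * (1 + ‖z‖))) := by
            refine mul_le_mul (hk.bd z) (h5.trans (by gcongr)) (abs_nonneg _) (by positivity)
        _ = _ := by ring
  have h5 : |(∫ z, k z) * (G (b, x) - G (a, x))| ≤ (K + C * K' * J) * M * √ρ := by
    rw [mul_sub, h3]
    have e : ∀ p q s : ℝ, p + q - s = (p - s) + q := by intros; ring
    rw [e]
    refine (abs_add_le _ _).trans ?_
    calc _ ≤ C * K' * J * M * √ρ + K * M * √ρ := add_le_add h4 h2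
      _ = _ := by ring
  have h6 : |G (b, x) - G (a, x)| ≤ C * (K + C * K' * J) * M * √ρ := by
    rw [abs_mul, abs_of_nonneg hm0] at h5
    calc _ = 1 * |G (b, x) - G (a, x)| := (one_mul _).symm
      _ ≤ (C * ∫ z, k z) * |G (b, x) - G (a, x)| := by gcongr
      _ = C * ((∫ z, k z) * |G (b, x) - G (a, x)|) := by ring
      _ ≤ C * ((K + C * K' * J) * M * √ρ) := by gcongr
      _ = _ := by ring
  have e : G (a, y) - G (b, x) = (G (a, y) - G (a, x)) - (G (b, x) - G (a, x)) := by ring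
  rw [e]
  refine (abs_sub _ _).trans ?_
  calc _ ≤ K' * M * √ρ + C * (K + C * K' * J) * M * √ρ := add_le_add h1 h6
    _ = _ := by ring

end

section

lemma energy_algebra (hlam : 0 < lam)
    (hA : ∀ ξ : Fin n → ℝ, lam * ∑ i, ξ i ^ 2 ≤ ∑ i, ∑ j, A i j * (ξ i * ξ j))
    (hL : ∀ i j, |A i j| ≤ L) (h F : ℝ) (e g : Fin n → ℝ) (D : Fin n → Fin n → ℝ) :
    (∑ l, -((2 * h * e l * g l + h ^ 2 * D l l) * F)) -
      ∑ l, ∑ i, ∑ j, A i j * ((2 * h * e j * g l + h ^ 2 * D l j) * D l i) ≤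
    -(lam / 2) * (h ^ 2 * ∑ l, ∑ i, D l i ^ 2) + 2 * n / lam * (h ^ 2 * F ^ 2) +
      (lam + 4 * (n + 1) ^ 2 * L ^ 2 / lam) * ((∑ j, e j ^ 2) * ∑ l, g l ^ 2) := by
  have T1 : ∀ l, -((2 * h * e l * g l + h ^ 2 * D l l) * F) ≤
      2 / lam * (h ^ 2 * F ^ 2) + lam / 4 * (h ^ 2 * ∑ i, D l i ^ 2) +
        lam * ((∑ j, e j ^ 2) * g l ^ 2) := by
    intro l
    have s1 : D l l ^ 2 ≤ ∑ i, D l i ^ 2 :=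
      single_le_sum (f := fun i => D l i ^ 2) (fun i _ => sq_nonneg _) (Finset.mem_univ l)
    have s2 : e l ^ 2 ≤ ∑ j, e j ^ 2 :=
      single_le_sum (f := fun i => e i ^ 2) (fun i _ => sq_nonneg _) (Finset.mem_univ l)
    have a1 : -(2 * h * e l * g l * F) ≤ lam⁻¹ * (h ^ 2 * F ^ 2) + lam * (e l ^ 2 * g l ^ 2) := by
      have : 0 ≤ lam⁻¹ * (h * F + lam * (e l * g l)) ^ 2 := by positivity
      have e1 : lam⁻¹ * (h * F + lam * (e l * g l)) ^ 2 = lam⁻¹ * (h ^ 2 * F ^ 2) +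
        2 * h * e l * g l * F + lam * (e l ^ 2 * g l ^ 2) := by field_simp; ring
      linarith
    have a2 : -(h ^ 2 * D l l * F) ≤ lam⁻¹ * (h ^ 2 * F ^ 2) + lam / 4 * (h ^ 2 * D l l ^ 2) := by
      have : 0 ≤ lam⁻¹ * h ^ 2 * (F + lam / 2 * D l l) ^ 2 := by positivity
      have e1 : lam⁻¹ * h ^ 2 * (F + lam / 2 * D l l) ^ 2 = lam⁻¹ * (h ^ 2 * F ^ 2) +
        h ^ 2 * D l l * F + lam / 4 * (h ^ 2 * D l l ^ 2) := by field_simp; ring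
      linarith
    have a3 : lam * (e l ^ 2 * g l ^ 2) ≤ lam * ((∑ j, e j ^ 2) * g l ^ 2) := by gcongr
    have a4 : lam / 4 * (h ^ 2 * D l l ^ 2) ≤ lam / 4 * (h ^ 2 * ∑ i, D l i ^ 2) := by gcongr
    have : 2 / lam * (h ^ 2 * F ^ 2) = lam⁻¹ * (h ^ 2 * F ^ 2) + lam⁻¹ * (h ^ 2 * F ^ 2) := by
      field_simp; ring
    linarith
  have T2 : ∀ l, -(∑ i, ∑ j, A i j * ((2 * h * e j * g l + h ^ 2 * D l j) * D l i)) ≤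
      -lam * (h ^ 2 * ∑ i, D l i ^ 2) + lam / 4 * (h ^ 2 * ∑ i, D l i ^ 2) +
        4 * (n + 1) ^ 2 * L ^ 2 / lam * ((∑ j, e j ^ 2) * g l ^ 2) := by
    intro l
    have b1 := mul_le_mul_of_nonneg_left (hA (D l)) (sq_nonneg h)
    have b2 : ∀ i j, -(A i j * (2 * h * e j * g l * D l i)) ≤
        lam / (4 * (n + 1)) * (h ^ 2 * D l i ^ 2) +
          4 * (n + 1) * L ^ 2 / lam * (e j ^ 2 * g l ^ 2) := by
      intro i j
      have c1 : A i j ^ 2 ≤ L ^ 2 := sq_le_sq' (by linarith [(abs_le.1 (hL i j)).1])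
        (abs_le.1 (hL i j)).2
      have c2 : 0 ≤ lam / (4 * (n + 1)) *
          (h * D l i + 4 * (n + 1) / lam * (A i j * (e j * g l))) ^ 2 := by positivity
      have e1 : lam / (4 * (n + 1)) *
          (h * D l i + 4 * (n + 1) / lam * (A i j * (e j * g l))) ^ 2 =
          lam / (4 * (n + 1)) * (h ^ 2 * D l i ^ 2) + A i j * (2 * h * e j * g l * D l i) +
          4 * (n + 1) * A i j ^ 2 / lam * (e j ^ 2 * g l ^ 2) := by field_simp; ring
      have c3 : 4 * (n + 1) * A i j ^ 2 / lam * (e j ^ 2 * g l ^ 2) ≤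
        4 * (n + 1) * L ^ 2 / lam * (e j ^ 2 * g l ^ 2) := by gcongr
      linarith
    have b3 := sum_le_sum fun i (_ : i ∈ Finset.univ) =>
      sum_le_sum fun j (_ : j ∈ Finset.univ) => b2 i j
    simp only [sum_add_distrib, sum_neg_distrib, ← mul_sum, ← sum_mul,
      sum_const, card_univ, Fintype.card_fin, nsmul_eq_mul] at b3
    have b4 : ∑ i, ∑ j, A i j * ((2 * h * e j * g l + h ^ 2 * D l j) * D l i) =
        (∑ i, ∑ j, A i j * (2 * h * e j * g l * D l i)) +
          h ^ 2 * ∑ i, ∑ j, A i j * (D l i * D l j) := by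
      simp only [mul_sum, ← sum_add_distrib]
      exact sum_congr rfl fun i _ => sum_congr rfl fun j _ => by ring
    rw [b4]
    have S : 0 ≤ h ^ 2 * ∑ i, D l i ^ 2 := by positivity
    have S' : 0 ≤ (∑ j, e j ^ 2) * g l ^ 2 := by positivity
    have m1 : (n : ℝ) * (lam / (4 * (n + 1)) * (h ^ 2 * ∑ i, D l i ^ 2)) ≤
        lam / 4 * (h ^ 2 * ∑ i, D l i ^ 2) := by
      rw [← mul_assoc]
      refine mul_le_mul_of_nonneg_right ?_ S
      rw [mul_div_assoc', div_le_div_iff₀ (by positivity) (by norm_num)]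
      nlinarith
    have m2 : n * (4 * (n + 1) * L ^ 2 / lam * ((∑ j, e j ^ 2) * g l ^ 2)) ≤
        4 * (n + 1) ^ 2 * L ^ 2 / lam * ((∑ j, e j ^ 2) * g l ^ 2) := by
      rw [← mul_assoc]
      refine mul_le_mul_of_nonneg_right ?_ S'
      rw [mul_div_assoc', div_le_div_iff_of_pos_right hlam]
      nlinarith [sq_nonneg L]
    have e1 : lam / (4 * (n + 1)) * (h ^ 2 * (n * ∑ i, D l i ^ 2)) =
      n * (lam / (4 * (n + 1)) * (h ^ 2 * ∑ i, D l i ^ 2)) := by ring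
    have e2 : 4 * (n + 1) * L ^ 2 / lam * ((∑ i, e i ^ 2) * (n * g l ^ 2)) =
      (n : ℝ) * (4 * (n + 1) * L ^ 2 / lam * ((∑ j, e j ^ 2) * g l ^ 2)) := by ring
    rw [e1, e2] at b3
    linarith
  have := sum_le_sum fun l (_ : l ∈ Finset.univ) => add_le_add (T1 l) (T2 l)
  simp only [sum_add_distrib, ← mul_sum, sum_neg_distrib,
    sum_const, card_univ, Fintype.card_fin, nsmul_eq_mul] at this
  simp only [sum_neg_distrib]
  have e2 : 2 / lam * (h ^ 2 * (n * F ^ 2)) = 2 * n / lam * (h ^ 2 * F ^ 2) := by ring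
  rw [e2] at this
  have e3 : (lam + 4 * (n + 1) ^ 2 * L ^ 2 / lam) * ((∑ j, e j ^ 2) * ∑ l, g l ^ 2) =
    lam * ((∑ j, e j ^ 2) * ∑ l, g l ^ 2) +
    4 * (n + 1) ^ 2 * L ^ 2 / lam * ((∑ j, e j ^ 2) * ∑ l, g l ^ 2) := by ring
  rw [e3]
  linarith

namespace SmC
variable {f g : SpT n → ℝ}

lemma integrable_slice (hf : SmC f) (t : ℝ) : Integrable fun x => f (t, x) :=
  (hf.slice_contDiff t).continuous.integrable_of_hasCompactSupport (hf.slice_hasCompactSupport t)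

lemma integral_dd_ex (hf : SmC f) (i : Fin n) (t : ℝ) : ∫ x, _root_.dd (ex i) f (t, x) = 0 := by
  have h := integral_mul_fderiv_eq_neg_fderiv_mul_of_integrable (μ := volume)
    (f := fun _ => (1:ℝ)) (g := fun x => f (t, x)) (v := single i 1)
    (by simp) (by simpa [← pd_slice hf.1, pd] using (hf.dd (ex i)).integrable_slice t)
    (by simpa using hf.integrable_slice t)
    (fun _ _ => by fun_prop) (fun z _ => (hf.slice_contDiff t).differentiable (by simp) z)
  simpa [← pd_slice hf.1, pd] using h

lemma hasDerivAt_integral (hf : SmC f) (t : ℝ) :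
    HasDerivAt (fun s => ∫ x, f (s, x)) (∫ x, _root_.dd et f (t, x)) t := by
  obtain ⟨R, hR⟩ := (hf.dd et).2
  obtain ⟨M, hM0, hM⟩ := (hf.dd et).bound (t - 1) (t + 1)
  refine (hasDerivAt_integral_of_dominated_loc_of_deriv_le
    (F' := fun s x => _root_.dd et f (s, x)) (s := ball t 1)
    (bound := fun x => (closedBall 0 R).indicator (fun _ => M) x)
    (ball_mem_nhds t one_pos) ?_ (hf.integrable_slice t) ?_ ?_ ?_ ?_).2
  · exact Eventually.of_forall fun s => (hf.integrable_slice s).aestronglyMeasurable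
  · exact ((hf.dd et).integrable_slice t).aestronglyMeasurable
  · refine ae_of_all _ fun x s hs => ?_
    by_cases hx : x ∈ closedBall 0 R
    · rw [indicator_of_mem hx, norm_eq_abs]
      rw [ball_eq_Ioo] at hs
      exact hM _ ⟨hs.1.le, hs.2.le⟩
    · rw [indicator_of_notMem hx, hR _ (by simpa using hx)]; simp
  · exact (integrable_indicator_iff measurableSet_closedBall).2
      (integrableOn_const (measure_closedBall_lt_top.ne))
  · refine ae_of_all _ fun x s _ => ?_
    have := hasDerivAt_line hf.1 (fun s => (s, x)) et s
      ((hasDerivAt_id s).prodMk (hasDerivAt_const s x))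
    exact this

lemma continuous_integral (hf : SmC f) : Continuous fun s => ∫ x, f (s, x) :=
  continuous_iff_continuousAt.2 fun t => (hf.hasDerivAt_integral t).continuousAt

lemma integral_dd_et (hf : SmC f) (a b : ℝ) :
    ∫ s in a..b, ∫ x, _root_.dd et f (s, x) = (∫ x, f (b, x)) - ∫ x, f (a, x) :=
  intervalIntegral.integral_eq_sub_of_hasDerivAt (fun t _ => hf.hasDerivAt_integral t)
    (hf.dd et).continuous_integral.continuousOn.intervalIntegrable

lemma lintegral_eq (hf : SmC f) (h0 : ∀ p, 0 ≤ f p) (hab : a ≤ b) :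
    ∫⁻ s in Ioc a b, ∫⁻ x, ENNReal.ofReal (f (s, x)) =
      ENNReal.ofReal (∫ s in a..b, ∫ x, f (s, x)) := by
  rw [intervalIntegral.integral_of_le hab, ofReal_integral_eq_lintegral_ofReal]
  · refine lintegral_congr fun s => ?_
    rw [ofReal_integral_eq_lintegral_ofReal (hf.integrable_slice s) (ae_of_all _ fun _ => h0 _)]
  · exact (hf.continuous_integral.continuousOn.integrableOn_Icc).mono_set Ioc_subset_Icc_self
  · exact ae_of_all _ fun s => integral_nonneg fun x => h0 _

end SmC

/-- Caccioppoli inequality for the gradient of a solution of a constant-coefficient equation. -/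
lemma energy (hlam : 0 < lam)
    (hA : ∀ ξ : Fin n → ℝ, lam * ∑ i, ξ i ^ 2 ≤ ∑ i, ∑ j, A i j * (ξ i * ξ j))
    (hL : ∀ i j, |A i j| ≤ L) {η w : SpT n → ℝ} (hη : SmC η) (hηt : ∀ p, dd et η p = 0)
    (hw : SmC w) (c : Fin n → ℝ) (hab : a ≤ b) :
    lam / 2 * ∫ s in a..b, ∫ x, η (s, x) ^ 2 * ∑ l, ∑ i, dd (ex i) (dd (ex l) w) (s, x) ^ 2 ≤
      (∫ x, 1 / 2 * (η (a, x) ^ 2 * ∑ l, (dd (ex l) w (a, x) - c l) ^ 2)) +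
      (2 * n / lam * (∫ s in a..b, ∫ x, η (s, x) ^ 2 * heatOp A w (s, x) ^ 2) +
      (lam + 4 * (n + 1) ^ 2 * L ^ 2 / lam) * ∫ s in a..b, ∫ x,
        (∑ j, dd (ex j) η (s, x) ^ 2) * ∑ l, (dd (ex l) w (s, x) - c l) ^ 2) := by
  set g : Fin n → SpT n → ℝ := fun l p => dd (ex l) w p - c l with hg
  have hgs : ∀ l, ContDiff ℝ ∞ (g l) := fun l => (hw.1.dd _).sub contDiff_const
  have hgd : ∀ l e, dd e (g l) = dd e (dd (ex l) w) := fun l e => dd_sub_const _ _ _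
  have hF := hw.heatOp A
  have sm2 : ∀ {f : SpT n → ℝ}, ContDiff ℝ ∞ f → SmC fun p => η p ^ 2 * f p := fun {f} hf => by
    have := hη.mul_left (hη.1.mul hf)
    convert this using 2
    ring
  set Φ : SpT n → ℝ := fun p => 1 / 2 * (η p ^ 2 * ∑ l, g l p ^ 2) with hΦ
  have hΦs : SmC Φ := (sm2 (ContDiff.sum fun l _ => (hgs l).pow 2)).const_mul _
  set E : Fin n → SpT n → ℝ := fun l p => η p ^ 2 * (g l p * heatOp A w p) with hE
  have hEs : ∀ l, SmC (E l) := fun l => sm2 ((hgs l).mul hF.1)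
  set V : Fin n → Fin n → SpT n → ℝ := fun l i p => η p ^ 2 * (g l p * dd (ex i) (g l) p) with hV
  have hVs : ∀ l i, SmC (V l i) := fun l i => sm2 ((hgs l).mul ((hgs l).dd _))
  have hη2 : ∀ e p, dd e (fun q => η q ^ 2) p = 2 * η p * dd e η p := fun e p => by
    have := dd_mul hη.1 hη.1 e p
    simp only [sq]; rw [this]; ring
  have hη2s : ContDiff ℝ ∞ fun q => η q ^ 2 := hη.1.pow 2
  set P : SpT n → ℝ := fun p => η p ^ 2 * ∑ l, ∑ i, dd (ex i) (dd (ex l) w) p ^ 2 with hP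
  set R1 : SpT n → ℝ := fun p => η p ^ 2 * heatOp A w p ^ 2 with hR1
  set R2 : SpT n → ℝ := fun p => (∑ j, dd (ex j) η p ^ 2) * ∑ l, g l p ^ 2 with hR2
  have hPs : SmC P := sm2 (ContDiff.sum fun l _ => ContDiff.sum fun i _ => ((hw.1.dd _).dd _).pow 2)
  have hR1s : SmC R1 := sm2 (hF.1.pow 2)
  have hR2s : SmC R2 := by
    have : SmC fun p => ∑ j, dd (ex j) η p ^ 2 := SmC.sum _ fun j _ => by
      have := (hη.dd (ex j)).mul_left (hη.dd (ex j)).1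
      simpa only [sq] using this
    have := this.mul_left (g := fun p => ∑ l, g l p ^ 2) (ContDiff.sum fun l _ => (hgs l).pow 2)
    convert this using 2
    ring
  have pt : ∀ p, dd et Φ p + lam / 2 * P p ≤ (∑ l, dd (ex l) (E l) p) +
      (∑ l, ∑ i, ∑ j, A i j * dd (ex j) (V l i) p) + (2 * n / lam * R1 p +
        (lam + 4 * (n + 1) ^ 2 * L ^ 2 / lam) * R2 p) := by
    intro p
    have a1 : dd et Φ p = ∑ l, η p ^ 2 * (g l p * dd et (g l) p) := by
      rw [hΦ, dd_const_mul (hη2s.mul (ContDiff.sum fun l _ => (hgs l).pow 2)),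
        dd_mul hη2s (ContDiff.sum fun l _ => (hgs l).pow 2), hη2, hηt,
        dd_sum _ (fun l _ => (hgs l).pow 2), mul_zero, zero_mul, zero_add, mul_sum,
        mul_sum]
      refine sum_congr rfl fun l _ => ?_
      have := dd_mul (hgs l) (hgs l) et p
      simp only [sq] at this ⊢
      rw [this]; ring
    have a2 : ∀ l, dd et (g l) p = dd (ex l) (heatOp A w) p +
        ∑ i, ∑ j, A i j * dd (ex j) (dd (ex i) (g l)) p := by
      intro l
      have := congrFun (heatOp_dd A hw (ex l)) p
      rw [← this]
      simp only [heatOp, hgd]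
      ring
    have a3 : ∀ l, dd (ex l) (E l) p = (2 * η p * dd (ex l) η p * g l p +
        η p ^ 2 * dd (ex l) (g l) p) * heatOp A w p +
        η p ^ 2 * (g l p * dd (ex l) (heatOp A w) p) := by
      intro l
      rw [hE, dd_mul hη2s ((hgs l).mul hF.1), dd_mul (hgs l) hF.1, hη2]
      ring
    have a4 : ∀ l i j, dd (ex j) (V l i) p = (2 * η p * dd (ex j) η p * g l p +
        η p ^ 2 * dd (ex j) (g l) p) * dd (ex i) (g l) p +
        η p ^ 2 * (g l p * dd (ex j) (dd (ex i) (g l)) p) := by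
      intro l i j
      rw [hV, dd_mul hη2s ((hgs l).mul ((hgs l).dd _)), dd_mul (hgs l) ((hgs l).dd _), hη2]
      ring
    have al := energy_algebra hlam hA hL (η p) (heatOp A w p) (fun j => dd (ex j) η p)
      (fun l => g l p) (fun l i => dd (ex i) (g l) p)
    have a5 : dd et Φ p = (∑ l, dd (ex l) (E l) p) +
      (∑ l, ∑ i, ∑ j, A i j * dd (ex j) (V l i) p) +
      ((∑ l, -((2 * η p * dd (ex l) η p * g l p + η p ^ 2 * dd (ex l) (g l) p) * heatOp A w p)) -
      ∑ l, ∑ i, ∑ j, A i j * ((2 * η p * dd (ex j) η p * g l p +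
        η p ^ 2 * dd (ex j) (g l) p) * dd (ex i) (g l) p)) := by
      rw [a1, ← sum_sub_distrib, ← sum_add_distrib, ← sum_add_distrib]
      refine sum_congr rfl fun l _ => ?_
      rw [a2, a3]
      simp only [a4, mul_add, mul_sum, sum_add_distrib, add_mul]
      have : ∑ i, ∑ j, η p ^ 2 * (g l p * (A i j * dd (ex j) (dd (ex i) (g l)) p)) =
        ∑ i, ∑ j, A i j * (η p ^ 2 * (g l p * dd (ex j) (dd (ex i) (g l)) p)) :=
        sum_congr rfl fun i _ => sum_congr rfl fun j _ => by ring
      rw [this]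
      ring
    rw [a5]
    have hPp : P p = η p ^ 2 * ∑ l, ∑ i, dd (ex i) (g l) p ^ 2 := by simp only [hP, hgd]
    rw [hPp]
    simp only [hR1, hR2]
    linarith
  have hZ1 : SmC fun p => ∑ l, dd (ex l) (E l) p := SmC.sum _ fun l _ => (hEs l).dd _
  have hZ2 : SmC fun p => ∑ l, ∑ i, ∑ j, A i j * dd (ex j) (V l i) p :=
    SmC.sum _ fun l _ => SmC.sum _ fun i _ => SmC.sum _ fun j _ => ((hVs l i).dd _).const_mul _
  have i1 : ∀ s, ∫ x, ∑ l, dd (ex l) (E l) (s, x) = 0 := fun s => by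
    rw [integral_finsetSum _ fun l _ => ((hEs l).dd _).integrable_slice s]
    simp [(hEs _).integral_dd_ex]
  have i2 : ∀ s, ∫ x, ∑ l, ∑ i, ∑ j, A i j * dd (ex j) (V l i) (s, x) = 0 := fun s => by
    rw [integral_finsetSum _ fun l _ => (SmC.sum _ fun i _ => SmC.sum _ fun j _ =>
      ((hVs l i).dd (ex j)).const_mul (A i j)).integrable_slice s]
    refine sum_eq_zero fun l _ => ?_
    rw [integral_finsetSum _ fun i _ => (SmC.sum _ fun j _ =>
      ((hVs l i).dd (ex j)).const_mul (A i j)).integrable_slice s]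
    refine sum_eq_zero fun i _ => ?_
    rw [integral_finsetSum _ fun j _ => (((hVs l i).dd (ex j)).const_mul (A i j)).integrable_slice s]
    refine sum_eq_zero fun j _ => ?_
    rw [integral_const_mul, (hVs l i).integral_dd_ex, mul_zero]
  have sl : ∀ s, (∫ x, dd et Φ (s, x)) + lam / 2 * ∫ x, P (s, x) ≤ 2 * n / lam * (∫ x, R1 (s, x)) +
        (lam + 4 * (n + 1) ^ 2 * L ^ 2 / lam) * ∫ x, R2 (s, x) := by
    intro s
    have := integral_mono ((hΦs.dd et).add (hPs.const_mul (lam / 2)) |>.integrable_slice s)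
      (((hZ1.add hZ2).add ((hR1s.const_mul (2 * n / lam)).add
        (hR2s.const_mul (lam + 4 * (n + 1) ^ 2 * L ^ 2 / lam)))).integrable_slice s)
      (fun x => pt (s, x))
    rw [integral_add ((hΦs.dd et).integrable_slice s) ((hPs.const_mul _).integrable_slice s),
      integral_add ((hZ1.add hZ2).integrable_slice s) (((hR1s.const_mul _).add
        (hR2s.const_mul _)).integrable_slice s),
      integral_add (hZ1.integrable_slice s) (hZ2.integrable_slice s),
      integral_add ((hR1s.const_mul _).integrable_slice s) ((hR2s.const_mul _).integrable_slice s),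
      i1, i2, integral_const_mul, integral_const_mul, integral_const_mul] at this
    linarith
  have ii : ∀ {f : SpT n → ℝ}, SmC f → ∀ k : ℝ,
      IntervalIntegrable (fun s => k * ∫ x, f (s, x)) volume a b :=
    fun hf k => (hf.continuous_integral.const_smul k |>.continuousOn.intervalIntegrable)
  have ii0 : IntervalIntegrable (fun s => ∫ x, dd et Φ (s, x)) volume a b :=
    (hΦs.dd et).continuous_integral.continuousOn.intervalIntegrable
  have fin := intervalIntegral.integral_mono_on hab (ii0.add (ii hPs (lam / 2)))
    ((ii hR1s (2 * n / lam)).add (ii hR2s (lam + 4 * (n + 1) ^ 2 * L ^ 2 / lam))) (fun s _ => sl s)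
  rw [intervalIntegral.integral_add ii0 (ii hPs _), intervalIntegral.integral_add (ii hR1s _)
    (ii hR2s _), hΦs.integral_dd_et] at fin
  simp at fin
  have : 0 ≤ ∫ x, Φ (b, x) := integral_nonneg fun x => by
    simp; positivity
  linarith

end

section rescale

/-- Spatial rescaling about a point. -/
def rsc (x : Eu n) (r : ℝ) (f : SpT n → ℝ) (p : SpT n) : ℝ := f (p.1, x - r • p.2)

lemma rsc_contDiff {f : SpT n → ℝ} (hf : ContDiff ℝ ∞ f) (x : Eu n) (r : ℝ) :
    ContDiff ℝ ∞ (rsc x r f) := by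
  unfold rsc
  exact hf.comp (by fun_prop)

lemma SmC.rsc {f : SpT n → ℝ} (hf : SmC f) (x : Eu n) (hr : 0 < r) :
    SmC (rsc x r f) := by
  refine ⟨rsc_contDiff hf.1 x r, ?_⟩
  obtain ⟨R, hR⟩ := hf.2
  refine ⟨(‖x‖ + R) / r, fun p hp => hR _ ?_⟩
  rw [div_lt_iff₀ hr] at hp
  have h1 : ‖r • p.2‖ = ‖p.2‖ * r := by rw [norm_smul, norm_eq_abs, abs_of_pos hr]; ring
  have h2 := norm_sub_norm_le (r • p.2) x
  rw [norm_sub_rev] at h2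
  simp only
  linarith

lemma dd_rsc {f : SpT n → ℝ} (hf : ContDiff ℝ ∞ f) (x : Eu n) (r : ℝ) (e p : SpT n) :
    dd e (rsc x r f) p = dd (e.1, -(r • e.2)) f (p.1, x - r • p.2) := by
  have h1 := hasDerivAt_line hf (fun s : ℝ => ((p + s • e).1, x - r • (p + s • e).2))
    (e.1, -(r • e.2)) 0 (by
      have h1 : HasDerivAt (fun s : ℝ => (p + s • e).1) e.1 0 := by
        simpa using ((hasDerivAt_id (0:ℝ)).mul_const e.1).const_add p.1
      have h2 : HasDerivAt (fun s : ℝ => (p + s • e).2) e.2 0 := by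
        simpa using ((hasDerivAt_id (0:ℝ)).smul_const e.2).const_add p.2
      exact h1.prodMk ((h2.const_smul r).const_sub x))
  have h2 := hasDerivAt_line (rsc_contDiff hf x r) (fun s => p + s • e) e 0
    (by simpa using ((hasDerivAt_id (0:ℝ)).smul_const e).const_add p)
  have := h2.unique h1
  simpa using this

lemma dd_ex_rsc {f : SpT n → ℝ} (hf : ContDiff ℝ ∞ f) (x : Eu n) (r : ℝ) (i : Fin n) :
    dd (ex i) (rsc x r f) = fun p => -r * rsc x r (dd (ex i) f) p := by
  funext p
  rw [dd_rsc hf]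
  have : (((ex i : SpT n).1, -(r • (ex i : SpT n).2)) : SpT n) = (-r) • ex i := by
    simp [ex]
  rw [this]
  simp [rsc, dd]

lemma dd_et_rsc {f : SpT n → ℝ} (hf : ContDiff ℝ ∞ f) (x : Eu n) (r : ℝ) :
    dd et (rsc x r f) = rsc x r (dd et f) := by
  funext p
  rw [dd_rsc hf]
  simp [rsc, et]

lemma heatOp_rsc {f : SpT n → ℝ} (hf : ContDiff ℝ ∞ f) (A : Fin n → Fin n → ℝ) (x : Eu n)
    (hr : r ≠ 0) : heatOp (fun i j => A i j / r ^ 2) (rsc x r f) = rsc x r (heatOp A f) := by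
  funext p
  simp only [heatOp, dd_et_rsc hf, dd_ex_rsc hf]
  have : ∀ i j, dd (ex j) (fun p => -r * rsc x r (dd (ex i) f) p) p =
      r ^ 2 * rsc x r (dd (ex j) (dd (ex i) f)) p := fun i j => by
    rw [dd_const_mul (rsc_contDiff (hf.dd _) x r), dd_ex_rsc (hf.dd _)]
    ring
  simp only [this]
  simp only [rsc]
  congr 1
  refine sum_congr rfl fun i _ => sum_congr rfl fun j _ => ?_
  field_simp

end rescale

lemma exists_unit_cutoff (n : ℕ) : ∃ η : SpT n → ℝ, SmC η ∧ (∀ p, dd et η p = 0) ∧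
    (∀ p, 0 ≤ η p ∧ η p ≤ 1) ∧ (∀ p, ‖p.2‖ < 1 / 2 → η p = 1) ∧ (∀ p, 1 ≤ ‖p.2‖ → η p = 0) ∧
    (∀ j p, 1 < ‖p.2‖ → dd (ex j) η p = 0) ∧ ∃ K, 0 ≤ K ∧ ∀ p, ∑ j, dd (ex j) η p ^ 2 ≤ K := by
  let χ : ContDiffBump (0 : Eu n) := ⟨1 / 2, 1, by norm_num, by norm_num⟩
  have hs : SmC (fun p : SpT n => χ p.2) :=
    ⟨χ.contDiff.comp contDiff_snd, 1, fun p hp => χ.zero_of_le_dist (by simpa using hp.le)⟩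
  refine ⟨fun p => χ p.2, hs, ?_, fun p => ⟨χ.nonneg, χ.le_one⟩, ?_, ?_, ?_, ?_⟩
  · intro p
    have h1 := hasDerivAt_line hs.1 (fun s => ((s, p.2) : SpT n)) et p.1
      ((hasDerivAt_id p.1).prodMk (hasDerivAt_const p.1 p.2))
    exact h1.unique (hasDerivAt_const p.1 (χ p.2))
  · exact fun p hp => χ.one_of_mem_closedBall (by simpa [χ] using hp.le)
  · exact fun p hp => χ.zero_of_le_dist (by simpa using hp)
  · intro j p hp
    refine dd_eq_zero_of_eventually ?_ _
    have : IsOpen {q : SpT n | 1 < ‖q.2‖} := isOpen_lt continuous_const (by fun_prop)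
    filter_upwards [this.mem_nhds hp] with q hq
    exact χ.zero_of_le_dist (by simpa using (le_of_lt hq))
  · have hs2 : SmC fun p : SpT n => ∑ j, dd (ex j) (fun p : SpT n => χ p.2) p ^ 2 :=
      SmC.sum _ fun j _ => by
        simpa only [sq] using (hs.dd (ex j)).mul_left (hs.dd (ex j)).1
    obtain ⟨K, hK, H⟩ := hs2.bound 0 0
    refine ⟨K, hK, fun p => ?_⟩
    have := (abs_le.1 (H (0, p.2) (by simp))).2
    simp only [← pd_slice hs.1] at this ⊢
    simpa only using this

lemma exists_finite_cover (n : ℕ) : ∃ P : Finset (Eu n),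
    ball (0 : Eu n) 1 ⊆ ⋃ p ∈ P, ball p (1 / 2) := by
  obtain ⟨t, ht⟩ := (isCompact_closedBall 0 1).elim_finite_subcover
    (fun p : Eu n => ball p (1 / 2)) (fun _ => isOpen_ball)
    (fun x _ => mem_iUnion.2 ⟨x, mem_ball_self (by norm_num)⟩)
  exact ⟨t, ball_subset_closedBall.trans ht⟩

lemma integral_le_of_ball (hf : Integrable f) (h : ∀ x, ‖x‖ ≤ 1 → f x ≤ B)
    (h0 : ∀ x, 1 < ‖x‖ → f x = 0) : ∫ x, f x ≤ B * volume.real (closedBall (0 : Eu n) 1) := by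
  have : ∫ x, f x ≤ ∫ x, (closedBall (0 : Eu n) 1).indicator (fun _ => B) x := by
    refine integral_mono hf ((integrable_indicator_iff measurableSet_closedBall).2
      (integrableOn_const measure_closedBall_lt_top.ne)) fun x => ?_
    by_cases hx : x ∈ closedBall (0 : Eu n) 1
    · rw [indicator_of_mem hx]; exact h x (by simpa using hx)
    · rw [indicator_of_notMem hx, h0 x (by simpa using hx)]
  rwa [integral_indicator measurableSet_closedBall, setIntegral_const, smul_eq_mul, mul_comm] at this

/-- A Morrey bound on balls of half the radius implies one on full balls. -/
lemma MB.of_half : ∃ K > 0, ∀ (t₁ t₂ : ℝ) (F : SpT n → ℝ), Continuous F → ∀ M : ℝ,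
    (∀ (x : Eu n) (r b : ℝ), 0 < r → t₁ ≤ b - r ^ 2 → b ≤ t₂ →
      ∫⁻ τ in Ioc (b - r ^ 2) b, ∫⁻ z in ball (0 : Eu n) (1 / 2), ENNReal.ofReal (F (τ, x - r • z) ^ 2) ≤
      ENNReal.ofReal (M ^ 2 * r)) → MB t₁ t₂ F (K * M) := by
  obtain ⟨P, hP⟩ := exists_finite_cover n
  refine ⟨P.card + 1, by positivity, fun t₁ t₂ F hF M H x r b hr h1 h2 => ?_⟩
  have hm := fun p =>
    measurable_ofReal.comp (by fun_prop : Continuous fun q : SpT n =>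
      F (q.1, x - r • p - r • q.2) ^ 2).measurable
  have hle : ∀ τ, ∫⁻ z in ball 0 1, ENNReal.ofReal (F (τ, x - r • z) ^ 2) ≤
      ∑ p ∈ P, ∫⁻ z in ball 0 (1 / 2), ENNReal.ofReal (F (τ, x - r • p - r • z) ^ 2) := by
    intro τ
    calc _ ≤ ∫⁻ z in ⋃ p ∈ P, ball p (1 / 2), ENNReal.ofReal (F (τ, x - r • z) ^ 2) :=
          lintegral_mono_set hP
      _ ≤ ∑ p ∈ P, ∫⁻ z in ball p (1 / 2), ENNReal.ofReal (F (τ, x - r • z) ^ 2) := by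
          clear hP
          classical
          induction P using Finset.induction_on with
          | empty => simp
          | insert a s ha ih =>
            rw [sum_insert ha, Finset.set_biUnion_insert]
            exact (lintegral_union_le _ _ _).trans (by gcongr)
      _ = _ := by
          refine sum_congr rfl fun p _ => ?_
          rw [← lintegral_indicator measurableSet_ball, ← lintegral_indicator measurableSet_ball,
            ← lintegral_add_right_eq_self _ p]
          refine lintegral_congr fun z => ?_
          have hz : z + p ∈ ball p (1 / 2) ↔ z ∈ ball 0 (1 / 2) := by
            simp
          by_cases h : z ∈ ball 0 (1 / 2)
          · rw [indicator_of_mem h, indicator_of_mem (hz.2 h), smul_add, sub_sub, add_comm (r • z)]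
          · rw [indicator_of_notMem h, indicator_of_notMem (hz.not.2 h)]
  calc _ ≤ ∫⁻ τ in Ioc (b - r ^ 2) b, ∑ p ∈ P, ∫⁻ z in ball 0 (1 / 2),
          ENNReal.ofReal (F (τ, x - r • p - r • z) ^ 2) := lintegral_mono fun τ => hle τ
    _ = ∑ p ∈ P, ∫⁻ τ in Ioc (b - r ^ 2) b, ∫⁻ z in ball 0 (1 / 2),
          ENNReal.ofReal (F (τ, x - r • p - r • z) ^ 2) :=
        lintegral_finsetSum _ fun p _ => (hm p).lintegral_prod_right'
    _ ≤ ∑ p ∈ P, ENNReal.ofReal (M ^ 2 * r) := sum_le_sum fun p _ => H _ r b hr h1 h2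
    _ ≤ _ := by
        rw [sum_const, ← ofReal_nsmul, nsmul_eq_mul]
        refine ofReal_le_ofReal ?_
        rw [mul_pow, mul_assoc]
        refine mul_le_mul_of_nonneg_right ?_ (by positivity)
        nlinarith [sq_nonneg (P.card : ℝ)]

set_option maxHeartbeats 400000 in
lemma clm_hess (C L : ℝ) (hc : 0 < c) (hC : 0 < C) (hlam : 0 < lam) :
    ∃ K > 0,
    ∀ (A : Fin n → Fin n → ℝ) (k : Eu n → ℝ), IsKer A k C c →
    (∀ ξ : Fin n → ℝ, lam * ∑ i, ξ i ^ 2 ≤ ∑ i, ∑ j, A i j * (ξ i * ξ j)) →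
    (∀ i j, |A i j| ≤ L) →
    ∀ (t₁ t₂ : ℝ) (w : SpT n → ℝ), SmC w → (∀ x, w (t₁, x) = 0) → ∀ M : ℝ, 0 < M →
    MB t₁ t₂ (heatOp A w) M → ∀ i l, MB t₁ t₂ (dd (ex i) (dd (ex l) w)) (K * M) := by
  obtain ⟨K₀, hK₀, H₀⟩ := clm_holder (n := n) C hc hC
  obtain ⟨K₁, hK₁, H₁⟩ := MB.of_half (n := n)
  obtain ⟨η, hη, hηt, hη01, hη1, hη0, hηd0, Kη, hKη, hηK⟩ := exists_unit_cutoff n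
  set V := volume.real (closedBall (0 : Eu n) 1) with hV
  set K₂ := 2 / lam * (1 / 2 * (n * K₀ ^ 2) * V + 2 * n / lam +
    (lam + 4 * (n + 1) ^ 2 * L ^ 2 / lam) * (Kη * (n * K₀ ^ 2) * V)) with hK₂
  refine ⟨K₁ * (K₂ + 1), by positivity, ?_⟩
  intro A k hk hA hL t₁ t₂ w hw hw0 M hM h i l
  rw [mul_assoc]
  refine H₁ t₁ t₂ _ ((hw.1.dd _).dd _).continuous _ fun x r b hr h1 h2 => ?_
  have hr2 : 0 < r ^ 2 := by positivity
  set g : Fin n → ℝ := fun l => dd (ex l) w (b, x) with hg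
  have hgb : ∀ τ ∈ Icc (b - r ^ 2) b, ∀ z : Eu n, ‖z‖ ≤ 1 →
      ∑ l, (dd (ex l) w (τ, x - r • z) - g l) ^ 2 ≤ n * K₀ ^ 2 * (M ^ 2 * r) := by
    intro τ hτ z hz
    have : ∀ l, (dd (ex l) w (τ, x - r • z) - g l) ^ 2 ≤ K₀ ^ 2 * (M ^ 2 * r) := fun l => by
      have := H₀ A k hk t₁ t₂ w hw hw0 M hM h τ b r x (x - r • z) (by linarith [hτ.1]) hτ.2 h2 hr
        (by linarith [hτ.1]) (by
          rw [sub_sub_cancel_left, norm_neg, norm_smul, norm_eq_abs, abs_of_pos hr]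
          nlinarith) l
      have h3 := sq_le_sq' (by linarith [(abs_le.1 this).1]) (abs_le.1 this).2
      rw [mul_pow, sq_sqrt hr.le, mul_pow] at h3
      linarith
    calc _ ≤ ∑ _l : Fin n, K₀ ^ 2 * (M ^ 2 * r) := sum_le_sum fun l _ => this l
      _ = _ := by simp; ring
  have en := energy (A := fun i j => A i j / r ^ 2) (lam := lam / r ^ 2) (L := L / r ^ 2)
    (by positivity) (fun ξ => by
      have := div_le_div_of_nonneg_right (hA ξ) hr2.le
      simp only [sum_div] at this
      refine le_trans (le_of_eq (by ring)) (this.trans (le_of_eq ?_))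
      exact sum_congr rfl fun i _ => sum_congr rfl fun j _ => by ring)
    (fun i j => by rw [abs_div, abs_of_pos hr2]; gcongr; exact hL i j) hη hηt (hw.rsc x hr)
    (fun l => -r * g l) (a := b - r ^ 2) (b := b) (by linarith)
  simp only [heatOp_rsc hw.1 A x hr.ne'] at en
  have d1 : ∀ l p, dd (ex l) (rsc x r w) p - -r * g l = -r * (dd (ex l) w (p.1, x - r • p.2) - g l) :=
    fun l p => by rw [dd_ex_rsc hw.1]; simp only [rsc]; ring
  have d2 : ∀ l i p, dd (ex i) (dd (ex l) (rsc x r w)) p =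
      r ^ 2 * dd (ex i) (dd (ex l) w) (p.1, x - r • p.2) := fun l i p => by
    rw [dd_ex_rsc hw.1, dd_const_mul (rsc_contDiff (hw.1.dd _) x r), dd_ex_rsc (hw.1.dd _)]
    simp only [rsc]; ring
  simp only [d1, d2, rsc, mul_pow, neg_sq, ← mul_sum] at en
  set G := n * K₀ ^ 2 * (M ^ 2 * r) with hG
  have hη2 : ∀ p, η p ^ 2 ≤ 1 := fun p => pow_le_one₀ (hη01 p).1 (hη01 p).2
  have hWs : ∀ l, SmC (fun p : SpT n => dd (ex l) w (p.1, x - r • p.2)) := fun l =>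
    (hw.dd (ex l)).rsc x hr
  have sm2 : ∀ {f : SpT n → ℝ}, ContDiff ℝ ∞ f → SmC fun p => η p ^ 2 * f p := fun {f} hf => by
    have := hη.mul_left (hη.1.mul hf)
    convert this using 2
    ring
  have hgs : ContDiff ℝ ∞ fun p : SpT n => ∑ l, (dd (ex l) w (p.1, x - r • p.2) - g l) ^ 2 :=
    ContDiff.sum fun l _ => ((hWs l).1.sub contDiff_const).pow 2
  have T1 : ∫ z, 1 / 2 * (η (b - r ^ 2, z) ^ 2 *
      (r ^ 2 * ∑ l, (dd (ex l) w (b - r ^ 2, x - r • z) - g l) ^ 2)) ≤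
      1 / 2 * (r ^ 2 * G) * V := by
    refine integral_le_of_ball (((sm2 (contDiff_const.mul hgs)).const_mul _).integrable_slice
      (b - r ^ 2)) (fun z hz => ?_) (fun z hz => ?_)
    · have := hgb (b - r ^ 2) ⟨le_rfl, by linarith⟩ z hz
      have h3 := hη2 (b - r ^ 2, z)
      have : r ^ 2 * ∑ l, (dd (ex l) w (b - r ^ 2, x - r • z) - g l) ^ 2 ≤ r ^ 2 * G := by gcongr
      refine mul_le_mul_of_nonneg_left ?_ (by norm_num)
      exact (mul_le_mul h3 this (by positivity) (by norm_num)).trans (by rw [one_mul])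
    · rw [hη0 (b - r ^ 2, z) hz.le]; simp
  have hFs : SmC fun p : SpT n => η p ^ 2 * heatOp A w (p.1, x - r • p.2) ^ 2 :=
    sm2 (((hw.heatOp A).rsc x hr).1.pow 2)
  have T2 : ∫ s in (b - r ^ 2)..b, ∫ z, η (s, z) ^ 2 * heatOp A w (s, x - r • z) ^ 2 ≤ M ^ 2 * r := by
    rw [← ofReal_le_ofReal_iff (by positivity)]
    rw [← hFs.lintegral_eq (fun p => by positivity) (by linarith)]
    have hmb := h x r b hr h1 h2
    refine le_trans (lintegral_mono fun s => ?_) hmb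
    rw [← lintegral_indicator measurableSet_ball]
    refine lintegral_mono fun z => ?_
    by_cases hz : z ∈ ball (0 : Eu n) 1
    · rw [indicator_of_mem hz]
      refine ofReal_le_ofReal ?_
      have := mul_le_mul_of_nonneg_right (hη2 (s, z)) (sq_nonneg (heatOp A w (s, x - r • z)))
      rwa [one_mul] at this
    · rw [indicator_of_notMem hz, hη0 (s, z) (by simpa using hz)]; simp
  have hDs : SmC fun p : SpT n => (∑ j, dd (ex j) η p ^ 2) *
      (r ^ 2 * ∑ l, (dd (ex l) w (p.1, x - r • p.2) - g l) ^ 2) := by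
    have h3 : SmC fun p => ∑ j, dd (ex j) η p ^ 2 := SmC.sum _ fun j _ => by
      simpa only [sq] using (hη.dd (ex j)).mul_left (hη.dd (ex j)).1
    have h4 := h3.mul_left (g := fun p => r ^ 2 * ∑ l,
      (dd (ex l) w (p.1, x - r • p.2) - g l) ^ 2) (contDiff_const.mul hgs)
    convert h4 using 2
    ring
  have T3 : ∫ s in (b - r ^ 2)..b, ∫ z, (∑ j, dd (ex j) η (s, z) ^ 2) *
      (r ^ 2 * ∑ l, (dd (ex l) w (s, x - r • z) - g l) ^ 2) ≤ r ^ 2 * (Kη * (r ^ 2 * G) * V) := by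
    have : ∀ s ∈ Icc (b - r ^ 2) b, ∫ z, (∑ j, dd (ex j) η (s, z) ^ 2) *
        (r ^ 2 * ∑ l, (dd (ex l) w (s, x - r • z) - g l) ^ 2) ≤ Kη * (r ^ 2 * G) * V := by
      intro s hs
      refine integral_le_of_ball (hDs.integrable_slice s) (fun z hz => ?_) (fun z hz => ?_)
      · have := hgb s hs z hz
        exact mul_le_mul (hηK (s, z)) (by gcongr) (by positivity) hKη
      · simp [hηd0 _ (s, z) hz]
    have h3 := intervalIntegral.integral_mono_on (by linarith)
      (hDs.continuous_integral.continuousOn.intervalIntegrable (μ := volume))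
      (continuous_const.continuousOn.intervalIntegrable (μ := volume)) this
    rw [intervalIntegral.integral_const, smul_eq_mul, show b - (b - r ^ 2) = r ^ 2 by ring] at h3
    exact h3
  have hPs : SmC fun p : SpT n => η p ^ 2 *
      ∑ l, ∑ i, dd (ex i) (dd (ex l) w) (p.1, x - r • p.2) ^ 2 :=
    sm2 (ContDiff.sum fun l _ => ContDiff.sum fun i _ => (((hw.dd (ex l)).dd (ex i)).rsc x hr).1.pow 2)
  have key : ∫ s in (b - r ^ 2)..b, ∫ z, η (s, z) ^ 2 *
      ∑ l, ∑ i, dd (ex i) (dd (ex l) w) (s, x - r • z) ^ 2 ≤ K₂ * (M ^ 2 * r) := by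
    set X := ∫ s in (b - r ^ 2)..b, ∫ z, η (s, z) ^ 2 *
      ∑ l, ∑ i, dd (ex i) (dd (ex l) w) (s, x - r • z) ^ 2 with hX
    have e1 : ∫ s in (b - r ^ 2)..b, ∫ z, η (s, z) ^ 2 *
      ((r ^ 2) ^ 2 * ∑ l, ∑ i, dd (ex i) (dd (ex l) w) (s, x - r • z) ^ 2) = (r ^ 2) ^ 2 * X := by
      rw [hX, ← intervalIntegral.integral_const_mul]
      refine intervalIntegral.integral_congr fun s _ => ?_
      rw [← integral_const_mul]
      congr 1; ext z; ring
    rw [e1] at en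
    have c3 : 0 ≤ lam / r ^ 2 + 4 * (n + 1) ^ 2 * (L / r ^ 2) ^ 2 / (lam / r ^ 2) := by
      positivity
    have en2 := en.trans (add_le_add T1 (add_le_add (mul_le_mul_of_nonneg_left T2 (by positivity))
      (mul_le_mul_of_nonneg_left T3 c3)))
    have e2 : lam / r ^ 2 / 2 * ((r ^ 2) ^ 2 * X) = r ^ 2 * lam / 2 * X := by field_simp
    have e3 : 1 / 2 * (r ^ 2 * G) * V + (2 * n / (lam / r ^ 2) * (M ^ 2 * r) +
      (lam / r ^ 2 + 4 * (n + 1) ^ 2 * (L / r ^ 2) ^ 2 / (lam / r ^ 2)) *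
        (r ^ 2 * (Kη * (r ^ 2 * G) * V))) = r ^ 2 * lam / 2 * (K₂ * (M ^ 2 * r)) := by
      rw [hK₂, hG]; field_simp; ring
    rw [e2, e3] at en2
    exact le_of_mul_le_mul_left en2 (by positivity)
  calc _ ≤ ∫⁻ s in Ioc (b - r ^ 2) b, ∫⁻ z, ENNReal.ofReal (η (s, z) ^ 2 *
        ∑ l, ∑ i, dd (ex i) (dd (ex l) w) (s, x - r • z) ^ 2) := by
        refine lintegral_mono fun s => ?_
        rw [← lintegral_indicator measurableSet_ball]
        refine lintegral_mono fun z => ?_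
        by_cases hz : z ∈ ball 0 (1 / 2)
        · rw [indicator_of_mem hz, hη1 (s, z) (by simpa using hz), one_pow, one_mul]
          refine ofReal_le_ofReal ?_
          refine le_trans ?_ (single_le_sum (fun l _ => by positivity) (Finset.mem_univ l))
          exact single_le_sum (f := fun i => dd (ex i) (dd (ex l) w) (s, x - r • z) ^ 2)
            (fun i _ => by positivity) (Finset.mem_univ i)
        · rw [indicator_of_notMem hz]; exact bot_le
    _ = _ := hPs.lintegral_eq (fun p => by positivity) (by linarith)
    _ ≤ _ := by
        refine ofReal_le_ofReal (key.trans ?_)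
        have h6 : 0 ≤ M ^ 2 * r := by positivity
        have h7 : K₂ * (M ^ 2 * r) ≤ (K₂ + 1) ^ 2 * (M ^ 2 * r) :=
          mul_le_mul_of_nonneg_right (by nlinarith) h6
        exact h7.trans (le_of_eq (by ring))

lemma exists_inverse_form (hlam : 0 < lam) (hL0 : 0 ≤ L)
    (hs : ∀ i j, A i j = A j i)
    (hA : ∀ ξ : Fin n → ℝ, lam * ∑ i, ξ i ^ 2 ≤ ∑ i, ∑ j, A i j * (ξ i * ξ j))
    (hL : ∀ i j, |A i j| ≤ L) :
    ∃ B : Eu n →L[ℝ] Eu n, (∀ z i, ∑ j, A i j * B z j = z i) ∧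
      (∀ y z, inner ℝ (B y) z = inner ℝ (B z) y) ∧ (∀ z, ‖B z‖ ≤ ‖z‖ / lam) ∧
      (∀ z, lam * ‖B z‖ ^ 2 ≤ inner ℝ (B z) z) ∧ (∀ z, ‖z‖ ≤ (n ^ 2 * L + 1) * ‖B z‖) := by
  have nsq : ∀ v : Eu n, ‖v‖ ^ 2 = ∑ i, v i ^ 2 := fun v => EuclideanSpace.real_norm_sq_eq v
  have inn : ∀ v w : Eu n, inner ℝ v w = ∑ i, v i * w i := fun v w => by
    simp [PiLp.inner_apply, mul_comm]
  set T : Eu n →ₗ[ℝ] Eu n := Matrix.toEuclideanLin (Matrix.of A) with hT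
  have Tap : ∀ y i, T y i = ∑ j, A i j * y j := fun y i => by
    simp [hT, Matrix.toLpLin_apply, Matrix.mulVec, dotProduct]
  have Tel : ∀ y, lam * ‖y‖ ^ 2 ≤ inner ℝ y (T y) := fun y => by
    rw [nsq, inn]
    refine (hA fun i => y i).trans (le_of_eq ?_)
    refine sum_congr rfl fun i _ => ?_
    rw [Tap, mul_sum]
    exact sum_congr rfl fun j _ => by ring
  have Tinj : Function.Injective T := by
    rw [← LinearMap.ker_eq_bot, LinearMap.ker_eq_bot']
    intro y hy
    have := Tel y
    rw [hy, inner_zero_right] at this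
    have h2 : ‖y‖ ^ 2 ≤ 0 := by
      by_contra h
      push Not at h
      nlinarith
    exact norm_eq_zero.1 (pow_eq_zero_iff two_ne_zero |>.1 (le_antisymm h2 (sq_nonneg _)))
  set e := LinearEquiv.ofInjectiveEndo T Tinj with he
  have hTe : ∀ z, T (e.symm z) = z := fun z => by
    have := e.apply_symm_apply z
    rwa [he, LinearEquiv.coe_ofInjectiveEndo] at this
  have Tsym : ∀ y z, inner ℝ (T y) z = inner ℝ y (T z) := fun y z => by
    rw [inn, inn]
    simp only [Tap, mul_sum, sum_mul]
    rw [sum_comm]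
    refine sum_congr rfl fun i _ => sum_congr rfl fun j _ => ?_
    rw [hs]; ring
  have B4 := fun z => by
    have := Tel (e.symm z)
    rwa [hTe] at this
  refine ⟨LinearMap.toContinuousLinearMap (e.symm : Eu n →ₗ[ℝ] Eu n), ?_, ?_, ?_, ?_, ?_⟩
  · intro z i
    have := congrArg (fun v => v i) (hTe z)
    exact this
  · intro y z
    have := Tsym (e.symm y) (e.symm z)
    rw [hTe, hTe] at this
    change inner ℝ (e.symm y) z = inner ℝ (e.symm z) y
    rw [← this, real_inner_comm]
  · intro z
    have h1 := B4 z
    have h2 := real_inner_le_norm (e.symm z) z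
    change ‖e.symm z‖ ≤ _
    rw [le_div_iff₀ hlam]
    rcases (norm_nonneg (e.symm z)).eq_or_lt with h | h
    · rw [← h]; simp
    · nlinarith
  · exact B4
  · intro z
    change _ ≤ _ * ‖e.symm z‖
    set y := e.symm z with hy
    have hz := (hTe z).symm
    have h1 : ∀ i, |z i| ≤ n * L * ‖y‖ := fun i => by
      rw [hz, Tap]
      calc _ ≤ ∑ j, |A i j * y j| := abs_sum_le_sum_abs _ _
        _ ≤ ∑ _j : Fin n, L * ‖y‖ := sum_le_sum fun j _ => by
            rw [abs_mul]
            exact mul_le_mul (hL i j) (by simpa using PiLp.norm_apply_le y j) (abs_nonneg _) hL0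
        _ = _ := by simp; ring
    have h2 : ‖z‖ ^ 2 ≤ (n ^ 2 * L * ‖y‖) ^ 2 := by
      rw [nsq]
      calc _ ≤ ∑ _i : Fin n, (n * L * ‖y‖) ^ 2 := sum_le_sum fun i _ => by
            rw [← sq_abs]; exact pow_le_pow_left₀ (abs_nonneg _) (h1 i) 2
        _ = n * (n * L * ‖y‖) ^ 2 := by simp
        _ ≤ n ^ 2 * (n * L * ‖y‖) ^ 2 := by
            refine mul_le_mul_of_nonneg_right ?_ (sq_nonneg _)
            exact_mod_cast Nat.le_self_pow two_ne_zero n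
        _ = _ := by ring
    have h3 := abs_le_of_sq_le_sq h2 (by positivity)
    nlinarith [(le_abs_self _).trans h3, norm_nonneg y]

set_option maxHeartbeats 2000000 in
lemma exists_ker (n : ℕ) (hlam : 0 < lam) (hL0 : 0 ≤ L) : ∃ C c : ℝ, 0 < C ∧ 0 < c ∧
    ∀ A : Fin n → Fin n → ℝ, (∀ i j, A i j = A j i) →
    (∀ ξ : Fin n → ℝ, lam * ∑ i, ξ i ^ 2 ≤ ∑ i, ∑ j, A i j * (ξ i * ξ j)) →
    (∀ i j, |A i j| ≤ L) → ∃ k, IsKer A k C c := by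
  set Λ : ℝ := n ^ 2 * L + 1 with hΛ
  set c₀ : ℝ := lam / (4 * Λ ^ 2) with hc₀
  have hc0 : 0 < c₀ := by positivity
  set m : ℝ := ∫ z : Eu n, exp (-(1 / (4 * lam) * ‖z‖ ^ 2)) with hm
  have hm0 : 0 < m := integral_exp_pos (integrable_gauss (by positivity))
  set D : ℝ := (1 / lam + 1 / lam ^ 2) * (1 + 2 / c₀) * exp (c₀ / 2) with hD
  have hD0 : 0 < D := by positivity
  refine ⟨1 + 1 / m + D, c₀ / 4, by positivity, by positivity, ?_⟩
  intro A hs hA hL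
  obtain ⟨B, B1, B2, B3, B4, B5⟩ := exists_inverse_form hlam hL0 hs hA hL
  set k : Eu n → ℝ := fun z => exp (-(inner ℝ (B z) z / 4)) with hk
  have ks : ContDiff ℝ ∞ k := by
    exact contDiff_exp.comp (ContDiff.neg ((B.contDiff.inner ℝ contDiff_id).div_const 4))
  have line : ∀ z ζ : Eu n, ∀ s : ℝ, HasDerivAt (fun s : ℝ => z + s • ζ) ζ s := fun z ζ s => by
    simpa using ((hasDerivAt_id s).smul_const ζ).const_add z
  have kd : ∀ z ζ : Eu n, ∀ s : ℝ, HasDerivAt (fun s : ℝ => k (z + s • ζ))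
      (-(inner ℝ (B (z + s • ζ)) ζ / 2) * k (z + s • ζ)) s := fun z ζ s => by
    have h1 := (B.hasFDerivAt.comp_hasDerivAt s (line z ζ s)).inner ℝ (line z ζ s)
    have h2 := (h1.div_const 4).neg.exp
    suffices hval : exp (-(inner ℝ (B (z + s • ζ)) (z + s • ζ) / 4)) *
        -((inner ℝ (B (z + s • ζ)) ζ + inner ℝ (B ζ) (z + s • ζ)) / 4) =
        -(inner ℝ (B (z + s • ζ)) ζ / 2) * k (z + s • ζ) by rw [← hval]; exact h2
    rw [B2 ζ]; simp only [hk]; ring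
  have kdd : ∀ e z, dd e k z = -(inner ℝ (B z) e / 2) * k z := fun e z => by
    have h1 := hasDerivAt_line ks (fun s : ℝ => z + s • e) e 0 (line z e 0)
    have h2 := kd z e 0
    simpa using h1.unique h2
  have kE : ∀ z, k z ≤ exp (-(c₀ * ‖z‖ ^ 2)) := fun z => by
    refine exp_le_exp.2 (neg_le_neg ?_)
    have h1 := B4 z
    have h2 := pow_le_pow_left₀ (norm_nonneg z) (B5 z) 2
    rw [hc₀, div_mul_eq_mul_div, div_le_div_iff₀ (by positivity) (by norm_num)]
    have h3 := mul_le_mul_of_nonneg_left h1 (by positivity : 0 ≤ 4 * Λ ^ 2)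
    have h4 := mul_le_mul_of_nonneg_left h2 hlam.le
    linarith [mul_pow Λ ‖B z‖ 2]
  have k0 : ∀ z, 0 ≤ k z := fun z => (exp_pos _).le
  have n1 : ∀ i : Fin n, ‖(single i (1:ℝ) : Eu n)‖ = 1 := fun i => by simp
  have half : ∀ x : ℝ, 0 ≤ x → (1 + x) * exp (-(c₀ * x)) ≤
      (1 + 2 / c₀) * exp (-(c₀ / 2 * x)) := fun x hx => by
    have h1 : 1 + c₀ / 2 * x ≤ exp (c₀ / 2 * x) := by
      rw [add_comm]; exact add_one_le_exp _
    have h2 : 1 + x ≤ (1 + 2 / c₀) * (1 + c₀ / 2 * x) := by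
      have : (1 + 2 / c₀) * (1 + c₀ / 2 * x) = 1 + 2 / c₀ + c₀ / 2 * x + x := by field_simp; ring
      rw [this]
      have : 0 ≤ 2 / c₀ := by positivity
      have : 0 ≤ c₀ / 2 * x := by positivity
      linarith
    have h3 : exp (-(c₀ / 2 * x)) = exp (c₀ / 2 * x) * exp (-(c₀ * x)) := by
      rw [← exp_add]; congr 1; ring
    rw [h3, ← mul_assoc]
    gcongr
    exact h2.trans (by gcongr)
  have mono : ∀ z : Eu n, exp (-(c₀ / 2 * ‖z‖ ^ 2)) ≤ exp (-(c₀ / 4 * ‖z‖ ^ 2)) :=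
    fun z => exp_le_exp.2 (by nlinarith [mul_nonneg hc0.le (sq_nonneg ‖z‖)])
  have xs : ∀ z : Eu n, ‖z‖ ≤ 1 + ‖z‖ ^ 2 := fun z => by nlinarith [sq_nonneg (‖z‖ - 1), norm_nonneg z]
  have CD : ∀ z : Eu n, (1 / lam + 1 / lam ^ 2) * ((1 + ‖z‖ ^ 2) * exp (-(c₀ * ‖z‖ ^ 2))) ≤
      (1 / lam + 1 / lam ^ 2) * (1 + 2 / c₀) * exp (-(c₀ / 2 * ‖z‖ ^ 2)) := fun z => by
    rw [mul_assoc]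
    exact mul_le_mul_of_nonneg_left (half _ (sq_nonneg _)) (by positivity)
  refine ⟨k, by positivity, by positivity, ks, k0, ?_, ?_, ?_, ?_, ?_⟩
  · intro i z
    simp only [kdd]
    have : ∀ j : Fin n, inner ℝ (B z) (single j (1:ℝ)) = B z j := fun j => by
      simp [EuclideanSpace.inner_single_right]
    simp only [this]
    rw [← B1 z i, mul_sum, sum_mul]
    exact sum_congr rfl fun j _ => by ring
  · intro z
    have h1 : exp (-(c₀ * ‖z‖ ^ 2)) ≤ exp (-(c₀ / 4 * ‖z‖ ^ 2)) :=
      exp_le_exp.2 (by nlinarith [mul_nonneg hc0.le (sq_nonneg ‖z‖)])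
    have h2 : 1 ≤ 1 + 1 / m + D := by linarith [one_div_pos.2 hm0]
    exact ((kE z).trans h1).trans (le_mul_of_one_le_left (exp_pos _).le h2)
  · intro i z
    rw [kdd, abs_mul, abs_neg, abs_div, abs_of_nonneg (k0 z), abs_two]
    have h1 : |inner ℝ (B z) (single i (1:ℝ))| ≤ ‖z‖ / lam := by
      have := abs_real_inner_le_norm (B z) (single i (1:ℝ))
      rw [n1, mul_one] at this
      exact this.trans (B3 z)
    calc _ ≤ (1 / lam + 1 / lam ^ 2) * ((1 + ‖z‖ ^ 2) * exp (-(c₀ * ‖z‖ ^ 2))) := by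
          rw [← mul_assoc]
          refine mul_le_mul ?_ (kE z) (k0 z) (by positivity)
          have h3 : |inner ℝ (B z) (single i (1:ℝ))| / 2 ≤ ‖z‖ / lam := by
            linarith [abs_nonneg (inner ℝ (B z) (single i (1:ℝ)))]
          refine h3.trans ?_
          have h4 : ‖z‖ / lam ≤ 1 / lam * (1 + ‖z‖ ^ 2) := by
            rw [div_eq_mul_one_div, mul_comm]
            exact mul_le_mul_of_nonneg_left (xs z) (by positivity)
          have h5 : 0 ≤ 1 / lam ^ 2 * (1 + ‖z‖ ^ 2) := by positivity
          linarith
      _ ≤ _ := CD z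
      _ ≤ D * exp (-(c₀ / 4 * ‖z‖ ^ 2)) :=
          mul_le_mul (le_mul_of_one_le_right (by positivity)
              (one_le_exp (by positivity))) (mono z) (exp_pos _).le hD0.le
      _ ≤ _ := mul_le_mul_of_nonneg_right (by linarith [one_div_pos.2 hm0]) (exp_pos _).le
  · intro i z ζ hζ
    set e : Eu n := single i (1:ℝ) with he
    have hder : ∀ s : ℝ, HasDerivAt (fun s : ℝ => dd e k (z + s • ζ))
        (-(inner ℝ (B ζ) e / 2) * k (z + s • ζ) + -(inner ℝ (B (z + s • ζ)) e / 2) *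
          (-(inner ℝ (B (z + s • ζ)) ζ / 2) * k (z + s • ζ))) s := fun s => by
      simp only [kdd]
      have h1 := (B.hasFDerivAt.comp_hasDerivAt s (line z ζ s)).inner ℝ (hasDerivAt_const s e)
      have h2 : HasDerivAt (fun s : ℝ => -(inner ℝ (B (z + s • ζ)) e / 2)) (-(inner ℝ (B ζ) e / 2)) s := by
        suffices hval : -((inner ℝ (B (z + s • ζ)) 0 + inner ℝ (B ζ) e) / 2) =
          -(inner ℝ (B ζ) e / 2) by rw [← hval]; exact (h1.div_const 2).neg
        simp
      exact h2.mul (kd z ζ s)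
    have hb : ∀ s ∈ Ico (0:ℝ) 1, ‖-(inner ℝ (B ζ) e / 2) * k (z + s • ζ) + -(inner ℝ (B (z + s • ζ)) e / 2) *
          (-(inner ℝ (B (z + s • ζ)) ζ / 2) * k (z + s • ζ))‖ ≤
          D * exp (-(c₀ / 4 * ‖z‖ ^ 2)) * ‖ζ‖ := by
      intro s hs
      set y := z + s • ζ with hy
      have i1 : |inner ℝ (B ζ) e| ≤ ‖ζ‖ / lam := by
        have := abs_real_inner_le_norm (B ζ) e
        rw [he, n1, mul_one] at this
        exact this.trans (B3 ζ)
      have i2 : |inner ℝ (B y) e| ≤ ‖y‖ / lam := by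
        have := abs_real_inner_le_norm (B y) e
        rw [he, n1, mul_one] at this
        exact this.trans (B3 y)
      have i3 : |inner ℝ (B y) ζ| ≤ ‖y‖ / lam * ‖ζ‖ :=
        (abs_real_inner_le_norm (B y) ζ).trans (by gcongr; exact B3 y)
      have hzy : ‖z‖ ^ 2 ≤ 2 * ‖y‖ ^ 2 + 2 := by
        have h1 : ‖z‖ ≤ ‖y‖ + 1 := by
          have h2 : z = y - s • ζ := by rw [hy]; abel
          have h3 : ‖s • ζ‖ ≤ 1 := by
            rw [norm_smul, norm_eq_abs, abs_of_nonneg hs.1]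
            nlinarith [hs.2, norm_nonneg ζ, hs.1]
          calc ‖z‖ = ‖y - s • ζ‖ := by rw [← h2]
            _ ≤ ‖y‖ + ‖s • ζ‖ := norm_sub_le _ _
            _ ≤ _ := by linarith
        nlinarith [norm_nonneg z, norm_nonneg y, sq_nonneg (‖y‖ - 1)]
      have e1 : exp (-(c₀ / 2 * ‖y‖ ^ 2)) ≤
          exp (c₀ / 2) * exp (-(c₀ / 4 * ‖z‖ ^ 2)) := by
        rw [← exp_add]
        exact exp_le_exp.2 (by nlinarith)
      rw [norm_eq_abs]
      calc _ ≤ |inner ℝ (B ζ) e| / 2 * k y + |inner ℝ (B y) e| / 2 * (|inner ℝ (B y) ζ| / 2 * k y) := by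
            refine (abs_add_le _ _).trans (le_of_eq ?_)
            simp only [abs_mul, abs_neg, abs_div, abs_two, abs_of_nonneg (k0 y)]
        _ ≤ ‖ζ‖ / lam / 2 * k y + ‖y‖ / lam / 2 * (‖y‖ / lam * ‖ζ‖ / 2 * k y) := by
            have := k0 y
            gcongr
        _ ≤ (1 / lam + 1 / lam ^ 2) * ((1 + ‖y‖ ^ 2) * k y) * ‖ζ‖ := by
            have e2 : ‖ζ‖ / lam / 2 * k y + ‖y‖ / lam / 2 * (‖y‖ / lam * ‖ζ‖ / 2 * k y) =
              (1 / lam * (1 / 2) + 1 / lam ^ 2 * (‖y‖ ^ 2 / 4)) * k y * ‖ζ‖ := by field_simp; ring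
            rw [e2, ← mul_assoc]
            have := k0 y
            gcongr
            have p1 : 0 ≤ 1 / lam := by positivity
            have p2 : 0 ≤ 1 / lam ^ 2 := by positivity
            nlinarith [mul_nonneg p2 (sq_nonneg ‖y‖)]
        _ ≤ (1 / lam + 1 / lam ^ 2) * ((1 + ‖y‖ ^ 2) * exp (-(c₀ * ‖y‖ ^ 2))) * ‖ζ‖ := by
            gcongr
            exact kE y
        _ ≤ (1 / lam + 1 / lam ^ 2) * (1 + 2 / c₀) * exp (-(c₀ / 2 * ‖y‖ ^ 2)) * ‖ζ‖ := by
            exact mul_le_mul_of_nonneg_right (CD y) (norm_nonneg _)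
        _ ≤ (1 / lam + 1 / lam ^ 2) * (1 + 2 / c₀) *
            (exp (c₀ / 2) * exp (-(c₀ / 4 * ‖z‖ ^ 2))) * ‖ζ‖ := by gcongr
        _ = _ := by rw [hD]; ring
    have := norm_image_sub_le_of_norm_deriv_le_segment_01'
      (fun s _ => (hder s).hasDerivWithinAt) hb
    simp only [one_smul, zero_smul, add_zero, norm_eq_abs] at this
    refine this.trans ?_
    have p1 : 0 ≤ exp (-(c₀ / 4 * ‖z‖ ^ 2)) * ‖ζ‖ := by positivity
    have p2 : 0 < 1 / m := by positivity
    nlinarith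
  · have h1 : m ≤ ∫ z, k z := by
      refine integral_mono (integrable_gauss (by positivity)) ?_ fun z => ?_
      · refine (integrable_gauss hc0).mono' ks.continuous.aestronglyMeasurable (ae_of_all _ fun z => ?_)
        rw [norm_eq_abs, abs_of_nonneg (k0 z)]; exact kE z
      · refine exp_le_exp.2 (neg_le_neg ?_)
        have h2 : inner ℝ (B z) z ≤ ‖z‖ / lam * ‖z‖ :=
          (real_inner_le_norm _ _).trans (by gcongr; exact B3 z)
        have : 1 / (4 * lam) * ‖z‖ ^ 2 = ‖z‖ / lam * ‖z‖ / 4 := by field_simp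
        rw [this]; linarith
    have h2 : 1 / m * m = 1 := by field_simp
    have h3 := hm0.le.trans h1
    have h4 : 1 / m * m ≤ 1 / m * ∫ z, k z := by gcongr
    nlinarith

lemma absorb {P : ℝ → Prop} (hc : 0 ≤ c)
    (hcl : ∀ M, 0 ≤ M → (∀ ε, 0 < ε → P (M + ε)) → P M)
    (hm : ∀ M M', 0 ≤ M → M ≤ M' → P M → P M') (h0 : ∃ M, 0 ≤ M ∧ P M)
    (hs : ∀ M, 0 ≤ M → P M → P (M / 2 + c)) : P (2 * c) := by
  obtain ⟨M₀, hM₀, hP⟩ := h0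
  have key : ∀ k, P (M₀ / 2 ^ k + 2 * c) := by
    intro k
    induction k with
    | zero => exact hm _ _ hM₀ (by simp; linarith) hP
    | succ k ih =>
      have := hs _ (by positivity) ih
      convert this using 1
      rw [pow_succ]; field_simp; ring
  refine hcl _ (by linarith) fun ε hε => ?_
  obtain ⟨k, hk⟩ := exists_pow_lt_of_lt_one (div_pos hε (by linarith : 0 < M₀ + 1))
    (by norm_num : (1 / 2 : ℝ) < 1)
  refine hm _ _ (by positivity) ?_ (key k)
  rw [lt_div_iff₀ (by linarith), one_div, inv_pow] at hk
  have h1 : M₀ / 2 ^ k = (2 ^ k)⁻¹ * M₀ := by rw [div_eq_inv_mul]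
  have : (0:ℝ) < (2 ^ k)⁻¹ := by positivity
  rw [h1]; nlinarith

section MB
variable {G : SpT n → ℝ}

lemma MB.of_abs_le (hG : MB t₁ t₂ G M)
    (h : ∀ τ ∈ Icc t₁ t₂, ∀ y, |F (τ, y)| ≤ |G (τ, y)|) : MB t₁ t₂ F M := fun x r b hr h1 h2 =>
  (setLIntegral_mono' measurableSet_Ioc fun τ hτ => lintegral_mono fun z =>
    ofReal_le_ofReal (sq_le_sq.2 (h τ ⟨by linarith [hτ.1], hτ.2.trans h2⟩ _))).trans
    (hG x r b hr h1 h2)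

lemma MB.mono (hF : MB t₁ t₂ F M) (hM : 0 ≤ M) (h : M ≤ N) : MB t₁ t₂ F N := fun x r b hr h1 h2 =>
  (hF x r b hr h1 h2).trans (ofReal_le_ofReal (by gcongr))

lemma MB.window {s₁ s₂ : ℝ} (hF : MB t₁ t₂ F M) (h1 : t₁ ≤ s₁) (h2 : s₂ ≤ t₂) : MB s₁ s₂ F M :=
  fun x r b hr h3 h4 => hF x r b hr (h1.trans h3) (h4.trans h2)

lemma MB.closed (h : ∀ ε, 0 < ε → MB t₁ t₂ F (M + ε)) : MB t₁ t₂ F M := fun x r b hr h1 h2 => by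
  refine ge_of_tendsto (x := 𝓝[>] (0:ℝ))
    (f := fun ε => ENNReal.ofReal ((M + ε) ^ 2 * r)) ?_ ?_
  · have : Tendsto (fun ε : ℝ => ENNReal.ofReal ((M + ε) ^ 2 * r)) (𝓝 0)
        (𝓝 (ENNReal.ofReal ((M + 0) ^ 2 * r))) :=
      (continuous_ofReal.comp (by fun_prop : Continuous fun ε : ℝ => (M + ε) ^ 2 * r)).tendsto 0
    rw [add_zero] at this
    exact this.mono_left nhdsWithin_le_nhds
  · filter_upwards [self_mem_nhdsWithin] with ε hε using h ε hε x r b hr h1 h2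

lemma MB.const_mul (hF : MB t₁ t₂ F M) (c : ℝ) : MB t₁ t₂ (fun p => c * F p) (|c| * M) :=
  fun x r b hr h1 h2 => by
  have h3 : ∀ y : ℝ, ENNReal.ofReal ((c * y) ^ 2) = ENNReal.ofReal (c ^ 2) * ENNReal.ofReal (y ^ 2) :=
    fun y => by rw [mul_pow, ofReal_mul (sq_nonneg c)]
  simp only [h3]
  have h4 : ∀ τ, ∫⁻ z in ball (0 : Eu n) 1, ENNReal.ofReal (c ^ 2) * ENNReal.ofReal (F (τ, x - r • z) ^ 2)
      = ENNReal.ofReal (c ^ 2) * ∫⁻ z in ball (0 : Eu n) 1, ENNReal.ofReal (F (τ, x - r • z) ^ 2) :=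
    fun τ => lintegral_const_mul' _ _ ofReal_ne_top
  simp only [h4]
  rw [lintegral_const_mul' _ _ ofReal_ne_top]
  refine (mul_le_mul_right (hF x r b hr h1 h2) _).trans (le_of_eq ?_)
  rw [← ofReal_mul (sq_nonneg c), mul_pow, sq_abs, mul_assoc]

lemma MB.bdd_mul {g : SpT n → ℝ} (hF : MB t₁ t₂ F M)
    (hg : ∀ τ ∈ Icc t₁ t₂, ∀ y, |g (τ, y)| ≤ c) (hc : 0 ≤ c) :
    MB t₁ t₂ (fun p => g p * F p) (c * M) := by
  have := hF.const_mul c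
  rw [abs_of_nonneg hc] at this
  refine this.of_abs_le fun τ hτ y => ?_
  rw [abs_mul, abs_mul]
  exact mul_le_mul_of_nonneg_right ((hg τ hτ y).trans (le_abs_self c)) (abs_nonneg _)

lemma MB.zero (t₁ t₂ : ℝ) : MB t₁ t₂ (fun _ : SpT n => (0:ℝ)) 0 := fun x r b hr h1 h2 => by simp

lemma lintegral_ofReal_const_mul {α : Type*} [MeasurableSpace α] (μ : Measure α) (hc : 0 ≤ c)
    (f : α → ℝ) : ∫⁻ z, ENNReal.ofReal (c * f z) ∂μ = ENNReal.ofReal c * ∫⁻ z, ENNReal.ofReal (f z) ∂μ := by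
  simp only [ofReal_mul hc]
  exact lintegral_const_mul' _ _ ofReal_ne_top

lemma MB.scale (hF : MB t₁ t₂ F M) (hc : 0 ≤ c) (x : Eu n) (hr : 0 < r)
    (h1 : t₁ ≤ b - r ^ 2) (h2 : b ≤ t₂) :
    ∫⁻ τ in Ioc (b - r ^ 2) b, ∫⁻ z in ball (0 : Eu n) 1, ENNReal.ofReal (c * F (τ, x - r • z) ^ 2) ≤
      ENNReal.ofReal (c * (M ^ 2 * r)) := by
  simp only [lintegral_ofReal_const_mul _ hc]
  rw [lintegral_const_mul' _ _ ofReal_ne_top, ofReal_mul hc]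
  exact mul_le_mul_right (hF x r b hr h1 h2) _

lemma MB.add_of_measurable (hFm : Measurable F) (hM : 0 < M) (hN : 0 < N) (hF : MB t₁ t₂ F M)
    (hG : MB t₁ t₂ G N) : MB t₁ t₂ (fun p => F p + G p) (M + N) := by
  intro x r b hr h1 h2
  have pt : ∀ a c : ℝ, (a + c) ^ 2 ≤ (1 + N / M) * a ^ 2 + (1 + M / N) * c ^ 2 := fun a c => by
    have e1 : (1 + N / M) * a ^ 2 + (1 + M / N) * c ^ 2 - (a + c) ^ 2 = (N * a - M * c) ^ 2 / (M * N) := by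
      field_simp; ring
    have : 0 ≤ (N * a - M * c) ^ 2 / (M * N) := by positivity
    linarith
  have hm : Measurable fun q : SpT n => ENNReal.ofReal ((1 + N / M) * F (q.1, x - r • q.2) ^ 2) := by
    refine (((hFm.comp ?_).pow_const 2).const_mul _).ennreal_ofReal
    exact (by fun_prop : Continuous fun q : SpT n => ((q.1, x - r • q.2) : SpT n)).measurable
  calc _ ≤ ∫⁻ τ in Ioc (b - r ^ 2) b, ((∫⁻ z in ball 0 1,
          ENNReal.ofReal ((1 + N / M) * F (τ, x - r • z) ^ 2)) +
          ∫⁻ z in ball (0 : Eu n) 1, ENNReal.ofReal ((1 + M / N) * G (τ, x - r • z) ^ 2)) := by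
        refine lintegral_mono fun τ => ?_
        have hmτ : Measurable fun z : Eu n => ENNReal.ofReal ((1 + N / M) * F (τ, x - r • z) ^ 2) :=
          hm.comp measurable_prodMk_left
        beta_reduce
        rw [← lintegral_add_left hmτ]
        refine lintegral_mono fun z => ?_
        beta_reduce
        rw [← ofReal_add (by positivity) (by positivity)]
        exact ofReal_le_ofReal (pt _ _)
    _ = _ := lintegral_add_left hm.lintegral_prod_right' _
    _ ≤ ENNReal.ofReal ((1 + N / M) * (M ^ 2 * r)) + ENNReal.ofReal ((1 + M / N) * (N ^ 2 * r)) :=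
        add_le_add (hF.scale (by positivity) x hr h1 h2) (hG.scale (by positivity) x hr h1 h2)
    _ = _ := by
        rw [← ofReal_add (by positivity) (by positivity)]
        congr 1
        field_simp; ring

lemma MB.add (hFc : ContinuousOn F (Icc t₁ t₂ ×ˢ univ)) (hF : MB t₁ t₂ F M) (hG : MB t₁ t₂ G N)
    (hM : 0 ≤ M) (hN : 0 ≤ N) : MB t₁ t₂ (fun p => F p + G p) (M + N) := by
  have hFm : Measurable ((Icc t₁ t₂ ×ˢ univ).piecewise F 0) :=
    hFc.measurable_piecewise continuousOn_const (measurableSet_Icc.prod MeasurableSet.univ)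
  have hFF : ∀ τ ∈ Icc t₁ t₂, ∀ y, (Icc t₁ t₂ ×ˢ univ).piecewise F 0 (τ, y) = F (τ, y) := fun τ hτ y =>
    piecewise_eq_of_mem _ _ _ (mk_mem_prod hτ (mem_univ _))
  have h : MB t₁ t₂ (fun p => (Icc t₁ t₂ ×ˢ univ).piecewise F 0 p + G p) (M + N) := by
    refine MB.closed fun ε hε => ?_
    have hFb : MB t₁ t₂ ((Icc t₁ t₂ ×ˢ univ).piecewise F 0) M := hF.of_abs_le fun τ hτ y => by rw [hFF τ hτ]
    have := MB.add_of_measurable hFm (by linarith) (by linarith) (hFb.mono hM (by linarith : M ≤ M + ε / 2))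
      (hG.mono hN (by linarith : N ≤ N + ε / 2))
    convert this using 1
    ring
  exact h.of_abs_le fun τ hτ y => by rw [hFF τ hτ]

lemma MB.sum (s : Finset ι) {F : ι → SpT n → ℝ} {M : ι → ℝ}
    (hc : ∀ i ∈ s, ContinuousOn (F i) (Icc t₁ t₂ ×ˢ univ)) (h : ∀ i ∈ s, MB t₁ t₂ (F i) (M i))
    (hM : ∀ i ∈ s, 0 ≤ M i) : MB t₁ t₂ (fun p => ∑ i ∈ s, F i p) (∑ i ∈ s, M i) := by
  classical
  induction s using Finset.induction_on with
  | empty => simpa using MB.zero t₁ t₂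
  | insert a s ha ih =>
    simp only [sum_insert ha]
    exact MB.add (hc a (by simp)) (h a (by simp)) (ih (fun i hi => hc i (by simp [hi]))
      (fun i hi => h i (by simp [hi])) (fun i hi => hM i (by simp [hi]))) (hM a (by simp))
      (sum_nonneg fun i hi => hM i (by simp [hi]))

end MB

lemma MB.of_bdd (n : ℕ) : ∃ K > 0, ∀ (t₁ t₂ : ℝ) (F : SpT n → ℝ) (N : ℝ), 0 ≤ N → t₁ ≤ t₂ →
    (∀ τ ∈ Icc t₁ t₂, ∀ y, |F (τ, y)| ≤ N) → MB t₁ t₂ F (K * N * √√(t₂ - t₁)) := by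
  set V := volume.real (ball (0 : Eu n) 1)
  have hV0 : 0 ≤ V := measureReal_nonneg
  refine ⟨√V + 1, by positivity, fun t₁ t₂ F N hN ht h x r b hr h1 h2 => ?_⟩
  calc _ ≤ ∫⁻ τ in Ioc (b - r ^ 2) b, ∫⁻ z in ball (0 : Eu n) 1, ENNReal.ofReal (N ^ 2) :=
        setLIntegral_mono' measurableSet_Ioc fun τ hτ => lintegral_mono fun z =>
          ofReal_le_ofReal (by
            rw [← sq_abs]
            exact pow_le_pow_left₀ (abs_nonneg _) (h τ ⟨by linarith [hτ.1], hτ.2.trans h2⟩ _) 2)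
    _ = ENNReal.ofReal (N ^ 2 * V * r ^ 2) := by
        simp only [lintegral_const, Measure.restrict_apply MeasurableSet.univ, univ_inter, volume_Ioc]
        rw [← ofReal_toReal (measure_ball_lt_top (μ := volume) (x := (0 : Eu n)) (r := 1)).ne,
          ← ofReal_mul (by positivity), ← ofReal_mul (by positivity)]
        congr 2; ring
    _ ≤ _ := by
        refine ofReal_le_ofReal ?_
        have hr2 : r ≤ √(t₂ - t₁) := le_sqrt_of_sq_le (by linarith)
        have e1 : (√√(t₂ - t₁)) ^ 2 = √(t₂ - t₁) := sq_sqrt (sqrt_nonneg _)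
        have e2 := sq_sqrt hV0
        have e3 : V ≤ (√V + 1) ^ 2 := by nlinarith [sqrt_nonneg V]
        rw [mul_pow, mul_pow, e1]
        calc N ^ 2 * V * r ^ 2 = V * N ^ 2 * r * r := by ring
          _ ≤ (√V + 1) ^ 2 * N ^ 2 * √(t₂ - t₁) * r := by gcongr

lemma dd_add_invariant {V : Type*} [NormedAddCommGroup V] [NormedSpace ℝ V] {f : V → ℝ} {v : V}
    (h : ∀ p, f (p + v) = f p) (e p : V) : dd e f (p + v) = dd e f p := by
  have := funext h
  unfold dd
  conv_rhs => rw [← this]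
  rw [fderiv_comp_add_right]

lemma dd_congr {V : Type*} [NormedAddCommGroup V] [NormedSpace ℝ V] {f g : V → ℝ} {p : V}
    (h : f =ᶠ[𝓝 p] g) (e : V) : dd e f p = dd e g p := by
  unfold dd; rw [h.fderiv_eq]

lemma dd_eventuallyEq {V : Type*} [NormedAddCommGroup V] [NormedSpace ℝ V] {f g : V → ℝ} {p : V}
    (h : f =ᶠ[𝓝 p] g) (e : V) : dd e f =ᶠ[𝓝 p] dd e g :=
  h.eventuallyEq_nhds.mono fun _ hq => dd_congr hq e

lemma exists_cutoff (n : ℕ) (hρ : 0 < ρ) : ∃ E : ℝ, 0 ≤ E ∧ ∀ c : Eu n, ∃ ζ : SpT n → ℝ, SmC ζ ∧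
    (∀ p, dd et ζ p = 0) ∧ (∀ p, 0 ≤ ζ p ∧ ζ p ≤ 1) ∧ (∀ p, ‖p.2 - c‖ < ρ / 2 → ζ p = 1) ∧
    (∀ p, ρ ≤ ‖p.2 - c‖ → ζ p = 0) ∧ (∀ i p, |dd (ex i) ζ p| ≤ E) ∧
    ∀ i j p, |dd (ex j) (dd (ex i) ζ) p| ≤ E := by
  obtain ⟨F, hs, inv, hF01, hF1, hF0⟩ : ∃ F : SpT n → ℝ, SmC F ∧ (∀ v : ℝ, ∀ p, F (p + (v, 0)) = F p) ∧
      (∀ p, 0 ≤ F p ∧ F p ≤ 1) ∧ (∀ p, ‖p.2‖ ≤ ρ / 2 → F p = 1) ∧ (∀ p, ρ ≤ ‖p.2‖ → F p = 0) := by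
    let χ : ContDiffBump (0 : Eu n) := ⟨ρ / 2, ρ, by positivity, by linarith⟩
    exact ⟨fun p => χ p.2, ⟨χ.contDiff.comp contDiff_snd, ρ, fun p hp =>
      χ.zero_of_le_dist (by simpa using hp.le)⟩, fun v p => by simp, fun p => ⟨χ.nonneg, χ.le_one⟩,
      fun p hp => χ.one_of_mem_closedBall (by simpa using hp),
      fun p hp => χ.zero_of_le_dist (by simpa using hp)⟩
  have b1 : ∀ g : SpT n → ℝ, SmC g → (∀ v : ℝ, ∀ p, g (p + (v, 0)) = g p) → ∃ M, 0 ≤ M ∧ ∀ p, |g p| ≤ M := by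
    intro g hg hi
    obtain ⟨M, hM0, hM⟩ := hg.bound 0 0
    refine ⟨M, hM0, fun p => ?_⟩
    have := hM (0, p.2) (by simp)
    rw [← hi p.1] at this
    simpa using this
  have i1 : ∀ i, ∀ v : ℝ, ∀ p, dd (ex i) F (p + (v, 0)) = _ :=
    fun i v p => dd_add_invariant (inv v) (ex i) p
  have i2 := fun i j v p => dd_add_invariant (i1 i v) (ex j) p
  choose M1 hM10 hM1 using fun i => b1 _ (hs.dd (ex i)) (i1 i)
  choose M2 hM20 hM2 using fun i j => b1 _ ((hs.dd (ex i)).dd (ex j)) (i2 i j)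
  have inv2 : ∀ c : Eu n, ∀ f : SpT n → ℝ, ∀ e p, dd e (fun p => f (p + (0, -c))) p = dd e f (p + (0, -c)) :=
    fun c f e p => by unfold dd; rw [fderiv_comp_add_right]
  refine ⟨∑ i, M1 i + ∑ i, ∑ j, M2 i j, add_nonneg (sum_nonneg fun i _ => hM10 i)
    (sum_nonneg fun i _ => sum_nonneg fun j _ => hM20 i j), fun c =>
    ⟨fun p => F (p + (0, -c)), ?_, ?_, fun p => hF01 _, ?_, ?_, ?_, ?_⟩⟩
  · refine ⟨hs.1.comp (contDiff_id.add contDiff_const), ρ + ‖c‖, fun p hp => ?_⟩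
    refine hF0 _ ?_
    have := norm_sub_norm_le p.2 c
    simp only [Prod.snd_add, ← sub_eq_add_neg]
    linarith
  · intro p
    rw [inv2]
    have hl := hasDerivAt_line hs.1 (fun s => p + (0, -c) + (s, 0)) et 0 (by
      have h1 : HasDerivAt (fun s : ℝ => ((s, 0) : SpT n)) (1, 0) 0 :=
        (hasDerivAt_id (0:ℝ)).prodMk (hasDerivAt_const 0 0)
      exact h1.const_add _)
    have hl2 : HasDerivAt (fun s => F (p + (0, -c) + (s, 0))) 0 0 := by
      simp only [inv]; exact hasDerivAt_const _ _
    have := hl.unique hl2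
    rwa [show ((0:ℝ), (0 : Eu n)) = 0 from rfl, add_zero] at this
  · intro p hp
    refine hF1 _ ?_
    exact hp.le
  · intro p hp
    refine hF0 _ ?_
    exact hp
  · intro i p
    rw [inv2]
    refine (hM1 i _).trans ?_
    have h1 := single_le_sum (fun i _ => hM10 i) (Finset.mem_univ i)
    have h2 : 0 ≤ ∑ i, ∑ j, M2 i j := sum_nonneg fun i _ => sum_nonneg fun j _ => hM20 i j
    linarith
  · intro i j p
    have : dd (ex i) (fun p : SpT n => F (p + (0, -c))) =
      fun p => dd (ex i) F (p + (0, -c)) := funext fun q => inv2 c _ _ q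
    rw [this, inv2]
    refine (hM2 i j _).trans ?_
    have h1 := single_le_sum (fun j _ => hM20 i j) (Finset.mem_univ j)
    have h2 := single_le_sum (f := fun i => ∑ j, M2 i j)
      (fun i _ => sum_nonneg fun j _ => hM20 i j) (Finset.mem_univ i)
    have h3 : 0 ≤ ∑ i, M1 i := sum_nonneg fun i _ => hM10 i
    linarith

lemma dd_dd_mul {V : Type*} [NormedAddCommGroup V] [NormedSpace ℝ V] {f g : V → ℝ}
    (hf : ContDiff ℝ ∞ f) (hg : ContDiff ℝ ∞ g) (e e' p : V) :
    dd e' (dd e (fun q => f q * g q)) p = f p * dd e' (dd e g) p + dd e' f p * dd e g p +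
      dd e f p * dd e' g p + dd e' (dd e f) p * g p := by
  have := funext fun q => dd_mul hf hg e q
  rw [this, dd_add ((hf.dd e).mul hg) (hf.mul (hg.dd e)), dd_mul (hf.dd e) hg, dd_mul hf (hg.dd e)]
  ring

/-- Combined bound for a function and its derivatives in the parabolic Morrey scale. -/
def QB (t₁ t₂ : ℝ) (w : SpT n → ℝ) (Z : ℝ) : Prop :=
  (∀ i j, MB t₁ t₂ (dd (ex j) (dd (ex i) w)) Z) ∧ MB t₁ t₂ (dd et w) Z ∧
    ∀ τ ∈ Icc t₁ t₂, ∀ y, |w (τ, y)| ≤ Z * √√(t₂ - t₁) ∧ ∀ i, |dd (ex i) w (τ, y)| ≤ Z * √√(t₂ - t₁)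

/-- Localized operator: pointwise bound for the frozen heat operator applied to `ζ w`. -/
lemma heatOp_cutoff_le {ζ w f : SpT n → ℝ} (hζ : SmC ζ) (hw : ContDiff ℝ ∞ w)
    {a : Fin n → Fin n → SpT n → ℝ} {p : SpT n} {E : ℝ}
    (hζt : dd et ζ p = 0) (hζ01 : 0 ≤ ζ p ∧ ζ p ≤ 1) (h1 : ∀ i, |dd (ex i) ζ p| ≤ E)
    (h2 : ∀ i j, |dd (ex j) (dd (ex i) ζ) p| ≤ E) (hL : ∀ i j, |a i j p| ≤ L)
    (hE : 0 ≤ E) (hL0 : 0 ≤ L)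
    (hosc : ∀ i j, |(a i j p - A i j) * dd (ex j) (dd (ex i) fun q => ζ q * w q) p| ≤
      ε * |dd (ex j) (dd (ex i) fun q => ζ q * w q) p|)
    (heq : dd et w p = (∑ i, ∑ j, a i j p * dd (ex j) (dd (ex i) w) p) + f p)
    (hN : |w p| ≤ N) (hN1 : ∀ i, |dd (ex i) w p| ≤ N) :
    |heatOp A (fun q => ζ q * w q) p| ≤
      |f p| + (∑ i, ∑ j, ε * |dd (ex j) (dd (ex i) fun q => ζ q * w q) p|) + n ^ 2 * (L * (3 * (E * N))) := by
  have e1 : heatOp A (fun q => ζ q * w q) p = ζ p * f p +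
      (∑ i, ∑ j, (a i j p - A i j) * dd (ex j) (dd (ex i) fun q => ζ q * w q) p) -
      ∑ i, ∑ j, a i j p * (dd (ex j) ζ p * dd (ex i) w p +
      dd (ex i) ζ p * dd (ex j) w p + dd (ex j) (dd (ex i) ζ) p * w p) := by
    unfold heatOp
    rw [dd_mul hζ.1 hw, hζt, heq, mul_add, mul_sum]
    simp only [mul_sum, dd_dd_mul hζ.1 hw]
    rw [zero_mul, zero_add, add_comm (∑ i, ∑ j, _) (ζ p * f p), add_sub_assoc, add_sub_assoc,
      ← sum_sub_distrib, ← sum_sub_distrib]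
    congr 1
    refine sum_congr rfl fun i _ => ?_
    rw [← sum_sub_distrib, ← sum_sub_distrib]
    exact sum_congr rfl fun j _ => by ring
  rw [e1]
  refine (abs_sub _ _).trans (add_le_add ((abs_add_le _ _).trans (add_le_add ?_ ?_)) ?_)
  · rw [abs_mul, abs_of_nonneg hζ01.1]
    exact mul_le_of_le_one_left (abs_nonneg _) hζ01.2
  · exact (abs_sum_le_sum_abs _ _).trans (sum_le_sum fun i _ =>
      (abs_sum_le_sum_abs _ _).trans (sum_le_sum fun j _ => hosc i j))
  · calc _ ≤ ∑ i : Fin n, ∑ j : Fin n, L * (3 * (E * N)) :=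
          (abs_sum_le_sum_abs _ _).trans (sum_le_sum fun i _ =>
            (abs_sum_le_sum_abs _ _).trans (sum_le_sum fun j _ => by
              rw [abs_mul]
              refine mul_le_mul (hL i j) ?_ (abs_nonneg _) hL0
              refine (abs_add_le _ _).trans ((add_le_add_left (abs_add_le _ _) _).trans ?_)
              rw [abs_mul, abs_mul, abs_mul]
              have q1 := mul_le_mul (h1 j) (hN1 i) (abs_nonneg _) hE
              have q2 := mul_le_mul (h1 i) (hN1 j) (abs_nonneg _) hE
              have q3 := mul_le_mul (h2 i j) hN (abs_nonneg _) hE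
              linarith))
      _ = _ := by simp; ring

/-- A linear parabolic equation `w_t = a D²w + f` with zero initial values on a time window, with
coefficients of small oscillation. -/
structure LinHyp (lam L ε ρ t₁ t₂ : ℝ) (a : Fin n → Fin n → SpT n → ℝ) (f w : SpT n → ℝ) :
    Prop where
  smooth : ContDiff ℝ ∞ w
  ini : ∀ x, w (t₁, x) = 0
  cont : ContinuousOn f (Icc t₁ t₂ ×ˢ univ)
  symm : ∀ c i j, a i j (t₁, c) = a j i (t₁, c)
  ell : ∀ c (ξ : Fin n → ℝ), lam * ∑ i, ξ i ^ 2 ≤ ∑ i, ∑ j, a i j (t₁, c) * (ξ i * ξ j)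
  bdd : ∀ τ ∈ Icc t₁ t₂, ∀ y i j, |a i j (τ, y)| ≤ L
  osc : ∀ c, ∀ τ ∈ Icc t₁ t₂, ∀ y, ‖y - c‖ ≤ ρ → ∀ i j, |a i j (τ, y) - a i j (t₁, c)| ≤ ε
  eq : ∀ τ ∈ Icc t₁ t₂, ∀ y,
    dd et w (τ, y) = (∑ i, ∑ j, a i j (τ, y) * dd (ex j) (dd (ex i) w) (τ, y)) + f (τ, y)

lemma eq_zero_mul_hess {c : Eu n}
    (h : ∀ p : SpT n, ρ ≤ ‖p.2 - c‖ → v p = 0) {p : SpT n} (hp : ρ < ‖p.2 - c‖) (e e' : SpT n) :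
    dd e' (dd e v) p = 0 := by
  have ho : IsOpen {q : SpT n | ρ < ‖q.2 - c‖} := isOpen_lt continuous_const (by fun_prop)
  refine dd_eq_zero_of_eventually ?_ _
  filter_upwards [ho.mem_nhds hp] with q hq
  refine dd_eq_zero_of_eventually ?_ _
  filter_upwards [ho.mem_nhds hq] with r hr using h r (le_of_lt hr)

set_option maxHeartbeats 1000000 in
lemma lin_local (n : ℕ) (hlam : 0 < lam) (hL0 : 0 ≤ L) : ∃ ε > 0, ∃ K > 0,
    ∀ ρ : ℝ, 0 < ρ → ∃ K₁ : ℝ, 0 ≤ K₁ ∧ ∀ (t₁ t₂ : ℝ), t₁ < t₂ → t₂ - t₁ ≤ 1 →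
    ∀ (a : Fin n → Fin n → SpT n → ℝ) (f w : SpT n → ℝ), LinHyp lam L ε ρ t₁ t₂ a f w →
    ∀ N : ℝ, (∀ τ ∈ Icc t₁ t₂, ∀ y, |w (τ, y)| ≤ N ∧ ∀ i, |dd (ex i) w (τ, y)| ≤ N) → ∀ F, 0 < F →
    MB t₁ t₂ f F → ∀ c : Eu n,
    ((∀ i l, ∀ r b : ℝ, 0 < r → r < ρ / 2 → t₁ ≤ b - r ^ 2 → b ≤ t₂ →
      ∫⁻ τ in Ioc (b - r ^ 2) b, ∫⁻ z in ball (0 : Eu n) 1,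
        ENNReal.ofReal (dd (ex i) (dd (ex l) w) (τ, c - r • z) ^ 2) ≤
      ENNReal.ofReal ((K * (F + K₁ * N * √√(t₂ - t₁))) ^ 2 * r)) ∧
    ∀ τ ∈ Icc t₁ t₂, |w (τ, c)| ≤ K * (F + K₁ * N * √√(t₂ - t₁)) * √√(t₂ - t₁) ∧
      ∀ i, |dd (ex i) w (τ, c)| ≤ K * (F + K₁ * N * √√(t₂ - t₁)) * √√(t₂ - t₁)) := by
  obtain ⟨Ck, ck, hCk, hck, hker⟩ := exists_ker n hlam hL0
  obtain ⟨Kh, hKh, Hh⟩ := clm_hess (n := n) Ck L hck hCk hlam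
  obtain ⟨Ks, hKs, Hs⟩ := clm_sup (n := n) Ck hck hCk
  obtain ⟨Kb, hKb, Hb⟩ := MB.of_bdd n
  set ε : ℝ := 1 / (2 * Kh * (n ^ 2 + 1)) with hε
  have hε0 : 0 < ε := by positivity
  have hεK : Kh * (n ^ 2 * ε) ≤ 1 / 2 := by
    have : Kh * (n ^ 2 * ε) = (n ^ 2 / (n ^ 2 + 1)) / 2 := by rw [hε]; field_simp
    rw [this]
    have : (n:ℝ) ^ 2 / (n ^ 2 + 1) ≤ 1 := by rw [div_le_one (by positivity)]; linarith
    linarith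
  refine ⟨ε, hε0, 2 * Kh + 2 * Ks, by positivity, fun ρ hρ => ?_⟩
  obtain ⟨E, hE, Hcut⟩ := exists_cutoff n hρ
  set K₁ : ℝ := Kb * (n ^ 2 * (L * (3 * E))) with hK₁
  have hK₁0 : 0 ≤ K₁ := by positivity
  refine ⟨K₁, hK₁0, fun t₁ t₂ ht hT a f w hw N hN F hF hf c => ?_⟩
  set q := √√(t₂ - t₁) with hq
  have hq0 : 0 ≤ q := sqrt_nonneg _
  have hN0 : 0 ≤ N := (abs_nonneg _).trans (hN t₁ ⟨le_rfl, ht.le⟩ 0).1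
  obtain ⟨ζ, hζ, hζt, hζ01, hζ1, hζ0, hζE, hζE2⟩ := Hcut c
  set A : Fin n → Fin n → ℝ := fun i j => a i j (t₁, c) with hA
  obtain ⟨k, hk⟩ := hker A (hw.symm c) (hw.ell c) (fun i j => hw.bdd t₁ ⟨le_rfl, ht.le⟩ c i j)
  set v : SpT n → ℝ := fun p => ζ p * w p with hv
  have hvs : SmC v := by
    have := hζ.mul_left hw.smooth
    have e : v = fun p => w p * ζ p := funext fun p => mul_comm _ _
    rw [e]; exact this
  have hv0 : ∀ x, v (t₁, x) = 0 := fun x => by simp [hv, hw.ini]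
  have hvz : ∀ p : SpT n, ρ ≤ ‖p.2 - c‖ → v p = 0 := fun p hp => by simp [hv, hζ0 p hp]
  set D : ℝ := F + K₁ * N * q with hD
  have hD0 : 0 < D := by positivity
  have hDc : ∀ i j, Continuous (dd (ex j) (dd (ex i) v)) := fun i j => ((hvs.dd _).dd _).1.continuous
  have step : ∀ M, 0 ≤ M → (∀ i j, MB t₁ t₂ (dd (ex j) (dd (ex i) v)) M) →
      MB t₁ t₂ (heatOp A v) (D + n ^ 2 * ε * M) := by
    intro M hM hMB
    have hS : MB t₁ t₂ (fun p => ∑ i, ∑ j, ε * |dd (ex j) (dd (ex i) v) p|) (∑ _i : Fin n, ∑ _j : Fin n, ε * M) := by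
      refine MB.sum _ (fun i _ => (continuous_finsetSum _ fun j _ =>
        continuous_const.mul (hDc i j).abs).continuousOn) (fun i _ => MB.sum _ (fun j _ =>
        (continuous_const.mul (hDc i j).abs).continuousOn) (fun j _ => ?_) (fun j _ => by positivity))
        (fun i _ => sum_nonneg fun j _ => by positivity)
      have := ((hMB i j).of_abs_le (F := fun p => |dd (ex j) (dd (ex i) v) p|)
        (fun τ _ y => by rw [abs_abs])).const_mul ε
      rwa [abs_of_pos hε0] at this
    have hC : MB t₁ t₂ (fun _ : SpT n => (n:ℝ) ^ 2 * (L * (3 * (E * N)))) (K₁ * N * q) := by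
      have := Hb t₁ t₂ (fun _ => (n:ℝ) ^ 2 * (L * (3 * (E * N)))) ((n:ℝ) ^ 2 * (L * (3 * (E * N))))
        (by positivity) ht.le (fun _ _ _ => (abs_of_nonneg (by positivity)).le)
      convert this using 1
      rw [hK₁]; ring
    have hfa : MB t₁ t₂ (fun p => |f p|) F := hf.of_abs_le fun τ _ y => by rw [abs_abs]
    have hfS := MB.add hw.cont.abs hfa hS hF.le
      (sum_nonneg fun i _ => sum_nonneg fun j _ => by positivity)
    have hall := MB.add continuousOn_const hC hfS (by positivity) (add_nonneg hF.le
      (sum_nonneg fun i _ => sum_nonneg fun j _ => by positivity))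
    have hfin : K₁ * N * q + (F + ∑ _i : Fin n, ∑ _j : Fin n, ε * M) = D + n ^ 2 * ε * M := by
      rw [hD]; simp; ring
    rw [hfin] at hall
    refine hall.of_abs_le fun τ hτ y => ?_
    refine (heatOp_cutoff_le (a := a) (A := A) (ε := ε) (L := L) (E := E) (N := N) hζ hw.smooth
      (hζt _) (hζ01 _) (fun i => hζE i _) (fun i j => hζE2 i j _)
      (hw.bdd τ hτ y) hE hL0 ?_ (hw.eq τ hτ y) (hN τ hτ y).1 (hN τ hτ y).2).trans ?_
    · intro i j
      by_cases hy : ‖y - c‖ ≤ ρ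
      · rw [abs_mul]
        exact mul_le_mul_of_nonneg_right (hw.osc c τ hτ y hy i j) (abs_nonneg _)
      · have hz := eq_zero_mul_hess hvz (p := (τ, y)) (not_le.1 hy) (ex i) (ex j)
        have hz' := hz
        rw [hz']; simp
    · refine le_trans (le_of_eq ?_) (le_abs_self _)
      ring
  have hP : ∀ i j, MB t₁ t₂ (dd (ex j) (dd (ex i) v)) (2 * (Kh * D)) := by
    refine absorb (P := fun M => ∀ i j, MB t₁ t₂ (dd (ex j) (dd (ex i) v)) M) (by positivity)
      (fun M _ h i j => MB.closed fun δ hδ => h δ hδ i j)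
      (fun M M' h0 hM h i j => (h i j).mono h0 hM) ?_ ?_
    · choose B hB0 hB using fun i j => ((hvs.dd (ex i)).dd (ex j)).bound t₁ t₂
      refine ⟨∑ i, ∑ j, Kb * B i j * q, sum_nonneg fun i _ => sum_nonneg fun j _ =>
        mul_nonneg (mul_nonneg hKb.le (hB0 i j)) hq0, fun i j => ?_⟩
      refine (Hb t₁ t₂ _ (B i j) (hB0 i j) ht.le fun τ hτ y => hB i j _ hτ).mono
        (mul_nonneg (mul_nonneg hKb.le (hB0 i j)) hq0) ?_
      have h1 := single_le_sum (f := fun j => Kb * B i j * q)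
        (fun j _ => mul_nonneg (mul_nonneg hKb.le (hB0 i j)) hq0) (Finset.mem_univ j)
      have h2 := single_le_sum (f := fun i => ∑ j, Kb * B i j * q)
        (fun i _ => sum_nonneg fun j _ => mul_nonneg (mul_nonneg hKb.le (hB0 i j)) hq0)
        (Finset.mem_univ i)
      exact h1.trans h2
    · intro M hM h i j
      have h1 := Hh A k hk (hw.ell c) (fun i j => hw.bdd t₁ ⟨le_rfl, ht.le⟩ c i j) t₁ t₂ v hvs hv0
        (D + n ^ 2 * ε * M) (by positivity) (step M hM h) j i
      refine h1.mono (by positivity) ?_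
      have := mul_le_mul_of_nonneg_right hεK hM
      linarith
  have hH : MB t₁ t₂ (heatOp A v) (2 * D) := by
    refine (step _ (by positivity) hP).mono (by positivity) ?_
    have := mul_le_mul_of_nonneg_right hεK hD0.le
    linarith
  have near : ∀ p : SpT n, ‖p.2 - c‖ < ρ / 2 → v =ᶠ[𝓝 p] w := fun p hp => by
    have ho : IsOpen {q : SpT n | ‖q.2 - c‖ < ρ / 2} := isOpen_lt (by fun_prop) continuous_const
    filter_upwards [ho.mem_nhds hp] with r hr
    simp [hv, hζ1 r hr]
  refine ⟨fun i l r b hr hr2 h1 h2 => ?_, fun τ hτ => ?_⟩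
  · have := hP l i c r b hr h1 h2
    refine le_trans (le_of_eq ?_) (this.trans (ofReal_le_ofReal ?_))
    · refine lintegral_congr fun τ => setLIntegral_congr_fun measurableSet_ball fun z hz => ?_
      have hn : ‖((τ, c - r • z) : SpT n).2 - c‖ < ρ / 2 := by
        simp only [sub_sub_cancel_left, norm_neg, norm_smul, norm_eq_abs, abs_of_pos hr]
        have : ‖z‖ < 1 := by simpa using hz
        nlinarith [norm_nonneg z]
      rw [dd_congr (dd_eventuallyEq (near _ hn) (ex l)) (ex i)]
    · have hKs : 0 ≤ Ks * D := by positivity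
      have hle : 2 * (Kh * D) ≤ (2 * Kh + 2 * Ks) * D := by linarith
      gcongr
  · have hs0 : 0 < √(t₂ - t₁) := sqrt_pos.2 (by linarith)
    obtain ⟨s1, s2⟩ := Hs A k hk t₁ t₂ v hvs hv0 (2 * D) (by positivity) hH τ (√(t₂ - t₁)) c hτ hs0
      (by rw [sq_sqrt (by linarith)])
    have hn : ‖((τ, c) : SpT n).2 - c‖ < ρ / 2 := by simpa using by positivity
    have hle := sqrt_le_one.2 hT
    have hb : Ks * (2 * D) * q ≤ (2 * Kh + 2 * Ks) * D * q := by
      have : 0 ≤ Kh * D * q := by positivity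
      nlinarith
    refine ⟨?_, fun i => ?_⟩
    · rw [(near _ hn).eq_of_nhds] at s1
      refine s1.trans (le_trans ?_ hb)
      exact mul_le_mul_of_nonneg_left (mul_le_of_le_one_left hq0 hle) (by positivity)
    · have := s2 i
      rw [dd_congr (near _ hn)] at this
      exact this.trans hb

set_option maxHeartbeats 1000000 in
lemma lin (n : ℕ) (hlam : 0 < lam) (hL0 : 0 ≤ L) : ∃ ε > 0,
    ∀ ρ : ℝ, 0 < ρ → ∃ T₀ > 0, T₀ ≤ 1 ∧ ∃ K > 0, ∀ (t₁ t₂ : ℝ), t₁ < t₂ → t₂ - t₁ ≤ T₀ →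
    ∀ (a : Fin n → Fin n → SpT n → ℝ) (f w : SpT n → ℝ), LinHyp lam L ε ρ t₁ t₂ a f w →
    (∃ N : ℝ, ∀ τ ∈ Icc t₁ t₂, ∀ y, |w (τ, y)| ≤ N ∧ ∀ i, |dd (ex i) w (τ, y)| ≤ N) → ∀ F, 0 < F →
    MB t₁ t₂ f F → QB t₁ t₂ w (K * F) := by
  obtain ⟨ε, hε, K, hK, H⟩ := lin_local n hlam hL0
  refine ⟨ε, hε, fun ρ hρ => ?_⟩
  obtain ⟨K₁, hK₁, H1⟩ := H ρ hρ
  set s : ℝ := 1 / (2 * (K * K₁ + 1)) with hs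
  have hs0 : 0 < s := by positivity
  have hsK : K * K₁ * s ≤ 1 / 2 := by
    rw [hs, mul_one_div, div_le_iff₀ (by positivity)]; linarith [mul_nonneg hK.le hK₁]
  refine ⟨min (min 1 (ρ ^ 2 / 16)) (s ^ 2), by positivity, (min_le_left _ _).trans (min_le_left _ _),
    1 + 2 * K + n ^ 2 * (L * (2 * K)), by positivity, fun t₁ t₂ ht hT a f w hw hN F hF hf => ?_⟩
  have hT1 := hT.trans ((min_le_left _ _).trans (min_le_left _ _))
  have hT2 := hT.trans ((min_le_left _ _).trans (min_le_right _ _))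
  have hT3 := hT.trans (min_le_right _ _)
  set q := √√(t₂ - t₁) with hq
  have hq0 : 0 ≤ q := sqrt_nonneg _
  have hqs : q * q ≤ s := by
    rw [hq, mul_self_sqrt (sqrt_nonneg _)]
    exact sqrt_le_iff.2 ⟨hs0.le, hT3⟩
  have hKq := (mul_le_mul_of_nonneg_left hqs (by positivity)).trans hsK
  have loc := H1 t₁ t₂ ht hT1 a f w hw
  have hP : ∀ τ ∈ Icc t₁ t₂, ∀ y, |w (τ, y)| ≤ 2 * (K * F * q) ∧
      ∀ i, |dd (ex i) w (τ, y)| ≤ 2 * (K * F * q) := by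
    refine absorb (P := fun M => ∀ τ ∈ Icc t₁ t₂, ∀ y, |w (τ, y)| ≤ M ∧ ∀ i, |dd (ex i) w (τ, y)| ≤ M)
      (by positivity) ?_ ?_ ?_ ?_
    · intro M _ h τ hτ y
      exact ⟨le_of_forall_pos_le_add fun δ hδ => (h δ hδ τ hτ y).1,
        fun i => le_of_forall_pos_le_add fun δ hδ => (h δ hδ τ hτ y).2 i⟩
    · intro M N _ hMN h τ hτ y
      exact ⟨(h τ hτ y).1.trans hMN, fun i => ((h τ hτ y).2 i).trans hMN⟩
    · obtain ⟨N, hN⟩ := hN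
      exact ⟨N, (abs_nonneg _).trans (hN t₁ ⟨le_rfl, ht.le⟩ 0).1, hN⟩
    · intro M hM h τ hτ y
      have hl := (loc M h F hF hf y).2 τ hτ
      have hle : K * (F + K₁ * M * q) * q ≤ M / 2 + K * F * q := by
        have := mul_le_mul_of_nonneg_right hKq hM
        linarith
      exact ⟨hl.1.trans hle, fun i => (hl.2 i).trans hle⟩
  have hD : ∀ i j, MB t₁ t₂ (dd (ex j) (dd (ex i) w)) (2 * K * F) := by
    intro i j x r b hr hb1 hb2
    have hr2 : r < ρ / 2 := by
      by_contra! hcon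
      nlinarith
    refine ((loc _ hP F hF hf x).1 j i r b hr hr2 hb1 hb2).trans (ofReal_le_ofReal ?_)
    have hle : K * (F + K₁ * (2 * (K * F * q)) * q) ≤ 2 * K * F := by
      have := mul_le_mul_of_nonneg_right hKq (show 0 ≤ 2 * (K * F) by positivity)
      linarith
    gcongr
  have hDc := fun i j => ((hw.smooth.dd (ex i)).dd (ex j)).continuous
  have hX : 0 ≤ (n:ℝ) ^ 2 * (L * (2 * K)) * F := by positivity
  refine ⟨fun i j => (hD i j).mono (by positivity) (by linarith), ?_, fun τ hτ y => ?_⟩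
  · have hS : MB t₁ t₂ (fun p => ∑ i, ∑ j, L * |dd (ex j) (dd (ex i) w) p|)
        (∑ _i : Fin n, ∑ _j : Fin n, L * (2 * K * F)) := by
      refine MB.sum _ (fun i _ => (continuous_finsetSum _ fun j _ =>
        continuous_const.mul (hDc i j).abs).continuousOn) (fun i _ => MB.sum _ (fun j _ =>
        (continuous_const.mul (hDc i j).abs).continuousOn) (fun j _ => ?_) (fun j _ => by positivity))
        (fun i _ => sum_nonneg fun j _ => by positivity)
      have := ((hD i j).of_abs_le (F := fun p => |dd (ex j) (dd (ex i) w) p|)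
        (fun τ _ y => by rw [abs_abs])).const_mul L
      rwa [abs_of_nonneg hL0] at this
    have hall := MB.add hw.cont.abs (hf.of_abs_le fun τ _ y => by rw [abs_abs]) hS hF.le
      (sum_nonneg fun i _ => sum_nonneg fun j _ => by positivity)
    refine (hall.of_abs_le (F := dd et w) fun τ hτ y => ?_).mono ?_ ?_
    · rw [hw.eq τ hτ y]
      refine le_trans ?_ (le_abs_self _)
      rw [add_comm]
      refine (abs_add_le _ _).trans (add_le_add le_rfl ?_)
      refine (abs_sum_le_sum_abs _ _).trans (sum_le_sum fun i _ => ?_)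
      refine (abs_sum_le_sum_abs _ _).trans (sum_le_sum fun j _ => ?_)
      rw [abs_mul]
      exact mul_le_mul_of_nonneg_right (hw.bdd τ hτ y i j) (abs_nonneg _)
    · simp; positivity
    · have : 0 ≤ K * F := by positivity
      simp; linarith
  · have hle : 2 * (K * F * q) ≤ (1 + 2 * K + n ^ 2 * (L * (2 * K))) * F * q := by
      have h1 : 0 ≤ F * q := by positivity
      have h2 := mul_nonneg hX hq0
      linarith
    exact ⟨(hP τ hτ y).1.trans hle, fun i => ((hP τ hτ y).2 i).trans hle⟩

/-- Iterated forward difference quotient with step `h`. -/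
def dq (h : ℝ) : ℕ → (ℝ → ℝ) → ℝ → ℝ
  | 0, F, s => F s
  | k + 1, F, s => (dq h k F (s + h) - dq h k F s) / h

lemma dq_const (h : ℝ) (k : ℕ) (c s : ℝ) : dq h (k + 1) (fun _ => c) s = 0 := by
  induction k generalizing s with
  | zero => simp [dq]
  | succ k ih => rw [dq, ih, ih]; simp

lemma dq_add (h : ℝ) (k : ℕ) (F G : ℝ → ℝ) (s : ℝ) :
    dq h k (fun s => F s + G s) s = dq h k F s + dq h k G s := by
  induction k generalizing s with
  | zero => rfl
  | succ k ih => simp only [dq, ih]; ring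

lemma dq_const_mul (h : ℝ) (k : ℕ) (c : ℝ) (F : ℝ → ℝ) (s : ℝ) :
    dq h k (fun s => c * F s) s = c * dq h k F s := by
  induction k generalizing s with
  | zero => rfl
  | succ k ih => simp only [dq, ih]; ring

lemma dq_sum (h : ℝ) (k : ℕ) (S : Finset ι) (F : ι → ℝ → ℝ) (s : ℝ) :
    dq h k (fun s => ∑ i ∈ S, F i s) s = ∑ i ∈ S, dq h k (F i) s := by
  induction k generalizing s with
  | zero => rfl
  | succ k ih => simp only [dq, ih, sum_div, ← sum_sub_distrib]

lemma dq_eq_zero (hh : 0 ≤ h) (k : ℕ) {F : ℝ → ℝ} (hs : s + k * h ≤ S)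
    (h0 : ∀ s', s ≤ s' → s' ≤ S → F s' = 0) : dq h k F s = 0 := by
  induction k generalizing s with
  | zero => exact h0 s le_rfl (by simpa using hs)
  | succ k ih =>
    push_cast at hs
    rw [dq, ih (by linarith) (fun s' h1 h2 => h0 s' (by linarith) h2), ih (by linarith) h0]; simp

lemma dq_mul (hh : h ≠ 0) (k : ℕ) (F G : ℝ → ℝ) (s : ℝ) :
    dq h k (fun s => F s * G s) s = ∑ ij ∈ antidiagonal k,
      (k.choose ij.1 : ℝ) * (dq h ij.1 F (s + ij.2 * h) * dq h ij.2 G s) := by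
  induction k generalizing s with
  | zero => simp [dq]
  | succ k ih =>
    rw [dq, ih, ih, Finset.sum_antidiagonal_choose_succ_mul
      (fun i j => dq h i F (s + j * h) * dq h j G s), ← sum_sub_distrib, sum_div,
      ← sum_add_distrib]
    refine sum_congr rfl fun ij hij => ?_
    rw [← Nat.choose_symm_of_eq_add (mem_antidiagonal.1 hij).symm]
    have e : s + h + ij.2 * h = s + ij.2 * h + h := by ring
    have e2 : s + ((ij.2 + 1 : ℕ) : ℝ) * h = s + ij.2 * h + h := by push_cast; ring
    rw [e2, e]
    simp only [dq]
    field_simp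
    ring

lemma dq_affine_mul (hh : h ≠ 0) (k : ℕ) (c : ℝ) (G : ℝ → ℝ) (s : ℝ) :
    dq h k (fun s => (c + s) * G s) s = (c + (s + k * h)) * dq h k G s + k * dq h (k - 1) G s := by
  induction k generalizing s with
  | zero => simp [dq]
  | succ k ih =>
    rw [dq, ih, ih]
    rcases k with - | k
    · simp only [dq, Nat.cast_zero, Nat.cast_one, zero_add, Nat.sub_self]
      field_simp
      ring
    · simp only [dq, Nat.add_sub_cancel]
      push_cast
      field_simp
      ring

/-- Majorant sequence for analytic functions. -/
def maj (Z B : ℝ) (k : ℕ) : ℝ := Z * k.factorial * B ^ k / (k + 1) ^ 2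

lemma maj_zero (Z B : ℝ) : maj Z B 0 = Z := by simp [maj]

lemma maj_pos (hZ : 0 < Z) (hB : 0 < B) (k : ℕ) : 0 < maj Z B k := by
  unfold maj; positivity

lemma mul_maj_pred_le (hZ : 0 < Z) (hB : 0 < B) (k : ℕ) :
    (k : ℝ) * maj Z B (k - 1) ≤ 4 / B * maj Z B k := by
  rcases k with - | k
  · simp only [Nat.cast_zero, zero_mul]
    have := maj_pos hZ hB 0
    positivity
  · simp only [maj, Nat.add_sub_cancel, Nat.factorial_succ]
    push_cast
    have e1 : ((k:ℝ) + 1) * (Z * k.factorial * B ^ k / (k + 1) ^ 2) =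
      (Z * k.factorial * B ^ k * (k + 1)) * (1 / (k + 1) ^ 2) := by ring
    have e2 : 4 / B * (Z * ((k + 1) * k.factorial) * B ^ (k + 1) / ((k:ℝ) + 1 + 1) ^ 2) =
      (Z * k.factorial * B ^ k * (k + 1)) * (4 / (k + 1 + 1) ^ 2) := by
      rw [pow_succ]; field_simp
    rw [e1, e2]
    refine mul_le_mul_of_nonneg_left ?_ (by positivity)
    rw [div_le_div_iff₀ (by positivity) (by positivity)]
    nlinarith

lemma sum_inv_sq_le (k : ℕ) : ∑ i ∈ Finset.range (k + 1), 1 / ((i:ℝ) + 1) ^ 2 ≤ 2 - 1 / ((k:ℝ) + 1) := by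
  induction k with
  | zero => norm_num
  | succ k ih =>
    rw [Finset.sum_range_succ]
    push_cast
    have : 1 / ((k:ℝ) + 1 + 1) ^ 2 ≤ 1 / (k + 1) - 1 / (k + 1 + 1) := by
      rw [div_sub_div _ _ (by positivity) (by positivity), div_le_div_iff₀ (by positivity) (by positivity)]
      have : (0:ℝ) ≤ k := Nat.cast_nonneg k
      nlinarith
    linarith

lemma maj_conv (hZ : 0 < Z) (hB : 0 < B) (k : ℕ) :
    ∑ ij ∈ antidiagonal k, (k.choose ij.1 : ℝ) * (maj Z B ij.1 * maj Z B ij.2) ≤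
      8 * Z * maj Z B k := by
  have h1 : ∀ ij ∈ antidiagonal k, (k.choose ij.1 : ℝ) * (maj Z B ij.1 * maj Z B ij.2) ≤
      Z * maj Z B k * (2 * (1 / ((ij.1:ℝ) + 1) ^ 2) + 2 * (1 / ((ij.2:ℝ) + 1) ^ 2)) := by
    rintro ⟨i, j⟩ hij
    have hk := mem_antidiagonal.1 hij
    subst hk
    have hc : ((i + j).choose i : ℝ) * i.factorial * j.factorial = (i + j).factorial := by
      rw [Nat.choose_symm_add]
      exact_mod_cast Nat.add_choose_mul_factorial_mul_factorial i j
    simp only [maj]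
    have e1 : ((i + j).choose i : ℝ) * (Z * i.factorial * B ^ i / ((i:ℝ) + 1) ^ 2 *
        (Z * j.factorial * B ^ j / ((j:ℝ) + 1) ^ 2)) =
        (Z ^ 2 * B ^ (i + j) * (i + j).factorial) * (1 / ((i + 1) ^ 2 * (j + 1) ^ 2)) := by
      rw [← hc, pow_add]; field_simp
    have e2 : Z * (Z * (i + j).factorial * B ^ (i + j) / (((i + j : ℕ) : ℝ) + 1) ^ 2) *
        (2 * (1 / ((i:ℝ) + 1) ^ 2) + 2 * (1 / ((j:ℝ) + 1) ^ 2)) =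
        (Z ^ 2 * B ^ (i + j) * (i + j).factorial) *
          ((2 * (1 / ((i:ℝ) + 1) ^ 2) + 2 * (1 / ((j:ℝ) + 1) ^ 2)) / (i + j + 1) ^ 2) := by
      push_cast; field_simp
    rw [e1, e2]
    refine mul_le_mul_of_nonneg_left ?_ (by positivity)
    have e3 : (2 * (1 / ((i:ℝ) + 1) ^ 2) + 2 * (1 / ((j:ℝ) + 1) ^ 2)) / (i + j + 1) ^ 2 =
      (2 * (j + 1) ^ 2 + 2 * (i + 1) ^ 2) / (((i + 1) ^ 2 * (j + 1) ^ 2) * (i + j + 1) ^ 2) := by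
      field_simp
    rw [e3, div_le_div_iff₀ (by positivity) (by positivity)]
    have hi : (0:ℝ) ≤ i := Nat.cast_nonneg i
    have hj : (0:ℝ) ≤ j := Nat.cast_nonneg j
    have : ((i:ℝ) + j + 1) ^ 2 ≤ 2 * (j + 1) ^ 2 + 2 * (i + 1) ^ 2 := by nlinarith [sq_nonneg ((i:ℝ) - j)]
    have h0 : 0 ≤ ((i:ℝ) + 1) ^ 2 * (j + 1) ^ 2 := by positivity
    nlinarith
  refine (sum_le_sum h1).trans ?_
  rw [← mul_sum, sum_add_distrib, ← mul_sum, ← mul_sum]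
  have hs := sum_inv_sq_le k
  have hp : (0:ℝ) ≤ 1 / (k + 1) := by positivity
  have s1 : ∑ ij ∈ antidiagonal k, 1 / ((ij.1:ℝ) + 1) ^ 2 ≤ 2 := by
    rw [Finset.Nat.sum_antidiagonal_eq_sum_range_succ_mk]; linarith
  have s2 : ∑ ij ∈ antidiagonal k, 1 / ((ij.2:ℝ) + 1) ^ 2 ≤ 2 := by
    rw [← Finset.Nat.sum_antidiagonal_swap]
    exact s1
  have := mul_le_mul_of_nonneg_left (add_le_add s1 s2) (mul_pos hZ (maj_pos hZ hB k)).le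
  linarith

lemma maj_le (hZ : 0 < Z) (hB : 0 < B) (k : ℕ) : maj Z B k ≤ Z * (k * B) ^ k := by
  unfold maj
  have h1 : (k.factorial : ℝ) ≤ (k:ℝ) ^ k := by exact_mod_cast Nat.factorial_le_pow k
  rw [mul_pow]
  have h2 : (1:ℝ) ≤ (k + 1) ^ 2 := one_le_pow₀ (by linarith)
  refine (div_le_self (by positivity) h2).trans ?_
  have : 0 < B ^ k := by positivity
  calc Z * k.factorial * B ^ k ≤ Z * (k:ℝ) ^ k * B ^ k := by gcongr
    _ = _ := by ring

/-- Pointwise difference quotients of a family of functions. -/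
def dqf (h : ℝ) (k : ℕ) (W : ℝ → SpT n → ℝ) (s : ℝ) : SpT n → ℝ := fun p => dq h k (fun s => W s p) s

lemma dqf_smooth (hW : ∀ s, ContDiff ℝ ∞ (W s)) (h : ℝ) (k : ℕ) (s : ℝ) :
    ContDiff ℝ ∞ (dqf h k W s) := by
  induction k generalizing s with
  | zero => exact hW s
  | succ k ih => exact ((ih (s + h)).sub (ih s)).div_const h

lemma dd_dqf (hW : ∀ s, ContDiff ℝ ∞ (W s)) (h : ℝ) (k : ℕ) (s : ℝ) (e : SpT n) :
    dd e (dqf h k W s) = dqf h k (fun s => dd e (W s)) s := by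
  induction k generalizing s with
  | zero => rfl
  | succ k ih =>
    funext p
    have e1 : dqf h (k + 1) W s = fun p => h⁻¹ * (dqf h k W (s + h) p - dqf h k W s p) := by
      funext p; rw [inv_mul_eq_div]; rfl
    rw [e1, dd_const_mul ((dqf_smooth hW h k _).sub (dqf_smooth hW h k _)),
      dd_sub (dqf_smooth hW h k _) (dqf_smooth hW h k _), ih, ih, inv_mul_eq_div]
    rfl

/-- Index set of the 2-jets entering a second order parabolic equation. -/
abbrev JI (n : ℕ) := Option ((Fin n × Fin n) ⊕ Fin n)

/-- The jets of a function: time derivative, second and first space derivatives. -/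
def jet (w : SpT n → ℝ) : JI n → SpT n → ℝ
  | none => dd et w
  | some (Sum.inl (i, j)) => dd (ex j) (dd (ex i) w)
  | some (Sum.inr l) => dd (ex l) w

lemma jet_smooth {w : SpT n → ℝ} (hw : ContDiff ℝ ∞ w) (ι : JI n) : ContDiff ℝ ∞ (jet w ι) := by
  rcases ι with - | ⟨i, j⟩ | l
  · exact hw.dd _
  · exact (hw.dd _).dd _
  · exact hw.dd _

lemma jet_dqf (hW : ∀ s, ContDiff ℝ ∞ (W s)) (h : ℝ) (k : ℕ) (s : ℝ) (ι : JI n) :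
    jet (dqf h k W s) ι = dqf h k (fun s => jet (W s) ι) s := by
  rcases ι with - | ⟨i, j⟩ | l
  · exact dd_dqf hW h k s _
  · simp only [jet]
    rw [dd_dqf hW, dd_dqf fun s => (hW s).dd _]
  · exact dd_dqf hW h k s _

/-- Time weights of the jets under the rescaling of time by `1 + s`. -/
def jw : JI n → ℝ → ℝ
  | none, _ => 1
  | some _, s => 1 + s

/-- Rescaling of time about `t₁` by `1 + s`. -/
def tsc (t₁ s : ℝ) (p : SpT n) : SpT n := (t₁ + (1 + s) * (p.1 - t₁), p.2)

lemma tsc_smooth (t₁ s : ℝ) : ContDiff ℝ ∞ (tsc (n := n) t₁ s) := by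
  unfold tsc; fun_prop

lemma dd_comp_tsc (hU : ContDiff ℝ ∞ U) (t₁ s : ℝ) (e p : SpT n) :
    dd e (fun q => U (tsc t₁ s q)) p = dd ((1 + s) * e.1, e.2) U (tsc t₁ s p) := by
  have hw : ContDiff ℝ ∞ (fun q => U (tsc t₁ s q)) := hU.comp (tsc_smooth t₁ s)
  have hγ : HasDerivAt (fun r : ℝ => p + r • e) e 0 := by
    simpa using ((hasDerivAt_id (0:ℝ)).smul_const e).const_add p
  have h1 := hasDerivAt_line hw (fun r : ℝ => p + r • e) e 0 hγ
  have hγ2 : HasDerivAt (fun r : ℝ => tsc t₁ s (p + r • e)) ((1 + s) * e.1, e.2) 0 := by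
    have e1 : (fun r : ℝ => tsc t₁ s (p + r • e)) =
        fun r : ℝ => tsc t₁ s p + r • (((1 + s) * e.1, e.2) : SpT n) := by
      funext r
      refine Prod.ext ?_ rfl
      simp [tsc]; ring
    rw [e1]
    simpa using ((hasDerivAt_id (0:ℝ)).smul_const (((1 + s) * e.1, e.2) : SpT n)).const_add (tsc t₁ s p)
  have h2 := hasDerivAt_line hU (fun r : ℝ => tsc t₁ s (p + r • e)) _ 0 hγ2
  have := h1.unique h2
  simpa using this

lemma dd_et_comp_tsc (hU : ContDiff ℝ ∞ U) (t₁ s : ℝ) (p : SpT n) :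
    dd et (fun q => U (tsc t₁ s q)) p = (1 + s) * dd et U (tsc t₁ s p) := by
  rw [dd_comp_tsc hU]
  have : (((1 + s) * (et : SpT n).1, (et : SpT n).2) : SpT n) = (1 + s) • et := by
    simp [et]
  rw [this]
  simp [dd]

lemma dd_ex_comp_tsc (hU : ContDiff ℝ ∞ U) (t₁ s : ℝ) (i : Fin n) :
    dd (ex i) (fun q => U (tsc t₁ s q)) = fun p => dd (ex i) U (tsc t₁ s p) := by
  funext p
  rw [dd_comp_tsc hU]
  simp [ex]

lemma jet_comp_tsc (hU : ContDiff ℝ ∞ U) (t₁ s : ℝ) (ι : JI n) (p : SpT n) :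
    jw ι s * jet (fun q => U (tsc t₁ s q)) ι p = (1 + s) * jet U ι (tsc t₁ s p) := by
  rcases ι with - | ⟨i, j⟩ | l
  · simp only [jet, jw, one_mul]; exact dd_et_comp_tsc hU t₁ s p
  · simp only [jet, jw]
    rw [dd_ex_comp_tsc hU, dd_ex_comp_tsc (hU.dd _)]
  · simp only [jet, jw]
    rw [dd_ex_comp_tsc hU]

/-- Coefficients depending quadratically on the gradient. -/
def quad (α : JI n → Eu n → ℝ) (β : JI n → Fin n → Fin n → Eu n → ℝ) (w : SpT n → ℝ) (ι : JI n)
    (p : SpT n) : ℝ :=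
  α ι p.2 + ∑ a, ∑ b, β ι a b p.2 * (dd (ex a) w p * dd (ex b) w p)

lemma quad_comp_tsc {α : JI n → Eu n → ℝ} {β : JI n → Fin n → Fin n → Eu n → ℝ}
    (hU : ContDiff ℝ ∞ U) (t₁ s : ℝ) (ι : JI n) (p : SpT n) :
    quad α β (fun q => U (tsc t₁ s q)) ι p = quad α β U ι (tsc t₁ s p) := by
  simp only [quad, dd_ex_comp_tsc hU]
  rfl

lemma dq_jw_mul (hh : h ≠ 0) (k : ℕ) (ι : JI n) (G : ℝ → ℝ) (s : ℝ) :
    dq h k (fun s => jw ι s * G s) s = jw ι (s + k * h) * dq h k G s +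
      (if ι = none then 0 else (k:ℝ)) * dq h (k - 1) G s := by
  rcases ι with - | ι
  · simp [jw]
  · simp only [jw, dq_affine_mul hh]
    simp

/-- The product rule for difference quotients with the principal term split off. -/
lemma dq_mul_split (hh : h ≠ 0) (k : ℕ) (F G : ℝ → ℝ) (s : ℝ) :
    dq h k (fun s => F s * G s) s = F (s + k * h) * dq h k G s +
      ∑ ij ∈ (antidiagonal k).erase (0, k),
        (k.choose ij.1 : ℝ) * (dq h ij.1 F (s + ij.2 * h) * dq h ij.2 G s) := by
  rw [dq_mul hh, ← add_sum_erase _ _ (show (0, k) ∈ antidiagonal k by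
    simp)]
  simp [dq]

/-- Error terms of the differenced equation. -/
def rest (h : ℝ) (k : ℕ) (W : ℝ → SpT n → ℝ) (s : ℝ) (ι : JI n) (a b : Fin n) (p : SpT n) : ℝ :=
  ∑ ij ∈ (antidiagonal k).erase (0, k), (k.choose ij.1 : ℝ) *
    (dqf h ij.1 (fun s p => dd (ex a) (W s) p * dd (ex b) (W s) p) (s + ij.2 * h) p *
      dqf h ij.2 (fun s p => jw ι s * jet (W s) ι p) s p)

/-- The equation satisfied by the difference quotients. -/
lemma dqf_eq {α : JI n → Eu n → ℝ} {β : JI n → Fin n → Fin n → Eu n → ℝ}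
    (hW : ∀ s, ContDiff ℝ ∞ (W s)) (hh : 0 < h) (k : ℕ) (hs : s + k * h ≤ S) {p : SpT n}
    (heq : ∀ s', s ≤ s' → s' ≤ S → ∑ ι, quad α β (W s') ι p * (jw ι s' * jet (W s') ι p) = 0) :
    ∑ ι, (quad α β (W (s + k * h)) ι p * (jw ι (s + k * h) * jet (dqf h k W s) ι p +
        (if ι = none then 0 else (k:ℝ)) * jet (dqf h (k - 1) W s) ι p) +
      ∑ a, ∑ b, β ι a b p.2 * rest h k W s ι a b p) = 0 := by
  refine Eq.trans ?_ (dq_eq_zero hh.le k hs heq)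
  rw [dq_sum]
  refine sum_congr rfl fun ι _ => ?_
  have e1 : (fun s => quad α β (W s) ι p * (jw ι s * jet (W s) ι p)) = fun s =>
      α ι p.2 * (jw ι s * jet (W s) ι p) + ∑ a, ∑ b, β ι a b p.2 *
        ((dd (ex a) (W s) p * dd (ex b) (W s) p) * (jw ι s * jet (W s) ι p)) := by
    funext s
    simp only [quad, add_mul, sum_mul, mul_assoc]
  rw [e1, dq_add, dq_const_mul, dq_sum]
  simp only [dq_sum, dq_const_mul]
  have e2 : dq h k (fun s => jw ι s * jet (W s) ι p) s = jw ι (s + k * h) * jet (dqf h k W s) ι p +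
      (if ι = none then 0 else (k:ℝ)) * jet (dqf h (k - 1) W s) ι p := by
    rw [dq_jw_mul hh.ne', jet_dqf hW, jet_dqf hW]
    rfl
  have e3 : ∀ a b, dq h k (fun s => (dd (ex a) (W s) p * dd (ex b) (W s) p) * (jw ι s * jet (W s) ι p)) s =
      (dd (ex a) (W (s + k * h)) p * dd (ex b) (W (s + k * h)) p) * dq h k (fun s => jw ι s * jet (W s) ι p) s
        + rest h k W s ι a b p := by
    intro a b
    rw [dq_mul_split hh.ne']
    rfl
  rw [← e2, quad, add_mul, sum_mul]
  simp only [e3, mul_add, sum_add_distrib, sum_mul]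
  ring_nf

variable {α : JI n → Eu n → ℝ} {β : JI n → Fin n → Fin n → Eu n → ℝ}

lemma conv_sub_le (hZ : 0 < Z) (hB : 0 < B) {i : ℕ} {T : Finset (ℕ × ℕ)}
    (hT : T ⊆ antidiagonal i) (x : ℕ × ℕ → ℝ) {e : ℝ} (he : 0 ≤ e)
    (h : ∀ ij ∈ T, |x ij| ≤ e * (maj Z B ij.1 * maj Z B ij.2)) :
    |∑ ij ∈ T, (i.choose ij.1 : ℝ) * x ij| ≤ e * (8 * Z * maj Z B i) := by
  have hp := fun k => maj_pos hZ hB k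
  calc |∑ ij ∈ T, (i.choose ij.1 : ℝ) * x ij|
      ≤ ∑ ij ∈ T, (i.choose ij.1 : ℝ) * (e * (maj Z B ij.1 * maj Z B ij.2)) := by
        refine (abs_sum_le_sum_abs _ _).trans (sum_le_sum fun ij hij => ?_)
        rw [abs_mul, Nat.abs_cast]
        exact mul_le_mul_of_nonneg_left (h ij hij) (Nat.cast_nonneg _)
    _ ≤ ∑ ij ∈ antidiagonal i,
          (i.choose ij.1 : ℝ) * (e * (maj Z B ij.1 * maj Z B ij.2)) :=
        Finset.sum_le_sum_of_subset_of_nonneg hT fun ij _ _ =>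
          mul_nonneg (Nat.cast_nonneg _) (mul_nonneg he (mul_pos (hp _) (hp _)).le)
    _ = e * ∑ ij ∈ antidiagonal i,
          (i.choose ij.1 : ℝ) * (maj Z B ij.1 * maj Z B ij.2) := by
        rw [mul_sum]; exact sum_congr rfl fun _ _ => by ring
    _ ≤ _ := mul_le_mul_of_nonneg_left (maj_conv hZ hB i) he

/-- Lower order difference quotients of a product. -/
lemma dq_mul_le (hZ : 0 < Z) (hB : 0 < B) (hq : 0 ≤ q) (hq1 : q ≤ 1) (hh : 0 < h)
    {i : ℕ} (hi : 1 ≤ i) (hs : s + i * h ≤ S) {F G : ℝ → ℝ}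
    (hF : ∀ j ≤ i, ∀ s', s ≤ s' → s' + j * h ≤ S → |dq h j F s'| ≤ (if j = 0 then 1 else q) * maj Z B j)
    (hG : ∀ j ≤ i, ∀ s', s ≤ s' → s' + j * h ≤ S → |dq h j G s'| ≤ (if j = 0 then 1 else q) * maj Z B j) :
    |dq h i (fun s => F s * G s) s| ≤ q * (8 * Z * maj Z B i) := by
  rw [dq_mul hh.ne']
  refine conv_sub_le hZ hB (Finset.Subset.refl _)
    (fun ij => dq h ij.1 F (s + ij.2 * h) * dq h ij.2 G s) hq fun ij hij => ?_
  have hk := mem_antidiagonal.1 hij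
  have hk' : (ij.1 : ℝ) + ij.2 = i := by exact_mod_cast hk
  have h2 : (0:ℝ) ≤ ij.2 * h := by positivity
  have h1 : (0:ℝ) ≤ ij.1 * h := by positivity
  have b1 := hF ij.1 (by omega) (s + ij.2 * h) (by linarith) (by rw [← hk'] at hs; linarith)
  have b2 := hG ij.2 (by omega) s le_rfl (by rw [← hk'] at hs; linarith)
  have p1 := maj_pos hZ hB ij.1
  have p2 := maj_pos hZ hB ij.2
  rw [abs_mul]
  refine (mul_le_mul b1 b2 (abs_nonneg _) (by positivity)).trans ?_
  have hc : (if ij.1 = 0 then 1 else q) * (if ij.2 = 0 then 1 else q) ≤ q := by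
    split_ifs with c1 c2 c2
    · omega
    · simp
    · simp
    · exact mul_le_of_le_one_right hq hq1
  have := mul_le_mul_of_nonneg_right hc (mul_pos p1 p2).le
  linarith

/-- Top order difference quotients of a product. -/
lemma dq_mul_top_le (hZ : 0 < Z) (hB : 0 < B) (hq : 0 ≤ q) (hq1 : q ≤ 1) (hh : 0 < h)
    {k : ℕ} (hk1 : 1 ≤ k) (hs : s + k * h ≤ S) {F G : ℝ → ℝ}
    (hF : ∀ j < k, ∀ s', s ≤ s' → s' + j * h ≤ S → |dq h j F s'| ≤ (if j = 0 then 1 else q) * maj Z B j)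
    (hG : ∀ j < k, ∀ s', s ≤ s' → s' + j * h ≤ S → |dq h j G s'| ≤ (if j = 0 then 1 else q) * maj Z B j)
    (hFk : |dq h k F s| ≤ q * M) (hGk : |dq h k G s| ≤ q * M) :
    |dq h k (fun s => F s * G s) s| ≤ q * (8 * Z * maj Z B k + 2 * Z * M) := by
  have hkh : (0:ℝ) ≤ k * h := by positivity
  have hmem : (k, 0) ∈ (antidiagonal k).erase (0, k) := by
    simp; omega
  rw [dq_mul_split hh.ne', ← add_sum_erase _ _ hmem]
  have t1 : |F (s + k * h) * dq h k G s| ≤ Z * (q * M) := by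
    rw [abs_mul]
    have := hF 0 (by omega) (s + k * h) (by linarith) (by simpa using hs)
    simp only [dq, if_true, maj_zero, one_mul] at this
    exact mul_le_mul this hGk (abs_nonneg _) hZ.le
  have t2 : |(k.choose k : ℝ) * (dq h k F (s + (0:ℕ) * h) * dq h 0 G s)| ≤ Z * (q * M) := by
    rw [Nat.choose_self, Nat.cast_one, one_mul, Nat.cast_zero, zero_mul, add_zero, abs_mul, mul_comm]
    have := hG 0 (by omega) s le_rfl (by simp; linarith)
    simp only [dq, if_true, maj_zero, one_mul] at this
    exact mul_le_mul this hFk (abs_nonneg _) hZ.le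
  have t3 : |∑ ij ∈ ((antidiagonal k).erase (0, k)).erase (k, 0),
      (k.choose ij.1 : ℝ) * (dq h ij.1 F (s + ij.2 * h) * dq h ij.2 G s)| ≤ q * (8 * Z * maj Z B k) := by
    refine conv_sub_le hZ hB ((Finset.erase_subset _ _).trans (Finset.erase_subset _ _))
      (fun ij => dq h ij.1 F (s + ij.2 * h) * dq h ij.2 G s) hq fun ij hij => ?_
    have n1 := (Finset.mem_erase.1 hij).1
    have n2 := (Finset.mem_erase.1 (Finset.mem_erase.1 hij).2).1
    have hk := mem_antidiagonal.1 (Finset.mem_erase.1 (Finset.mem_erase.1 hij).2).2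
    have m1 : ij.1 ≠ 0 := fun h0 => n2 (Prod.ext h0 (by simp; omega))
    have m2 : ij.2 ≠ 0 := fun h0 => n1 (Prod.ext (by simp; omega) h0)
    have hk' : (ij.1 : ℝ) + ij.2 = k := by exact_mod_cast hk
    have h2 : (0:ℝ) ≤ ij.2 * h := by positivity
    have h1 : (0:ℝ) ≤ ij.1 * h := by positivity
    have b1 := hF ij.1 (by omega) (s + ij.2 * h) (by linarith) (by rw [← hk'] at hs; linarith)
    have b2 := hG ij.2 (by omega) s le_rfl (by rw [← hk'] at hs; linarith)
    rw [if_neg m1] at b1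
    rw [if_neg m2] at b2
    have p1 := maj_pos hZ hB ij.1
    have p2 := maj_pos hZ hB ij.2
    rw [abs_mul]
    refine (mul_le_mul b1 b2 (abs_nonneg _) (by positivity)).trans ?_
    have := mul_le_mul_of_nonneg_right (mul_le_of_le_one_right hq hq1) (mul_pos p1 p2).le
    linarith
  have := abs_add_le (F (s + k * h) * dq h k G s) ((k.choose k : ℝ) * (dq h k F (s + (0:ℕ) * h) * dq h 0 G s) +
    ∑ ij ∈ ((antidiagonal k).erase (0, k)).erase (k, 0),
      (k.choose ij.1 : ℝ) * (dq h ij.1 F (s + ij.2 * h) * dq h ij.2 G s))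
  have h' := abs_add_le ((k.choose k : ℝ) * (dq h k F (s + (0:ℕ) * h) * dq h 0 G s))
    (∑ ij ∈ ((antidiagonal k).erase (0, k)).erase (k, 0),
      (k.choose ij.1 : ℝ) * (dq h ij.1 F (s + ij.2 * h) * dq h ij.2 G s))
  linarith

/-- Bounds for the difference quotients of order less than `k` of a family. -/
def LowB (t₁ t₂ h q Z B : ℝ) (k : ℕ) (W : ℝ → SpT n → ℝ) : Prop :=
  ∀ j < k, ∀ s, 0 ≤ s → s + j * h ≤ 1 → (∀ ι, MB t₁ t₂ (jet (dqf h j W s) ι) (maj Z B j)) ∧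
    ∀ τ ∈ Icc t₁ t₂, ∀ y, ∀ a, |dd (ex a) (dqf h j W s) (τ, y)| ≤ (if j = 0 then 1 else q) * maj Z B j

lemma jw_mem (h0 : 0 ≤ s) (h1 : s ≤ 1) (ι : JI n) : 0 ≤ jw ι s ∧ jw ι s ≤ 2 := by
  rcases ι with - | ι
  · simp [jw]
  · simp only [jw]; constructor <;> linarith

lemma LowB.weighted {k : ℕ} (hW : ∀ s, ContDiff ℝ ∞ (W s))
    (H : LowB t₁ t₂ h q Z B k W) (hZ : 0 < Z) (hB : 4 ≤ B) (hh : 0 < h) {j : ℕ} (hj : j < k)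
    (hs : 0 ≤ s) (hs1 : s + j * h ≤ 1) (ι : JI n) :
    MB t₁ t₂ (dqf h j (fun s p => jw ι s * jet (W s) ι p) s) (3 * maj Z B j) := by
  have hB0 : 0 < B := by linarith
  have hjh : (0:ℝ) ≤ j * h := by positivity
  have e : dqf h j (fun s p => jw ι s * jet (W s) ι p) s = fun p =>
      jw ι (s + j * h) * jet (dqf h j W s) ι p +
        (if ι = none then 0 else (j:ℝ)) * jet (dqf h (j - 1) W s) ι p := by
    funext p
    rw [jet_dqf hW, jet_dqf hW]
    exact dq_jw_mul hh.ne' j ι _ s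
  rw [e]
  have p0 := (maj_pos hZ hB0 j).le
  obtain ⟨w0, w2⟩ := jw_mem (by linarith) hs1 ι
  have m1 : MB t₁ t₂ (fun p => jw ι (s + j * h) * jet (dqf h j W s) ι p) (2 * maj Z B j) := by
    refine ((H j hj s hs hs1).1 ι).bdd_mul (fun _ _ _ => ?_) (by norm_num)
    rwa [abs_of_nonneg w0]
  have m2 : MB t₁ t₂ (fun p => (if ι = none then 0 else (j:ℝ)) * jet (dqf h (j - 1) W s) ι p)
      (maj Z B j) := by
    have hs2 : s + ((j - 1 : ℕ) : ℝ) * h ≤ 1 := by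
      have : ((j - 1 : ℕ) : ℝ) ≤ j := by exact_mod_cast Nat.sub_le j 1
      nlinarith
    have hb := ((H (j - 1) (by omega) s hs hs2).1 ι).bdd_mul
      (g := fun _ => if ι = none then 0 else (j:ℝ)) (c := j) (fun _ _ _ => by
        split_ifs <;> simp) (Nat.cast_nonneg j)
    refine hb.mono (mul_nonneg (Nat.cast_nonneg _) (maj_pos hZ hB0 _).le) ?_
    refine (mul_maj_pred_le hZ hB0 j).trans ?_
    have : 4 / B ≤ 1 := by rw [div_le_one hB0]; exact hB
    nlinarith
  have hc : Continuous fun p => jw ι (s + j * h) * jet (dqf h j W s) ι p :=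
    continuous_const.mul (jet_smooth (dqf_smooth hW h j s) ι).continuous
  have := MB.add hc.continuousOn m1 m2 (by positivity) p0
  have e2 : 2 * maj Z B j + maj Z B j = 3 * maj Z B j := by ring
  rwa [e2] at this

set_option maxHeartbeats 1000000 in
lemma LowB.rest {k : ℕ} (hW : ∀ s, ContDiff ℝ ∞ (W s))
    (H : LowB t₁ t₂ h q Z B k W) (hZ : 0 < Z) (hB : 4 ≤ B) (hq : 0 ≤ q) (hq1 : q ≤ 1) (hh : 0 < h)
    (hM : 0 ≤ M) (hk : 1 ≤ k) (hs : 0 ≤ s) (hs1 : s + k * h ≤ 1)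
    (htop : ∀ τ ∈ Icc t₁ t₂, ∀ y, ∀ a, |dd (ex a) (dqf h k W s) (τ, y)| ≤ q * M) (ι : JI n) (a b : Fin n) :
    MB t₁ t₂ (rest h k W s ι a b) (q * (192 * Z ^ 2 * maj Z B k + 6 * Z ^ 2 * M)) := by
  have hB0 : 0 < B := by linarith
  have hkh : (0:ℝ) ≤ k * h := by positivity
  have hp := fun k => (maj_pos hZ hB0 k).le
  have hD : ∀ τ ∈ Icc t₁ t₂, ∀ y, ∀ a : Fin n, ∀ j < k, ∀ s', 0 ≤ s' → s' + j * h ≤ 1 →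
      |dq h j (fun s => dd (ex a) (W s) (τ, y)) s'| ≤ (if j = 0 then 1 else q) * maj Z B j := by
    intro τ hτ y a j hj s' h1 h2
    have := (H j hj s' h1 h2).2 τ hτ y a
    rwa [dd_dqf hW] at this
  have hDk : ∀ τ ∈ Icc t₁ t₂, ∀ y, ∀ a : Fin n,
      |dq h k (fun s => dd (ex a) (W s) (τ, y)) s| ≤ q * M := by
    intro τ hτ y a
    have := htop τ hτ y a
    rwa [dd_dqf hW] at this
  set g : ℕ × ℕ → ℝ := fun ij => q * (8 * Z * maj Z B ij.1 + if ij.1 = k then 2 * Z * M else 0) with hg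
  have hg0 : ∀ ij, 0 ≤ g ij := fun ij => by
    have := hp ij.1
    rw [hg]; dsimp only; split_ifs <;> positivity
  have hWb : ∀ ij ∈ (antidiagonal k).erase (0, k), ∀ τ ∈ Icc t₁ t₂, ∀ y,
      |dqf h ij.1 (fun s p => dd (ex a) (W s) p * dd (ex b) (W s) p) (s + ij.2 * h) (τ, y)| ≤ g ij := by
    intro ij hij τ hτ y
    have n2 : ij ≠ (0, k) := (Finset.mem_erase.1 hij).1
    have hsum : ij.1 + ij.2 = k := mem_antidiagonal.1 (Finset.mem_erase.1 hij).2
    have m1 : ij.1 ≠ 0 := fun h0 => n2 (Prod.ext h0 (by simp; omega))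
    have hk' : (ij.1 : ℝ) + ij.2 = k := by exact_mod_cast hsum
    have h2 : (0:ℝ) ≤ ij.2 * h := by positivity
    by_cases hik : ij.1 = k
    · have hj0 : ij.2 = 0 := by omega
      rw [hg]; dsimp only
      rw [if_pos hik, hj0, Nat.cast_zero, zero_mul, add_zero, hik]
      exact dq_mul_top_le (F := fun s => dd (ex a) (W s) (τ, y)) (G := fun s => dd (ex b) (W s) (τ, y))
        hZ hB0 hq hq1 hh hk hs1
        (fun j hj s' h1 h2 => hD τ hτ y a j hj s' (hs.trans h1) h2)
        (fun j hj s' h1 h2 => hD τ hτ y b j hj s' (hs.trans h1) h2) (hDk τ hτ y a) (hDk τ hτ y b)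
    · rw [hg]; dsimp only
      rw [if_neg hik, add_zero]
      exact dq_mul_le (F := fun s => dd (ex a) (W s) (τ, y)) (G := fun s => dd (ex b) (W s) (τ, y))
        (S := 1) hZ hB0 hq hq1 hh (i := ij.1) (by omega) (by rw [← hk'] at hs1; linarith)
        (fun j hj s' h1 h3 => hD τ hτ y a j (by omega) s' (by linarith) h3)
        (fun j hj s' h1 h3 => hD τ hτ y b j (by omega) s' (by linarith) h3)
  have hcF : ∀ i s', Continuous
      (dqf h i (fun s p => dd (ex a) (W s) p * dd (ex b) (W s) p) s') := fun i s' =>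
    (dqf_smooth (fun s => ((hW s).dd _).mul ((hW s).dd _)) h i s').continuous
  have hcG : ∀ j, Continuous (dqf h j (fun s p => jw ι s * jet (W s) ι p) s) := fun j =>
    (dqf_smooth (fun s => contDiff_const.mul (jet_smooth (hW s) ι)) h j s).continuous
  have hsumMB := MB.sum (t₁ := t₁) (t₂ := t₂) ((antidiagonal k).erase (0, k))
    (F := fun ij p => (k.choose ij.1 : ℝ) *
      (dqf h ij.1 (fun s p => dd (ex a) (W s) p * dd (ex b) (W s) p) (s + ij.2 * h) p *
        dqf h ij.2 (fun s p => jw ι s * jet (W s) ι p) s p))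
    (M := fun ij => (k.choose ij.1 : ℝ) * (g ij * (3 * maj Z B ij.2)))
    (fun ij _ => (continuous_const.mul ((hcF _ _).mul (hcG _))).continuousOn)
    (fun ij hij => by
      have n2 : ij ≠ (0, k) := (Finset.mem_erase.1 hij).1
      have hsum : ij.1 + ij.2 = k := mem_antidiagonal.1 (Finset.mem_erase.1 hij).2
      have m1 : ij.1 ≠ 0 := fun h0 => n2 (Prod.ext h0 (by simp; omega))
      have hk' : (ij.1 : ℝ) + ij.2 = k := by exact_mod_cast hsum
      have h1 : (0:ℝ) ≤ ij.1 * h := by positivity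
      have := ((H.weighted hW hZ hB hh (j := ij.2) (by omega) hs (by rw [← hk'] at hs1; linarith) ι).bdd_mul
        (hWb ij hij) (hg0 ij)).const_mul (k.choose ij.1 : ℝ)
      rwa [Nat.abs_cast] at this)
    (fun ij _ => mul_nonneg (Nat.cast_nonneg _) (mul_nonneg (hg0 ij) (mul_nonneg (by norm_num) (hp _))))
  have hterm : ∀ ij : ℕ × ℕ, 0 ≤ (k.choose ij.1 : ℝ) * (g ij * (3 * maj Z B ij.2)) := fun ij =>
    mul_nonneg (Nat.cast_nonneg _) (mul_nonneg (hg0 ij) (mul_nonneg (by norm_num) (hp _)))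
  refine MB.mono hsumMB (sum_nonneg fun ij _ => hterm ij) ?_
  refine (Finset.sum_le_sum_of_subset_of_nonneg (Finset.erase_subset _ _) fun ij _ _ => hterm ij).trans ?_
  have split : ∀ ij : ℕ × ℕ, (k.choose ij.1 : ℝ) * (g ij * (3 * maj Z B ij.2)) =
      24 * q * Z * ((k.choose ij.1 : ℝ) * (maj Z B ij.1 * maj Z B ij.2)) +
      (if ij.1 = k then (k.choose ij.1 : ℝ) * (6 * q * Z * M * maj Z B ij.2) else 0) := by
    intro ij
    rw [hg]; dsimp only
    split_ifs <;> ring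
  have hS2 : ∑ ij ∈ antidiagonal k,
      (if ij.1 = k then (k.choose ij.1 : ℝ) * (6 * q * Z * M * maj Z B ij.2) else 0) =
      6 * q * Z * M * Z := by
    rw [Finset.sum_eq_single (k, 0)]
    · simp [maj_zero]
    · intro ij hij hne
      rw [if_neg]
      intro hik
      have hsum : ij.1 + ij.2 = k := mem_antidiagonal.1 hij
      exact hne (Prod.ext hik (by simp; omega))
    · intro hn
      simp at hn
  rw [sum_congr rfl fun ij _ => split ij, sum_add_distrib, ← mul_sum, hS2]
  have := mul_le_mul_of_nonneg_left (maj_conv hZ hB0 k) (show 0 ≤ 24 * q * Z by positivity)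
  linarith

/-- Leading coefficients after solving for the time derivative. -/
def acoef (α : JI n → Eu n → ℝ) (β : JI n → Fin n → Fin n → Eu n → ℝ) (w : SpT n → ℝ) (i j : Fin n)
    (p : SpT n) : ℝ :=
  -quad α β w (some (Sum.inl (i, j))) p / quad α β w none p

/-- A quasilinear parabolic equation with uniform bounds on a time window, whose leading
coefficients oscillate by at most `ε` on the scale `(η, ρ)`. -/
structure Sol (lam L κ ε ρ η ta tb : ℝ) (α : JI n → Eu n → ℝ) (β : JI n → Fin n → Fin n → Eu n → ℝ)
    (U : SpT n → ℝ) : Prop where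
  smooth : ContDiff ℝ ∞ U
  ca : ∀ ι, Continuous (α ι)
  cb : ∀ ι a b, Continuous (β ι a b)
  bb : ∀ ι a b x, |β ι a b x| ≤ L
  eq : ∀ τ ∈ Icc ta tb, ∀ y, ∑ ι, quad α β U ι (τ, y) * jet U ι (τ, y) = 0
  low : ∀ τ ∈ Icc ta tb, ∀ y, κ ≤ quad α β U none (τ, y)
  bq : ∀ ι, ∀ τ ∈ Icc ta tb, ∀ y, |quad α β U ι (τ, y)| ≤ L
  bU : ∀ τ ∈ Icc ta tb, ∀ y, |U (τ, y)| ≤ L ∧ ∀ a, |dd (ex a) U (τ, y)| ≤ L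
  symm : ∀ i j, ∀ p, acoef α β U i j p = acoef α β U j i p
  ell : ∀ τ ∈ Icc ta tb, ∀ y, ∀ ξ : Fin n → ℝ,
    lam * ∑ i, ξ i ^ 2 ≤ ∑ i, ∑ j, acoef α β U i j (τ, y) * (ξ i * ξ j)
  bdd : ∀ τ ∈ Icc ta tb, ∀ y i j, |acoef α β U i j (τ, y)| ≤ L
  osc : ∀ τ ∈ Icc ta tb, ∀ τ' ∈ Icc ta tb, ∀ y c, |τ - τ'| ≤ η → ‖y - c‖ ≤ ρ → ∀ i j,
    |acoef α β U i j (τ, y) - acoef α β U i j (τ', c)| ≤ ε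

lemma quad_continuous
    (ca : ∀ ι, Continuous (α ι)) (cb : ∀ ι a b, Continuous (β ι a b)) {w : SpT n → ℝ}
    (hw : ContDiff ℝ ∞ w) (ι : JI n) : Continuous (quad α β w ι) := by
  refine ((ca ι).comp continuous_snd).add ?_
  exact continuous_finsetSum _ fun a _ => continuous_finsetSum _ fun b _ =>
    ((cb ι a b).comp continuous_snd).mul ((hw.dd _).continuous.mul (hw.dd _).continuous)

lemma tsc_mem (hs0 : 0 ≤ s) (hs1 : s ≤ 1) (ha : ta ≤ t₁)
    (hb : t₁ + 2 * (t₂ - t₁) ≤ tb) (hτ : τ ∈ Icc t₁ t₂) : t₁ + (1 + s) * (τ - t₁) ∈ Icc ta tb := by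
  obtain ⟨h1, h2⟩ := hτ
  constructor <;> nlinarith

/-- Coefficients of the time-rescaled linear equation satisfy the structural hypotheses. -/
lemma Sol.linHyp {η : ℝ}
    (h : Sol lam L κ (ε / 2) ρ η ta tb α β U)
    (hlam : 0 < lam) (hκ : 0 < κ) (ht : t₁ ≤ t₂)
    (hmem : ∀ τ ∈ Icc t₁ t₂, t₀ + (1 + s) * (τ - t₀) ∈ Icc ta tb)
    (hη : 2 * (t₂ - t₁) ≤ η) (hL : 0 ≤ L) (hε : 0 ≤ ε) (hs0 : 0 ≤ s) (hs1 : s ≤ 1)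
    (hv : ContDiff ℝ ∞ v) (hv0 : ∀ x, v (t₁, x) = 0) :
    LinHyp lam (2 * L) ε ρ t₁ t₂ (fun i j p => (1 + s) * acoef α β U i j (tsc t₀ s p))
      (fun p => dd et v p - ∑ i, ∑ j, (1 + s) * acoef α β U i j (tsc t₀ s p) * dd (ex j) (dd (ex i) v) p) v := by
  have ht1 : t₁ ∈ Icc t₁ t₂ := ⟨le_rfl, ht⟩
  refine ⟨hv, hv0, ?_, fun c i j => ?_, fun c ξ => ?_, fun τ hτ y i j => ?_, fun c τ hτ y hy i j => ?_,
    fun τ hτ y => ?_⟩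
  · refine (hv.dd _).continuous.continuousOn.sub ?_
    refine continuousOn_finsetSum _ fun i _ => continuousOn_finsetSum _ fun j _ =>
      (continuousOn_const.mul ?_).mul ((hv.dd _).dd _).continuous.continuousOn
    have hc := fun ι =>
      (quad_continuous h.ca h.cb h.smooth ι).comp (tsc_smooth t₀ s).continuous
    refine ContinuousOn.div (hc _).neg.continuousOn (hc _).continuousOn ?_
    rintro ⟨τ, y⟩ ⟨hτ, -⟩
    exact (hκ.trans_le (h.low _ (hmem τ hτ) y)).ne'
  · rw [h.symm]
  · have := h.ell _ (hmem t₁ ht1) c ξ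
    have h0 : 0 ≤ lam * ∑ i, ξ i ^ 2 := mul_nonneg hlam.le (sum_nonneg fun i _ => sq_nonneg _)
    have e : ∑ i, ∑ j, (1 + s) * acoef α β U i j (tsc t₀ s (t₁, c)) * (ξ i * ξ j) =
        (1 + s) * ∑ i, ∑ j, acoef α β U i j (t₀ + (1 + s) * (t₁ - t₀), c) * (ξ i * ξ j) := by
      rw [mul_sum]
      refine sum_congr rfl fun i _ => ?_
      rw [mul_sum]
      exact sum_congr rfl fun j _ => by simp only [tsc]; ring
    rw [e]
    nlinarith
  · have := h.bdd _ (hmem τ hτ) y i j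
    simp only [tsc, abs_mul]
    rw [abs_of_nonneg (by linarith : 0 ≤ 1 + s)]
    have h0 := abs_nonneg (acoef α β U i j (t₀ + (1 + s) * (τ - t₀), y))
    nlinarith
  · have h1 : |t₀ + (1 + s) * (τ - t₀) - (t₀ + (1 + s) * (t₁ - t₀))| ≤ η := by
      have : t₀ + (1 + s) * (τ - t₀) - (t₀ + (1 + s) * (t₁ - t₀)) = (1 + s) * (τ - t₁) := by ring
      rw [this, abs_of_nonneg (mul_nonneg (by linarith) (by linarith [hτ.1]))]
      have := hτ.1
      have := hτ.2
      nlinarith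
    have := h.osc _ (hmem τ hτ) _ (hmem t₁ ht1) y c h1 hy i j
    simp only [tsc, ← mul_sub, abs_mul]
    rw [abs_of_nonneg (by linarith : 0 ≤ 1 + s)]
    nlinarith
  · ring

lemma JI.sum_eq (F : JI n → ℝ) :
    ∑ ι, F ι = F none + (∑ i, ∑ j, F (some (Sum.inl (i, j))) + ∑ l, F (some (Sum.inr l))) := by
  rw [Fintype.sum_option, Fintype.sum_sum_type, Fintype.sum_prod_type]

lemma MB.sum_const [Fintype ι] {F : ι → SpT n → ℝ}
    (hc : ∀ i, ContinuousOn (F i) (Icc t₁ t₂ ×ˢ univ)) (h : ∀ i, MB t₁ t₂ (F i) M) (hM : 0 ≤ M) :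
    MB t₁ t₂ (fun p => ∑ i, F i p) (Fintype.card ι * M) := by
  have := MB.sum Finset.univ (M := fun _ => M) (fun i _ => hc i) (fun i _ => h i) fun _ _ => hM
  simpa using this

/-- The inhomogeneous term of the linear equation satisfied by the difference quotients. -/
lemma Sol.step_mb {η Kb : ℝ} {k : ℕ}
    (H : Sol lam L κ ε ρ η ta tb α β U)
    (hκ : 0 < κ) (ha : ta ≤ t₁) (hb : t₁ + 2 * (t₂ - t₁) ≤ tb) (hL : 0 ≤ L)
    (hKb : ∀ (F : SpT n → ℝ) (N : ℝ), 0 ≤ N → (∀ τ ∈ Icc t₁ t₂, ∀ y, |F (τ, y)| ≤ N) →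
      MB t₁ t₂ F (Kb * N * √√(t₂ - t₁))) (hKb0 : 0 ≤ Kb) (hq : q = √√(t₂ - t₁)) (hq1 : q ≤ 1)
    (hKq : Kb * q ≤ 1)
    (hlow : LowB t₁ t₂ h q Z B k (fun s r => U (tsc t₁ s r))) (hZ : 0 < Z) (hB : 4 ≤ B) (hh : 0 < h)
    (hM : 0 ≤ M) (hk : 1 ≤ k) (hs : 0 ≤ s) (hs1 : s + k * h ≤ 1)
    (hQ : QB t₁ t₂ (dqf h k (fun s r => U (tsc t₁ s r)) s) M) :
    MB t₁ t₂ (fun p => dd et (dqf h k (fun s r => U (tsc t₁ s r)) s) p -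
        ∑ i, ∑ j, (1 + (s + k * h)) * acoef α β U i j (tsc t₁ (s + k * h) p) *
          dd (ex j) (dd (ex i) (dqf h k (fun s r => U (tsc t₁ s r)) s)) p)
      (κ⁻¹ * (Fintype.card (JI n) * (L * (4 / B * maj Z B k) +
        n * (n * (L * (q * (192 * Z ^ 2 * maj Z B k + 6 * Z ^ 2 * M))))) + n * (2 * L * (q * M)))) := by
  set W : ℝ → SpT n → ℝ := fun s r => U (tsc t₁ s r) with hWdef
  have hW : ∀ s, ContDiff ℝ ∞ (W s) := fun s => H.smooth.comp (tsc_smooth t₁ s)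
  set V := dqf h k W s with hV
  have hVs : ContDiff ℝ ∞ V := dqf_smooth hW h k s
  have hB0 : 0 < B := by linarith
  have hq0 : 0 ≤ q := hq ▸ sqrt_nonneg _
  have hkh : (0:ℝ) ≤ k * h := by positivity
  have p0 := (maj_pos hZ hB0 k).le
  set s' := s + k * h with hs'
  have hs0 : 0 ≤ s' := by linarith
  have hmem := fun (r : ℝ) (h0 : 0 ≤ r) (h1 : r ≤ 1) τ (hτ : τ ∈ Icc t₁ t₂) => tsc_mem h0 h1 ha hb hτ
  have hqc : ∀ ι, Continuous fun p => quad α β (W s') ι p := fun ι => quad_continuous H.ca H.cb (hW s') ι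
  have hqb : ∀ ι, ∀ τ ∈ Icc t₁ t₂, ∀ y, |quad α β (W s') ι (τ, y)| ≤ L := fun ι τ hτ y => by
    rw [quad_comp_tsc H.smooth]; exact H.bq ι _ (hmem s' hs0 hs1 τ hτ) y
  have hrest : ∀ ι a b, MB t₁ t₂ (rest h k W s ι a b) (q * (192 * Z ^ 2 * maj Z B k + 6 * Z ^ 2 * M)) :=
    fun ι a b => hlow.rest hW hZ hB hq0 hq1 hh hM hk hs hs1 (fun τ hτ y a => by
      have := (hQ.2.2 τ hτ y).2 a
      rw [← hq] at this; linarith) ι a b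
  have hjc : ∀ (k : ℕ) (s : ℝ) ι, Continuous (jet (dqf h k W s) ι) := fun k s ι =>
    (jet_smooth (dqf_smooth hW h k s) ι).continuous
  have hrestc : ∀ ι a b, Continuous (rest h k W s ι a b) := by
    intro ι a b
    unfold rest
    refine continuous_finsetSum _ fun ij _ => continuous_const.mul (Continuous.mul ?_ ?_)
    · exact (dqf_smooth (fun s => ((hW s).dd _).mul ((hW s).dd _)) h ij.1 _).continuous
    · exact (dqf_smooth (fun s => contDiff_const.mul (jet_smooth (hW s) ι)) h ij.2 _).continuous
  -- the two groups of error terms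
  have m1 : ∀ ι, MB t₁ t₂ (fun p => quad α β (W s') ι p *
      ((if ι = none then 0 else (k:ℝ)) * jet (dqf h (k - 1) W s) ι p)) (L * (4 / B * maj Z B k)) := by
    intro ι
    refine MB.bdd_mul ?_ (hqb ι) hL
    have hs2 : s + ((k - 1 : ℕ) : ℝ) * h ≤ 1 := by
      have : ((k - 1 : ℕ) : ℝ) ≤ k := by exact_mod_cast Nat.sub_le k 1
      nlinarith
    have hb := ((hlow (k - 1) (by omega) s hs hs2).1 ι).bdd_mul
      (g := fun _ => if ι = none then 0 else (k:ℝ)) (c := k) (fun _ _ _ => by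
        split_ifs <;> simp) (Nat.cast_nonneg k)
    exact hb.mono (mul_nonneg (Nat.cast_nonneg _) (maj_pos hZ hB0 _).le) (mul_maj_pred_le hZ hB0 k)
  have r0 : 0 ≤ q * (192 * Z ^ 2 * maj Z B k + 6 * Z ^ 2 * M) := by positivity
  have hbc : ∀ ι a b, Continuous fun p : SpT n => β ι a b p.2 := fun ι a b =>
    (H.cb ι a b).comp continuous_snd
  have m2 : ∀ ι, MB t₁ t₂ (fun p => ∑ a, ∑ b, β ι a b p.2 * rest h k W s ι a b p)
      (n * (n * (L * (q * (192 * Z ^ 2 * maj Z B k + 6 * Z ^ 2 * M))))) := by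
    intro ι
    have := MB.sum_const (t₁ := t₁) (t₂ := t₂) (F := fun a p => ∑ b, β ι a b p.2 * rest h k W s ι a b p)
      (M := n * (L * (q * (192 * Z ^ 2 * maj Z B k + 6 * Z ^ 2 * M))))
      (fun a => (continuous_finsetSum _ fun b _ => (hbc ι a b).mul (hrestc ι a b)).continuousOn)
      (fun a => by
        have := MB.sum_const (t₁ := t₁) (t₂ := t₂) (F := fun b p => β ι a b p.2 * rest h k W s ι a b p)
          (fun b => ((hbc ι a b).mul (hrestc ι a b)).continuousOn)
          (fun b => (hrest ι a b).bdd_mul (fun τ _ y => H.bb ι a b y) hL) (by positivity)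
        simpa using this) (by positivity)
    simpa using this
  have m3 : ∀ l : Fin n, MB t₁ t₂ (fun p => quad α β (W s') (some (Sum.inr l)) p *
      ((1 + s') * dd (ex l) V p)) (2 * L * (q * M)) := by
    intro l
    have e := hKb (dd (ex l) V) (M * q) (by positivity) (fun τ hτ y => by
      have := (hQ.2.2 τ hτ y).2 l
      rwa [← hq] at this)
    rw [← hq] at e
    have e2 : MB t₁ t₂ (dd (ex l) V) (q * M) := e.mono (by positivity) (by
      have := mul_le_mul_of_nonneg_right hKq (mul_nonneg hM hq0)
      linarith)
    have e3 := (e2.bdd_mul (g := fun _ => 1 + s') (c := 2) (fun _ _ _ => by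
      rw [abs_of_nonneg] <;> linarith) (by norm_num)).bdd_mul (hqb (some (Sum.inr l))) hL
    have e4 : L * (2 * (q * M)) = 2 * L * (q * M) := by ring
    rwa [e4] at e3
  have c1 : ∀ ι, Continuous (fun p => quad α β (W s') ι p *
      ((if ι = none then 0 else (k:ℝ)) * jet (dqf h (k - 1) W s) ι p)) := fun ι =>
    (hqc ι).mul (continuous_const.mul (hjc _ _ _))
  have c2 : ∀ ι, Continuous (fun p => ∑ a, ∑ b, β ι a b p.2 * rest h k W s ι a b p) := fun ι =>
    continuous_finsetSum _ fun a _ => continuous_finsetSum _ fun b _ => (hbc ι a b).mul (hrestc ι a b)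
  have c3 : ∀ l : Fin n, Continuous (fun p => quad α β (W s') (some (Sum.inr l)) p *
      ((1 + s') * dd (ex l) V p)) := fun l => (hqc _).mul (continuous_const.mul (hVs.dd _).continuous)
  have m0 : 0 ≤ L * (4 / B * maj Z B k) := by positivity
  have m12 := fun ι => MB.add (c1 ι).continuousOn (m1 ι) (m2 ι) m0 (by positivity)
  have ms := MB.sum_const (fun ι => ((c1 ι).add (c2 ι)).continuousOn) m12 (by positivity)
  have ml := MB.sum_const (fun l => (c3 l).continuousOn) m3 (by positivity)
  have mt := MB.add (continuous_finsetSum _ fun ι _ => (c1 ι).add (c2 ι)).continuousOn ms ml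
    (by positivity) (by positivity)
  rw [Fintype.card_fin] at mt
  have hlowW : ∀ τ ∈ Icc t₁ t₂, ∀ y, κ ≤ quad α β (W s') none (τ, y) := fun τ hτ y => by
    rw [quad_comp_tsc H.smooth]; exact H.low _ (hmem s' hs0 hs1 τ hτ) y
  refine (mt.bdd_mul (g := fun p => (quad α β (W s') none p)⁻¹) (c := κ⁻¹) (fun τ hτ y => ?_)
    (by positivity)).of_abs_le fun τ hτ y => ?_
  · rw [abs_inv, abs_of_pos (hκ.trans_le (hlowW τ hτ y))]
    exact inv_anti₀ hκ (hlowW τ hτ y)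
  · have hP := hκ.trans_le (hlowW τ hτ y)
    have E := dqf_eq (α := α) (β := β) hW hh k (s := s) (S := 1) hs1 (p := (τ, y)) (fun r hr0 hr1 => by
      have h1 : ∀ ι, quad α β (W r) ι (τ, y) * (jw ι r * jet (W r) ι (τ, y)) =
          (1 + r) * (quad α β U ι (tsc t₁ r (τ, y)) * jet U ι (tsc t₁ r (τ, y))) := fun ι => by
        rw [quad_comp_tsc H.smooth, jet_comp_tsc H.smooth]; ring
      simp only [h1, ← mul_sum]
      have := H.eq _ (hmem r (hs.trans hr0) hr1 τ hτ) y
      simp only [tsc]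
      rw [this, mul_zero])
    have E1 : ∑ ι, quad α β (W s') ι (τ, y) * (jw ι s' * jet V ι (τ, y)) +
        ∑ ι, (quad α β (W s') ι (τ, y) *
      ((if ι = none then 0 else (k:ℝ)) * jet (dqf h (k - 1) W s) ι (τ, y)) +
        ∑ a, ∑ b, β ι a b y * rest h k W s ι a b (τ, y)) = 0 := by
      refine Eq.trans ?_ E
      rw [← sum_add_distrib]
      refine sum_congr rfl fun ι _ => ?_
      rw [hs']; ring
    rw [JI.sum_eq (fun ι => quad α β (W s') ι (τ, y) * (jw ι s' * jet V ι (τ, y)))] at E1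
    change quad α β (W s') none (τ, y) * (1 * dd et V (τ, y)) +
      (∑ i, ∑ j, quad α β (W s') (some (Sum.inl (i, j))) (τ, y) * ((1 + s') * dd (ex j) (dd (ex i) V) (τ, y)) +
        ∑ l, quad α β (W s') (some (Sum.inr l)) (τ, y) * ((1 + s') * dd (ex l) V (τ, y))) + _ = 0 at E1
    rw [one_mul] at E1
    have E2 : quad α β (W s') none (τ, y) * (dd et V (τ, y) -
        ∑ i, ∑ j, (1 + s') * acoef α β U i j (tsc t₁ s' (τ, y)) * dd (ex j) (dd (ex i) V) (τ, y)) =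
        quad α β (W s') none (τ, y) * dd et V (τ, y) + ∑ i, ∑ j,
          quad α β (W s') (some (Sum.inl (i, j))) (τ, y) * ((1 + s') * dd (ex j) (dd (ex i) V) (τ, y)) := by
      rw [mul_sub, sub_eq_add_neg, mul_sum, ← sum_neg_distrib]
      congr 1
      refine sum_congr rfl fun i _ => ?_
      rw [mul_sum, ← sum_neg_distrib]
      refine sum_congr rfl fun j _ => ?_
      have : acoef α β U i j (tsc t₁ s' (τ, y)) = -quad α β (W s') (some (Sum.inl (i, j))) (τ, y) /
          quad α β (W s') none (τ, y) := by
        rw [acoef, ← quad_comp_tsc H.smooth, ← quad_comp_tsc H.smooth]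
      rw [this]
      field_simp
    set D := dd et V (τ, y) -
        ∑ i, ∑ j, (1 + s') * acoef α β U i j (tsc t₁ s' (τ, y)) * dd (ex j) (dd (ex i) V) (τ, y) with hD
    refine le_of_eq ?_
    have E3 : D = -((quad α β (W s') none (τ, y))⁻¹ * (quad α β (W s') none (τ, y) * -D)) := by
      field_simp
    rw [E3, abs_neg]
    congr 2
    rw [mul_neg, E2]
    simp only [Pi.add_apply]
    linarith only [E1]

lemma dd_comp_fst {g : ℝ → ℝ} (hg : ContDiff ℝ ∞ g) (e p : SpT n) :
    dd e (fun q => g q.1) p = e.1 * deriv g p.1 := by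
  have h1 : HasDerivAt g (deriv g p.1) p.1 := (hg.differentiable (by simp)).differentiableAt.hasDerivAt
  have h2 : HasFDerivAt (fun q : SpT n => g q.1)
      (ContinuousLinearMap.toSpanSingleton ℝ (deriv g p.1) ∘L ContinuousLinearMap.fst ℝ ℝ (Eu n)) p :=
    h1.hasFDerivAt.comp p hasFDerivAt_fst
  rw [dd, h2.fderiv]
  simp

/-- The time cutoff, its derivative, and the resulting bounds. -/
lemma exists_time_cutoff (hμ : 0 < μ) : ∃ C : ℝ, 0 ≤ C ∧ ∀ t₀ : ℝ, ∃ θ : ℝ → ℝ, ContDiff ℝ ∞ θ ∧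
    (∀ τ, |θ τ| ≤ 1) ∧ θ (t₀ - μ) = 0 ∧ (∀ τ, t₀ - μ / 2 ≤ τ → θ τ = 1) ∧
    ∀ τ ∈ Icc (t₀ - μ) (t₀ + μ), |deriv θ τ| ≤ C := by
  have hs : ContDiff ℝ ∞ smoothTransition := smoothTransition.contDiff
  obtain ⟨C, hC⟩ := (isCompact_Icc (a := (0:ℝ)) (b := 4)).exists_bound_of_continuousOn
    (hs.continuous_deriv (by simp)).continuousOn
  refine ⟨2 / μ * C, mul_nonneg (by positivity) ((norm_nonneg _).trans (hC 0 ⟨le_rfl, by norm_num⟩)),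
    fun t₀ => ⟨fun τ => smoothTransition ((τ - (t₀ - μ)) * (2 / μ)), ?_, fun τ => ?_, ?_, fun τ hτ => ?_,
    fun τ hτ => ?_⟩⟩
  · exact hs.comp (by fun_prop)
  · rw [abs_of_nonneg (smoothTransition.nonneg _)]
    exact smoothTransition.le_one _
  · simp
  · refine smoothTransition.one_of_one_le ?_
    have : 1 = (μ / 2) * (2 / μ) := by field_simp
    rw [this]
    have : 0 ≤ 2 / μ := by positivity
    gcongr
    linarith
  · have h1 : HasDerivAt (fun τ => (τ - (t₀ - μ)) * (2 / μ)) (2 / μ) τ := by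
      simpa using ((hasDerivAt_id τ).sub_const (t₀ - μ)).mul_const (2 / μ)
    have h3 := ((hs.differentiable (by simp)).differentiableAt.hasDerivAt).comp τ h1
    have h4 : deriv (fun τ => smoothTransition ((τ - (t₀ - μ)) * (2 / μ))) τ = _ := h3.deriv
    rw [h4, abs_mul, abs_of_pos (by positivity : 0 < 2 / μ), mul_comm]
    refine mul_le_mul_of_nonneg_left (hC _ ⟨?_, ?_⟩) (by positivity)
    · exact mul_nonneg (by linarith [hτ.1]) (by positivity)
    · have : 4 = (2 * μ) * (2 / μ) := by field_simp; norm_num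
      rw [this]
      gcongr
      linarith [hτ.2]

/-- The linear estimate, as a hypothesis on its constants. -/
def LinEst (n : ℕ) (lam L ε ρ T₀ K : ℝ) : Prop :=
  ∀ (t₁ t₂ : ℝ), t₁ < t₂ → t₂ - t₁ ≤ T₀ →
    ∀ (a : Fin n → Fin n → SpT n → ℝ) (f w : SpT n → ℝ), LinHyp lam L ε ρ t₁ t₂ a f w →
    (∃ N : ℝ, ∀ τ ∈ Icc t₁ t₂, ∀ y, |w (τ, y)| ≤ N ∧ ∀ i, |dd (ex i) w (τ, y)| ≤ N) → ∀ F, 0 < F →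
    MB t₁ t₂ f F → QB t₁ t₂ w (K * F)

lemma Sol.base {T₀ : ℝ} (hlam : 0 < lam) (hκ : 0 < κ) (hL : 0 < L) (hε : 0 < ε)
    (hK : 0 < K) (Hlin : LinEst n lam (2 * L) ε ρ T₀ K) (hμ : 0 < μ) (hμ1 : 2 * μ ≤ 1) (hμT : 2 * μ ≤ T₀) :
    ∃ Z : ℝ, L ≤ Z ∧ ∀ (η ta tb : ℝ) (α : JI n → Eu n → ℝ) (β : JI n → Fin n → Fin n → Eu n → ℝ)
      (U : SpT n → ℝ), Sol lam L κ (ε / 2) ρ η ta tb α β U → 4 * μ ≤ η → ∀ t₁ t₂, t₁ < t₂ → t₂ - t₁ ≤ μ →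
      ta ≤ t₁ - 2 * μ → t₁ + 2 * (t₂ - t₁) ≤ tb → ∀ s, 0 ≤ s → s ≤ 1 → ∀ ι,
      MB t₁ t₂ (jet (fun r => U (tsc t₁ s r)) ι) Z := by
  obtain ⟨Kb, hKb, Hb⟩ := MB.of_bdd n
  obtain ⟨C, hC, Hθ⟩ := exists_time_cutoff hμ
  set N₀ := C * L + n * (2 * (κ⁻¹ * L) * L) with hN₀
  have hN0 : 0 < N₀ + 1 := by positivity
  refine ⟨K * (Kb * (N₀ + 1)) + Kb * L + L, by nlinarith [mul_pos hKb hL, mul_pos hK (mul_pos hKb hN0)],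
    fun η ta tb α β U H hη t₁ t₂ h12 hT hta htb s hs0 hs1 ι => ?_⟩
  obtain ⟨θ, hθ, θ1, θ0, θone, θd⟩ := Hθ t₁
  have hmem : ∀ τ ∈ Icc (t₁ - μ) t₂, t₁ + (1 + s) * (τ - t₁) ∈ Icc ta tb := by
    rintro τ ⟨h1, h2⟩
    constructor <;> nlinarith
  set V : SpT n → ℝ := fun r => U (tsc t₁ s r) with hV
  have hVs : ContDiff ℝ ∞ V := H.smooth.comp (tsc_smooth t₁ s)
  have hθs : ContDiff ℝ ∞ (fun p : SpT n => θ p.1) := hθ.comp contDiff_fst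
  set w : SpT n → ℝ := fun p => θ p.1 * V p with hw
  have bV : ∀ τ ∈ Icc (t₁ - μ) t₂, ∀ y, |V (τ, y)| ≤ L ∧ ∀ a, |dd (ex a) V (τ, y)| ≤ L := by
    intro τ hτ y
    refine ⟨(H.bU _ (hmem τ hτ) y).1, fun a => ?_⟩
    rw [hV, dd_ex_comp_tsc H.smooth]
    exact (H.bU _ (hmem τ hτ) y).2 a
  have dwx : ∀ i, dd (ex i) w = fun p => θ p.1 * dd (ex i) V p := by
    intro i
    funext p
    rw [hw, dd_mul hθs hVs, dd_comp_fst hθ]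
    simp [ex]
  have dwt : ∀ p, dd et w p = θ p.1 * dd et V p + deriv θ p.1 * V p := by
    intro p
    rw [hw, dd_mul hθs hVs, dd_comp_fst hθ]
    simp [et]; ring
  have dwxx : ∀ i j p, dd (ex j) (dd (ex i) w) p = θ p.1 * dd (ex j) (dd (ex i) V) p := by
    intro i j p
    rw [dwx, dd_mul hθs (hVs.dd _), dd_comp_fst hθ]
    simp [ex]
  have LH := H.linHyp hlam hκ (t₀ := t₁) (t₁ := t₁ - μ) (t₂ := t₂) (by linarith) hmem (by linarith) hL.le hε.le
    hs0 hs1 (hθs.mul hVs) (fun x => by simp [θ0])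
  have eqV : ∀ τ ∈ Icc (t₁ - μ) t₂, ∀ y, dd et V (τ, y) -
      ∑ i, ∑ j, (1 + s) * acoef α β U i j (tsc t₁ s (τ, y)) * dd (ex j) (dd (ex i) V) (τ, y) =
      -∑ l, (1 + s) * ((quad α β U none (tsc t₁ s (τ, y)))⁻¹ *
        quad α β U (some (Sum.inr l)) (tsc t₁ s (τ, y))) * dd (ex l) V (τ, y) := by
    intro τ hτ y
    have hP : 0 < quad α β U none (tsc t₁ s (τ, y)) := hκ.trans_le (H.low _ (hmem τ hτ) y)
    have E := H.eq _ (hmem τ hτ) y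
    rw [JI.sum_eq] at E
    change quad α β U none (tsc t₁ s (τ, y)) * dd et U (tsc t₁ s (τ, y)) +
      (∑ i, ∑ j, quad α β U (some (Sum.inl (i, j))) (tsc t₁ s (τ, y)) *
          dd (ex j) (dd (ex i) U) (tsc t₁ s (τ, y)) +
        ∑ l, quad α β U (some (Sum.inr l)) (tsc t₁ s (τ, y)) * dd (ex l) U (tsc t₁ s (τ, y))) = 0 at E
    have h1 : dd et V (τ, y) = (1 + s) * dd et U (tsc t₁ s (τ, y)) := dd_et_comp_tsc H.smooth _ _ _
    have h2 : ∀ i, dd (ex i) V = fun p => dd (ex i) U (tsc t₁ s p) := fun i => dd_ex_comp_tsc H.smooth _ _ _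
    have h3 : ∀ i j, dd (ex j) (dd (ex i) V) (τ, y) = dd (ex j) (dd (ex i) U) (tsc t₁ s (τ, y)) := fun i j => by
      rw [h2, dd_ex_comp_tsc (H.smooth.dd _)]
    simp only [h1, h3, acoef]
    simp only [h2]
    set P := quad α β U none (tsc t₁ s (τ, y))
    have e1 : ∑ i, ∑ j, (1 + s) * (-quad α β U (some (Sum.inl (i, j))) (tsc t₁ s (τ, y)) / P) *
        dd (ex j) (dd (ex i) U) (tsc t₁ s (τ, y)) = -((1 + s) * P⁻¹) *
        ∑ i, ∑ j, quad α β U (some (Sum.inl (i, j))) (tsc t₁ s (τ, y)) *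
          dd (ex j) (dd (ex i) U) (tsc t₁ s (τ, y)) := by
      rw [mul_sum]
      refine sum_congr rfl fun i _ => ?_
      rw [mul_sum]
      exact sum_congr rfl fun j _ => by rw [div_eq_mul_inv]; ring
    have e2 : ∑ l, (1 + s) * (P⁻¹ * quad α β U (some (Sum.inr l)) (tsc t₁ s (τ, y))) *
        dd (ex l) U (tsc t₁ s (τ, y)) = ((1 + s) * P⁻¹) *
        ∑ l, quad α β U (some (Sum.inr l)) (tsc t₁ s (τ, y)) * dd (ex l) U (tsc t₁ s (τ, y)) := by
      rw [mul_sum]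
      exact sum_congr rfl fun l _ => by ring
    rw [e1, e2]
    have e3 : (1 + s) * dd et U (tsc t₁ s (τ, y)) = ((1 + s) * P⁻¹) * (P * dd et U (tsc t₁ s (τ, y))) := by
      field_simp
    rw [e3]
    linear_combination ((1 + s) * P⁻¹) * E
  have hfb : ∀ τ ∈ Icc (t₁ - μ) t₂, ∀ y, |dd et w (τ, y) -
      ∑ i, ∑ j, (1 + s) * acoef α β U i j (tsc t₁ s (τ, y)) * dd (ex j) (dd (ex i) w) (τ, y)| ≤ N₀ + 1 := by
    intro τ hτ y
    have e1 : dd et w (τ, y) -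
        ∑ i, ∑ j, (1 + s) * acoef α β U i j (tsc t₁ s (τ, y)) * dd (ex j) (dd (ex i) w) (τ, y) =
        deriv θ τ * V (τ, y) + θ τ * (dd et V (τ, y) -
      ∑ i, ∑ j, (1 + s) * acoef α β U i j (tsc t₁ s (τ, y)) * dd (ex j) (dd (ex i) V) (τ, y)) := by
      rw [dwt, mul_sub, mul_sum]
      simp only [dwxx, mul_sum]
      have : ∀ i j, θ τ * ((1 + s) * acoef α β U i j (tsc t₁ s (τ, y)) * dd (ex j) (dd (ex i) V) (τ, y)) =
        (1 + s) * acoef α β U i j (tsc t₁ s (τ, y)) * (θ τ * dd (ex j) (dd (ex i) V) (τ, y)) := fun i j => by ring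
      simp only [this]
      ring
    rw [e1, eqV τ hτ y]
    have b1 : |deriv θ τ * V (τ, y)| ≤ C * L := by
      rw [abs_mul]
      exact mul_le_mul (θd τ ⟨hτ.1, by linarith [hτ.2]⟩) (bV τ hτ y).1 (abs_nonneg _) hC
    have b2 : |∑ l, (1 + s) * ((quad α β U none (tsc t₁ s (τ, y)))⁻¹ *
        quad α β U (some (Sum.inr l)) (tsc t₁ s (τ, y))) * dd (ex l) V (τ, y)| ≤ n * (2 * (κ⁻¹ * L) * L) := by
      refine (abs_sum_le_sum_abs _ _).trans ?_
      have : ∀ l ∈ Finset.univ, |(1 + s) * ((quad α β U none (tsc t₁ s (τ, y)))⁻¹ *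
        quad α β U (some (Sum.inr l)) (tsc t₁ s (τ, y))) * dd (ex l) V (τ, y)| ≤ 2 * (κ⁻¹ * L) * L := by
        intro l _
        rw [abs_mul, abs_mul, abs_mul, abs_of_nonneg (by linarith), abs_inv]
        have h1 := H.low _ (hmem τ hτ) y
        have h2 := H.bq (some (Sum.inr l)) _ (hmem τ hτ) y
        have h3 : |quad α β U none (tsc t₁ s (τ, y))|⁻¹ ≤ κ⁻¹ := inv_anti₀ hκ (h1.trans (le_abs_self _))
        have h4 := (bV τ hτ y).2 l
        have h5 : 1 + s ≤ 2 := by linarith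
        have h6 : |quad α β U none (tsc t₁ s (τ, y))|⁻¹ * |quad α β U (some (Sum.inr l)) (tsc t₁ s (τ, y))| ≤
          κ⁻¹ * L := mul_le_mul h3 h2 (abs_nonneg _) (by positivity)
        exact mul_le_mul (mul_le_mul h5 h6 (by positivity) (by norm_num)) h4 (abs_nonneg _) (by positivity)
      refine (sum_le_sum this).trans (le_of_eq ?_)
      simp
    have b3 : |θ τ * -∑ l, (1 + s) * ((quad α β U none (tsc t₁ s (τ, y)))⁻¹ *
        quad α β U (some (Sum.inr l)) (tsc t₁ s (τ, y))) * dd (ex l) V (τ, y)| ≤ n * (2 * (κ⁻¹ * L) * L) := by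
      rw [abs_mul, abs_neg]
      calc _ ≤ 1 * _ := mul_le_mul_of_nonneg_right (θ1 τ) (abs_nonneg _)
        _ ≤ _ := by rw [one_mul]; exact b2
    linarith [abs_add_le (deriv θ τ * V (τ, y)) (θ τ * -∑ l, (1 + s) * ((quad α β U none (tsc t₁ s (τ, y)))⁻¹ *
        quad α β U (some (Sum.inr l)) (tsc t₁ s (τ, y))) * dd (ex l) V (τ, y))]
  have hq1 : √√(t₂ - (t₁ - μ)) ≤ 1 := by
    exact sqrt_le_one.2 (sqrt_le_one.2 (by linarith))
  have hmb := (Hb (t₁ - μ) t₂ (fun p => dd et w p -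
      ∑ i, ∑ j, (1 + s) * acoef α β U i j (tsc t₁ s p) * dd (ex j) (dd (ex i) w) p) (N₀ + 1) hN0.le (by linarith) hfb).mono (by positivity)
    (show Kb * (N₀ + 1) * √√(t₂ - (t₁ - μ)) ≤ Kb * (N₀ + 1) from mul_le_of_le_one_right (by positivity) hq1)
  have Q := Hlin (t₁ - μ) t₂ (by linarith) (by linarith) _ _ w LH ⟨L, fun τ hτ y => by
    have hb := bV τ hτ y
    refine ⟨?_, fun i => ?_⟩
    · rw [hw]; simp only [abs_mul]
      calc |θ τ| * |V (τ, y)| ≤ 1 * L := mul_le_mul (θ1 τ) hb.1 (abs_nonneg _) (by norm_num)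
        _ = L := one_mul _
    · rw [dwx]; simp only [abs_mul]
      calc |θ τ| * |dd (ex i) V (τ, y)| ≤ 1 * L := mul_le_mul (θ1 τ) (hb.2 i) (abs_nonneg _) (by norm_num)
        _ = L := one_mul _⟩ _ (by positivity) hmb
  have p1 : 0 < K * (Kb * (N₀ + 1)) := by positivity
  have p2 : 0 < Kb * L := by positivity
  rcases ι with - | ⟨i, j⟩ | l
  · refine ((Q.2.1.window (s₁ := t₁) (s₂ := t₂) (by linarith) le_rfl).of_abs_le
      fun τ hτ y => ?_).mono p1.le (by linarith)
    have : dd et w (τ, y) = dd et V (τ, y) := by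
      refine dd_congr ?_ _
      have ho : IsOpen {q : SpT n | t₁ - μ / 2 < q.1} := isOpen_lt continuous_const continuous_fst
      filter_upwards [ho.mem_nhds (show t₁ - μ / 2 < τ by linarith [hτ.1])] with q hq
      rw [hw]; simp only [θone q.1 hq.le, one_mul]
    rw [this]; rfl
  · refine ((((Q.1 i j).window (s₁ := t₁) (s₂ := t₂) (by linarith) le_rfl)).of_abs_le
      fun τ hτ y => ?_).mono p1.le (by linarith)
    rw [dwxx, θone _ (by linarith [hτ.1]), one_mul]; rfl
  · have hq2 : √√(t₂ - t₁) ≤ 1 := by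
      exact sqrt_le_one.2 (sqrt_le_one.2 (by linarith))
    refine (Hb t₁ t₂ (jet V (some (Sum.inr l))) L hL.le h12.le (fun τ hτ y =>
      (bV τ ⟨by linarith [hτ.1], hτ.2⟩ y).2 l)).mono (by positivity) ?_
    have := mul_le_of_le_one_right p2.le hq2
    linarith

/-- Crude finite bounds for all difference quotients. -/
lemma Sol.apriori {η : ℝ}
    (H : Sol lam L κ ε ρ η ta tb α β U)
    (ha : ta ≤ t₁) (hb : t₁ + 2 * (t₂ - t₁) ≤ tb) (hL : 0 ≤ L) (hZ : 0 ≤ Z) (hh : 0 < h)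
    (hbase : ∀ s, 0 ≤ s → s ≤ 1 → ∀ ι, MB t₁ t₂ (jet (fun r => U (tsc t₁ s r)) ι) Z) (k : ℕ) :
    ∃ M, 0 ≤ M ∧ ∀ s, 0 ≤ s → s + k * h ≤ 1 →
      (∀ ι, MB t₁ t₂ (jet (dqf h k (fun s r => U (tsc t₁ s r)) s) ι) M) ∧
      ∀ τ ∈ Icc t₁ t₂, ∀ y, |dqf h k (fun s r => U (tsc t₁ s r)) s (τ, y)| ≤ M ∧
        ∀ a, |dd (ex a) (dqf h k (fun s r => U (tsc t₁ s r)) s) (τ, y)| ≤ M := by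
  set W : ℝ → SpT n → ℝ := fun s r => U (tsc t₁ s r) with hWdef
  have hW : ∀ s, ContDiff ℝ ∞ (W s) := fun s => H.smooth.comp (tsc_smooth t₁ s)
  induction k with
  | zero =>
    refine ⟨Z + L, by positivity, fun s hs hs1 => ⟨fun ι => ?_, fun τ hτ y => ?_⟩⟩
    · exact (hbase s hs (by simpa using hs1) ι).mono hZ (by linarith)
    · have := H.bU _ (tsc_mem hs (by simpa using hs1) ha hb hτ) y
      refine ⟨?_, fun a => ?_⟩
      · change |U (tsc t₁ s (τ, y))| ≤ _
        exact this.1.trans (by linarith)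
      · change |dd (ex a) (fun r => U (tsc t₁ s r)) (τ, y)| ≤ _
        rw [dd_ex_comp_tsc H.smooth]
        exact (this.2 a).trans (by linarith)
  | succ k ih =>
    obtain ⟨M, hM, ih⟩ := ih
    refine ⟨h⁻¹ * (M + M), by positivity, fun s hs hs1 => ?_⟩
    push_cast at hs1
    have i1 := ih s hs (by linarith)
    have i2 := ih (s + h) (by linarith) (by linarith)
    have sm := fun s => dqf_smooth hW h k s
    have e1 : dqf h (k + 1) W s = fun p => h⁻¹ * (dqf h k W (s + h) p - dqf h k W s p) := by
      funext p; rw [inv_mul_eq_div]; rfl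
    have hin : 0 ≤ h⁻¹ := by positivity
    refine ⟨fun ι => ?_, fun τ hτ y => ⟨?_, fun a => ?_⟩⟩
    · have e2 : jet (dqf h (k + 1) W s) ι = fun p => h⁻¹ * (jet (dqf h k W (s + h)) ι p +
          -1 * jet (dqf h k W s) ι p) := by
        rw [jet_dqf hW, jet_dqf hW, jet_dqf hW]
        funext p
        rw [neg_one_mul, ← sub_eq_add_neg, inv_mul_eq_div]; rfl
      rw [e2]
      have m := MB.add (jet_smooth (sm (s + h)) ι).continuous.continuousOn (i2.1 ι)
        ((i1.1 ι).const_mul (-1)) hM (by simpa using hM)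
      have m2 := m.const_mul h⁻¹
      rw [abs_of_nonneg hin] at m2
      simpa using m2
    · rw [e1]; simp only [abs_mul, abs_of_nonneg hin]
      have h1 := (i1.2 τ hτ y).1
      have h2 := (i2.2 τ hτ y).1
      gcongr
      exact (abs_sub _ _).trans (add_le_add h2 h1)
    · rw [e1, dd_const_mul ((sm _).sub (sm _)), dd_sub (sm _) (sm _), abs_mul, abs_of_nonneg hin]
      have h1 := (i1.2 τ hτ y).2 a
      have h2 := (i2.2 τ hτ y).2 a
      gcongr
      exact (abs_sub _ _).trans (add_le_add h2 h1)

lemma QB.mono {M' : ℝ} {w : SpT n → ℝ} (hM : 0 ≤ M) (h : M ≤ M') (H : QB t₁ t₂ w M) :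
    QB t₁ t₂ w M' := by
  have hq : 0 ≤ √√(t₂ - t₁) := sqrt_nonneg _
  have hle := mul_le_mul_of_nonneg_right h hq
  exact ⟨fun i j => (H.1 i j).mono hM h, H.2.1.mono hM h, fun τ hτ y =>
    ⟨(H.2.2 τ hτ y).1.trans hle, fun i => ((H.2.2 τ hτ y).2 i).trans hle⟩⟩

lemma QB.closed {w : SpT n → ℝ} (H : ∀ ε, 0 < ε → QB t₁ t₂ w (M + ε)) :
    QB t₁ t₂ w M := by
  have hl : ∀ x, (∀ ε, 0 < ε → x ≤ (M + ε) * √√(t₂ - t₁)) → x ≤ M * √√(t₂ - t₁) := fun x hx => by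
    refine ge_of_tendsto (x := 𝓝[>] (0:ℝ)) (f := fun ε => (M + ε) * √√(t₂ - t₁)) ?_
      (eventually_nhdsWithin_of_forall hx)
    have := (by fun_prop : Continuous fun ε : ℝ => (M + ε) * √√(t₂ - t₁)).tendsto 0
    rw [add_zero] at this
    exact this.mono_left nhdsWithin_le_nhds
  exact ⟨fun i j => MB.closed fun ε hε => (H ε hε).1 i j, MB.closed fun ε hε => (H ε hε).2.1,
    fun τ hτ y => ⟨hl _ fun ε hε => ((H ε hε).2.2 τ hτ y).1, fun i => hl _ fun ε hε =>
      ((H ε hε).2.2 τ hτ y).2 i⟩⟩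

set_option maxHeartbeats 1600000 in
/-- Quantitative time analyticity. -/
lemma Sol.analytic (n : ℕ) (hlam : 0 < lam) (hκ : 0 < κ) (hL : 0 < L) : ∃ ε > 0,
    ∀ ρ η, 0 < ρ → 0 < η → ∃ T₀ > 0, T₀ ≤ 1 ∧ ∀ T', 0 < T' → T' ≤ T₀ →
    ∃ T Z B : ℝ, 0 < T ∧ T ≤ T' ∧ 0 < Z ∧ 0 < B ∧
    ∀ (ta tb : ℝ) (α : JI n → Eu n → ℝ) (β : JI n → Fin n → Fin n → Eu n → ℝ)
      (U : SpT n → ℝ), Sol lam L κ ε ρ η ta tb α β U → ∀ t₁, ta + 2 * T' ≤ t₁ → t₁ + 2 * T ≤ tb →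
      ∀ (k : ℕ) (h s : ℝ), 0 < h → 0 ≤ s → s + k * h ≤ 1 → ∀ τ ∈ Icc t₁ (t₁ + T), ∀ y,
        |dqf h k (fun s r => U (tsc t₁ s r)) s (τ, y)| ≤ maj Z B k := by
  obtain ⟨ε, hε, Hlin⟩ := lin n hlam (L := 2 * L) (by positivity)
  obtain ⟨Kb, hKb, Hb⟩ := MB.of_bdd n
  refine ⟨ε / 2, by positivity, fun ρ η hρ hη => ?_⟩
  obtain ⟨T₁, hT₁, hT₁1, K, hK, HK⟩ := Hlin ρ hρ
  have HK' : LinEst n lam (2 * L) ε ρ T₁ K := HK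
  refine ⟨min (T₁ / 2) (η / 4), by positivity, (min_le_left _ _).trans (by linarith), fun μ hμ hμT => ?_⟩
  have hμ1 : 2 * μ ≤ T₁ := by linarith [hμT.trans (min_le_left _ _)]
  have hμη : 4 * μ ≤ η := by linarith [hμT.trans (min_le_right _ _)]
  obtain ⟨Z, hZL, HZ⟩ := Sol.base hlam hκ hL hε hK HK' hμ (by linarith) hμ1
  have hZ : 0 < Z := hL.trans_le hZL
  set A := K * κ⁻¹ with hA
  set cJ : ℝ := (Fintype.card (JI n) : ℝ) with hcJ
  set B := max 4 (16 * A * cJ * L)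
  have hB4 : 4 ≤ B := le_max_left _ _
  have hB0 : 0 < B := by linarith
  set E := 1 + Kb + 4 * (A * cJ * n * n * L * 192 * Z ^ 2) +
    2 * (A * cJ * n * n * L * 6 * Z ^ 2 + A * n * 2 * L) with hE
  have hE0 : 0 < E := by positivity
  set q₀ := E⁻¹
  have hq00 : 0 < q₀ := by positivity
  set T := min μ (q₀ ^ 4)
  have hT0 : 0 < T := by positivity
  have hTμ : T ≤ μ := min_le_left _ _
  set q := √√T with hq
  have hq0 : 0 < q := by positivity
  have hqq : q ≤ q₀ := by
    rw [hq, sqrt_le_left hq00.le, sqrt_le_left (by positivity)]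
    refine (min_le_right _ _).trans (le_of_eq (by ring))
  have hqE : q * E ≤ 1 := by
    calc q * E ≤ q₀ * E := by gcongr
      _ = 1 := inv_mul_cancel₀ hE0.ne'
  have x1 : 0 ≤ q * Kb := by positivity
  have x2 : 0 ≤ q * (4 * (A * cJ * n * n * L * 192 * Z ^ 2)) := by positivity
  have x3 : 0 ≤ q * (2 * (A * cJ * n * n * L * 6 * Z ^ 2 + A * n * 2 * L)) := by positivity
  have hqE' : q + q * Kb + q * (4 * (A * cJ * n * n * L * 192 * Z ^ 2)) +
    q * (2 * (A * cJ * n * n * L * 6 * Z ^ 2 + A * n * 2 * L)) ≤ 1 := by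
    refine le_trans (le_of_eq ?_) hqE
    rw [hE]; ring
  have hq1 : q ≤ 1 := by linarith
  have hKq : Kb * q ≤ 1 := by linarith
  have hBc : A * cJ * L * (4 / B) ≤ 1 / 4 := by
    rw [mul_div_assoc', div_le_iff₀ hB0]
    have := le_max_right 4 (16 * A * cJ * L)
    linarith
  refine ⟨T, Z, B, hT0, hTμ, hZ, hB0, fun ta tb α β U H t₁ hta htb k h s hh hs hs1 τ hτ y => ?_⟩
  set t₂ := t₁ + T with ht₂
  have h21 : t₂ - t₁ = T := by rw [ht₂]; ring
  have hqt : q = √√(t₂ - t₁) := by rw [h21]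
  have hbase : ∀ s, 0 ≤ s → s ≤ 1 → ∀ ι, MB t₁ t₂ (jet (fun r => U (tsc t₁ s r)) ι) Z :=
    HZ η ta tb α β U H hμη t₁ t₂ (by linarith) (by linarith) (by linarith) (by linarith)
  set W : ℝ → SpT n → ℝ := fun s r => U (tsc t₁ s r) with hWdef
  have hW : ∀ s, ContDiff ℝ ∞ (W s) := fun s => H.smooth.comp (tsc_smooth t₁ s)
  have hmem := fun (r : ℝ) (h0 : 0 ≤ r) (h1 : r ≤ 1) τ (hτ : τ ∈ Icc t₁ t₂) =>
    tsc_mem (ta := ta) (tb := tb) h0 h1 (by linarith) (by linarith) hτ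
  have step : ∀ k : ℕ, 1 ≤ k → LowB t₁ t₂ h q Z B k W → ∀ s, 0 ≤ s → s + k * h ≤ 1 →
      QB t₁ t₂ (dqf h k W s) (maj Z B k) := by
    intro k hk hlow s hs hs1
    have pm := maj_pos hZ hB0 k
    have hkh : (0:ℝ) ≤ k * h := by positivity
    have e : maj Z B k = 2 * (maj Z B k / 2) := by ring
    rw [e]
    refine absorb (P := fun M => QB t₁ t₂ (dqf h k W s) M) (by positivity) (fun M _ => QB.closed)
      (fun M M' => QB.mono) ?_ fun M hM hQ => ?_
    · obtain ⟨M, hM, Ha⟩ := H.apriori (t₁ := t₁) (t₂ := t₂) (by linarith) (by linarith) hL.le hZ.le hh hbase k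
      obtain ⟨a1, a2⟩ := Ha s hs hs1
      have hle : M ≤ (M + M / q) * q := by
        rw [add_mul, div_mul_cancel₀ _ hq0.ne']
        have := mul_nonneg hM hq0.le
        linarith
      have hle2 : M ≤ M + M / q := by
        have : 0 ≤ M / q := by positivity
        linarith
      refine ⟨M + M / q, by positivity, fun i j => (a1 (some (Sum.inl (i, j)))).mono hM hle2,
        (a1 none).mono hM hle2, fun τ hτ y => ?_⟩
      rw [← hqt]
      exact ⟨(a2 τ hτ y).1.trans hle, fun i => ((a2 τ hτ y).2 i).trans hle⟩
    · have hf := H.step_mb hκ (by linarith) (by linarith) hL.le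
        (fun F N hN hF => Hb t₁ t₂ F N hN (by linarith) hF) hKb.le hqt hq1 hKq hlow hZ hB4 hh hM hk hs hs1 hQ
      have LH := H.linHyp hlam hκ (t₀ := t₁) (t₁ := t₁) (t₂ := t₂) (by linarith)
        (hmem (s + k * h) (by linarith) hs1) (by linarith) hL.le hε.le (by linarith) hs1
        (dqf_smooth hW h k s) (fun x => by
          obtain ⟨k, rfl⟩ := Nat.exists_eq_succ_of_ne_zero (by omega : k ≠ 0)
          have : (fun s => W s (t₁, x)) = fun _ => U (t₁, x) := by
            funext s
            simp [hWdef, tsc]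
          simp only [dqf, this, Nat.succ_eq_add_one, dq_const])
      obtain ⟨N, hN, Ha⟩ := H.apriori (t₁ := t₁) (t₂ := t₂) (by linarith) (by linarith) hL.le hZ.le hh hbase k
      have F0 : 0 < (M / 2 + maj Z B k / 2) / K := by positivity
      have hfin := HK t₁ t₂ (by linarith) (by linarith) _ _ _ LH ⟨N, (Ha s hs hs1).2⟩ _ F0
        (hf.mono (by positivity) ?_)
      · rwa [mul_div_cancel₀ _ hK.ne'] at hfin
      · rw [le_div_iff₀ hK]
        have y1 := mul_le_mul_of_nonneg_right hBc pm.le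
        have y2 : (q * (A * cJ * n * n * L * 192 * Z ^ 2)) * maj Z B k ≤ 1 / 4 * maj Z B k :=
          mul_le_mul_of_nonneg_right (by linarith) pm.le
        have y3 : (q * (A * cJ * n * n * L * 6 * Z ^ 2 + A * n * 2 * L)) * M ≤ 1 / 2 * M :=
          mul_le_mul_of_nonneg_right (by linarith) hM
        refine le_trans (le_of_eq ?_) (add_le_add (add_le_add y1 y2) y3 |>.trans (le_of_eq ?_))
        · rw [hA]; ring
        · ring
  have hlow : ∀ k, LowB t₁ t₂ h q Z B k W := by
    intro k
    induction k with
    | zero => intro j hj; omega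
    | succ k ih =>
      intro j hj s hs hs1
      rcases Nat.lt_succ_iff_lt_or_eq.1 hj with hj | rfl
      · exact ih j hj s hs hs1
      rcases Nat.eq_zero_or_pos j with rfl | hj0
      · rw [maj_zero]
        have hs1' : s ≤ 1 := by simpa using hs1
        refine ⟨fun ι => hbase s hs hs1' ι, fun τ hτ y a => ?_⟩
        change |dd (ex a) (fun r => U (tsc t₁ s r)) (τ, y)| ≤ _
        rw [dd_ex_comp_tsc H.smooth, if_pos rfl, one_mul]
        exact ((H.bU _ (hmem s hs hs1' τ hτ) y).2 a).trans hZL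
      · have Q := step j hj0 ih s hs hs1
        have pm := maj_pos hZ hB0 j
        have hb : ∀ τ ∈ Icc t₁ t₂, ∀ y, ∀ a, |dd (ex a) (dqf h j W s) (τ, y)| ≤ maj Z B j * q := by
          intro τ hτ y a
          have := (Q.2.2 τ hτ y).2 a
          rwa [← hqt] at this
        refine ⟨fun ι => ?_, fun τ hτ y a => ?_⟩
        · rcases ι with - | ⟨i, l⟩ | l
          · exact Q.2.1
          · exact Q.1 i l
          · refine (Hb t₁ t₂ (dd (ex l) (dqf h j W s)) (maj Z B j * q) (by positivity) (by linarith)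
              (fun τ hτ y => hb τ hτ y l)).mono (by positivity) ?_
            rw [← hqt]
            have := mul_le_mul hKq hq1 hq0.le (by norm_num)
            have := mul_le_mul_of_nonneg_right this pm.le
            linarith
        · rw [if_neg (by omega), mul_comm]
          exact hb τ hτ y a
  rcases Nat.eq_zero_or_pos k with rfl | hk0
  · rw [maj_zero]
    exact (H.bU _ (hmem s hs (by simpa using hs1) τ hτ) y).1.trans hZL
  · have := ((step k hk0 (hlow k) s hs hs1).2.2 τ hτ y).1
    rw [← hqt] at this
    exact this.trans (mul_le_of_le_one_right (maj_pos hZ hB0 k).le hq1)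

section Differences

variable {E : Type*} [NormedAddCommGroup E] [NormedSpace ℝ E]

/-- Translation of functions by a vector. -/
def sh (v : E) : Module.End ℝ (E → ℝ) := LinearMap.funLeft ℝ ℝ (fun x => x + v)

/-- Forward difference in direction `v`. -/
def df (v : E) : Module.End ℝ (E → ℝ) := sh v - 1

lemma df_apply (v : E) (g : E → ℝ) (x : E) : df v g x = g (x + v) - g x := rfl

lemma df_pow_succ_apply (v : E) (k : ℕ) (g : E → ℝ) (x : E) :
    (df v ^ (k + 1)) g x = (df v ^ k) g (x + v) - (df v ^ k) g x := by
  rw [pow_succ']; rfl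

lemma df_pow_succ_apply' (v : E) (k : ℕ) (g : E → ℝ) (x : E) :
    (df v ^ (k + 1)) g x = (df v ^ k) (df v g) x := by
  rw [pow_succ]; rfl

lemma abs_df_pow_le (v : E) (k : ℕ) {g : E → ℝ} (h : ∀ x, |g x| ≤ M) (x : E) :
    |(df v ^ k) g x| ≤ 2 ^ k * M := by
  induction k generalizing x with
  | zero => simpa using h x
  | succ k ih =>
    rw [df_pow_succ_apply, pow_succ]
    have := abs_sub ((df v ^ k) g (x + v)) ((df v ^ k) g x)
    linarith [ih x, ih (x + v)]

lemma dq_linear (A : Module.End ℝ (E → ℝ)) (W : ℝ → E → ℝ) (h : ℝ) (k : ℕ) (s : ℝ) (x : E) :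
    dq h k (fun s => A (W s) x) s = A (fun y => dq h k (fun s => W s y) s) x := by
  induction k generalizing s with
  | zero => rfl
  | succ k ih =>
    simp only [dq, ih]
    have : (fun y => (dq h k (fun s => W s y) (s + h) - dq h k (fun s => W s y) s) / h) =
        h⁻¹ • ((fun y => dq h k (fun s => W s y) (s + h)) - fun y => dq h k (fun s => W s y) s) := by
      funext y
      simp [div_eq_inv_mul]
    rw [this, map_smul, map_sub]
    simp [div_eq_inv_mul]

lemma dq_rescale (hh : h ≠ 0) (k : ℕ) (G : ℝ → ℝ) (r : ℝ) :
    dq 1 k (fun r => G (h * r)) r = h ^ k * dq h k G (h * r) := by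
  induction k generalizing r with
  | zero => simp [dq]
  | succ k ih =>
    simp only [dq, ih, mul_add, mul_one]
    field_simp
    ring

lemma dq_shift (h : ℝ) (k : ℕ) (F : ℝ → ℝ) (c s : ℝ) :
    dq h k (fun s => F (c + s)) s = dq h k F (c + s) := by
  induction k generalizing s with
  | zero => rfl
  | succ k ih => simp only [dq, ih, add_assoc]

lemma abs_dq_one_le {F : ℝ → ℝ} (k : ℕ) (r : ℝ) (h : ∀ r' ∈ Icc r (r + k), |F r'| ≤ ε) :
    |dq 1 k F r| ≤ 2 ^ k * ε := by
  induction k generalizing r with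
  | zero => simpa [dq] using h r (by simp)
  | succ k ih =>
    push_cast at h
    have h1 := ih r fun r' hr => h r' ⟨hr.1, by linarith [hr.2]⟩
    have h2 := ih (r + 1) fun r' hr => h r' ⟨by linarith [hr.1], by linarith [hr.2]⟩
    simp only [dq, div_one, pow_succ]
    have := abs_sub (dq 1 k F (r + 1)) (dq 1 k F r)
    linarith

/-- Propagation of smallness against the direction of time by one difference table. -/
lemma backward_step {F : ℝ → ℝ} {N : ℕ} {e : ℝ} (hε : 0 ≤ ε) (he : 0 ≤ e)
    (h1 : ∀ r ∈ Icc (N:ℝ) (2 * N), |F r| ≤ ε) (h2 : ∀ r ∈ Icc (0:ℝ) N, |dq 1 N F r| ≤ e) :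
    |F 0| ≤ 4 ^ N * (2 ^ N * ε + e) := by
  have key : ∀ m, m ≤ N → ∀ j, j ≤ N → |dq 1 (N - j) F (N - m)| ≤ (2 ^ N * ε + e) * 2 ^ (m + j) := by
    have hp : 0 ≤ 2 ^ N * ε + e := by positivity
    intro m
    induction m with
    | zero =>
      intro _ j hj
      have h3 := abs_dq_one_le (F := F) (ε := ε) (N - j) (N - (0:ℕ) : ℝ) fun r hr => h1 r ⟨by
        have := hr.1; simpa using this, by
        have := hr.2
        have h4 : ((N - j : ℕ) : ℝ) ≤ N := by exact_mod_cast Nat.sub_le _ _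
        push_cast at this; linarith⟩
      refine h3.trans ?_
      have h5 : (2:ℝ) ^ (N - j) ≤ 2 ^ N := pow_le_pow_right₀ (by norm_num) (Nat.sub_le _ _)
      have h6 : (1:ℝ) ≤ 2 ^ (0 + j) := one_le_pow₀ (by norm_num)
      nlinarith [mul_le_mul_of_nonneg_left h6 hp]
    | succ m ihm =>
      intro hm j
      have hmN : (m:ℝ) + 1 ≤ N := by exact_mod_cast hm
      induction j with
      | zero =>
        intro _
        have h6 : (1:ℝ) ≤ 2 ^ (m + 1 + 0) := one_le_pow₀ (by norm_num)
        have h3 := h2 (N - (m + 1 : ℕ)) ⟨by push_cast; linarith, by push_cast; linarith⟩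
        rw [Nat.sub_zero]
        have : 0 ≤ 2 ^ N * ε := by positivity
        nlinarith
      | succ j ihj =>
        intro hj
        have i1 := ihm (by omega) (j + 1) hj
        have i2 := ihj (by omega)
        have e1 : N - j = (N - (j + 1)) + 1 := by omega
        rw [e1] at i2
        simp only [dq, div_one] at i2
        have e2 : (N : ℝ) - ((m + 1 : ℕ) : ℝ) + 1 = N - m := by push_cast; ring
        rw [e2] at i2
        have e3 : (2:ℝ) ^ (m + 1 + (j + 1)) = 2 ^ (m + (j + 1)) + 2 ^ (m + 1 + j) := by ring
        rw [e3]
        have := abs_sub_abs_le_abs_sub (dq 1 (N - (j + 1)) F (N - ((m + 1 : ℕ) : ℝ))) (dq 1 (N - (j + 1)) F (N - m))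
        rw [abs_sub_comm] at this
        linarith
  have := key N le_rfl N le_rfl
  simp only [Nat.sub_self, dq, sub_self] at this
  refine this.trans (le_of_eq ?_)
  have : (4:ℝ) ^ N = 2 ^ (N + N) := by rw [pow_add, ← mul_pow]; norm_num
  rw [this, mul_comm]

/-- Rapid decay of high order spatial differences, uniformly on the time interval `[a, 2]`. -/
def RT (g : ℝ → E → ℝ) (a : ℝ) : Prop :=
  ∀ P : ℕ, ∃ L : ℕ, ∃ C : ℝ, 0 ≤ C ∧ ∀ t ∈ Icc a 2, ∀ x v, v ≠ 0 → ‖v‖ ≤ 1 → |(df v ^ L) (g t) x| ≤ C * ‖v‖ ^ P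

lemma RT.step {g : ℝ → E → ℝ} (hT : 0 < T) (hZ : 0 < Z) (hB : 0 < B)
    (hg : ∀ t ∈ Icc ts 2, ∀ x, ∀ (k : ℕ) (h : ℝ), 0 < h → k * h ≤ 1 →
      |dq h k (fun s => g (t + T * s) x) 0| ≤ maj Z B k)
    (hρ : 0 < ρ) (hρT : ρ ≤ T) (hρB : B * ρ / T ≤ 1 / 64) (ha : a ≤ 1) (hρ1 : ρ ≤ 1 / 2) (H : RT g a) :
    RT g (max ts (a - ρ)) := by
  intro P
  obtain ⟨L, C, hC, HL⟩ := H (2 * P)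
  refine ⟨L, C + (8 * C + 2 ^ L * Z), by positivity, fun t ht x v hv0 hv => ?_⟩
  have hnv := norm_pos_iff.2 hv0
  have hts := (le_max_left _ _).trans ht.1
  have hta := (le_max_right _ _).trans ht.1
  have hnp : 0 < ‖v‖ ^ P := by positivity
  rcases le_or_gt a t with h | h
  · refine (HL t ⟨h, ht.2⟩ x v hv0 hv).trans ?_
    have h1 : ‖v‖ ^ (2 * P) ≤ ‖v‖ ^ P := pow_le_pow_of_le_one hnv.le hv (by omega)
    have h2 : C * ‖v‖ ^ (2 * P) ≤ C * ‖v‖ ^ P := by gcongr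
    have : 0 ≤ (8 * C + 2 ^ L * Z) * ‖v‖ ^ P := by positivity
    linarith
  obtain ⟨m, hm1, hm2⟩ := exists_nat_pow_near (x := (‖v‖ ^ P)⁻¹) (y := 16)
    ((one_le_inv₀ hnp).2 (pow_le_one₀ hnv.le hv)) (by norm_num)
  set N := m + 1 with hN
  have hN0 : (0:ℝ) < N := by positivity
  set h' := ρ / (N * T) with hh'
  have hh0 : 0 < h' := by positivity
  have hNh : N * h' ≤ 1 := by
    rw [hh', ← div_le_one hT] at *
    have : (N:ℝ) * (ρ / (N * T)) = ρ / T := by field_simp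
    rw [this]; exact hρT
  have hδ : T * h' * N = ρ := by rw [hh']; field_simp
  set e := h' ^ N * (2 ^ L * maj Z B N) with he
  have hm := maj_pos hZ hB N
  have hb := backward_step (F := fun r => (df v ^ L) (g (t + T * (h' * r))) x) (N := N)
    (ε := C * ‖v‖ ^ (2 * P)) (e := e) (by positivity) (by positivity) (fun r hr => ?_) (fun r hr => ?_)
  · simp only [mul_zero, add_zero] at hb
    have e1 : e ≤ 2 ^ L * Z * (1 / 64) ^ N := by
      have h1 := maj_le hZ hB N
      have h2 : h' ^ N * maj Z B N ≤ Z * (1 / 64) ^ N := by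
        calc h' ^ N * maj Z B N ≤ h' ^ N * (Z * (N * B) ^ N) := by gcongr
          _ = Z * (B * ρ / T) ^ N := by
            rw [mul_left_comm, ← mul_pow, hh']
            congr 2
            field_simp
          _ ≤ _ := by gcongr
      calc e = 2 ^ L * (h' ^ N * maj Z B N) := by rw [he]; ring
        _ ≤ 2 ^ L * (Z * (1 / 64) ^ N) := by gcongr
        _ = _ := by ring
    have h8 : (8:ℝ) ^ N * ‖v‖ ^ P ≤ 8 := by
      have h1 : (8:ℝ) ^ m ≤ (‖v‖ ^ P)⁻¹ := le_trans (by gcongr; norm_num) hm1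
      calc (8:ℝ) ^ N * ‖v‖ ^ P = 8 * (8 ^ m * ‖v‖ ^ P) := by rw [hN]; ring
        _ ≤ 8 * ((‖v‖ ^ P)⁻¹ * ‖v‖ ^ P) := by gcongr
        _ = 8 := by rw [inv_mul_cancel₀ hnp.ne', mul_one]
    have h16 : (1 / 16 : ℝ) ^ N ≤ ‖v‖ ^ P := by
      rw [one_div, inv_pow]
      exact inv_le_of_inv_le₀ hnp hm2.le
    have e2 : (4:ℝ) ^ N * (2 ^ N * (C * ‖v‖ ^ (2 * P))) = C * (8 ^ N * ‖v‖ ^ P) * ‖v‖ ^ P := by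
      have : (8:ℝ) ^ N = 4 ^ N * 2 ^ N := by rw [← mul_pow]; norm_num
      rw [this, two_mul, pow_add]; ring
    have e3 : (4:ℝ) ^ N * (2 ^ L * Z * (1 / 64) ^ N) = 2 ^ L * Z * (1 / 16) ^ N := by
      have : (1 / 16 : ℝ) ^ N = 4 ^ N * (1 / 64) ^ N := by rw [← mul_pow]; norm_num
      rw [this]; ring
    have e4 : C * (8 ^ N * ‖v‖ ^ P) * ‖v‖ ^ P ≤ C * 8 * ‖v‖ ^ P := by gcongr
    have e5 : 2 ^ L * Z * (1 / 16) ^ N ≤ 2 ^ L * Z * ‖v‖ ^ P := by gcongr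
    have e6 : (4:ℝ) ^ N * e ≤ 4 ^ N * (2 ^ L * Z * (1 / 64) ^ N) := by gcongr
    have : 0 ≤ C * ‖v‖ ^ P := by positivity
    rw [mul_add, e2] at hb
    linarith
  · refine HL _ ⟨?_, ?_⟩ x v hv0 hv
    · have : ρ ≤ T * (h' * r) := by
        rw [← hδ, mul_assoc]
        have := hr.1
        gcongr
      linarith
    · have : T * (h' * r) ≤ ρ * 2 := by
        rw [← hδ, mul_assoc, mul_assoc]
        have := hr.2
        gcongr
        linarith
      linarith
  · have hr0 : 0 ≤ T * (h' * r) := by have := hr.1; positivity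
    have hr1 : T * (h' * r) ≤ ρ := by
      rw [← hδ, mul_assoc]
      have := hr.2
      gcongr
    have e1 := dq_rescale hh0.ne' N (fun s => (df v ^ L) (g (t + T * s)) x) r
    rw [e1, abs_mul, abs_of_pos (by positivity), he]
    refine mul_le_mul_of_nonneg_left ?_ (by positivity)
    have e2 := dq_shift h' N (fun s => (df v ^ L) (g (t + T * s)) x) (h' * r) 0
    rw [add_zero] at e2
    rw [← e2, dq_linear]
    refine abs_df_pow_le v L (fun y => ?_) x
    have := hg (t + T * (h' * r)) ⟨by linarith, by linarith⟩ y N h' hh0 hNh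
    have e3 : ∀ s, t + T * (h' * r + s) = t + T * (h' * r) + T * s := fun s => by ring
    simp only [e3]
    exact this

lemma RT.all {g : ℝ → E → ℝ} (hT : 0 < T) (hZ : 0 < Z) (hB : 0 < B)
    (hg : ∀ t ∈ Icc ts 2, ∀ x, ∀ (k : ℕ) (h : ℝ), 0 < h → k * h ≤ 1 →
      |dq h k (fun s => g (t + T * s) x) 0| ≤ maj Z B k) (H : RT g 1) : RT g ts := by
  set ρ := min (min T (1 / 2)) (T / (64 * B)) with hρ
  have hρ0 : 0 < ρ := by positivity
  have h3 : B * ρ / T ≤ 1 / 64 := by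
    rw [div_le_iff₀ hT]
    have := mul_le_mul_of_nonneg_left (min_le_right (min T (1 / 2)) (T / (64 * B))) hB.le
    refine this.trans (le_of_eq ?_)
    field_simp
  have key : ∀ m : ℕ, RT g (max ts (1 - m * ρ)) := by
    intro m
    induction m with
    | zero =>
      intro P
      obtain ⟨L, C, hC, HL⟩ := H P
      exact ⟨L, C, hC, fun t ht => HL t ⟨by simpa using (le_max_right _ _).trans ht.1, ht.2⟩⟩
    | succ m ih =>
      by_cases hts : ts ≤ 1
      · have hm : (0:ℝ) ≤ m * ρ := by positivity
        have := RT.step hT hZ hB hg hρ0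
            ((min_le_left _ _).trans (min_le_left _ _)) h3 (max_le hts (by linarith))
            ((min_le_left _ _).trans (min_le_right _ _)) ih
        have e : max ts (max ts (1 - m * ρ) - ρ) = max ts (1 - (m + 1 : ℕ) * ρ) := by
          push_cast
          rcases le_total ts (1 - m * ρ) with h | h
          · rw [max_eq_right h]; congr 1; ring
          · rw [max_eq_left h, max_eq_left (by linarith), max_eq_left (by linarith)]
        rwa [e] at this
      · intro P
        obtain ⟨L, C, hC, HL⟩ := H P
        exact ⟨L, C, hC, fun t ht => HL t ⟨(not_le.1 hts).le.trans ((le_max_left _ _).trans ht.1), ht.2⟩⟩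
  obtain ⟨m, hm⟩ := exists_nat_gt ((1 - ts) / ρ)
  have := key m
  rw [div_lt_iff₀ hρ0] at hm
  rwa [max_eq_left (by linarith)] at this

end Differences

section Marchaud

variable {E : Type*} [NormedAddCommGroup E] [NormedSpace ℝ E] {w : E → ℝ}

lemma df_pow_add_apply (v : E) (k l : ℕ) (g : E → ℝ) : (df v ^ (k + l)) g = (df v ^ k) ((df v ^ l) g) := by
  rw [pow_add]; rfl

/-- Rapid decay of high order differences. -/
def Rap (w : E → ℝ) : Prop :=
  ∀ P : ℕ, ∃ L : ℕ, ∃ C : ℝ, 0 ≤ C ∧ ∀ x v, v ≠ 0 → ‖v‖ ≤ 1 → |(df v ^ L) w x| ≤ C * ‖v‖ ^ P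

lemma df_two_smul_pow (v : E) (k : ℕ) : df ((2:ℝ) • v) ^ k = df v ^ k * (df v + 2) ^ k := by
  have h : df ((2:ℝ) • v) = df v * (df v + 2) := by
    ext g x
    rw [mul_add]
    change g (x + (2:ℝ) • v) - g x = (g (x + v + v) - g (x + v) - (g (x + v) - g x)) + (df v * 2) g x
    have : (df v * 2) g x = 2 * (g (x + v) - g x) := by
      rw [mul_two]
      change (g (x + v) - g x) + (g (x + v) - g x) = _
      ring
    rw [this, two_smul, add_assoc]
    ring
  rw [h]
  exact Commute.mul_pow ((Commute.refl _).add_right (Commute.ofNat_right _ 2)) k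

lemma df_add_two_apply (v : E) (g : E → ℝ) (x : E) : (df v + 2) g x = g (x + v) + g x := by
  change (g (x + v) - g x) + (2 : Module.End ℝ (E → ℝ)) g x = _
  have : (2 : Module.End ℝ (E → ℝ)) g x = g x + g x := by
    rw [← one_add_one_eq_two]; rfl
  rw [this]; ring

lemma abs_df_add_two_pow_sub_le (v : E) (k : ℕ) {g : E → ℝ} (h : ∀ x, |df v g x| ≤ M) (x : E) :
    |((df v + 2) ^ k) g x - 2 ^ k * g x| ≤ k * 2 ^ k * M := by
  have hM := (abs_nonneg _).trans (h x)
  induction k generalizing x with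
  | zero => simp
  | succ k ih =>
    rw [pow_succ']
    change |(df v + 2) (((df v + 2) ^ k) g) x - _| ≤ _
    rw [df_add_two_apply]
    have h1 := ih (x + v)
    have h2 := ih x
    have h3 := h x
    rw [df_apply] at h3
    have h4 : (0:ℝ) < 2 ^ k := by positivity
    have e : ((df v + 2) ^ k) g (x + v) + ((df v + 2) ^ k) g x - 2 ^ (k + 1) * g x =
      (((df v + 2) ^ k) g (x + v) - 2 ^ k * g (x + v)) + (((df v + 2) ^ k) g x - 2 ^ k * g x)
        + 2 ^ k * (g (x + v) - g x) := by ring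
    rw [e]
    refine (abs_add_three _ _ _).trans ?_
    rw [abs_mul, abs_of_pos h4]
    have := mul_le_mul_of_nonneg_left h3 h4.le
    have h5 : 0 ≤ 2 ^ k * M := by positivity
    push_cast
    rw [pow_succ]
    nlinarith

/-- Marchaud's inequality for one dyadic step. -/
lemma marchaud_step (v : E) (k : ℕ) {A : ℝ} (h1 : ∀ x, |(df ((2:ℝ) • v) ^ k) w x| ≤ A)
    (h2 : ∀ x, |(df v ^ (k + 1)) w x| ≤ B) (x : E) : |(df v ^ k) w x| ≤ A / 2 ^ k + k * B := by
  have h3 := abs_df_add_two_pow_sub_le v k (fun y => by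
    have := h2 y
    rw [add_comm, df_pow_add_apply, pow_one] at this
    exact this) x
  have h4 := h1 x
  rw [df_two_smul_pow] at h4
  have e : (df v ^ k * (df v + 2) ^ k) w x = ((df v + 2) ^ k) ((df v ^ k) w) x := by
    rw [((Commute.refl (df v)).add_right (Commute.ofNat_right _ 2) : Commute (df v) (df v + 2)).pow_pow k k |>.eq]
    rfl
  rw [e] at h4
  have h5 : (0:ℝ) < 2 ^ k := by positivity
  have h6 : |2 ^ k * (df v ^ k) w x| ≤ A + k * 2 ^ k * B := by
    have := abs_sub_abs_le_abs_sub (2 ^ k * (df v ^ k) w x) (((df v + 2) ^ k) ((df v ^ k) w) x)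
    rw [abs_sub_comm] at this
    linarith
  rw [abs_mul, abs_of_pos h5] at h6
  have e2 : A / 2 ^ k + k * B = (A + k * 2 ^ k * B) / 2 ^ k := by field_simp
  rw [e2, le_div_iff₀ h5]
  linarith

lemma norm_two_smul (v : E) : ‖(2:ℝ) • v‖ = 2 * ‖v‖ := by rw [norm_smul]; norm_num

lemma dyadic_induction {P : E → E → Prop} (h1 : ∀ v, 1 / 2 < ‖v‖ → ‖v‖ ≤ 1 → ∀ x, P x v)
    (h2 : ∀ v, v ≠ 0 → ‖v‖ ≤ 1 / 2 → (∀ x, P x ((2:ℝ) • v)) → ∀ x, P x v) (x v : E) (hv : v ≠ 0)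
    (hv1 : ‖v‖ ≤ 1) : P x v := by
  have key : ∀ m, ∀ v : E, v ≠ 0 → ‖v‖ ≤ 1 → (1 / 2 : ℝ) ^ m < ‖v‖ → ∀ x, P x v := by
    intro m
    induction m with
    | zero => intro v _ h3 h4; simp at h4; linarith
    | succ m ih =>
      intro v hv h3 h4
      rcases lt_or_ge (1 / 2) ‖v‖ with h | h
      · exact h1 v h h3
      rw [pow_succ] at h4
      exact h2 v hv h (ih _ (by simpa using hv) (by rw [norm_two_smul]; linarith)
        (by rw [norm_two_smul]; linarith))
  obtain ⟨m, hm⟩ := exists_pow_lt_of_lt_one (norm_pos_iff.2 hv) (show (1 / 2 : ℝ) < 1 by norm_num)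
  exact key m v hv hv1 hm x

lemma Rap.order_four (hM : ∀ x, |w x| ≤ M) (H : Rap w) :
    ∃ A, 0 ≤ A ∧ ∀ x v, v ≠ 0 → ‖v‖ ≤ 1 → |(df v ^ 4) w x| ≤ A * ‖v‖ ^ 3 := by
  have hM0 : 0 ≤ M := (abs_nonneg _).trans (hM 0)
  obtain ⟨L, C, hC, hL⟩ := H 3
  have desc : ∀ j, ∃ A, 0 ≤ A ∧ ∀ x v, v ≠ 0 → ‖v‖ ≤ 1 → |(df v ^ (L - j + 4)) w x| ≤ A * ‖v‖ ^ 3 := by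
    intro j
    induction j with
    | zero =>
      refine ⟨2 ^ 4 * C, by positivity, fun x v h1 h2 => ?_⟩
      rw [Nat.sub_zero, add_comm, df_pow_add_apply, mul_assoc]
      exact abs_df_pow_le v 4 (fun y => hL y v h1 h2) x
    | succ j ih =>
      by_cases hj : L ≤ j
      · rw [Nat.sub_eq_zero_of_le hj] at ih
        rw [Nat.sub_eq_zero_of_le (by omega)]
        exact ih
      obtain ⟨A, hA, hA2⟩ := ih
      set k := L - (j + 1) + 4
      have e : L - j + 4 = k + 1 := by omega
      rw [e] at hA2
      refine ⟨8 * (2 ^ k * M) + 2 * k * A, by positivity, dyadic_induction ?_ ?_⟩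
      · intro v h1 _ x
        refine (abs_df_pow_le v k hM x).trans ?_
        have h3 : (1 / 2 : ℝ) ^ 3 ≤ ‖v‖ ^ 3 := by gcongr
        have h4 : 0 ≤ 2 ^ k * M := by positivity
        have h5 : 0 ≤ 2 * k * A * ‖v‖ ^ 3 := by positivity
        nlinarith
      · intro v hv h1 h2 x
        rw [norm_two_smul] at h2
        refine (marchaud_step v k h2 (fun y => hA2 y v hv (by linarith)) x).trans ?_
        have h3 : (2:ℝ) ^ 4 ≤ 2 ^ k := pow_le_pow_right₀ (by norm_num) (by omega)
        set D := 8 * (2 ^ k * M) + 2 * k * A with hD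
        have h4 : 0 ≤ D * ‖v‖ ^ 3 := by positivity
        have h5 : D * (2 * ‖v‖) ^ 3 / 2 ^ k ≤ D * ‖v‖ ^ 3 / 2 := by
          rw [div_le_div_iff₀ (by positivity) (by norm_num)]
          nlinarith
        have h6 : 0 ≤ 8 * (2 ^ k * M) * ‖v‖ ^ 3 := by positivity
        nlinarith
  obtain ⟨A, hA, h⟩ := desc L
  exact ⟨A, hA, by simpa using h⟩

lemma Rap.order_two (hM : ∀ x, |w x| ≤ M) (H : Rap w) :
    ∃ A, 0 ≤ A ∧ ∀ x v, v ≠ 0 → ‖v‖ ≤ 1 → |(df v ^ 2) w x| ≤ A * ‖v‖ ^ 2 := by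
  have hM0 : 0 ≤ M := (abs_nonneg _).trans (hM 0)
  obtain ⟨C, hC, h4⟩ := H.order_four hM
  have sq2 : ∀ h : ℝ, √(2 * h) = √2 * √h := fun h => sqrt_mul (by norm_num) h
  have s2a : √2 ≤ 1.5 := by rw [sqrt_le_left (by norm_num)]; norm_num
  have s2b : 1.4 ≤ √2 := by apply le_sqrt_of_sq_le; norm_num
  have h3 : ∀ x v, v ≠ 0 → ‖v‖ ≤ 1 → |(df v ^ 3) w x| ≤ (64 * M + 12 * C) * (‖v‖ ^ 2 * √‖v‖) := by
    refine dyadic_induction ?_ ?_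
    · intro v h1 h2 x
      refine (abs_df_pow_le v 3 hM x).trans ?_
      have e1 : (1 / 2 : ℝ) ^ 2 ≤ ‖v‖ ^ 2 := by gcongr
      have e2 : (1 / 2 : ℝ) ≤ √‖v‖ := by apply le_sqrt_of_sq_le; linarith
      have e3 : (1 / 8 : ℝ) ≤ ‖v‖ ^ 2 * √‖v‖ := by nlinarith
      have : 0 ≤ 12 * C * (‖v‖ ^ 2 * √‖v‖) := by positivity
      nlinarith
    · intro v hv h1 h2 x
      rw [norm_two_smul, sq2] at h2
      refine (marchaud_step v 3 h2 (fun y => h4 y v hv (by linarith)) x).trans ?_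
      set s := √‖v‖
      have hss := (sq_sqrt (norm_nonneg v)).symm
      have hs0 : 0 ≤ s := sqrt_nonneg _
      have hs1 : s ≤ 1 := sqrt_le_one.2 (by linarith)
      have e0 : 0 ≤ ‖v‖ ^ 2 * s := by positivity
      have e1 : ‖v‖ ^ 3 ≤ ‖v‖ ^ 2 * s := by
        have : ‖v‖ ≤ s := by rw [hss]; nlinarith
        have := mul_le_mul_of_nonneg_left this (sq_nonneg ‖v‖)
        linarith
      have e2 : (64 * M + 12 * C) * ((2 * ‖v‖) ^ 2 * (√2 * s)) ≤ (64 * M + 12 * C) * (6 * (‖v‖ ^ 2 * s)) := by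
        refine mul_le_mul_of_nonneg_left ?_ (by positivity)
        have := mul_le_mul_of_nonneg_right s2a e0
        nlinarith
      have e3 := mul_le_mul_of_nonneg_left e1 hC
      have e4 : 0 ≤ M * (‖v‖ ^ 2 * s) := by positivity
      have e5 : 0 ≤ C * (‖v‖ ^ 2 * s) := by positivity
      nlinarith
  set B := 64 * M + 12 * C
  have hB0 : 0 ≤ B := by positivity
  have h2 : ∀ x v, v ≠ 0 → ‖v‖ ≤ 1 → |(df v ^ 2) w x| ≤
      (16 * M + 5 * B) * ‖v‖ ^ 2 - 5 * B * (‖v‖ ^ 2 * √‖v‖) := by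
    refine dyadic_induction ?_ ?_
    · intro v h1 h2 x
      refine (abs_df_pow_le v 2 hM x).trans ?_
      have e1 : (1 / 2 : ℝ) ^ 2 ≤ ‖v‖ ^ 2 := by gcongr
      have e2 := sqrt_le_one.2 h2
      have e3 : ‖v‖ ^ 2 * √‖v‖ ≤ ‖v‖ ^ 2 * 1 := by gcongr
      have e4 := mul_le_mul_of_nonneg_left e3 hB0
      nlinarith
    · intro v hv h1 h2 x
      rw [norm_two_smul, sq2] at h2
      refine (marchaud_step v 2 h2 (fun y => h3 y v hv (by linarith)) x).trans ?_
      have e0 : 0 ≤ B * (‖v‖ ^ 2 * √‖v‖) := by positivity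
      have := mul_le_mul_of_nonneg_right s2b e0
      nlinarith
  refine ⟨16 * M + 5 * B, by positivity, fun x v hv hv1 => (h2 x v hv hv1).trans (sub_le_self _ ?_)⟩
  positivity

lemma Rap.dd_approx (hw : ContDiff ℝ ∞ w) (hM : ∀ x, |w x| ≤ M) (H : Rap w) :
    ∃ A, 0 ≤ A ∧ ∀ e : E, e ≠ 0 → ‖e‖ ≤ 1 → ∀ s, 0 < s → s ≤ 1 → ∀ x, |(w (x + s • e) - w x) / s - dd e w x| ≤ A * s := by
  obtain ⟨A, hA, h2⟩ := H.order_two hM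
  refine ⟨A, hA, fun e he0 he s hs hs1 x => ?_⟩
  set a : ℕ → ℝ := fun k => (w (x + (s / 2 ^ k) • e) - w x) / (s / 2 ^ k) with ha
  have hd : Tendsto a atTop (𝓝 (dd e w x)) := by
    have hl := hasDerivAt_line hw (fun r : ℝ => x + r • e) e 0 (by
      simpa using ((hasDerivAt_id (0:ℝ)).smul_const e).const_add x)
    have := hl.tendsto_slope_zero_right
    simp only [zero_smul, add_zero, zero_add] at this
    have ht : Tendsto (fun k : ℕ => s / 2 ^ k) atTop (𝓝[>] 0) := by
      refine tendsto_nhdsWithin_iff.2 ⟨?_, Eventually.of_forall fun k => by simp only [mem_Ioi]; positivity⟩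
      have := (tendsto_pow_atTop_nhds_zero_of_lt_one (r := (1 / 2 : ℝ)) (by norm_num) (by norm_num)).const_mul s
      simpa [div_eq_mul_inv] using this
    have h3 := this.comp ht
    refine h3.congr fun k => ?_
    simp only [Function.comp, smul_eq_mul, ha, div_eq_inv_mul]
  have hdist : ∀ k, dist (a k) (a (k + 1)) ≤ A * s / 2 / 2 ^ k := by
    intro k
    set r := s / 2 ^ (k + 1) with hr
    have hr0 : 0 < r := by positivity
    have hr1 : r ≤ 1 := (div_le_one (by positivity)).2 (hs1.trans (one_le_pow₀ (by norm_num)))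
    have e1 : s / 2 ^ k = 2 * r := by rw [hr, pow_succ]; field_simp
    have h3 := h2 x (r • e) (smul_ne_zero hr0.ne' he0) (by
      rw [norm_smul, norm_of_nonneg hr0.le]; nlinarith)
    rw [df_pow_succ_apply, df_pow_succ_apply, df_pow_succ_apply] at h3
    simp only [pow_zero, Module.End.one_apply] at h3
    rw [norm_smul, norm_of_nonneg hr0.le] at h3
    have e2 : x + r • e + r • e = x + (2 * r) • e := by rw [add_assoc, ← add_smul, two_mul]
    rw [e2] at h3
    have h4 : A * (r * ‖e‖) ^ 2 ≤ A * r ^ 2 := by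
      gcongr
      nlinarith [norm_nonneg e]
    have e3 : A * s / 2 / 2 ^ k = A * r := by rw [hr, pow_succ]; field_simp
    simp only [ha]
    rw [e3, dist_eq, e1]
    have e4 : (w (x + (2 * r) • e) - w x) / (2 * r) - (w (x + r • e) - w x) / r =
      (w (x + (2 * r) • e) - w (x + r • e) - (w (x + r • e) - w x)) / (2 * r) := by field_simp; ring
    rw [← hr, e4, abs_div, abs_of_pos (by positivity : 0 < 2 * r), div_le_iff₀ (by positivity)]
    have : 0 ≤ A * r ^ 2 := by positivity
    nlinarith
  have := dist_le_of_le_geometric_two_of_tendsto₀ hdist hd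
  simpa [ha, dist_eq] using this

lemma Rap.dd_bounded (hw : ContDiff ℝ ∞ w) (hM : ∀ x, |w x| ≤ M) (H : Rap w) :
    ∃ M', ∀ e : E, e ≠ 0 → ‖e‖ ≤ 1 → ∀ x, |dd e w x| ≤ M' := by
  obtain ⟨A, hA, h⟩ := H.dd_approx hw hM
  refine ⟨2 * M + A, fun e he0 he x => ?_⟩
  have h1 := h e he0 he 1 one_pos le_rfl x
  rw [div_one] at h1
  have h2 := abs_sub_abs_le_abs_sub (dd e w x) (w (x + (1:ℝ) • e) - w x)
  rw [abs_sub_comm (dd e w x)] at h2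
  have h3 := abs_sub (w (x + (1:ℝ) • e)) (w x)
  linarith [hM x, hM (x + (1:ℝ) • e)]

lemma Rap.dd_rap (hw : ContDiff ℝ ∞ w) (hM : ∀ x, |w x| ≤ M) (H : Rap w)
    {e : E} (he0 : e ≠ 0) (he : ‖e‖ ≤ 1) : Rap (dd e w) := by
  obtain ⟨A, hA, h⟩ := H.dd_approx hw hM
  intro P
  obtain ⟨L, C, hC, hL⟩ := H (2 * P)
  refine ⟨L, 2 * C + 2 ^ L * A, by positivity, fun x v hv hv1 => ?_⟩
  have hnv := norm_pos_iff.2 hv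
  set s := ‖v‖ ^ P with hs
  have hs0 : 0 < s := by positivity
  have hs1 : s ≤ 1 := pow_le_one₀ hnv.le hv1
  have e1 : dd e w = s⁻¹ • df (s • e) w - ((fun x => (w (x + s • e) - w x) / s - dd e w x)) := by
    funext y
    simp only [Pi.sub_apply, Pi.smul_apply, df_apply, smul_eq_mul]
    ring
  rw [e1, map_sub, map_smul]
  have h1 := abs_df_pow_le v L (fun y => h e he0 he s hs0 hs1 y) x
  have h2 : (df v ^ L) (df (s • e) w) x = (df v ^ L) w (x + s • e) - (df v ^ L) w x := by
    have hc : Commute (df v) (df (s • e)) := by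
      apply LinearMap.ext
      intro g
      funext y
      change g (y + v + s • e) - g (y + v) - (g (y + s • e) - g y) =
        g (y + s • e + v) - g (y + s • e) - (g (y + v) - g y)
      rw [add_right_comm]; ring
    have := congrArg (fun A : Module.End ℝ (E → ℝ) => A w x) (hc.pow_left L).eq
    exact this
  have h3 := hL x v hv hv1
  have h4 := hL (x + s • e) v hv hv1
  have h5 := abs_sub ((df v ^ L) w (x + s • e)) ((df v ^ L) w x)
  simp only [Pi.sub_apply, Pi.smul_apply, smul_eq_mul, h2]
  refine (abs_sub _ _).trans ?_
  rw [abs_mul, abs_of_pos (inv_pos.2 hs0)]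
  have e2 : ‖v‖ ^ (2 * P) = s * s := by rw [hs, two_mul, pow_add]
  rw [e2] at h3 h4
  have h6 : s⁻¹ * |(df v ^ L) w (x + s • e) - (df v ^ L) w x| ≤ s⁻¹ * (2 * C * (s * s)) := by
    gcongr
    linarith
  have e3 : s⁻¹ * (2 * C * (s * s)) = 2 * C * s := by field_simp
  linarith

lemma abs_df_pow_le_of_iteratedFDeriv (v : E) (L : ℕ) (hw : ContDiff ℝ ∞ w)
    (h : ∀ x, |iteratedFDeriv ℝ L w x (fun _ => v)| ≤ M) (x : E) : |(df v ^ L) w x| ≤ M := by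
  induction L generalizing w x with
  | zero => simpa using h x
  | succ L ih =>
    rw [df_pow_succ_apply']
    have hw' : ContDiff ℝ ∞ (fun y => w (y + v)) := hw.comp (contDiff_id.add contDiff_const)
    have hdf : df v w = (fun y => w (y + v)) - w := by funext y; rfl
    refine ih (by rw [hdf]; exact hw'.sub hw) (fun y => ?_) x
    rw [hdf, iteratedFDeriv_sub_apply (hw'.of_le (by exact_mod_cast le_top)).contDiffAt
      (hw.of_le (by exact_mod_cast le_top)).contDiffAt, iteratedFDeriv_comp_add_right]
    have hd := hw.differentiable_iteratedFDeriv (by exact_mod_cast ENat.natCast_lt_top L)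
    have hl : ∀ s : ℝ, HasDerivAt (fun s : ℝ => iteratedFDeriv ℝ L w (y + s • v) (fun _ => v))
        (iteratedFDeriv ℝ (L + 1) w (y + s • v) (fun _ => v)) s := by
      intro s
      have h1 : HasDerivAt (fun r => y + r • v) v s := by
        simpa using ((hasDerivAt_id s).smul_const v).const_add y
      have h2 := (hd (y + s • v)).hasFDerivAt.comp_hasDerivAt s h1
      have h3 := ((ContinuousMultilinearMap.apply ℝ (fun _ : Fin L => E) ℝ (fun _ => v)).hasFDerivAt).comp_hasDerivAt s h2
      rw [iteratedFDeriv_succ_apply_left]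
      exact h3
    have := norm_image_sub_le_of_norm_deriv_le_segment_01' (fun s _ => (hl s).hasDerivWithinAt) (fun s _ => h (y + s • v))
    simpa using this

lemma Rap.iteratedFDeriv_bounded {w : Eu n → ℝ} (hw : ContDiff ℝ ∞ w) (hM : ∀ x, |w x| ≤ M)
    (H : Rap w) (m : ℕ) : ∃ C, ∀ x, ‖iteratedFDeriv ℝ m w x‖ ≤ C := by
  induction m generalizing w M with
  | zero => exact ⟨M, fun x => by rw [norm_iteratedFDeriv_zero]; exact hM x⟩
  | succ m ih =>
    set e : Fin n → Eu n := fun i => single i 1 with he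
    have hne : ∀ i, ‖e i‖ = 1 := fun i => by simp [he]
    have he0 : ∀ i, e i ≠ 0 := fun i => norm_ne_zero_iff.1 (by rw [hne]; norm_num)
    obtain ⟨M', hM'⟩ := H.dd_bounded hw hM
    have hsm : ∀ i, ContDiff ℝ ∞ (dd (e i) w) := fun i => hw.dd (e i)
    have := fun i => ih (hsm i) (hM' (e i) (he0 i) (hne i).le) (H.dd_rap hw hM (he0 i) (hne i).le)
    choose C hC using this
    set ℓ : Fin n → ℝ →L[ℝ] (Eu n →L[ℝ] ℝ) := fun i =>
      ContinuousLinearMap.toSpanSingleton ℝ (EuclideanSpace.proj i : Eu n →L[ℝ] ℝ) with hℓ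
    have hf : fderiv ℝ w = fun x => ∑ i, (ℓ i ∘ dd (e i) w) x := by
      funext x
      ext y
      have hy : y = ∑ i, y i • e i := by
        ext j
        simp [he, Pi.single_apply]
      conv_lhs => rw [hy]
      rw [map_sum]
      simp [hℓ, dd, mul_comm]
    refine ⟨∑ i, ‖ℓ i‖ * C i, fun x => ?_⟩
    rw [← norm_iteratedFDeriv_fderiv, hf, iteratedFDeriv_sum fun i _ =>
      (ℓ i).contDiff.comp ((hsm i).of_le (by exact_mod_cast le_top)), Finset.sum_apply]
    refine (norm_sum_le _ _).trans (sum_le_sum fun i _ => ?_)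
    refine ((ℓ i).norm_iteratedFDeriv_comp_left (hsm i).contDiffAt (by exact_mod_cast le_top)).trans ?_
    exact mul_le_mul_of_nonneg_left (hC i x) (norm_nonneg _)

end Marchaud

/-- Backward propagation of spatial regularity through uniform analyticity in time. -/
lemma iteratedFDeriv_bounded_of_time_analytic {g : ℝ → Eu n → ℝ} (hT : 0 < T) (hZ : 0 < Z)
    (hB : 0 < B) (hg : ∀ t ∈ Icc ts 2, ∀ x, ∀ (k : ℕ) (h : ℝ), 0 < h → k * h ≤ 1 →
      |dq h k (fun s => g (t + T * s) x) 0| ≤ maj Z B k)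
    (hsm : ∀ t ∈ Icc (min ts 1) 2, ContDiff ℝ ∞ (g t)) (hM : ∀ t ∈ Icc ts 2, ∀ x, |g t x| ≤ M)
    (hder : ∀ l : ℕ, 1 ≤ l → ∃ Cl, ∀ t ∈ Icc (1:ℝ) 2, ∀ x, ‖iteratedFDeriv ℝ l (g t) x‖ ≤ Cl)
    (ht : t ∈ Icc ts 2) (m : ℕ) : ∃ C, ∀ x, ‖iteratedFDeriv ℝ m (g t) x‖ ≤ C := by
  have h1 : RT g 1 := by
    intro P
    obtain ⟨Cl, hCl⟩ := hder (P + 1) (by omega)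
    refine ⟨P + 1, |Cl|, abs_nonneg _, fun t ht x v hv hv1 => ?_⟩
    refine (abs_df_pow_le_of_iteratedFDeriv v (P + 1) (M := |Cl| * ‖v‖ ^ (P + 1))
      (hsm t ⟨(min_le_right _ _).trans ht.1, ht.2⟩) (fun y => ?_) x).trans ?_
    · have := (iteratedFDeriv ℝ (P + 1) (g t) y).le_opNorm (fun _ => v)
      simp only [Finset.prod_const, card_univ, Fintype.card_fin] at this
      refine this.trans ?_
      gcongr
      exact (hCl t ht y).trans (le_abs_self _)
    · gcongr ?_ * ?_
      exact pow_le_pow_of_le_one (norm_nonneg _) hv1 (by omega)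
  have h2 := RT.all hT hZ hB hg h1
  refine Rap.iteratedFDeriv_bounded (hsm t ⟨(min_le_left _ _).trans ht.1, ht.2⟩) (hM t ht) (fun P => ?_) m
  obtain ⟨L, C, hC, H⟩ := h2 P
  exact ⟨L, C, hC, fun x v => H t ht x v⟩

section Geometry

lemma exists_bound_of_tendsto_cocompact (hc : Continuous f)
    (ht : Tendsto f (cocompact (Eu n)) (𝓝 a)) : ∃ K, ∀ x, |f x| ≤ K := by
  have h1 : ∀ᶠ x in cocompact (Eu n), |f x - a| < 1 := by
    have := (Metric.tendsto_nhds.1 ht) 1 one_pos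
    simpa [dist_eq] using this
  obtain ⟨s, hs, hst⟩ := mem_cocompact.1 h1
  obtain ⟨K, hK⟩ := hs.exists_bound_of_continuousOn hc.continuousOn
  refine ⟨max K (|a| + 1), fun x => ?_⟩
  by_cases hx : x ∈ s
  · exact (hK x hx).trans (le_max_left _ _)
  · have : |f x - a| < 1 := hst hx
    have h2 := abs_sub_abs_le_abs_sub (f x) a
    exact le_trans (by linarith) (le_max_right _ _)

lemma continuous_pd (hf : ContDiff ℝ ∞ f) (i : Fin n) : Continuous (pd i f) :=
  (hf.continuous_fderiv (by simp)).clm_apply continuous_const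

lemma contDiff_pd (hf : ContDiff ℝ ∞ f) (i : Fin n) : ContDiff ℝ ∞ (pd i f) :=
  (hf.fderiv_right (by simp)).clm_apply contDiff_const

lemma IsAsympFlat.smooth (hσ : IsAsympFlat σ R₀ C Ω) (i j : Fin n) : ContDiff ℝ ∞ fun x => σ x i j := hσ.2.2.1 i j

lemma IsAsympFlat.posDef (hσ : IsAsympFlat σ R₀ C Ω) (x : Eu n) : (σ x).PosDef := hσ.2.2.2.1 x

lemma IsAsympFlat.tendsto_decay (hσ : IsAsympFlat σ R₀ C Ω) :
    Tendsto (fun x : Eu n => C * Ω ‖x‖) (cocompact (Eu n)) (𝓝 0) := by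
  have := (hσ.2.2.2.2.2.1.comp (tendsto_norm_cocompact_atTop (E := Eu n))).const_mul C
  simpa using this

lemma IsAsympFlat.tendsto_apply (hσ : IsAsympFlat σ R₀ C Ω) (i j : Fin n) :
    Tendsto (fun x => σ x i j) (cocompact (Eu n)) (𝓝 ((1 : Matrix (Fin n) (Fin n) ℝ) i j)) := by
  rw [tendsto_iff_dist_tendsto_zero]
  refine squeeze_zero' (Eventually.of_forall fun _ => dist_nonneg) ?_ hσ.tendsto_decay
  filter_upwards [(tendsto_norm_cocompact_atTop).eventually_ge_atTop R₀] with x hx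
  exact (hσ.2.2.2.2.2.2 x hx).1 i j

lemma IsAsympFlat.tendsto_pd (hσ : IsAsympFlat σ R₀ C Ω) (k i j : Fin n) :
    Tendsto (pd k fun y => σ y i j) (cocompact (Eu n)) (𝓝 0) := by
  rw [tendsto_iff_dist_tendsto_zero]
  refine squeeze_zero' (Eventually.of_forall fun _ => dist_nonneg) ?_ hσ.tendsto_decay
  filter_upwards [(tendsto_norm_cocompact_atTop).eventually_gt_atTop R₀,
    (tendsto_norm_cocompact_atTop).eventually_ge_atTop 1] with x hx hx1
  rw [dist_eq, sub_zero]
  refine ((hσ.2.2.2.2.2.2 x hx.le).2 i j k).trans (div_le_self ?_ hx1)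
  obtain ⟨B, hB⟩ := hσ.2.2.2.2.1
  exact mul_nonneg hσ.2.1.le (hB _ hx).1.le

lemma IsAsympFlat.continuousAt_inv {A : Matrix (Fin n) (Fin n) ℝ} (h : A.det ≠ 0) : ContinuousAt Inv.inv A := by
  refine continuousAt_matrix_inv A ?_
  rw [Ring.inverse_eq_inv']
  exact continuousAt_inv₀ h

lemma IsAsympFlat.continuous_inv (hσ : IsAsympFlat σ R₀ C Ω) (i j : Fin n) : Continuous fun x => (σ x)⁻¹ i j := by
  have h1 := continuous_pi fun i => continuous_pi fun j => (hσ.smooth i j).continuous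
  have h2 := continuous_iff_continuousAt.2 fun x =>
    ContinuousAt.comp (IsAsympFlat.continuousAt_inv (hσ.posDef x).det_pos.ne') h1.continuousAt
  exact (continuous_apply_apply i j).comp h2

lemma IsAsympFlat.tendsto_inv (hσ : IsAsympFlat σ R₀ C Ω) (i j : Fin n) :
    Tendsto (fun x => (σ x)⁻¹ i j) (cocompact (Eu n)) (𝓝 ((1 : Matrix (Fin n) (Fin n) ℝ) i j)) := by
  have h3 := (IsAsympFlat.continuousAt_inv (by simp)).tendsto.comp
      (tendsto_pi_nhds.2 fun i => tendsto_pi_nhds.2 fun j => hσ.tendsto_apply i j)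
  rw [inv_one] at h3
  exact ((continuous_apply_apply i j).tendsto (1 : Matrix (Fin n) (Fin n) ℝ)).comp h3

lemma IsAsympFlat.continuous_christoffel (hσ : IsAsympFlat σ R₀ C Ω) (k i j : Fin n) :
    Continuous (christoffel σ k i j) := by
  refine continuous_const.mul (continuous_finsetSum _ fun l _ => (hσ.continuous_inv k l).mul ?_)
  exact ((continuous_pd (hσ.smooth l i) j).add (continuous_pd (hσ.smooth l j) i)).sub (continuous_pd (hσ.smooth i j) l)

lemma IsAsympFlat.tendsto_christoffel (hσ : IsAsympFlat σ R₀ C Ω) (k i j : Fin n) :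
    Tendsto (christoffel σ k i j) (cocompact (Eu n)) (𝓝 0) := by
  have : Tendsto (christoffel σ k i j) (cocompact (Eu n))
      (𝓝 ((1 / 2) * ∑ l, (1 : Matrix (Fin n) (Fin n) ℝ) k l * (0 + 0 - 0))) :=
    tendsto_const_nhds.mul (tendsto_finsetSum _ fun l _ => (hσ.tendsto_inv k l).mul
      (((hσ.tendsto_pd j l i).add (hσ.tendsto_pd i l j)).sub (hσ.tendsto_pd l i j)))
  simpa using this

lemma exists_uniform_bound [Fintype ι] {P : ι → ℝ → Prop} (hP : ∀ i a b, a ≤ b → P i a → P i b)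
    (h : ∀ i, ∃ K, P i K) : ∃ K, 1 ≤ K ∧ ∀ i, P i K := by
  choose K hK using h
  refine ⟨1 + ∑ i, |K i|, by have := sum_nonneg fun i (_ : i ∈ Finset.univ) => abs_nonneg (K i); linarith,
    fun i => hP i _ _ ?_ (hK i)⟩
  have := single_le_sum (fun i _ => abs_nonneg (K i)) (Finset.mem_univ i)
  linarith [le_abs_self (K i)]

lemma IsAsympFlat.bound_inv (hσ : IsAsympFlat σ R₀ C Ω) : ∃ K, 1 ≤ K ∧ ∀ (ij : Fin n × Fin n) x, |(σ x)⁻¹ ij.1 ij.2| ≤ K :=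
  exists_uniform_bound (fun _ _ _ h h' x => (h' x).trans h) fun ij =>
    exists_bound_of_tendsto_cocompact (hσ.continuous_inv ij.1 ij.2) (hσ.tendsto_inv ij.1 ij.2)

lemma IsAsympFlat.bound (hσ : IsAsympFlat σ R₀ C Ω) : ∃ K, 1 ≤ K ∧ ∀ (ij : Fin n × Fin n) x, |σ x ij.1 ij.2| ≤ K :=
  exists_uniform_bound (fun _ _ _ h h' x => (h' x).trans h) fun ij =>
    exists_bound_of_tendsto_cocompact (hσ.smooth ij.1 ij.2).continuous (hσ.tendsto_apply ij.1 ij.2)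

lemma IsAsympFlat.bound_christoffel (hσ : IsAsympFlat σ R₀ C Ω) :
    ∃ K, 1 ≤ K ∧ ∀ (ijk : Fin n × Fin n × Fin n) x, |christoffel σ ijk.1 ijk.2.1 ijk.2.2 x| ≤ K :=
  exists_uniform_bound (fun _ _ _ h h' x => (h' x).trans h) fun ijk =>
    exists_bound_of_tendsto_cocompact (hσ.continuous_christoffel _ _ _) (hσ.tendsto_christoffel _ _ _)

lemma norm_fderiv_le_of_pd (h : ∀ i, |pd i f x| ≤ K) :
    ‖fderiv ℝ f x‖ ≤ n * K := by
  have hK : ∀ i : Fin n, 0 ≤ K := fun i => (abs_nonneg _).trans (h i)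
  have hnK : 0 ≤ n * K := by
    rcases Nat.eq_zero_or_pos n with rfl | hn
    · simp
    · exact mul_nonneg (Nat.cast_nonneg _) (hK ⟨0, hn⟩)
  refine ContinuousLinearMap.opNorm_le_bound _ hnK fun y => ?_
  have hy : y = ∑ i, y i • (single i (1:ℝ) : Eu n) := by
    ext j
    simp [Pi.single_apply]
  conv_lhs => rw [hy]
  rw [map_sum]
  refine (norm_sum_le _ _).trans ?_
  have : ∀ i ∈ Finset.univ, ‖fderiv ℝ f x (y i • (single i (1:ℝ) : Eu n))‖ ≤ K * ‖y‖ := by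
    intro i _
    rw [map_smul, norm_smul, mul_comm]
    exact mul_le_mul (h i) (PiLp.norm_apply_le y i) (norm_nonneg _) (hK i)
  refine (sum_le_sum this).trans (le_of_eq ?_)
  simp; ring

lemma lipschitz_of_pd (hf : ContDiff ℝ ∞ f) (h : ∀ i x, |pd i f x| ≤ K) (x y : Eu n) :
    |f x - f y| ≤ n * K * ‖x - y‖ :=
  Convex.norm_image_sub_le_of_norm_fderiv_le (fun z _ => (hf.differentiable (by simp)) z)
    (fun z _ => norm_fderiv_le_of_pd fun i => h i z) convex_univ (mem_univ y) (mem_univ x)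

lemma IsAsympFlat.lipschitz_inv (hσ : IsAsympFlat σ R₀ C Ω) :
    ∃ K, 0 ≤ K ∧ ∀ i j x y, |(σ x)⁻¹ i j - (σ y)⁻¹ i j| ≤ K * ‖x - y‖ := by
  obtain ⟨K, hK1, hK⟩ := hσ.bound_inv
  obtain ⟨D, hD1, hD⟩ : ∃ D, 1 ≤ D ∧ ∀ (ijk : Fin n × Fin n × Fin n) x, |pd ijk.1 (fun y => σ y ijk.2.1 ijk.2.2) x| ≤ D :=
    exists_uniform_bound (fun _ _ _ h h' x => (h' x).trans h) fun ijk =>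
      exists_bound_of_tendsto_cocompact (continuous_pd (hσ.smooth _ _) _) (hσ.tendsto_pd _ _ _)
  refine ⟨n * (n * (K * (n * D) * K)), by positivity, fun i j x y => ?_⟩
  have e : (σ x)⁻¹ - (σ y)⁻¹ = (σ x)⁻¹ * (σ y - σ x) * (σ y)⁻¹ := by
    rw [mul_sub, sub_mul, Matrix.mul_assoc, Matrix.mul_nonsing_inv _ (hσ.posDef y).det_pos.ne'.isUnit,
      Matrix.nonsing_inv_mul _ (hσ.posDef x).det_pos.ne'.isUnit, Matrix.mul_one, Matrix.one_mul]
  rw [← Matrix.sub_apply, e, Matrix.mul_apply]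
  have h1 : ∀ k l, |(σ x)⁻¹ i k * (σ y - σ x) k l * (σ y)⁻¹ l j| ≤ K * (n * D * ‖x - y‖) * K := by
    intro k l
    rw [abs_mul, abs_mul]
    have h2 : |(σ y - σ x) k l| ≤ n * D * ‖x - y‖ := by
      rw [Matrix.sub_apply, abs_sub_comm]
      exact lipschitz_of_pd (hσ.smooth k l) (fun m z => hD (m, k, l) z) x y
    gcongr
    · exact hK (i, k) x
    · exact hK (l, j) y
  calc |∑ l, ((σ x)⁻¹ * (σ y - σ x)) i l * (σ y)⁻¹ l j|
      ≤ ∑ l, ∑ k, |(σ x)⁻¹ i k * (σ y - σ x) k l * (σ y)⁻¹ l j| := by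
        refine (abs_sum_le_sum_abs _ _).trans (sum_le_sum fun l _ => ?_)
        rw [Matrix.mul_apply, sum_mul]
        exact abs_sum_le_sum_abs _ _
    _ ≤ ∑ l : Fin n, ∑ k : Fin n, K * (n * D * ‖x - y‖) * K := by gcongr with l _ k _; exact h1 k l
    _ = _ := by simp; ring

/-- Uniform ellipticity of the inverse metric. -/
lemma IsAsympFlat.elliptic_inv (hσ : IsAsympFlat σ R₀ C Ω) :
    ∃ c, 0 < c ∧ ∀ x (ξ : Fin n → ℝ), c * ∑ i, ξ i ^ 2 ≤ ∑ i, ∑ j, (σ x)⁻¹ i j * (ξ i * ξ j) := by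
  obtain ⟨K, hK1, hK⟩ := hσ.bound
  refine ⟨1 / (n * K + 1), by positivity, fun x ξ => ?_⟩
  set A := n * K + 1 with hA
  have hpd := hσ.posDef x
  set η := Matrix.mulVec (σ x)⁻¹ ξ with hη
  have h1 := hpd.posSemidef.dotProduct_mulVec_nonneg (η - (1 / A) • ξ)
  have hση : Matrix.mulVec (σ x) η = ξ := by
    rw [hη, Matrix.mulVec_mulVec, Matrix.mul_nonsing_inv _ hpd.det_pos.ne'.isUnit, Matrix.one_mulVec]
  have hsym : dotProduct η (Matrix.mulVec (σ x) ξ) = dotProduct ξ ξ := by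
    have ht : (σ x).transpose = σ x := by simpa [Matrix.IsSymm] using hpd.isHermitian
    rw [Matrix.dotProduct_mulVec, ← Matrix.mulVec_transpose, ht, hση]
  have hup : dotProduct ξ (Matrix.mulVec (σ x) ξ) ≤ A * dotProduct ξ ξ := by
    have h2 : dotProduct ξ (Matrix.mulVec (σ x) ξ) = ∑ i, ∑ j, σ x i j * (ξ i * ξ j) := by
      simp only [dotProduct, Matrix.mulVec, mul_sum]
      refine sum_congr rfl fun i _ => sum_congr rfl fun j _ => by ring
    have h3 : ∀ i j, σ x i j * (ξ i * ξ j) ≤ K * ((ξ i ^ 2 + ξ j ^ 2) / 2) := by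
      intro i j
      refine (le_abs_self _).trans ?_
      rw [abs_mul]
      refine mul_le_mul (hK (i, j) x) ?_ (abs_nonneg _) (by linarith)
      rw [abs_le]; constructor <;> nlinarith [sq_nonneg (ξ i + ξ j), sq_nonneg (ξ i - ξ j)]
    have h4 : ∑ i, ∑ j, K * ((ξ i ^ 2 + ξ j ^ 2) / 2) = n * K * ∑ i, ξ i ^ 2 := by
      simp only [← mul_sum, ← sum_div, sum_add_distrib, sum_const, card_univ,
        Fintype.card_fin, nsmul_eq_mul]
      ring
    have h5 : dotProduct ξ ξ = ∑ i, ξ i ^ 2 := by simp [dotProduct, sq]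
    have h6 : 0 ≤ ∑ i, ξ i ^ 2 := sum_nonneg fun i _ => sq_nonneg _
    rw [h2, h5]
    refine (sum_le_sum fun i _ => sum_le_sum fun j _ => h3 i j).trans ?_
    rw [h4, hA]; linarith
  have e2 : ∑ i, ∑ j, (σ x)⁻¹ i j * (ξ i * ξ j) = dotProduct ξ η := by
    simp only [dotProduct, hη, Matrix.mulVec, mul_sum]
    refine sum_congr rfl fun i _ => sum_congr rfl fun j _ => by ring
  have e3 : ∑ i, ξ i ^ 2 = dotProduct ξ ξ := by simp [dotProduct, sq]
  rw [e2, e3]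
  simp only [star_trivial, Matrix.mulVec_sub, Matrix.mulVec_smul, sub_dotProduct, dotProduct_sub, hση,
    smul_dotProduct, dotProduct_smul, smul_eq_mul, hsym] at h1
  rw [dotProduct_comm η ξ] at h1
  have h7 : 1 / A * (1 / A * dotProduct ξ (Matrix.mulVec (σ x) ξ)) ≤ 1 / A * (1 / A * (A * dotProduct ξ ξ)) := by gcongr
  have h8 : 1 / A * (1 / A * (A * dotProduct ξ ξ)) = 1 / A * dotProduct ξ ξ := by field_simp
  linarith

end Geometry

section BoundedLipschitz

variable {X : Type*} {D : X → X → ℝ}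

/-- Bounded functions which are Lipschitz with respect to `D`. -/
def LB (D : X → X → ℝ) (f : X → ℝ) : Prop := ∃ K, ∀ x, |f x| ≤ K ∧ ∀ y, |f x - f y| ≤ K * D x y

lemma LB.add {f g : X → ℝ} (hf : LB D f) (hg : LB D g) : LB D fun x => f x + g x := by
  obtain ⟨K, hK⟩ := hf
  obtain ⟨L, hL⟩ := hg
  refine ⟨K + L, fun x => ⟨(abs_add_le _ _).trans (add_le_add (hK x).1 (hL x).1), fun y => ?_⟩⟩
  have e : f x + g x - (f y + g y) = (f x - f y) + (g x - g y) := by ring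
  rw [e, add_mul]
  exact (abs_add_le _ _).trans (add_le_add ((hK x).2 y) ((hL x).2 y))

lemma LB.mul (hD : ∀ x y, 0 ≤ D x y) {f g : X → ℝ} (hf : LB D f) (hg : LB D g) : LB D fun x => f x * g x := by
  obtain ⟨K, hK⟩ := hf
  obtain ⟨L, hL⟩ := hg
  refine ⟨2 * |K| * |L|, fun x => ⟨?_, fun y => ?_⟩⟩
  · rw [abs_mul]
    have h1 := mul_le_mul ((hK x).1.trans (le_abs_self K)) ((hL x).1.trans (le_abs_self L)) (abs_nonneg _) (abs_nonneg _)
    have : 0 ≤ |K| * |L| := by positivity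
    linarith
  · have e : f x * g x - f y * g y = (f x - f y) * g x + f y * (g x - g y) := by ring
    rw [e]
    refine (abs_add_le _ _).trans ?_
    rw [abs_mul, abs_mul]
    have hd := hD x y
    have h1 : |f x - f y| ≤ |K| * D x y := ((hK x).2 y).trans (by gcongr; exact le_abs_self K)
    have h2 : |g x - g y| ≤ |L| * D x y := ((hL x).2 y).trans (by gcongr; exact le_abs_self L)
    have h3 := mul_le_mul h1 ((hL x).1.trans (le_abs_self L)) (abs_nonneg _) (by positivity)
    have h4 := mul_le_mul ((hK y).1.trans (le_abs_self K)) h2 (abs_nonneg _) (abs_nonneg _)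
    linarith

lemma LB.const (hD : ∀ x y, 0 ≤ D x y) (c : ℝ) : LB D fun _ => c :=
  ⟨|c|, fun x => ⟨le_rfl, fun y => by rw [sub_self, abs_zero]; exact mul_nonneg (abs_nonneg _) (hD x y)⟩⟩

lemma LB.sum [Fintype ι] {f : ι → X → ℝ} (hf : ∀ i, LB D (f i)) :
    LB D fun x => ∑ i, f i x := by
  choose K hK using hf
  refine ⟨∑ i, K i, fun x => ⟨(abs_sum_le_sum_abs _ _).trans (sum_le_sum fun i _ => (hK i x).1), fun y => ?_⟩⟩
  rw [← sum_sub_distrib, sum_mul]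
  exact (abs_sum_le_sum_abs _ _).trans (sum_le_sum fun i _ => (hK i x).2 y)

lemma LB.inv (hD : ∀ x y, 0 ≤ D x y) {f : X → ℝ} (hf : LB D f) (hc : 0 < c) (h : ∀ x, c ≤ f x) :
    LB D fun x => (f x)⁻¹ := by
  obtain ⟨K, hK⟩ := hf
  refine ⟨max c⁻¹ (K * (c⁻¹ * c⁻¹)), fun x => ⟨?_, fun y => ?_⟩⟩
  · rw [abs_inv, abs_of_pos (hc.trans_le (h x))]
    exact (inv_anti₀ hc (h x)).trans (le_max_left _ _)
  · have hx := hc.trans_le (h x)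
    have hy := hc.trans_le (h y)
    have e : (f x)⁻¹ - (f y)⁻¹ = (f y - f x) * ((f x)⁻¹ * (f y)⁻¹) := by field_simp
    rw [e, abs_mul, abs_sub_comm, abs_of_pos (by positivity : 0 < (f x)⁻¹ * (f y)⁻¹)]
    have h1 : (f x)⁻¹ * (f y)⁻¹ ≤ c⁻¹ * c⁻¹ := mul_le_mul (inv_anti₀ hc (h x)) (inv_anti₀ hc (h y)) (by positivity) (by positivity)
    have h2 := mul_le_mul ((hK x).2 y) h1 (by positivity) ((abs_nonneg _).trans ((hK x).2 y))
    refine h2.trans ?_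
    have := mul_le_mul_of_nonneg_right (le_max_right c⁻¹ (K * (c⁻¹ * c⁻¹))) (hD x y)
    linarith

end BoundedLipschitz

section ParFlow

/-- A graphical flow written as a uniformly parabolic equation with coefficients `a`, `B`. -/
structure ParFlow (c K : ℝ) (a : ℝ → Eu n → Fin n → Fin n → ℝ) (B : ℝ → Eu n → Fin n → ℝ)
    (u : ℝ → Eu n → ℝ) : Prop where
  smooth : ContDiffOn ℝ ∞ (fun p : SpT n => u p.1 p.2) (Ioi 0 ×ˢ univ)
  eq : ∀ t, 0 < t → ∀ x, HasDerivAt (fun s => u s x)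
    (∑ i, ∑ j, a t x i j * pd i (fun y => pd j (u t) y) x - ∑ k, B t x k * pd k (u t) x) t
  ell : ∀ t, 0 < t → ∀ x (ξ : Fin n → ℝ), c * ∑ i, ξ i ^ 2 ≤ ∑ i, ∑ j, a t x i j * (ξ i * ξ j)
  symm : ∀ t, 0 < t → ∀ x i j, a t x i j = a t x j i
  bdd : ∀ t, 0 < t → ∀ x i j, |a t x i j| ≤ K
  lip : ∀ t, 0 < t → ∀ x y i j,
    |a t x i j - a t y i j| ≤ K * (‖x - y‖ + ∑ k, |pd k (u t) x - pd k (u t) y|)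
  drift : ∀ t, 0 < t → ∀ x k, |B t x k| ≤ K
  decay : ∀ δ, 0 < δ → ∃ R, ∀ t, 0 < t → ∀ x, R ≤ ‖x‖ → ∀ k, |B t x k| ≤ δ
  grad : ∀ t, 0 < t → ∀ x k, |pd k (u t) x| ≤ K

lemma ParFlow.smooth_slice {a : ℝ → Eu n → Fin n → Fin n → ℝ} {B : ℝ → Eu n → Fin n → ℝ}
    (h : ParFlow c K a B u) (ht : 0 < t) : ContDiff ℝ ∞ (u t) := by
  have : ContDiffOn ℝ ∞ (fun y : Eu n => u t y) univ :=
    h.smooth.comp (contDiff_const.prodMk contDiff_id).contDiffOn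
      fun y _ => ⟨ht, mem_univ _⟩
  exact contDiffOn_univ.1 this

lemma IsAsympFlat.symm_inv (hσ : IsAsympFlat σ R₀ C Ω) (x : Eu n) (i j : Fin n) : (σ x)⁻¹ i j = (σ x)⁻¹ j i := by
  have := (hσ.posDef x).isHermitian.inv
  simpa using (this.apply j i)

lemma ginv_symm (hσ : IsAsympFlat σ R₀ C Ω) (w : Eu n → ℝ) (x : Eu n) (i j : Fin n) :
    ginv σ w i j x = ginv σ w j i x := by
  unfold ginv
  rw [hσ.symm_inv x i j, sum_comm]
  congr 2
  refine sum_congr rfl fun k _ => sum_congr rfl fun l _ => by ring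

lemma gradSq_nonneg (hσ : IsAsympFlat σ R₀ C Ω) (w : Eu n → ℝ) (x : Eu n) : 0 ≤ gradSq σ w x := by
  obtain ⟨c, hc, h⟩ := hσ.elliptic_inv
  have h1 := h x fun i => pd i w x
  refine ((mul_nonneg hc.le (sum_nonneg fun i _ => sq_nonneg _)).trans h1).trans (le_of_eq ?_)
  exact sum_congr rfl fun k _ => sum_congr rfl fun l _ => by ring

lemma gradSq_le_of_sqrt (hσ : IsAsympFlat σ R₀ C Ω) (hκ : 0 < κ)
    (h : √(gradSq σ w x) ≤ 1 - κ) : κ ≤ 1 - gradSq σ w x := by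
  have h1 := sq_sqrt (gradSq_nonneg hσ w x)
  have h0 := sqrt_nonneg (gradSq σ w x)
  nlinarith

lemma ginv_elliptic (hq : gradSq σ w x < 1)
    (h : ∀ ξ : Fin n → ℝ, c * ∑ i, ξ i ^ 2 ≤ ∑ i, ∑ j, (σ x)⁻¹ i j * (ξ i * ξ j)) (ξ : Fin n → ℝ) :
    c * ∑ i, ξ i ^ 2 ≤ ∑ i, ∑ j, ginv σ w i j x * (ξ i * ξ j) := by
  refine (h ξ).trans ?_
  have e : ∑ i, ∑ j, ginv σ w i j x * (ξ i * ξ j) = ∑ i, ∑ j, (σ x)⁻¹ i j * (ξ i * ξ j) +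
      (∑ i, ξ i * ∑ k, (σ x)⁻¹ i k * pd k w x) ^ 2 / (1 - gradSq σ w x) := by
    rw [sq, sum_mul_sum, sum_div, ← sum_add_distrib]
    refine sum_congr rfl fun i _ => ?_
    rw [sum_div, ← sum_add_distrib]
    refine sum_congr rfl fun j _ => ?_
    unfold ginv
    rw [add_mul]
    congr 1
    rw [div_mul_eq_mul_div]
    congr 1
    have : ∑ k, ∑ l, (σ x)⁻¹ i k * (σ x)⁻¹ j l * pd k w x * pd l w x =
        (∑ k, (σ x)⁻¹ i k * pd k w x) * ∑ l, (σ x)⁻¹ j l * pd l w x := by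
      rw [sum_mul_sum]
      exact sum_congr rfl fun k _ => sum_congr rfl fun l _ => by ring
    rw [this]; ring
  rw [e]
  have : 0 ≤ (∑ i, ξ i * ∑ k, (σ x)⁻¹ i k * pd k w x) ^ 2 / (1 - gradSq σ w x) :=
    div_nonneg (sq_nonneg _) (by linarith)
  linarith

lemma exists_flow (hσ : IsAsympFlat σ R₀ C Ω)
    (hsmooth : ContDiffOn ℝ ∞ (fun p : SpT n => u p.1 p.2) (Ioi 0 ×ˢ univ))
    (hκ : 0 < κ) (hspace : ∀ t : ℝ, 0 < t → ∀ x, √(gradSq σ (u t) x) ≤ 1 - κ)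
    (heq : ∀ (x : Eu n) (t : ℝ), 0 < t → HasDerivAt (fun s => u s x) (mcfOp σ (u t) x) t) :
    ∃ c K, 0 < c ∧ 1 ≤ K ∧ ParFlow c K (fun t x i j => ginv σ (u t) i j x)
      (fun t x k => ∑ i, ∑ j, ginv σ (u t) i j x * christoffel σ k i j x) u := by
  obtain ⟨c, hc, hell⟩ := hσ.elliptic_inv
  obtain ⟨KS, hKS1, hKS⟩ := hσ.bound_inv
  obtain ⟨LS, hLS0, hLS⟩ := hσ.lipschitz_inv
  obtain ⟨KΓ, hKΓ1, hKΓ⟩ := hσ.bound_christoffel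
  have hq : ∀ t, 0 < t → ∀ x, κ ≤ 1 - gradSq σ (u t) x := fun t ht x => gradSq_le_of_sqrt hσ hκ (hspace t ht x)
  have hgr : ∀ t, 0 < t → ∀ x k, |pd k (u t) x| ≤ 1 + c⁻¹ := by
    intro t ht x k
    have h1 := hell x fun i => pd i (u t) x
    have h2 : ∑ i, ∑ j, (σ x)⁻¹ i j * (pd i (u t) x * pd j (u t) x) = gradSq σ (u t) x :=
      sum_congr rfl fun k _ => sum_congr rfl fun l _ => by ring
    rw [h2] at h1
    have h3 := single_le_sum (fun i _ => sq_nonneg (pd i (u t) x)) (Finset.mem_univ k)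
    have h4 := hq t ht x
    have h5 : (pd k (u t) x) ^ 2 ≤ c⁻¹ := by
      rw [← one_div, le_div_iff₀ hc]
      nlinarith
    refine abs_le_of_sq_le_sq ?_ (by positivity)
    have : 0 < c⁻¹ := inv_pos.2 hc
    nlinarith
  let X := {t : ℝ // 0 < t} × Eu n
  let D : X → X → ℝ := fun p q => ‖p.2 - q.2‖ + ∑ k, |pd k (u p.1.1) p.2 - pd k (u q.1.1) q.2|
  have hD : ∀ p q, 0 ≤ D p q := fun p q => by
    have := sum_nonneg fun k (_ : k ∈ Finset.univ) => abs_nonneg (pd k (u p.1.1) p.2 - pd k (u q.1.1) q.2)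
    have := norm_nonneg (p.2 - q.2)
    simp only [D]; linarith
  have lS : ∀ i j, LB D fun p : X => (σ p.2)⁻¹ i j := fun i j => by
    refine ⟨max KS LS, fun p => ⟨(hKS (i, j) p.2).trans (le_max_left _ _), fun q => (hLS i j p.2 q.2).trans ?_⟩⟩
    have h1 : ‖p.2 - q.2‖ ≤ D p q := by
      have := sum_nonneg fun k (_ : k ∈ Finset.univ) => abs_nonneg (pd k (u p.1.1) p.2 - pd k (u q.1.1) q.2)
      simp only [D]; linarith
    exact mul_le_mul (le_max_right _ _) h1 (norm_nonneg _) (hLS0.trans (le_max_right _ _))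
  have lp : ∀ k, LB D fun p : X => pd k (u p.1.1) p.2 := fun k => by
    refine ⟨1 + c⁻¹, fun p => ⟨hgr _ p.1.2 _ _, fun q => ?_⟩⟩
    have h1 : |pd k (u p.1.1) p.2 - pd k (u q.1.1) q.2| ≤ D p q := by
      have := single_le_sum (fun k _ => abs_nonneg (pd k (u p.1.1) p.2 - pd k (u q.1.1) q.2)) (Finset.mem_univ k)
      have := norm_nonneg (p.2 - q.2)
      simp only [D]; linarith
    have := inv_pos.2 hc
    nlinarith [hD p q]
  have lq : LB D fun p : X => 1 - gradSq σ (u p.1.1) p.2 := by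
    have h1 : LB D fun p : X => gradSq σ (u p.1.1) p.2 :=
      LB.sum fun i => LB.sum fun j => ((lS i j).mul hD (lp i)).mul hD (lp j)
    have := (LB.const hD 1).add ((LB.const hD (-1)).mul hD h1)
    convert this using 2
    ring
  have lg : ∀ i j, LB D fun p : X => ginv σ (u p.1.1) i j p.2 := fun i j => by
    refine (lS i j).add ?_
    have h1 : LB D fun p : X => ∑ k, ∑ l, (σ p.2)⁻¹ i k * (σ p.2)⁻¹ j l * pd k (u p.1.1) p.2 * pd l (u p.1.1) p.2 :=
      LB.sum fun k => LB.sum fun l => (((lS i k).mul hD (lS j l)).mul hD (lp k)).mul hD (lp l)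
    exact h1.mul hD (lq.inv hD hκ fun p => hq _ p.1.2 p.2)
  obtain ⟨G, hG1, hG⟩ : ∃ G, 1 ≤ G ∧ ∀ ij : Fin n × Fin n, ∀ p : X, |ginv σ (u p.1.1) ij.1 ij.2 p.2| ≤ G ∧
      ∀ q : X, |ginv σ (u p.1.1) ij.1 ij.2 p.2 - ginv σ (u q.1.1) ij.1 ij.2 q.2| ≤ G * D p q :=
    exists_uniform_bound (fun _ a b hab h p => ⟨(h p).1.trans hab, fun q => ((h p).2 q).trans
      (mul_le_mul_of_nonneg_right hab (hD p q))⟩) fun ij => lg ij.1 ij.2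
  have hB : ∀ t, 0 < t → ∀ x k, |∑ i, ∑ j, ginv σ (u t) i j x * christoffel σ k i j x| ≤
      ∑ i, ∑ j, G * |christoffel σ k i j x| := by
    intro t ht x k
    refine (abs_sum_le_sum_abs _ _).trans (sum_le_sum fun i _ =>
      (abs_sum_le_sum_abs _ _).trans (sum_le_sum fun j _ => ?_))
    rw [abs_mul]
    exact mul_le_mul_of_nonneg_right (hG (i, j) (⟨t, ht⟩, x)).1 (abs_nonneg _)
  have hci : 0 < c⁻¹ := inv_pos.2 hc
  have hG0 : 0 ≤ G := by linarith
  have hKΓ0 : 0 ≤ KΓ := by linarith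
  have hnn : 0 ≤ n * (n * (G * KΓ)) := by positivity
  refine ⟨c, G + (1 + c⁻¹) + n * (n * (G * KΓ)), hc, by linarith, ?_⟩
  refine ⟨hsmooth, fun t ht x => ?_, fun t ht x ξ => ginv_elliptic (by linarith [hq t ht x]) (hell x) ξ,
    fun t ht x i j => ginv_symm hσ _ _ _ _, fun t ht x i j => ?_, fun t ht x y i j => ?_, fun t ht x k => ?_, fun δ hδ => ?_,
    fun t ht x k => (hgr t ht x k).trans (by linarith)⟩
  · have := heq x t ht
    have e : mcfOp σ (u t) x = ∑ i, ∑ j, ginv σ (u t) i j x * pd i (fun y => pd j (u t) y) x -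
        ∑ k, (∑ i, ∑ j, ginv σ (u t) i j x * christoffel σ k i j x) * pd k (u t) x := by
      unfold mcfOp covHess
      have e1 : ∑ k, (∑ i, ∑ j, ginv σ (u t) i j x * christoffel σ k i j x) * pd k (u t) x =
          ∑ i, ∑ j, ginv σ (u t) i j x * ∑ k, christoffel σ k i j x * pd k (u t) x := by
        simp only [sum_mul, mul_sum]
        rw [sum_comm]
        refine sum_congr rfl fun i _ => ?_
        rw [sum_comm]
        exact sum_congr rfl fun j _ => sum_congr rfl fun k _ => by ring
      rw [e1]
      simp only [mul_sub, sum_sub_distrib]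
    rw [e] at this
    exact this
  · have := (hG (i, j) (⟨t, ht⟩, x)).1
    exact this.trans (by linarith)
  · have := (hG (i, j) (⟨t, ht⟩, x)).2 (⟨t, ht⟩, y)
    refine this.trans (mul_le_mul_of_nonneg_right (by linarith) (hD (⟨t, ht⟩, x) (⟨t, ht⟩, y)))
  · refine (hB t ht x k).trans ?_
    have : ∑ i, ∑ j, G * |christoffel σ k i j x| ≤ ∑ _i : Fin n, ∑ _j : Fin n, G * KΓ := by
      gcongr with i _ j _
      exact hKΓ (k, i, j) x
    simp only [sum_const, card_univ, Fintype.card_fin, nsmul_eq_mul] at this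
    linarith
  · have h1 : ∀ k, Tendsto (fun x => ∑ i, ∑ j, G * |christoffel σ k i j x|) (cocompact (Eu n)) (𝓝 0) := by
      intro k
      have : Tendsto (fun x => ∑ i, ∑ j, G * |christoffel σ k i j x|) (cocompact (Eu n)) (𝓝 (∑ _i : Fin n, ∑ _j : Fin n, G * |0|)) :=
        tendsto_finsetSum _ fun i _ => tendsto_finsetSum _ fun j _ =>
          tendsto_const_nhds.mul (hσ.tendsto_christoffel k i j).abs
      simpa using this
    have h2 := eventually_all.2 fun k => ((h1 k).eventually (ge_mem_nhds hδ))
    obtain ⟨s, hs, hst⟩ := mem_cocompact.1 h2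
    obtain ⟨R, hR⟩ := hs.isBounded.exists_norm_le
    refine ⟨R + 1, fun t ht x hx k => (hB t ht x k).trans ?_⟩
    exact hst (fun h => by have := hR x h; linarith) k

end ParFlow

section SecondDerivativeTest

lemma second_derivative_test {f f' : ℝ → ℝ} {f'' : ℝ} (h1 : ∀ s, HasDerivAt f (f' s) s)
    (h2 : HasDerivAt f' f'' 0) (h : ∀ᶠ s in 𝓝 0, f s ≤ f 0 + b * s + d * s ^ 2) : f' 0 = b ∧ f'' ≤ 2 * d := by
  have g1 : ∀ s, HasDerivAt (fun s => f s - b * s - d * s ^ 2) (f' s - b - d * (2 * s)) s := fun s => by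
    have h := ((h1 s).sub ((hasDerivAt_id' s).const_mul b)).sub (((hasDerivAt_id' s).pow 2).const_mul d)
    suffices hval : f' s - b * 1 - d * ((2 : ℕ) * s ^ (2 - 1) * 1) = f' s - b - d * (2 * s) by rw [← hval]; exact h
    simp
  have g2 : HasDerivAt (fun s => f' s - b - d * (2 * s)) (f'' - d * 2) 0 := by
    have h := (h2.sub_const b).sub (((hasDerivAt_id' (0 : ℝ)).const_mul 2).const_mul d)
    suffices hval : f'' - d * (2 * 1) = f'' - d * 2 by rw [← hval]; exact h
    ring
  have hd1 := funext fun s => (g1 s).deriv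
  have hmax : IsLocalMax (fun s => f s - b * s - d * s ^ 2) 0 := h.mono fun s hs => by
    linarith
  have h0 := hmax.hasDerivAt_eq_zero (g1 0)
  refine ⟨by linarith, ?_⟩
  by_contra! hlt
  have hdd : deriv (deriv fun s => f s - b * s - d * s ^ 2) 0 = f'' - d * 2 := by rw [hd1]; exact g2.deriv
  have hmin := isLocalMin_of_deriv_deriv_pos (by rw [hdd]; linarith) (by rw [hd1]; exact h0) (g1 0).continuousAt
  have heq : (fun s => f s - b * s - d * s ^ 2) =ᶠ[𝓝 0] fun _ => f 0 - b * 0 - d * 0 ^ 2 := by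
    filter_upwards [hmax, hmin] with s a b using le_antisymm a b
  have h3 : deriv (deriv fun s => f s - b * s - d * s ^ 2) 0 = 0 := by
    have := heq.deriv.deriv_eq
    rw [this]; simp
  rw [hdd] at h3
  linarith

lemma deriv_nonneg_of_left_max {f : ℝ → ℝ} {f' : ℝ} (hf : HasDerivAt f f' t) (hat : a < t)
    (h : ∀ s ∈ Icc a t, f s ≤ f t) : 0 ≤ f' := by
  have h1 := hasDerivWithinAt_iff_tendsto_slope.1 (hf.hasDerivWithinAt (s := Iio t))
  rw [sdiff_singleton_eq_self (by simp)] at h1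
  refine ge_of_tendsto h1 ?_
  have := Ioo_mem_nhdsLT hat
  filter_upwards [this] with s hs
  rw [slope_def_field]
  exact div_nonneg_of_nonpos (by linarith [h s ⟨hs.1.le, hs.2.le⟩]) (by linarith [hs.2])

lemma dd_eq_sum_pd (w : Eu n → ℝ) (ξ x : Eu n) : dd ξ w x = ∑ i, ξ i * pd i w x := by
  have hy : ξ = ∑ i, ξ i • single i (1 : ℝ) := by ext j; simp [Pi.single_apply]
  unfold dd pd
  conv_lhs => rw [hy]
  rw [map_sum]
  exact sum_congr rfl fun i _ => by rw [map_smul, smul_eq_mul]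

lemma dd_dd_eq_sum_pd (hw : ContDiff ℝ ∞ w) (ξ x : Eu n) :
    dd ξ (dd ξ w) x = ∑ i, ∑ j, pd i (fun y => pd j w y) x * (ξ i * ξ j) := by
  have e := funext fun x => dd_eq_sum_pd w ξ x
  rw [dd_eq_sum_pd]
  refine sum_congr rfl fun i _ => ?_
  have h : pd i (dd ξ w) x = ∑ j, ξ j * pd i (fun y => pd j w y) x := by
    rw [e]
    change dd _ _ x = _
    rw [dd_sum _ (fun j _ => contDiff_const.mul (contDiff_pd hw j))]
    refine sum_congr rfl fun j _ => ?_
    rw [dd_const_mul (contDiff_pd hw j)]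
    rfl
  rw [h, mul_sum]
  exact sum_congr rfl fun j _ => by ring

lemma hasDerivAt_ray (hw : ContDiff ℝ ∞ w) (x ξ : Eu n) (s : ℝ) :
    HasDerivAt (fun s : ℝ => w (x + s • ξ)) (dd ξ w (x + s • ξ)) s := by
  refine hasDerivAt_line hw (fun s => x + s • ξ) ξ s ?_
  have := ((hasDerivAt_id s).smul_const ξ).const_add x
  simpa using this

/-- First and second order conditions at a point where a difference of values of `w` at two points is touched from above. -/
lemma two_point_test (hw : ContDiff ℝ ∞ w) {η : Eu n}
    (h : ∀ᶠ s : ℝ in 𝓝 0, w (x + s • ξ) - w (y + s • η) ≤ w x - w y + b * s + d * s ^ 2) :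
    (∑ i, ξ i * pd i w x - ∑ i, η i * pd i w y = b) ∧
    (∑ i, ∑ j, pd i (fun z => pd j w z) x * (ξ i * ξ j) - ∑ i, ∑ j, pd i (fun z => pd j w z) y * (η i * η j) ≤ 2 * d) := by
  have := second_derivative_test (f := fun s => w (x + s • ξ) - w (y + s • η))
    (fun s => (hasDerivAt_ray hw x ξ s).sub (hasDerivAt_ray hw y η s))
    ((hasDerivAt_ray (hw.dd ξ) x ξ 0).sub (hasDerivAt_ray (hw.dd η) y η 0))
    (b := b) (d := d) (by simpa using h)
  simpa only [zero_smul, add_zero, dd_dd_eq_sum_pd hw, dd_eq_sum_pd] using this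

lemma trace_mul_le {P X : Fin n → Fin n → ℝ} {m : ℝ} (hs : ∀ i j, P i j = P j i)
    (hP : ∀ ξ : Fin n → ℝ, 0 ≤ ∑ i, ∑ j, P i j * (ξ i * ξ j))
    (hX : ∀ ξ : Fin n → ℝ, ∑ i, ∑ j, X i j * (ξ i * ξ j) ≤ m * ∑ i, ξ i ^ 2) :
    ∑ i, ∑ j, P i j * X i j ≤ m * ∑ i, P i i := by
  have hpsd : (Matrix.of P).PosSemidef := by
    refine Matrix.PosSemidef.of_dotProduct_mulVec_nonneg (by ext i j; simp [hs j i]) fun ξ => ?_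
    refine (hP ξ).trans (le_of_eq ?_)
    simp only [dotProduct, Matrix.mulVec, mul_sum, Matrix.of_apply]
    exact sum_congr rfl fun i _ => sum_congr rfl fun j _ => by
      simp only [Pi.star_apply, star_trivial]; ring
  obtain ⟨m', L, hL⟩ := Matrix.posSemidef_iff_eq_sum_vecMulVec.1 hpsd
  have e := fun i j => by
    have := congrFun (congrFun hL i) j
    simpa [Matrix.sum_apply, Matrix.vecMulVec_apply] using this
  have e1 : ∑ i, ∑ j, P i j * X i j = ∑ k, ∑ i, ∑ j, X i j * (L k i * L k j) := by
    symm
    rw [sum_comm]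
    refine sum_congr rfl fun i _ => ?_
    rw [sum_comm]
    refine sum_congr rfl fun j _ => ?_
    rw [e, sum_mul]
    exact sum_congr rfl fun k _ => by ring
  have e2 : ∑ i, P i i = ∑ k, ∑ i, L k i ^ 2 := by
    rw [sum_comm]
    exact sum_congr rfl fun i _ => by rw [e]; exact sum_congr rfl fun k _ => by ring
  rw [e1, e2, mul_sum]
  exact sum_le_sum fun k _ => hX (L k)

end SecondDerivativeTest

section Doubling

lemma sub_mul_sqrt_le (hr : 0 < r) (hρ : 0 ≤ ρ) :
    ρ - ρ * √ρ ≤ r - r * √r + (1 - 3 / 2 * √r) * (ρ - r) ∧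
    (ρ ≤ 4 * r → ρ - ρ * √ρ ≤ r - r * √r + (1 - 3 / 2 * √r) * (ρ - r) - (ρ - r) ^ 2 / (12 * √r)) := by
  set q := √r
  set p := √ρ
  have hq0 : 0 < q := sqrt_pos.2 hr
  have hp0 : 0 ≤ p := sqrt_nonneg _
  have er := (sq_sqrt hr.le).symm
  have eρ := (sq_sqrt hρ).symm
  have key : ρ - ρ * p = r - r * q + (1 - 3 / 2 * q) * (ρ - r) - (p - q) ^ 2 * (p + q / 2) := by
    rw [er, eρ]; ring
  constructor
  · rw [key]
    have : 0 ≤ (p - q) ^ 2 * (p + q / 2) := by positivity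
    linarith
  · intro h
    rw [key]
    have : (ρ - r) ^ 2 / (12 * q) ≤ (p - q) ^ 2 * (p + q / 2) := by
      rw [div_le_iff₀ (by positivity), er, eρ]
      have e : (p ^ 2 - q ^ 2) ^ 2 = (p - q) ^ 2 * (p + q) ^ 2 := by ring
      have h2 : (p + q) ^ 2 ≤ (p + q / 2) * (12 * q) := by nlinarith [mul_nonneg hp0 hq0.le]
      rw [e, mul_assoc]
      exact mul_le_mul_of_nonneg_left h2 (sq_nonneg _)
    linarith

lemma norm_add_smul_le {V : Type*} [NormedAddCommGroup V] [InnerProductSpace ℝ V] {z : V} (hz : 0 < ‖z‖) (ζ : V) (s : ℝ) :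
    ‖z + s • ζ‖ ≤ ‖z‖ + inner ℝ z ζ / ‖z‖ * s + ‖ζ‖ ^ 2 / (2 * ‖z‖) * s ^ 2 := by
  have h1 : ‖z + s • ζ‖ ^ 2 = ‖z‖ ^ 2 + 2 * (s * inner ℝ z ζ) + s ^ 2 * ‖ζ‖ ^ 2 := by
    rw [norm_add_sq_real, inner_smul_right, norm_smul, mul_pow, norm_eq_abs, sq_abs]
  have h2 : ‖z‖ + inner ℝ z ζ / ‖z‖ * s + ‖ζ‖ ^ 2 / (2 * ‖z‖) * s ^ 2 = (‖z + s • ζ‖ ^ 2 + ‖z‖ ^ 2) / (2 * ‖z‖) := by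
    rw [h1]; field_simp; ring
  rw [h2, le_div_iff₀ (by positivity)]
  nlinarith [sq_nonneg (‖z + s • ζ‖ - ‖z‖)]

/-- Comparison of the traces of `Ax X` and `Ay Y` for an elliptic `Ay` and a small perturbation `Ax`. -/
lemma trace_gap {Ax Ay X Y : Fin n → Fin n → ℝ} {e : Fin n → ℝ} {θ m₁ m₂ m₃ m₄ : ℝ} (hc : 0 ≤ c) (hθ : 0 ≤ θ)
    (hm₁ : 0 ≤ m₁) (hm₂ : 0 ≤ m₂)
    (hell : ∀ ξ : Fin n → ℝ, c * ∑ i, ξ i ^ 2 ≤ ∑ i, ∑ j, Ay i j * (ξ i * ξ j))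
    (hsx : ∀ i j, Ax i j = Ax j i) (hsy : ∀ i j, Ay i j = Ay j i) (hb : ∀ i j, |Ay i j| ≤ K)
    (hd : ∀ i j, |Ax i j - Ay i j| ≤ θ) (hnθ : n * θ ≤ c / 2) (he : ∑ i, e i ^ 2 = 1)
    (hXY : ∀ ξ : Fin n → ℝ, ∑ i, ∑ j, X i j * (ξ i * ξ j) - ∑ i, ∑ j, Y i j * (ξ i * ξ j) ≤ m₁ * ∑ i, ξ i ^ 2)
    (hX : ∀ ξ : Fin n → ℝ, ∑ i, ∑ j, X i j * (ξ i * ξ j) ≤ m₂ * ∑ i, ξ i ^ 2)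
    (hY : ∀ ξ : Fin n → ℝ, -∑ i, ∑ j, Y i j * (ξ i * ξ j) ≤ m₃ * ∑ i, ξ i ^ 2)
    (hE : ∑ i, ∑ j, X i j * (e i * e j) - ∑ i, ∑ j, Y i j * (e i * e j) ≤ -m₄) :
    ∑ i, ∑ j, Ax i j * X i j - ∑ i, ∑ j, Ay i j * Y i j ≤
      m₁ * (n * K) - c / 2 * m₄ + m₂ * (n * θ + n * (n * θ)) + n * θ * (n * m₃) := by
  let d : Fin n → Fin n → ℝ := fun i j => if i = j then 1 else 0
  have hdd : ∀ ξ : Fin n → ℝ, ∑ i, ∑ j, d i j * (ξ i * ξ j) = ∑ i, ξ i ^ 2 := fun ξ =>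
    sum_congr rfl fun i _ => by simp [d, sq]
  have hds : ∀ i j, d i j = d j i := fun i j => by simp only [d, eq_comm]
  have hdi : ∀ i, d i i = 1 := fun i => by simp [d]
  have hnθ0 : 0 ≤ n * θ := by positivity
  have T1 : ∑ i, ∑ j, (Ay i j - n * θ * d i j - c / 2 * (e i * e j)) * (X i j - Y i j) ≤
      m₁ * ∑ i, (Ay i i - n * θ * d i i - c / 2 * (e i * e i)) := by
    refine trace_mul_le (fun i j => by rw [hsy i j, hds i j, mul_comm (e i)]) (fun ξ => ?_) fun ξ => ?_
    · have h1 : ∑ i, ∑ j, (Ay i j - n * θ * d i j - c / 2 * (e i * e j)) * (ξ i * ξ j) =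
          ∑ i, ∑ j, Ay i j * (ξ i * ξ j) - n * θ * ∑ i, ξ i ^ 2 - c / 2 * (∑ i, e i * ξ i) ^ 2 := by
        rw [← hdd ξ, sq, sum_mul_sum, mul_sum, mul_sum, ← sum_sub_distrib, ← sum_sub_distrib]
        refine sum_congr rfl fun i _ => ?_
        rw [mul_sum, mul_sum, ← sum_sub_distrib, ← sum_sub_distrib]
        exact sum_congr rfl fun j _ => by ring
      have h2 := Finset.sum_mul_sq_le_sq_mul_sq Finset.univ e ξ
      rw [he, one_mul] at h2
      have h3 : 0 ≤ ∑ i, ξ i ^ 2 := sum_nonneg fun i _ => sq_nonneg _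
      have h4 := mul_le_mul_of_nonneg_right hnθ h3
      have h5 := mul_le_mul_of_nonneg_left h2 (by linarith : 0 ≤ c / 2)
      rw [h1]
      linarith [hell ξ]
    · refine le_of_eq_of_le ?_ (hXY ξ)
      simp only [sub_mul, sum_sub_distrib]
  have T1' : ∑ i, (Ay i i - n * θ * d i i - c / 2 * (e i * e i)) ≤ n * K := by
    have : ∑ i, (Ay i i - n * θ * d i i - c / 2 * (e i * e i)) ≤ ∑ _i : Fin n, K := by
      refine sum_le_sum fun i _ => ?_
      have h1 := le_of_abs_le (hb i i)
      have h2 : 0 ≤ c / 2 * (e i * e i) := mul_nonneg (by linarith) (mul_self_nonneg _)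
      rw [hdi]; linarith
    simpa using this
  have T2 : ∑ i, ∑ j, (Ax i j - Ay i j + n * θ * d i j) * X i j ≤ m₂ * ∑ i, (Ax i i - Ay i i + n * θ * d i i) := by
    refine trace_mul_le (fun i j => by rw [hsy i j, hsx i j, hds i j]) (fun ξ => ?_) hX
    have h1 : ∑ i, ∑ j, (Ax i j - Ay i j + n * θ * d i j) * (ξ i * ξ j) =
        ∑ i, ∑ j, (Ax i j - Ay i j) * (ξ i * ξ j) + n * θ * ∑ i, ξ i ^ 2 := by
      rw [← hdd ξ, mul_sum, ← sum_add_distrib]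
      refine sum_congr rfl fun i _ => ?_
      rw [mul_sum, ← sum_add_distrib]
      exact sum_congr rfl fun j _ => by ring
    have h2 : |∑ i, ∑ j, (Ax i j - Ay i j) * (ξ i * ξ j)| ≤ θ * (∑ i, |ξ i|) ^ 2 := by
      rw [sq, sum_mul_sum, mul_sum]
      refine (abs_sum_le_sum_abs _ _).trans (sum_le_sum fun i _ => ?_)
      rw [mul_sum]
      refine (abs_sum_le_sum_abs _ _).trans (sum_le_sum fun j _ => ?_)
      rw [abs_mul, abs_mul]
      exact mul_le_mul_of_nonneg_right (hd i j) (by positivity)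
    have h3 : (∑ i, |ξ i|) ^ 2 ≤ n * ∑ i, ξ i ^ 2 := by
      have := sq_sum_le_card_mul_sum_sq (s := Finset.univ) (f := fun i => |ξ i|)
      simpa using this
    have h4 := mul_le_mul_of_nonneg_left h3 hθ
    rw [h1]
    linarith [(abs_le.1 h2).1]
  have T2' : ∑ i, (Ax i i - Ay i i + n * θ * d i i) ≤ n * θ + n * (n * θ) := by
    have : ∑ i, (Ax i i - Ay i i + n * θ * d i i) ≤ ∑ _i : Fin n, (θ + n * θ) := by
      refine sum_le_sum fun i _ => ?_
      have h1 := le_of_abs_le (hd i i)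
      rw [hdi]; linarith
    simp only [sum_const, card_univ, Fintype.card_fin, nsmul_eq_mul] at this
    linarith
  have T3 : ∑ i, ∑ j, d i j * -Y i j ≤ m₃ * ∑ i, d i i := by
    refine trace_mul_le hds (fun ξ => ?_) fun ξ => ?_
    · rw [hdd]; exact sum_nonneg fun i _ => sq_nonneg _
    · simpa only [neg_mul, sum_neg_distrib] using hY ξ
  have T3' : ∑ i, d i i = (n : ℝ) := by simp [hdi]
  have key : ∑ i, ∑ j, Ax i j * X i j - ∑ i, ∑ j, Ay i j * Y i j =
      ∑ i, ∑ j, (Ay i j - n * θ * d i j - c / 2 * (e i * e j)) * (X i j - Y i j) +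
      c / 2 * (∑ i, ∑ j, X i j * (e i * e j) - ∑ i, ∑ j, Y i j * (e i * e j)) +
      ∑ i, ∑ j, (Ax i j - Ay i j + n * θ * d i j) * X i j + n * θ * ∑ i, ∑ j, d i j * -Y i j := by
    simp only [mul_sum, ← sum_sub_distrib, ← sum_add_distrib]
    exact sum_congr rfl fun i _ => sum_congr rfl fun j _ => by ring
  rw [key]
  have := mul_le_mul_of_nonneg_left T1' hm₁
  have := mul_le_mul_of_nonneg_left T2' hm₂
  have := mul_le_mul_of_nonneg_left hE (by linarith : 0 ≤ c / 2)
  rw [T3'] at T3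
  have := mul_le_mul_of_nonneg_left T3 hnθ0
  linarith

/-- First and second order conditions at an interior maximum of the doubled function. -/
lemma doubled_max_test (hw : ContDiff ℝ ∞ w) {x₀ : Eu n} (hM : 0 ≤ M)
    (hr : 0 < ‖x - y‖) (hr' : ‖x - y‖ ≤ 1 / 4)
    (h : ∀ᶠ p : Eu n × Eu n in 𝓝 (x, y),
      w p.1 - w p.2 - M * (‖p.1 - p.2‖ - ‖p.1 - p.2‖ * √‖p.1 - p.2‖) - 4 * δ * ‖p.1 - x₀‖ ^ 2 ≤
      w x - w y - M * (‖x - y‖ - ‖x - y‖ * √‖x - y‖) - 4 * δ * ‖x - x₀‖ ^ 2) :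
    (∀ k, pd k w x - pd k w y = 8 * δ * (x - x₀) k) ∧
    (∀ ξ η : Eu n, ∑ i, ∑ j, pd i (fun z => pd j w z) x * (ξ i * ξ j) - ∑ i, ∑ j, pd i (fun z => pd j w z) y * (η i * η j) ≤
      M / ‖x - y‖ * ‖ξ - η‖ ^ 2 + 8 * δ * ‖ξ‖ ^ 2) ∧
    ∃ e : Eu n, ‖e‖ = 1 ∧
      ∑ i, ∑ j, pd i (fun z => pd j w z) x * (e i * e j) - ∑ i, ∑ j, pd i (fun z => pd j w z) y * (e i * e j) ≤
      -(2 * M / (3 * √‖x - y‖) - 8 * δ) := by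
  set r := ‖x - y‖ with hrdef
  set q := √r with hq
  have hq0 : 0 < q := sqrt_pos.2 hr
  have hq2 : q ≤ 1 / 2 := sqrt_le_iff.2 ⟨by norm_num, by linarith⟩
  have hray : ∀ ξ η, ∀ᶠ s : ℝ in 𝓝 0, w (x + s • ξ) - w (y + s • η) ≤ w x - w y +
      M * ((‖(x - y) + s • (ξ - η)‖ - ‖(x - y) + s • (ξ - η)‖ * √‖(x - y) + s • (ξ - η)‖) - (r - r * q)) +
      4 * δ * (2 * inner ℝ (x - x₀) ξ * s + ‖ξ‖ ^ 2 * s ^ 2) := by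
    intro ξ η
    have hc : Tendsto (fun s : ℝ => (x + s • ξ, y + s • η)) (𝓝 0) (𝓝 (x, y)) := by
      have : Continuous fun s : ℝ => (x + s • ξ, y + s • η) := by fun_prop
      have := this.tendsto 0
      simpa using this
    filter_upwards [hc.eventually h] with s hs
    have e1 : x + s • ξ - (y + s • η) = (x - y) + s • (ξ - η) := by rw [smul_sub]; abel
    have e2 : ‖x + s • ξ - x₀‖ ^ 2 = ‖x - x₀‖ ^ 2 + (2 * inner ℝ (x - x₀) ξ * s + ‖ξ‖ ^ 2 * s ^ 2) := by
      have : x + s • ξ - x₀ = (x - x₀) + s • ξ := by abel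
      rw [this, norm_add_sq_real, inner_smul_right, norm_smul, mul_pow, norm_eq_abs, sq_abs]; ring
    rw [e1, e2] at hs
    linarith
  have hgen : ∀ ξ η, ∀ᶠ s : ℝ in 𝓝 0, w (x + s • ξ) - w (y + s • η) ≤ w x - w y +
      (M * (1 - 3 / 2 * q) * (inner ℝ (x - y) (ξ - η) / r) + 8 * δ * inner ℝ (x - x₀) ξ) * s +
      (M * (‖ξ - η‖ ^ 2 / (2 * r)) + 4 * δ * ‖ξ‖ ^ 2) * s ^ 2 := by
    intro ξ η
    filter_upwards [hray ξ η] with s hs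
    have h1 := (sub_mul_sqrt_le hr (norm_nonneg ((x - y) + s • (ξ - η)))).1
    have h2 := norm_add_smul_le hr (ξ - η) s
    have h3 : (1 - 3 / 2 * q) * (‖(x - y) + s • (ξ - η)‖ - r) ≤
        (1 - 3 / 2 * q) * (inner ℝ (x - y) (ξ - η) / r * s) + ‖ξ - η‖ ^ 2 / (2 * r) * s ^ 2 := by
      have h4 := mul_le_mul_of_nonneg_left h2 (by linarith : 0 ≤ 1 - 3 / 2 * q)
      have h5 : 0 ≤ ‖ξ - η‖ ^ 2 / (2 * r) * s ^ 2 := by positivity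
      have h6 := mul_nonneg (by linarith : 0 ≤ 3 / 2 * q) h5
      linarith
    have h7 := mul_le_mul_of_nonneg_left (h1.trans (add_le_add_right h3 (r - r * q))) hM
    linarith
  refine ⟨fun k => ?_, fun ξ η => ?_, r⁻¹ • (x - y), ?_, ?_⟩
  · have := (two_point_test hw (hgen (single k 1) (single k 1))).1
    simpa [Pi.single_apply, EuclideanSpace.inner_single_right] using this
  · refine (two_point_test hw (hgen ξ η)).2.trans (le_of_eq ?_)
    field_simp
    ring
  · rw [norm_smul, norm_inv, norm_eq_abs, abs_of_pos hr, ← hrdef, inv_mul_cancel₀ hr.ne']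
  · set e := r⁻¹ • (x - y) with he
    have hne : ‖e‖ = 1 := by rw [he, norm_smul, norm_inv, norm_eq_abs, abs_of_pos hr, ← hrdef, inv_mul_cancel₀ hr.ne']
    have hev : ∀ᶠ s : ℝ in 𝓝 0, w (x + s • e) - w (y + s • -e) ≤ w x - w y +
        (M * (1 - 3 / 2 * q) * 2 + 8 * δ * inner ℝ (x - x₀) e) * s + (-(M / (3 * q)) + 4 * δ) * s ^ 2 := by
      have hs : ∀ᶠ s : ℝ in 𝓝 0, |s| < r / 2 := by
        have : ∀ᶠ s : ℝ in 𝓝 0, s ∈ Metric.ball (0 : ℝ) (r / 2) := Metric.ball_mem_nhds _ (by positivity)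
        simpa [dist_eq] using this
      filter_upwards [hray e (-e), hs] with s h1 h2
      have h3 := abs_lt.1 h2
      have e1 : ‖(x - y) + s • (e - -e)‖ = r + 2 * s := by
        have : (x - y) + s • (e - -e) = (1 + 2 * s * r⁻¹) • (x - y) := by
          rw [he, sub_neg_eq_add, ← two_smul ℝ (r⁻¹ • (x - y)), smul_smul, smul_smul, add_smul, one_smul]
          congr 2; ring
        rw [this, norm_smul, ← hrdef, norm_eq_abs]
        have e2 : (1 + 2 * s * r⁻¹) * r = r + 2 * s := by field_simp
        have : 0 < (1 + 2 * s * r⁻¹) * r := by rw [e2]; linarith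
        rw [abs_of_pos (pos_of_mul_pos_left this hr.le), e2]
      rw [e1, hne] at h1
      have h4 := (sub_mul_sqrt_le hr (by linarith : 0 ≤ r + 2 * s)).2 (by linarith)
      have e3 : (r + 2 * s - r) ^ 2 / (12 * q) = s ^ 2 / (3 * q) := by field_simp; ring
      rw [← hq, e3] at h4
      have h5 := mul_le_mul_of_nonneg_left h4 hM
      have e4 : M / (3 * q) * s ^ 2 = M * (s ^ 2 / (3 * q)) := by ring
      linarith
    have := (two_point_test hw hev).2
    simp only [PiLp.neg_apply, neg_mul_neg] at this
    refine this.trans (le_of_eq ?_)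
    ring

end Doubling

section GradientDecay

lemma doubling_constants {k : ℝ} (hN : 1 ≤ N) (hK : 1 ≤ K) (hc : 0 < c) (hτ : 0 < τ) (hq : 0 < q)
    (hq' : q ≤ 1 / 2) (hδ : 0 < δ) (hδM : δ ≤ M) (hμ : 0 ≤ μ) (hk : k = K * (q + 8 * N * μ))
    (h1 : (4 / τ + 10 * (N * K) + 4 * c + 19 * (N ^ 2 * K)) * q ≤ c / 12) (h2 : 152 * (N ^ 3 * K) * μ ≤ c / 12)
    (h : -(4 * δ / τ) ≤ 8 * δ * (N * K) - c / 2 * (2 * M / (3 * q) - 8 * δ) +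
      (M / q ^ 2 + 8 * δ) * (N * (q * k) + N * (N * (q * k))) + N * (q * k) * (N * (M / q ^ 2)) + 2 * (N * (δ * K))) : False := by
  obtain ⟨P, hP⟩ : ∃ P, P = M / q := ⟨_, rfl⟩
  have hM : M = P * q := by rw [hP]; field_simp
  have hP0 : 0 < P := by rw [hP]; exact div_pos (hδ.trans_le hδM) hq
  have hk0 : 0 ≤ k := by rw [hk]; positivity
  have hN2 : N ≤ N ^ 2 := by nlinarith
  have e1 : 2 * M / (3 * q) = 2 / 3 * P := by rw [hM]; field_simp
  have e2 : (M / q ^ 2 + 8 * δ) * (N * (q * k) + N * (N * (q * k))) = P * k * (N + N ^ 2) + 8 * (δ * (q * k * (N + N ^ 2))) := by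
    rw [hM]; field_simp
  have e3 : N * (q * k) * (N * (M / q ^ 2)) = N ^ 2 * (P * k) := by rw [hM]; field_simp
  rw [e1, e2, e3] at h
  have hPk : 0 ≤ P * k := by positivity
  have b1 : P * k * (N + N ^ 2) ≤ P * k * (2 * N ^ 2) := mul_le_mul_of_nonneg_left (by linarith) hPk
  have b2 : δ * (q * k * (N + N ^ 2)) ≤ 1 / 4 * (P * k * (2 * N ^ 2)) := by
    have s1 : δ * (q * k * (N + N ^ 2)) ≤ P * q * (q * k * (2 * N ^ 2)) :=
      mul_le_mul (hM ▸ hδM) (mul_le_mul_of_nonneg_left (by linarith) (by positivity)) (by positivity) (by positivity)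
    have s2 : q * q ≤ 1 / 4 := by nlinarith
    have s3 := mul_le_mul_of_nonneg_right s2 (by positivity : 0 ≤ P * k * (2 * N ^ 2))
    linarith
  have hS : 0 ≤ 4 / τ + 10 * (N * K) + 4 * c := by positivity
  have b3 := mul_le_mul_of_nonneg_right (hM ▸ hδM) hS
  have e4 : 4 * δ / τ = δ * (4 / τ) := by ring
  rw [e4] at h
  have b4 : c / 3 * P ≤ P * (q * (4 / τ + 10 * (N * K) + 4 * c) + 7 * N ^ 2 * k) := by linarith
  have b5 : c / 3 ≤ q * (4 / τ + 10 * (N * K) + 4 * c) + 7 * N ^ 2 * k := by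
    rw [mul_comm] at b4
    exact le_of_mul_le_mul_left b4 hP0
  have e5 : 7 * N ^ 2 * k = 7 * (N ^ 2 * K * q) + 56 * (N ^ 3 * K * μ) := by rw [hk]; ring
  have b6 : 0 ≤ N ^ 2 * K * q := by positivity
  have b7 : 0 ≤ N ^ 3 * K * μ := by positivity
  rw [e5] at b5
  linarith

variable {a : ℝ → Eu n → Fin n → Fin n → ℝ} {B : ℝ → Eu n → Fin n → ℝ}

lemma ParFlow.abs_drift_le (hF : ParFlow c K a B u) (ht : 0 < t) (hδ : ∀ k, |B t x k| ≤ δ) :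
    |∑ k, B t x k * pd k (u t) x| ≤ n * (δ * K) := by
  refine (abs_sum_le_sum_abs _ _).trans ?_
  have : ∑ k, |B t x k * pd k (u t) x| ≤ ∑ _k : Fin n, δ * K := sum_le_sum fun k _ => by
    rw [abs_mul]
    exact mul_le_mul (hδ k) (hF.grad t ht x k) (abs_nonneg _) ((abs_nonneg _).trans (hδ k))
  simpa using this

/-- The interior maximum of the doubled function is excluded by the equation. -/
lemma ParFlow.no_interior_max (hF : ParFlow c K a B u) (hn : 0 < n) (hc : 0 < c) (hK : 1 ≤ K) {x₀ : Eu n}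
    (ht : 0 < t) (hτ : 0 < τ) (hδ : 0 < δ) (hδM : δ ≤ M) (hμ : 0 ≤ μ) (hδμ : δ * (n * K) ≤ μ ^ 2)
    (hr : 0 < ‖x - y‖) (hr' : ‖x - y‖ ≤ 1 / 4)
    (h1 : (4 / τ + 10 * (n * K) + 4 * c + 19 * ((n : ℝ) ^ 2 * K)) * √‖x - y‖ ≤ c / 12) (h2 : 152 * ((n : ℝ) ^ 3 * K) * μ ≤ c / 12)
    (hBx : ∀ k, |B t x k| ≤ δ) (hBy : ∀ k, |B t y k| ≤ δ) (hpos : 4 * δ * ‖x - x₀‖ ^ 2 ≤ u t x - u t y)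
    (hmax : ∀ᶠ p : Eu n × Eu n in 𝓝 (x, y),
      u t p.1 - u t p.2 - M * (‖p.1 - p.2‖ - ‖p.1 - p.2‖ * √‖p.1 - p.2‖) - 4 * δ * ‖p.1 - x₀‖ ^ 2 ≤
      u t x - u t y - M * (‖x - y‖ - ‖x - y‖ * √‖x - y‖) - 4 * δ * ‖x - x₀‖ ^ 2)
    (htime : -(4 * δ / τ) ≤
      (∑ i, ∑ j, a t x i j * pd i (fun y => pd j (u t) y) x - ∑ k, B t x k * pd k (u t) x) -
      (∑ i, ∑ j, a t y i j * pd i (fun y => pd j (u t) y) y - ∑ k, B t y k * pd k (u t) y)) : False := by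
  have hM : 0 ≤ M := hδ.le.trans hδM
  have hN : (1 : ℝ) ≤ n := by exact_mod_cast hn
  have hw := hF.smooth_slice ht
  obtain ⟨hp, hQ, e, hne, hE⟩ := doubled_max_test hw hM hr hr' hmax
  set r := ‖x - y‖ with hrdef
  obtain ⟨q, hq⟩ : ∃ q, q = √r := ⟨_, rfl⟩
  rw [← hq] at h1 hE
  have hq0 : 0 < q := hq ▸ sqrt_pos.2 hr
  have hq2 : q ≤ 1 / 2 := hq ▸ sqrt_le_iff.2 ⟨by norm_num, by linarith⟩
  have hrq : r = q ^ 2 := hq ▸ (sq_sqrt hr.le).symm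
  obtain ⟨k, hk⟩ : ∃ k, k = K * (q + 8 * n * μ) := ⟨_, rfl⟩
  have hk0 : 0 ≤ k := by rw [hk]; positivity
  have hloc : δ * ‖x - x₀‖ ≤ μ * q := by
    have l1 := (le_abs_self _).trans (lipschitz_of_pd hw (fun i x => hF.grad t ht x i) x y)
    rw [← hrdef, hrq] at l1
    refine abs_le_of_sq_le_sq' ?_ (by positivity) |>.2
    have l2 := mul_le_mul_of_nonneg_left (hpos.trans l1) hδ.le
    have l3 := mul_le_mul_of_nonneg_right hδμ (sq_nonneg q)
    have l4 : 0 ≤ (δ * ‖x - x₀‖) ^ 2 := sq_nonneg _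
    linarith
  have hθ : ∀ i j, |a t x i j - a t y i j| ≤ q * k := by
    intro i j
    refine (hF.lip t ht x y i j).trans ?_
    have s1 : ∑ k, |pd k (u t) x - pd k (u t) y| ≤ ∑ _k : Fin n, 8 * (μ * q) := sum_le_sum fun k _ => by
      rw [hp k, abs_mul, abs_of_pos (by positivity : 0 < 8 * δ)]
      have := PiLp.norm_apply_le (x - x₀) k
      rw [norm_eq_abs] at this
      have := mul_le_mul_of_nonneg_left this hδ.le
      linarith
    rw [sum_const, card_univ, Fintype.card_fin, nsmul_eq_mul] at s1
    rw [← hrdef, hrq, hk]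
    have := mul_le_mul_of_nonneg_left s1 (by linarith : 0 ≤ K)
    linarith
  have hq2' : q * q ≤ 1 * q := mul_le_mul_of_nonneg_right (by linarith) hq0.le
  have hnθ : n * (q * k) ≤ c / 2 := by
    have s1 : n * (q * k) ≤ n * k := by
      have : q * k ≤ 1 * k := mul_le_mul_of_nonneg_right (by linarith) hk0
      exact mul_le_mul_of_nonneg_left (by linarith) (by linarith)
    have s2 : n * k = n * K * q + 8 * ((n : ℝ) ^ 2 * K * μ) := by rw [hk]; ring
    have s3 : 0 ≤ (4 / τ + 9 * (n * K) + 4 * c + 19 * ((n : ℝ) ^ 2 * K)) * q := by positivity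
    have s4 : (n : ℝ) ^ 2 * K * μ ≤ (n : ℝ) ^ 3 * K * μ := by
      gcongr
      norm_num
    have s5 : 0 ≤ (n : ℝ) ^ 3 * K * μ := by positivity
    linarith
  have hsq : ∀ ξ : Fin n → ℝ, ‖(WithLp.toLp 2 ξ : Eu n)‖ ^ 2 = ∑ i, ξ i ^ 2 := fun ξ => by
    rw [EuclideanSpace.real_norm_sq_eq]
  have hMr : 0 ≤ M / r := by positivity
  have gap := trace_gap (Ax := a t x) (Ay := a t y) (X := fun i j => pd i (fun z => pd j (u t) z) x)
    (Y := fun i j => pd i (fun z => pd j (u t) z) y) (e := e) (θ := q * k) (m₁ := 8 * δ) (m₂ := M / r + 8 * δ) (m₃ := M / r)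
    hc.le (by positivity) (by positivity) (by positivity) (hF.ell t ht y) (hF.symm t ht x) (hF.symm t ht y) (hF.bdd t ht y)
    hθ hnθ (by rw [← EuclideanSpace.real_norm_sq_eq, hne]; norm_num)
    (fun ξ => by
      have := hQ (WithLp.toLp 2 ξ) (WithLp.toLp 2 ξ)
      rw [sub_self, hsq ξ] at this
      simpa using this)
    (fun ξ => by
      have := hQ (WithLp.toLp 2 ξ) 0
      rw [sub_zero, hsq ξ, ← add_mul] at this
      simpa using this)
    (fun ξ => by
      have := hQ 0 (WithLp.toLp 2 ξ)
      rw [zero_sub, norm_neg, hsq ξ] at this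
      simpa using this)
    hE
  have dx := abs_le.1 (hF.abs_drift_le ht hBx)
  have dy := abs_le.1 (hF.abs_drift_le ht hBy)
  rw [hrq] at gap
  refine doubling_constants hN hK hc hτ hq0 hq2 hδ hδM hμ hk h1 h2 ?_
  linarith [dy.2]

lemma dd_le_of_sub_le (hw : ContDiff ℝ ∞ w) (hr : 0 < r) (hξ : ‖ξ‖ = 1)
    (h : ∀ y, ‖x - y‖ ≤ r → w x - w y ≤ M * ‖x - y‖) : dd ξ w x ≤ M := by
  have h1 := hasDerivAt_ray hw x ξ 0
  rw [zero_smul, add_zero] at h1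
  have h2 : HasDerivAt (fun s : ℝ => M * s - w (x + s • ξ)) (M * 1 - dd ξ w x) 0 := ((hasDerivAt_id' (0 : ℝ)).const_mul M).sub h1
  have := deriv_nonneg_of_left_max h2 (a := -r) (by linarith) fun s hs => by
    have e : ‖x - (x + s • ξ)‖ = -s := by
      rw [sub_add_cancel_left, norm_neg, norm_smul, hξ, mul_one, norm_eq_abs, abs_of_nonpos hs.2]
    have := h (x + s • ξ) (by rw [e]; linarith [hs.1])
    rw [e] at this
    rw [zero_smul, add_zero, mul_zero]
    linarith
  linarith

set_option maxHeartbeats 1600000 in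
lemma ParFlow.grad_decay (hF : ParFlow c K a B u) (hn : 0 < n) (hc : 0 < c) (hK : 1 ≤ K)
    (hu : ∀ δ, 0 < δ → ∃ R, ∀ t, 0 < t → ∀ x, R ≤ ‖x‖ → |u t x| ≤ δ) (ht₀ : 0 < t₀) (hε : 0 < ε) :
    ∃ R, ∀ t, t₀ ≤ t → ∀ x, R ≤ ‖x‖ → ∀ k, |pd k (u t) x| ≤ ε := by
  obtain ⟨τ, hτ⟩ : ∃ τ, τ = t₀ / 2 := ⟨_, rfl⟩
  have hτ0 : 0 < τ := by rw [hτ]; positivity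
  obtain ⟨C₁, hC₁⟩ : ∃ C₁, C₁ = 4 / τ + 10 * (n * K) + 4 * c + 19 * ((n : ℝ) ^ 2 * K) := ⟨_, rfl⟩
  have hC₁0 : 0 < C₁ := by rw [hC₁]; positivity
  obtain ⟨q₀, hq₀⟩ : ∃ q₀, q₀ = min (1 / 2) (c / (12 * C₁)) := ⟨_, rfl⟩
  have hq₀0 : 0 < q₀ := by rw [hq₀]; positivity
  have hq₀2 : q₀ ≤ 1 / 2 := hq₀ ▸ min_le_left _ _
  have hq₀C : C₁ * q₀ ≤ c / 12 := by
    have : q₀ ≤ c / (12 * C₁) := hq₀ ▸ min_le_right _ _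
    rw [le_div_iff₀ (by positivity)] at this
    linarith
  obtain ⟨r₀, hr₀⟩ : ∃ r₀, r₀ = q₀ ^ 2 := ⟨_, rfl⟩
  have hr₀0 : 0 < r₀ := by rw [hr₀]; positivity
  have hr₀4 : r₀ ≤ 1 / 4 := by rw [hr₀]; nlinarith
  obtain ⟨μ, hμ⟩ : ∃ μ, μ = c / 12 / (152 * ((n : ℝ) ^ 3 * K)) := ⟨_, rfl⟩
  have hμ0 : 0 < μ := by rw [hμ]; positivity
  have hμC : 152 * ((n : ℝ) ^ 3 * K) * μ ≤ c / 12 := by rw [hμ, mul_div_cancel₀ _ (by positivity)]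
  obtain ⟨δ, hδ⟩ : ∃ δ, δ = min (ε * r₀ / 4) (μ ^ 2 / (n * K)) := ⟨_, rfl⟩
  have hδ0 : 0 < δ := by rw [hδ]; positivity
  have hδε : δ ≤ ε * r₀ / 4 := hδ ▸ min_le_left _ _
  have hδμ : δ * (n * K) ≤ μ ^ 2 := by
    have : δ ≤ μ ^ 2 / (n * K) := hδ ▸ min_le_right _ _
    rwa [le_div_iff₀ (by positivity)] at this
  obtain ⟨M, hM⟩ : ∃ M, M = 4 * δ / r₀ := ⟨_, rfl⟩
  have hMr : M * r₀ = 4 * δ := by rw [hM]; field_simp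
  have hM0 : 0 < M := by rw [hM]; positivity
  have hδM : δ ≤ M := by nlinarith
  have hMε : M ≤ ε := by rw [hM, div_le_iff₀ hr₀0]; linarith
  obtain ⟨R₁, hR₁⟩ := hu δ hδ0
  obtain ⟨R₂, hR₂⟩ := hF.decay δ hδ0
  refine ⟨max R₁ R₂ + 2, fun t₁ ht₁ x₀ hx₀ => ?_⟩
  have hclaim : ∀ y, ‖x₀ - y‖ ≤ r₀ → u t₁ x₀ - u t₁ y ≤ M * ‖x₀ - y‖ := by
    intro y₀ hy₀
    by_contra! hlt
    let Φ : ℝ × Eu n × Eu n → ℝ := fun p => u p.1 p.2.1 - u p.1 p.2.2 -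
      M * (‖p.2.1 - p.2.2‖ - ‖p.2.1 - p.2.2‖ * √‖p.2.1 - p.2.2‖) - 4 * δ * ‖p.2.1 - x₀‖ ^ 2 - 4 * δ / τ * (t₁ - p.1)
    let Q : Set (ℝ × Eu n × Eu n) := {p | p.1 ∈ Icc (t₁ - τ) t₁ ∧ ‖p.2.1 - x₀‖ ≤ 1 ∧ ‖p.2.1 - p.2.2‖ ≤ r₀}
    have hpos : ∀ p ∈ Q, 0 < p.1 := fun p hp => by have := hp.1.1; linarith
    have hQc : IsCompact Q := by
      refine IsCompact.of_isClosed_subset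
        ((isCompact_Icc (a := t₁ - τ) (b := t₁)).prod ((isCompact_closedBall x₀ 1).prod (isCompact_closedBall x₀ 2))) ?_ ?_
      · have h1 : IsClosed {p : ℝ × Eu n × Eu n | ‖p.2.1 - x₀‖ ≤ 1} := isClosed_le (by fun_prop) continuous_const
        have h2 : IsClosed {p : ℝ × Eu n × Eu n | ‖p.2.1 - p.2.2‖ ≤ r₀} := isClosed_le (by fun_prop) continuous_const
        exact (isClosed_Icc.preimage continuous_fst).inter (h1.inter h2)
      · rintro ⟨t, x, y⟩ ⟨h1, h2, h3⟩
        refine ⟨h1, mem_closedBall_iff_norm.2 h2, mem_closedBall_iff_norm.2 ?_⟩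
        have e : y - x₀ = (x - x₀) - (x - y) := by abel
        rw [e]
        exact (norm_sub_le _ _).trans (by linarith)
    have hΦ : ContinuousOn Φ Q := by
      have h1 : ContinuousOn (fun p : ℝ × Eu n × Eu n => u p.1 p.2.1) Q :=
        hF.smooth.continuousOn.comp (f := fun p : ℝ × Eu n × Eu n => ((p.1, p.2.1) : SpT n))
          (by fun_prop : Continuous _).continuousOn fun p hp => ⟨hpos p hp, mem_univ _⟩
      have h2 : ContinuousOn (fun p : ℝ × Eu n × Eu n => u p.1 p.2.2) Q :=
        hF.smooth.continuousOn.comp (f := fun p : ℝ × Eu n × Eu n => ((p.1, p.2.2) : SpT n))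
          (by fun_prop : Continuous _).continuousOn fun p hp => ⟨hpos p hp, mem_univ _⟩
      have h3 : Continuous fun p : ℝ × Eu n × Eu n => M * (‖p.2.1 - p.2.2‖ - ‖p.2.1 - p.2.2‖ * √‖p.2.1 - p.2.2‖) := by fun_prop
      have h4 : Continuous fun p : ℝ × Eu n × Eu n => 4 * δ * ‖p.2.1 - x₀‖ ^ 2 := by fun_prop
      have h5 : Continuous fun p : ℝ × Eu n × Eu n => 4 * δ / τ * (t₁ - p.1) := by fun_prop
      exact (((h1.sub h2).sub h3.continuousOn).sub h4.continuousOn).sub h5.continuousOn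
    have h₀ : (t₁, x₀, y₀) ∈ Q := ⟨⟨by linarith, le_rfl⟩, by simp, hy₀⟩
    obtain ⟨⟨t, x, y⟩, ⟨htI, hx, hxy⟩, hmax⟩ := hQc.exists_isMaxOn ⟨_, h₀⟩ hΦ
    have hΦ0 : 0 < Φ (t, x, y) := by
      refine lt_of_lt_of_le ?_ (hmax h₀)
      have : 0 ≤ M * (‖x₀ - y₀‖ * √‖x₀ - y₀‖) := by positivity
      simp only [Φ, sub_self, norm_zero]
      linarith
    simp only [Φ] at hΦ0
    simp only at htI hx hxy
    have ht : 0 < t := by have := htI.1; linarith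
    have hxn : max R₁ R₂ + 1 ≤ ‖x‖ := by
      have := norm_sub_norm_le x₀ x
      rw [norm_sub_rev] at this
      linarith
    have hyn : max R₁ R₂ ≤ ‖y‖ := by
      have := norm_sub_norm_le x y
      linarith
    have hux := abs_le.1 (hR₁ t ht x (by linarith [le_max_left R₁ R₂]))
    have huy := abs_le.1 (hR₁ t ht y (by linarith [le_max_left R₁ R₂]))
    have hg : ‖x - y‖ * (1 / 2) ≤ ‖x - y‖ - ‖x - y‖ * √‖x - y‖ := by
      have : √‖x - y‖ ≤ 1 / 2 := sqrt_le_iff.2 ⟨by norm_num, by linarith⟩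
      nlinarith [norm_nonneg (x - y)]
    have hg0 := mul_le_mul_of_nonneg_left hg hM0.le
    have hMn : 0 ≤ M * (‖x - y‖ * (1 / 2)) := by positivity
    have hdn : 0 ≤ 4 * δ * ‖x - x₀‖ ^ 2 := by positivity
    have htn : 0 ≤ 4 * δ / τ * (t₁ - t) := mul_nonneg (by positivity) (by linarith [htI.2])
    have hx1 : ‖x - x₀‖ < 1 := by
      refine lt_of_le_of_ne hx fun h => ?_
      rw [h] at hΦ0
      linarith
    have hr1 : ‖x - y‖ < r₀ := by
      refine lt_of_le_of_ne hxy fun h => ?_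
      rw [h] at hΦ0 hg0
      linarith
    have ht1 : t₁ - τ < t := by
      refine lt_of_le_of_ne htI.1 fun h => ?_
      rw [← h] at hΦ0
      have : 4 * δ / τ * (t₁ - (t₁ - τ)) = 4 * δ := by field_simp; ring
      rw [this, h] at hΦ0
      linarith
    have hr0 : 0 < ‖x - y‖ := by
      refine lt_of_le_of_ne (norm_nonneg _) fun h => ?_
      have := sub_eq_zero.1 (norm_eq_zero.1 h.symm)
      rw [this] at hΦ0 hg0 hMn hdn
      linarith
    refine hF.no_interior_max hn hc hK (y := y) (x₀ := x₀) ht hτ0 hδ0 hδM hμ0.le hδμ hr0 (by linarith) ?_ hμC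
      (hR₂ t ht x (by linarith [le_max_right R₁ R₂])) (hR₂ t ht y (by linarith [le_max_right R₁ R₂])) (by linarith) ?_ ?_
    · rw [← hC₁]
      exact (mul_le_mul_of_nonneg_left (sqrt_le_iff.2 ⟨hq₀0.le, by linarith⟩) hC₁0.le).trans hq₀C
    · have n1 : ∀ᶠ p : Eu n × Eu n in 𝓝 (x, y), ‖p.1 - x₀‖ < 1 :=
        (by fun_prop : Continuous fun p : Eu n × Eu n => ‖p.1 - x₀‖).continuousAt.eventually_lt_const hx1
      have n2 : ∀ᶠ p : Eu n × Eu n in 𝓝 (x, y), ‖p.1 - p.2‖ < r₀ :=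
        (by fun_prop : Continuous fun p : Eu n × Eu n => ‖p.1 - p.2‖).continuousAt.eventually_lt_const hr1
      filter_upwards [n1, n2] with p h1 h2
      have : Φ (t, p.1, p.2) ≤ Φ (t, x, y) := hmax (⟨htI, h1.le, h2.le⟩ : (t, p.1, p.2) ∈ Q)
      linarith
    · have hd : HasDerivAt (fun s => u s x - u s y - 4 * δ / τ * (t₁ - s)) _ t :=
        ((hF.eq t ht x).sub (hF.eq t ht y)).sub (((hasDerivAt_id' t).const_sub t₁).const_mul (4 * δ / τ))
      have := deriv_nonneg_of_left_max hd ht1 fun s hs => by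
        have : Φ (s, x, y) ≤ Φ (t, x, y) := hmax (⟨⟨hs.1, hs.2.trans htI.2⟩, hx, hxy⟩ : (s, x, y) ∈ Q)
        linarith
      linarith
  have hw := hF.smooth_slice (ht₀.trans_le ht₁)
  intro k
  have h1 := dd_le_of_sub_le hw hr₀0 (ξ := single k 1) (by simp) hclaim
  have h2 := dd_le_of_sub_le hw hr₀0 (ξ := -single k 1) (by simp) hclaim
  have e : dd (-single k 1) (u t₁) x₀ = -pd k (u t₁) x₀ := map_neg (fderiv ℝ (u t₁) x₀) _
  rw [e] at h2
  have h3 : pd k (u t₁) x₀ ≤ M := h1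
  exact abs_le.2 ⟨by linarith, by linarith⟩

end GradientDecay

section Window

variable (σ : Eu n → Matrix (Fin n) (Fin n) ℝ)

/-- Gradient-free part of the coefficients of the flow multiplied by `1 - |∇u|²`. -/
def flowA : JI n → Eu n → ℝ
  | none, _ => 1
  | some (Sum.inl (i, j)), x => -(σ x)⁻¹ i j
  | some (Sum.inr l), x => ∑ i, ∑ j, (σ x)⁻¹ i j * christoffel σ l i j x

/-- Quadratic part of the coefficients of the flow multiplied by `1 - |∇u|²`. -/
def flowB : JI n → Fin n → Fin n → Eu n → ℝ
  | none, a, b, x => -(σ x)⁻¹ a b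
  | some (Sum.inl (i, j)), a, b, x => (σ x)⁻¹ a b * (σ x)⁻¹ i j - (σ x)⁻¹ i a * (σ x)⁻¹ j b
  | some (Sum.inr l), a, b, x => ∑ i, ∑ j, (σ x)⁻¹ i a * (σ x)⁻¹ j b * christoffel σ l i j x -
      (σ x)⁻¹ a b * ∑ i, ∑ j, (σ x)⁻¹ i j * christoffel σ l i j x

variable {σ} {w : SpT n → ℝ}

lemma quad_flow_none (h : ∀ i, dd (ex i) w (t, x) = pd i f x) :
    quad (flowA σ) (flowB σ) w none (t, x) = 1 - gradSq σ f x := by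
  change 1 + ∑ a, ∑ b, -(σ x)⁻¹ a b * (dd (ex a) w (t, x) * dd (ex b) w (t, x)) = _
  simp only [h, gradSq, neg_mul, sum_neg_distrib, mul_assoc, sub_eq_add_neg]

lemma quad_flow_inl (h : ∀ i, dd (ex i) w (t, x) = pd i f x) (i j : Fin n) :
    quad (flowA σ) (flowB σ) w (some (Sum.inl (i, j))) (t, x) = -((σ x)⁻¹ i j * (1 - gradSq σ f x) +
      ∑ k, ∑ l, (σ x)⁻¹ i k * (σ x)⁻¹ j l * pd k f x * pd l f x) := by
  change -(σ x)⁻¹ i j + ∑ a, ∑ b, ((σ x)⁻¹ a b * (σ x)⁻¹ i j - (σ x)⁻¹ i a * (σ x)⁻¹ j b) *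
    (dd (ex a) w (t, x) * dd (ex b) w (t, x)) = _
  have e : ∑ a, ∑ b, ((σ x)⁻¹ a b * (σ x)⁻¹ i j - (σ x)⁻¹ i a * (σ x)⁻¹ j b) *
      (dd (ex a) w (t, x) * dd (ex b) w (t, x)) = (σ x)⁻¹ i j * gradSq σ f x -
      ∑ k, ∑ l, (σ x)⁻¹ i k * (σ x)⁻¹ j l * pd k f x * pd l f x := by
    simp only [h, gradSq, mul_sum, ← sum_sub_distrib]
    exact sum_congr rfl fun a _ => sum_congr rfl fun b _ => by ring
  rw [e]; ring

lemma quad_flow_inl_eq (h : ∀ i, dd (ex i) w (t, x) = pd i f x) (hq : 1 - gradSq σ f x ≠ 0) (i j : Fin n) :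
    quad (flowA σ) (flowB σ) w (some (Sum.inl (i, j))) (t, x) = -((1 - gradSq σ f x) * ginv σ f i j x) := by
  rw [quad_flow_inl h, ginv]
  field_simp

lemma quad_flow_inr_eq (h : ∀ i, dd (ex i) w (t, x) = pd i f x) (hq : 1 - gradSq σ f x ≠ 0) (m : Fin n) :
    quad (flowA σ) (flowB σ) w (some (Sum.inr m)) (t, x) =
      (1 - gradSq σ f x) * ∑ i, ∑ j, ginv σ f i j x * christoffel σ m i j x := by
  change ∑ i, ∑ j, (σ x)⁻¹ i j * christoffel σ m i j x +
    ∑ a, ∑ b, (∑ i, ∑ j, (σ x)⁻¹ i a * (σ x)⁻¹ j b * christoffel σ m i j x -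
      (σ x)⁻¹ a b * ∑ i, ∑ j, (σ x)⁻¹ i j * christoffel σ m i j x) * (dd (ex a) w (t, x) * dd (ex b) w (t, x)) = _
  have e1 : (1 - gradSq σ f x) * ∑ i, ∑ j, ginv σ f i j x * christoffel σ m i j x =
      ∑ i, ∑ j, (σ x)⁻¹ i j * christoffel σ m i j x - gradSq σ f x * ∑ i, ∑ j, (σ x)⁻¹ i j * christoffel σ m i j x +
      ∑ i, ∑ j, (∑ k, ∑ l, (σ x)⁻¹ i k * (σ x)⁻¹ j l * pd k f x * pd l f x) * christoffel σ m i j x := by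
    simp only [mul_sum, ← sum_sub_distrib, ← sum_add_distrib, ginv]
    refine sum_congr rfl fun i _ => sum_congr rfl fun j _ => ?_
    field_simp
  have e2 : ∑ i, ∑ j, (∑ k, ∑ l, (σ x)⁻¹ i k * (σ x)⁻¹ j l * pd k f x * pd l f x) * christoffel σ m i j x =
      ∑ a, ∑ b, (∑ i, ∑ j, (σ x)⁻¹ i a * (σ x)⁻¹ j b * christoffel σ m i j x) * (pd a f x * pd b f x) := by
    have s1 : ∀ F : Fin n → Fin n → Fin n → Fin n → ℝ,
        ∑ i, ∑ j, ∑ a, ∑ b, F i j a b = ∑ a, ∑ b, ∑ i, ∑ j, F i j a b := fun F => by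
      rw [sum_congr rfl fun i _ => sum_comm, sum_comm]
      refine sum_congr rfl fun a _ => ?_
      rw [sum_congr rfl fun i _ => sum_comm, sum_comm]
    simp only [sum_mul]
    rw [s1]
    exact sum_congr rfl fun a _ => sum_congr rfl fun b _ => sum_congr rfl fun i _ =>
      sum_congr rfl fun j _ => by ring
  rw [e1, e2]
  simp only [h, sub_mul, sum_sub_distrib, gradSq, sum_mul]
  rw [← sub_eq_zero]
  have e3 : ∑ a, ∑ b, (σ x)⁻¹ a b * (∑ i, ∑ j, (σ x)⁻¹ i j * christoffel σ m i j x) * (pd a f x * pd b f x) =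
      ∑ a, ∑ b, (σ x)⁻¹ a b * pd a f x * pd b f x * ∑ i, ∑ j, (σ x)⁻¹ i j * christoffel σ m i j x :=
    sum_congr rfl fun a _ => sum_congr rfl fun b _ => by ring
  rw [e3]; ring

lemma flowA_continuous (hσ : IsAsympFlat σ R₀ C Ω) : ∀ ι, Continuous (flowA σ ι)
  | none => continuous_const
  | some (Sum.inl (i, j)) => (hσ.continuous_inv i j).neg
  | some (Sum.inr l) => continuous_finsetSum _ fun i _ => continuous_finsetSum _ fun j _ =>
      (hσ.continuous_inv i j).mul (hσ.continuous_christoffel l i j)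

lemma flowB_continuous (hσ : IsAsympFlat σ R₀ C Ω) : ∀ ι a b, Continuous (flowB σ ι a b)
  | none, a, b => (hσ.continuous_inv a b).neg
  | some (Sum.inl (i, j)), a, b => ((hσ.continuous_inv a b).mul (hσ.continuous_inv i j)).sub
      ((hσ.continuous_inv i a).mul (hσ.continuous_inv j b))
  | some (Sum.inr l), a, b => (continuous_finsetSum _ fun i _ => continuous_finsetSum _ fun j _ =>
      ((hσ.continuous_inv i a).mul (hσ.continuous_inv j b)).mul (hσ.continuous_christoffel l i j)).sub
      ((hσ.continuous_inv a b).mul (flowA_continuous hσ (some (Sum.inr l))))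

lemma flowA_tendsto (hσ : IsAsympFlat σ R₀ C Ω) : ∀ ι, ∃ z, Tendsto (flowA σ ι) (cocompact (Eu n)) (𝓝 z)
  | none => ⟨_, tendsto_const_nhds⟩
  | some (Sum.inl (i, j)) => ⟨_, (hσ.tendsto_inv i j).neg⟩
  | some (Sum.inr l) => ⟨_, tendsto_finsetSum _ fun i _ => tendsto_finsetSum _ fun j _ =>
      (hσ.tendsto_inv i j).mul (hσ.tendsto_christoffel l i j)⟩

lemma flowB_tendsto (hσ : IsAsympFlat σ R₀ C Ω) : ∀ ι a b, ∃ z, Tendsto (flowB σ ι a b) (cocompact (Eu n)) (𝓝 z)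
  | none, a, b => ⟨_, (hσ.tendsto_inv a b).neg⟩
  | some (Sum.inl (i, j)), a, b => ⟨_, ((hσ.tendsto_inv a b).mul (hσ.tendsto_inv i j)).sub
      ((hσ.tendsto_inv i a).mul (hσ.tendsto_inv j b))⟩
  | some (Sum.inr l), a, b => ⟨_, (tendsto_finsetSum _ fun i _ => tendsto_finsetSum _ fun j _ =>
      ((hσ.tendsto_inv i a).mul (hσ.tendsto_inv j b)).mul (hσ.tendsto_christoffel l i j)).sub
      ((hσ.tendsto_inv a b).mul (flowA_tendsto hσ (some (Sum.inr l))).choose_spec)⟩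

lemma flowB_bound (hσ : IsAsympFlat σ R₀ C Ω) : ∃ K, 1 ≤ K ∧ ∀ (ι : JI n × Fin n × Fin n) x, |flowB σ ι.1 ι.2.1 ι.2.2 x| ≤ K :=
  exists_uniform_bound (fun _ _ _ hab h x => (h x).trans hab) fun ι =>
    exists_bound_of_tendsto_cocompact (flowB_continuous hσ _ _ _) (flowB_tendsto hσ ι.1 ι.2.1 ι.2.2).choose_spec

/-- The leading coefficients are uniformly continuous on time windows, because they converge at infinity. -/
lemma acoef_flow_osc (hσ : IsAsympFlat σ R₀ C Ω) (hU : ContDiff ℝ ∞ U) (hκ : 0 < κ)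
    (hlow : ∀ τ ∈ Icc ta tb, ∀ y, κ ≤ quad (flowA σ) (flowB σ) U none (τ, y))
    (hdec : ∀ ε, 0 < ε → ∃ R, ∀ τ ∈ Icc ta tb, ∀ y, R ≤ ‖y‖ → ∀ k, |dd (ex k) U (τ, y)| ≤ ε) (hε : 0 < ε) :
    ∃ ρ, 0 < ρ ∧ ∀ τ ∈ Icc ta tb, ∀ τ' ∈ Icc ta tb, ∀ y c, |τ - τ'| ≤ ρ → ‖y - c‖ ≤ ρ → ∀ i j,
      |acoef (flowA σ) (flowB σ) U i j (τ, y) - acoef (flowA σ) (flowB σ) U i j (τ', c)| ≤ ε := by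
  let X := Icc ta tb × Eu n
  let e : X → SpT n := fun p => (p.1.1, p.2)
  have hsnd : Tendsto (fun p : X => p.2) (cocompact X) (cocompact (Eu n)) := by
    rw [← coprod_cocompact, cocompact_eq_bot, Filter.coprod, comap_bot, bot_sup_eq]
    exact tendsto_comap
  have hd : ∀ k, Tendsto (fun p : X => dd (ex k) U (e p)) (cocompact X) (𝓝 0) := fun k => by
    refine Metric.tendsto_nhds.2 fun δ hδ => ?_
    obtain ⟨R, hR⟩ := hdec (δ / 2) (half_pos hδ)
    filter_upwards [hsnd.eventually ((tendsto_norm_cocompact_atTop).eventually (eventually_ge_atTop R))] with p hp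
    rw [dist_zero_right, norm_eq_abs]
    linarith [hR _ p.1.2 _ hp k]
  have hquad : ∀ ι z, Tendsto (flowA σ ι) (cocompact (Eu n)) (𝓝 z) →
      Tendsto (fun p : X => quad (flowA σ) (flowB σ) U ι (e p)) (cocompact X) (𝓝 z) := fun ι z hz => by
    have h2 := (hz.comp hsnd).add (tendsto_finsetSum Finset.univ fun a _ => tendsto_finsetSum Finset.univ fun b _ =>
      ((flowB_tendsto hσ ι a b).choose_spec.comp hsnd).mul ((hd a).mul (hd b)))
    simp only [mul_zero, Finset.sum_const_zero, add_zero] at h2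
    exact h2
  have huc : ∀ ij : Fin n × Fin n, ∃ z, Tendsto (fun p : X => acoef (flowA σ) (flowB σ) U ij.1 ij.2 (e p)) (cocompact X) (𝓝 z) :=
    fun ij => ⟨_, (hquad _ _ (flowA_tendsto hσ (some (Sum.inl (ij.1, ij.2)))).choose_spec).neg.div
      (hquad none 1 tendsto_const_nhds) one_ne_zero⟩
  have hunif : ∀ ij : Fin n × Fin n, UniformContinuous fun p : X => acoef (flowA σ) (flowB σ) U ij.1 ij.2 (e p) := fun ij => by
    obtain ⟨z, hz⟩ := huc ij
    refine Continuous.uniformContinuous_of_tendsto_cocompact ?_ hz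
    have hc : ∀ ι, Continuous fun p : X => quad (flowA σ) (flowB σ) U ι (e p) := fun ι =>
      (quad_continuous (flowA_continuous hσ) (flowB_continuous hσ) hU ι).comp
          ((continuous_subtype_val.comp continuous_fst).prodMk continuous_snd)
    exact (hc _).neg.div (hc _) fun p => (hκ.trans_le (hlow _ p.1.2 _)).ne'
  obtain ⟨ρ, hρ, h⟩ : ∃ ρ, 0 < ρ ∧ ∀ (ij : Fin n × Fin n) (p q : X), dist p q < ρ →
      |acoef (flowA σ) (flowB σ) U ij.1 ij.2 (e p) - acoef (flowA σ) (flowB σ) U ij.1 ij.2 (e q)| < ε := by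
    obtain ⟨ρ, hρ, hh⟩ := Metric.uniformContinuous_iff.1 (uniformContinuous_pi.2 hunif) ε hε
    exact ⟨ρ, hρ, fun ij p q hpq => (dist_le_pi_dist _ _ ij).trans_lt (hh hpq)⟩
  refine ⟨ρ / 2, half_pos hρ, fun τ hτ τ' hτ' y c h1 h2 i j => (h (i, j) (⟨τ, hτ⟩, y) (⟨τ', hτ'⟩, c) ?_).le⟩
  rw [Prod.dist_eq, max_lt_iff]
  refine ⟨?_, ?_⟩
  · change |τ - τ'| < ρ
    linarith
  · rw [dist_eq_norm]
    linarith

end Window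

section Smoothing

/-- A flow can be extended smoothly to all times without changing it after a given positive time. -/
lemma exists_smooth_extension
    (hsmooth : ContDiffOn ℝ ∞ (fun p : SpT n => u p.1 p.2) (Ioi 0 ×ˢ univ)) (ht : 0 < t) :
    ∃ U : SpT n → ℝ, ContDiff ℝ ∞ U ∧ ∀ s, t ≤ s → ∀ x, U (s, x) = u s x := by
  refine ⟨fun p => smoothTransition (2 / t * p.1 - 1) * u p.1 p.2, contDiff_iff_contDiffAt.2 fun p => ?_, fun s hs x => ?_⟩
  · by_cases hp : 0 < p.1
    · exact ((smoothTransition.contDiff.comp (by fun_prop)).contDiffAt).mul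
        (hsmooth.contDiffAt ((isOpen_Ioi.prod isOpen_univ).mem_nhds ⟨hp, mem_univ _⟩))
    · have h1 : ∀ᶠ q : SpT n in 𝓝 p, q.1 < t / 2 :=
        continuous_fst.continuousAt.eventually (gt_mem_nhds (by push Not at hp; linarith))
      refine (contDiffAt_const (c := 0)).congr_of_eventuallyEq ?_
      filter_upwards [h1] with q hq
      rw [smoothTransition.zero_of_nonpos, zero_mul]
      have : 2 / t * q.1 ≤ 2 / t * (t / 2) := mul_le_mul_of_nonneg_left hq.le (by positivity)
      have e : 2 / t * (t / 2) = 1 := by field_simp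
      linarith
  · have : 2 / t * t ≤ 2 / t * s := mul_le_mul_of_nonneg_left hs (by positivity)
    have e : 2 / t * t = 2 := by field_simp
    simp only
    rw [smoothTransition.one_of_one_le (by linarith), one_mul]

lemma ParFlow.sol (hσ : IsAsympFlat σ R₀ C Ω) (hκ : 0 < κ) (hq : ∀ t, 0 < t → ∀ x, κ ≤ 1 - gradSq σ (u t) x)
    (hF : ParFlow c K (fun t x i j => ginv σ (u t) i j x)
      (fun t x k => ∑ i, ∑ j, ginv σ (u t) i j x * christoffel σ k i j x) u)
    (ht₀ : 0 < t₀) (hta : t₀ < ta) (hU : ContDiff ℝ ∞ U)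
    (hUu : ∀ s, t₀ ≤ s → ∀ x, U (s, x) = u s x) (hL1 : 1 ≤ L) (hKL : K ≤ L) (hM : ∀ t, 0 < t → ∀ x, |u t x| ≤ L)
    (hBL : ∀ (ι : JI n × Fin n × Fin n) x, |flowB σ ι.1 ι.2.1 ι.2.2 x| ≤ L)
    (hosc : ∀ τ ∈ Icc ta tb, ∀ τ' ∈ Icc ta tb, ∀ y c, |τ - τ'| ≤ ρ → ‖y - c‖ ≤ ρ → ∀ i j,
      |acoef (flowA σ) (flowB σ) U i j (τ, y) - acoef (flowA σ) (flowB σ) U i j (τ', c)| ≤ ε) :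
    Sol c L κ ε ρ ρ ta tb (flowA σ) (flowB σ) U := by
  have hpd : ∀ τ, t₀ ≤ τ → ∀ y i, dd (ex i) U (τ, y) = pd i (u τ) y := fun τ hτ y i => by
    rw [← pd_slice hU]
    exact congrArg (fun f => pd i f y) (funext (hUu τ hτ))
  have hpos : ∀ τ ∈ Icc ta tb, 0 < τ ∧ t₀ ≤ τ := fun τ hτ => ⟨by linarith [hτ.1], by linarith [hτ.1]⟩
  have hW : ∀ τ ∈ Icc ta tb, ∀ y, 1 - gradSq σ (u τ) y ≠ 0 := fun τ hτ y => (hκ.trans_le (hq τ (hpos τ hτ).1 y)).ne'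
  have h0 : ∀ τ ∈ Icc ta tb, ∀ y, quad (flowA σ) (flowB σ) U none (τ, y) = 1 - gradSq σ (u τ) y :=
    fun τ hτ y => quad_flow_none (hpd τ (hpos τ hτ).2 y)
  have hl : ∀ τ ∈ Icc ta tb, ∀ y i j, quad (flowA σ) (flowB σ) U (some (Sum.inl (i, j))) (τ, y) =
      -((1 - gradSq σ (u τ) y) * ginv σ (u τ) i j y) :=
    fun τ hτ y i j => quad_flow_inl_eq (hpd τ (hpos τ hτ).2 y) (hW τ hτ y) i j
  have hr : ∀ τ ∈ Icc ta tb, ∀ y m, quad (flowA σ) (flowB σ) U (some (Sum.inr m)) (τ, y) =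
      (1 - gradSq σ (u τ) y) * ∑ i, ∑ j, ginv σ (u τ) i j y * christoffel σ m i j y :=
    fun τ hτ y m => quad_flow_inr_eq (hpd τ (hpos τ hτ).2 y) (hW τ hτ y) m
  have ha : ∀ τ ∈ Icc ta tb, ∀ y i j, acoef (flowA σ) (flowB σ) U i j (τ, y) = ginv σ (u τ) i j y := fun τ hτ y i j => by
    rw [acoef, h0 τ hτ, hl τ hτ, neg_neg, mul_div_cancel_left₀ _ (hW τ hτ y)]
  have hW1 : ∀ τ ∈ Icc ta tb, ∀ y, |1 - gradSq σ (u τ) y| ≤ 1 := fun τ hτ y => by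
    rw [abs_of_nonneg (hκ.le.trans (hq τ (hpos τ hτ).1 y))]
    linarith [gradSq_nonneg hσ (u τ) y]
  refine ⟨hU, flowA_continuous hσ, flowB_continuous hσ, fun ι a b => hBL (ι, a, b), fun τ hτ y => ?_, fun τ hτ y => ?_,
    fun ι τ hτ y => ?_, fun τ hτ y => ⟨?_, fun a => ?_⟩, fun i j p => ?_, fun τ hτ y ξ => ?_, fun τ hτ y i j => ?_, hosc⟩
  · obtain ⟨hτ0, hτ1⟩ := hpos τ hτ
    have e1 : dd et U (τ, y) = ∑ i, ∑ j, ginv σ (u τ) i j y * pd i (fun z => pd j (u τ) z) y -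
        ∑ k, (∑ i, ∑ j, ginv σ (u τ) i j y * christoffel σ k i j y) * pd k (u τ) y := by
      refine HasDerivAt.unique (hasDerivAt_line hU (fun s => (s, y)) et τ ?_) ((hF.eq τ hτ0 y).congr_of_eventuallyEq ?_)
      · exact (hasDerivAt_id' τ).prodMk (hasDerivAt_const τ y)
      · filter_upwards [lt_mem_nhds (hta.trans_le hτ.1)] with s hs
        exact hUu s hs.le y
    have e2 : ∀ i j, dd (ex j) (dd (ex i) U) (τ, y) = pd i (fun z => pd j (u τ) z) y := fun i j => by
      rw [dd_comm hU, ← pd_slice (hU.dd _)]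
      exact congrArg (fun f => pd i f y) (funext fun z => hpd τ hτ1 z j)
    rw [JI.sum_eq]
    change quad (flowA σ) (flowB σ) U none (τ, y) * dd et U (τ, y) +
      (∑ i, ∑ j, quad (flowA σ) (flowB σ) U (some (Sum.inl (i, j))) (τ, y) * dd (ex j) (dd (ex i) U) (τ, y) +
        ∑ l, quad (flowA σ) (flowB σ) U (some (Sum.inr l)) (τ, y) * dd (ex l) U (τ, y)) = 0
    simp only [h0 τ hτ, hl τ hτ, hr τ hτ, e1, e2, hpd τ hτ1, neg_mul, sum_neg_distrib, mul_assoc, ← mul_sum]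
    ring
  · rw [h0 τ hτ]
    exact hq τ (hpos τ hτ).1 y
  · have hb : ∀ z, |z| ≤ K → |(1 - gradSq σ (u τ) y) * z| ≤ L := fun z hz => by
      rw [abs_mul]
      have := mul_le_mul_of_nonneg_right (hW1 τ hτ y) (abs_nonneg z)
      linarith
    match ι with
    | none => rw [h0 τ hτ]; exact (hW1 τ hτ y).trans hL1
    | some (Sum.inl (i, j)) =>
      rw [hl τ hτ, abs_neg]
      exact hb _ (hF.bdd τ (hpos τ hτ).1 y i j)
    | some (Sum.inr m) =>
      rw [hr τ hτ]
      exact hb _ (hF.drift τ (hpos τ hτ).1 y m)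
  · rw [hUu τ (hpos τ hτ).2]
    exact hM τ (hpos τ hτ).1 y
  · rw [hpd τ (hpos τ hτ).2]
    exact (hF.grad τ (hpos τ hτ).1 y a).trans hKL
  · obtain ⟨τ, y⟩ := p
    have hp := fun i => (pd_slice hU i τ y).symm
    unfold acoef
    rw [quad_flow_inl hp, quad_flow_inl hp, hσ.symm_inv y i j]
    congr 4
    rw [sum_comm]
    exact sum_congr rfl fun k _ => sum_congr rfl fun l _ => by ring
  · simp only [ha τ hτ]
    exact hF.ell τ (hpos τ hτ).1 y ξ
  · rw [ha τ hτ]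
    exact (hF.bdd τ (hpos τ hτ).1 y i j).trans hKL

lemma ParFlow.exists_iteratedFDeriv_bound (hσ : IsAsympFlat σ R₀ C Ω) (hn : 0 < n) (hκ : 0 < κ)
    (hq : ∀ t, 0 < t → ∀ x, κ ≤ 1 - gradSq σ (u t) x) (hc : 0 < c) (hK : 1 ≤ K)
    (hF : ParFlow c K (fun t x i j => ginv σ (u t) i j x)
      (fun t x k => ∑ i, ∑ j, ginv σ (u t) i j x * christoffel σ k i j x) u)
    (hu : ∀ δ, 0 < δ → ∃ R, ∀ t, 0 < t → ∀ x, R ≤ ‖x‖ → |u t x| ≤ δ) (hM : ∀ t, 0 < t → ∀ x, |u t x| ≤ M)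
    (hder : ∀ l : ℕ, 1 ≤ l → ∃ Cl, ∀ t, 1 ≤ t → ∀ x, ‖iteratedFDeriv ℝ l (u t) x‖ ≤ Cl)
    (ht : 0 < t) (m : ℕ) : ∃ C, ∀ x, ‖iteratedFDeriv ℝ m (u t) x‖ ≤ C := by
  by_cases ht2 : 2 < t
  · rcases Nat.eq_zero_or_pos m with rfl | hm
    · exact ⟨M, fun x => by rw [norm_iteratedFDeriv_zero]; exact hM t ht x⟩
    · obtain ⟨Cl, hCl⟩ := hder m hm
      exact ⟨Cl, hCl t (by linarith)⟩
  push Not at ht2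
  obtain ⟨U, hU, hUu⟩ := exists_smooth_extension hF.smooth (by positivity : 0 < t / 4)
  obtain ⟨KB, hKB1, hKB⟩ := flowB_bound hσ
  have hM0 := (abs_nonneg _).trans (hM t ht 0)
  obtain ⟨L, hL⟩ : ∃ L, L = KB + K + M := ⟨_, rfl⟩
  obtain ⟨ε, hε, hA⟩ := Sol.analytic n hc hκ (by rw [hL]; linarith : 0 < L)
  have hpd : ∀ τ, t / 4 ≤ τ → ∀ y i, dd (ex i) U (τ, y) = pd i (u τ) y := fun τ hτ y i => by
    rw [← pd_slice hU]
    exact congrArg (fun f => pd i f y) (funext (hUu τ hτ))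
  obtain ⟨ρ, hρ, hosc⟩ := acoef_flow_osc hσ hU (ta := t / 2) (tb := 3) hκ (fun τ hτ y => by
    rw [quad_flow_none (hpd τ (by linarith [hτ.1]) y)]
    exact hq τ (by linarith [hτ.1]) y) (fun δ hδ => by
    obtain ⟨R, hR⟩ := hF.grad_decay hn hc hK hu (by positivity : 0 < t / 2) hδ
    refine ⟨R, fun τ hτ y hy k => ?_⟩
    rw [hpd τ (by linarith [hτ.1]) y]
    exact hR τ hτ.1 y hy k) hε
  obtain ⟨T₀, hT₀, -, hA⟩ := hA ρ ρ hρ hρ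
  obtain ⟨T, Z, B, hT, hTT, hZ, hB, hA⟩ := hA (min T₀ (t / 8)) (lt_min hT₀ (by positivity)) (min_le_left _ _)
  have hA := hA _ _ _ _ _ (hF.sol hσ hκ hq (by positivity) (by linarith) hU hUu
    (by linarith) (by linarith) (fun t ht x => (hM t ht x).trans (by linarith)) (fun ι x => (hKB ι x).trans (by linarith)) hosc)
  have hT8 := hTT.trans (min_le_right T₀ (t / 8))
  have heq : ∀ s, t / 4 ≤ s → (fun y => U (s, y)) = u s := fun s hs => funext (hUu s hs)
  have key := iteratedFDeriv_bounded_of_time_analytic (g := fun s y => U (s, y)) (ts := t) (M := M) (t := t) hT hZ hB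
    (fun s hs x k h hh hkh => by
      have h1 := hA (s - T) (by have := min_le_right T₀ (t / 8); linarith [hs.1]) (by linarith [hs.2]) k h 0 hh le_rfl
        (by linarith) s ⟨by linarith, by linarith⟩ x
      have e : ∀ r, tsc (s - T) r (s, x) = (s + T * r, x) := fun r => by
        simp only [tsc]
        congr 1
        ring
      simp only [dqf, e] at h1
      exact h1)
    (fun s _ => hU.comp (contDiff_const.prodMk contDiff_id)) (fun s hs x => by
      rw [hUu s (by linarith [hs.1])]
      exact hM s (by linarith [hs.1]) x)
    (fun l hl => by
      obtain ⟨Cl, hCl⟩ := hder l hl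
      refine ⟨Cl, fun s hs x => ?_⟩
      rw [heq s (by linarith [hs.1])]
      exact hCl s hs.1 x) ⟨le_rfl, ht2⟩ m
  rwa [heq t (by linarith)] at key

end Smoothing

section TimeDecay

lemma local_max_test (hw : ContDiff ℝ ∞ w) (h : ∀ᶠ y in 𝓝 x, w y ≤ w x) :
    (∀ k, pd k w x = 0) ∧ ∀ P : Fin n → Fin n → ℝ, (∀ i j, P i j = P j i) →
      (∀ ξ : Fin n → ℝ, 0 ≤ ∑ i, ∑ j, P i j * (ξ i * ξ j)) → ∑ i, ∑ j, P i j * pd i (fun y => pd j w y) x ≤ 0 := by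
  have key := fun ξ => by
    have hc : Tendsto (fun s : ℝ => x + s • ξ) (𝓝 0) (𝓝 x) := by
      have : Continuous fun s : ℝ => x + s • ξ := by fun_prop
      simpa using this.tendsto 0
    have := two_point_test hw (x := x) (y := x) (ξ := ξ) (η := 0) (b := 0) (d := 0) (by
      filter_upwards [hc.eventually h] with s hs
      simpa using hs)
    simpa using this
  refine ⟨fun k => ?_, fun P hs hP => ?_⟩
  · have := (key (single k 1)).1
    simpa using this
  · have := trace_mul_le (X := fun i j => pd i (fun y => pd j w y) x) (m := 0) hs hP fun ξ => by
      have := (key (WithLp.toLp 2 ξ)).2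
      simpa using this
    simpa using this

lemma pd_exp_coord (l : ℝ) (i j : Fin n) (x : Eu n) :
    pd j (fun y : Eu n => exp (l * y i)) x = (if i = j then l else 0) * exp (l * x i) := by
  have h1 : HasFDerivAt (fun y : Eu n => y i) (EuclideanSpace.proj i : Eu n →L[ℝ] ℝ) x :=
    (EuclideanSpace.proj i : Eu n →L[ℝ] ℝ).hasFDerivAt
  rw [pd, (h1.const_mul l).exp.fderiv]
  simp [mul_comm]

variable {a : ℝ → Eu n → Fin n → Fin n → ℝ} {B : ℝ → Eu n → Fin n → ℝ}

/-- A positive interior maximum of a multiple of the solution minus the exponential barrier is impossible. -/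
lemma ParFlow.not_barrier_max (hF : ParFlow c K a B u) (hc : 0 < c) (i₀ : Fin n) {l γ E P : ℝ}
    (ht : 0 < t) (hl : 0 < l) (hE : 0 < E) (hcl : c * l = K + 1) (hγ : γ * (P - exp (l * x i₀)) < l * exp (l * x i₀))
    (hx : ∀ᶠ y in 𝓝 x, s * u t y - E * (P - exp (l * y i₀)) ≤ s * u t x - E * (P - exp (l * x i₀)))
    (hd : HasDerivAt (fun r => s * u r x) d t) (hd0 : 0 ≤ d + γ * E * (P - exp (l * x i₀))) : False := by
  have hu := hF.smooth_slice ht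
  have hg : ContDiff ℝ ∞ fun y : Eu n => exp (l * y i₀) := by fun_prop
  obtain ⟨h1, h2⟩ := local_max_test (by fun_prop) hx
  have hpw : ∀ j y, pd j (fun y : Eu n => s * u t y - E * (P - exp (l * y i₀))) y =
      s * pd j (u t) y + (E * if i₀ = j then l else 0) * exp (l * y i₀) := fun j y => by
    have e : (fun y : Eu n => s * u t y - E * (P - exp (l * y i₀))) = fun y => s * u t y + (E * exp (l * y i₀) + (-(E * P))) := by
      funext y; ring
    rw [e]
    change dd _ _ y = _
    rw [dd_add (contDiff_const.mul hu) ((contDiff_const.mul hg).add contDiff_const),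
      dd_add (contDiff_const.mul hg) contDiff_const, dd_const_mul hu, dd_const_mul hg]
    have := pd_exp_coord l i₀ j y
    unfold pd at this
    simp only [dd, fderiv_fun_const, Pi.zero_apply, _root_.zero_apply, this, pd]
    ring
  have hpw2 : ∀ i j, pd i (fun y => pd j (fun y : Eu n => s * u t y - E * (P - exp (l * y i₀))) y) x =
      s * pd i (fun y => pd j (u t) y) x +
        (E * if i₀ = j then l else 0) * ((if i₀ = i then l else 0) * exp (l * x i₀)) := fun i j => by
    simp only [hpw]
    change dd _ _ x = _
    rw [dd_add (contDiff_const.mul (contDiff_pd hu j)) (contDiff_const.mul hg), dd_const_mul (contDiff_pd hu j),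
      dd_const_mul hg, ← pd_exp_coord]
    rfl
  have h3 := h2 (a t x) (hF.symm t ht x) fun ξ =>
    (mul_nonneg hc.le (sum_nonneg fun i _ => sq_nonneg _)).trans (hF.ell t ht x ξ)
  simp only [hpw2, mul_add, sum_add_distrib] at h3
  have e1 : ∑ i, ∑ j, a t x i j * ((E * if i₀ = j then l else 0) * ((if i₀ = i then l else 0) * exp (l * x i₀))) =
      a t x i₀ i₀ * (E * l * (l * exp (l * x i₀))) := by
    simp
  have e2 : ∑ k, B t x k * (s * pd k (u t) x) = -(B t x i₀ * (E * l * exp (l * x i₀))) := by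
    have : ∀ k, s * pd k (u t) x = -((E * if i₀ = k then l else 0) * exp (l * x i₀)) := fun k => by
      have := h1 k
      rw [hpw] at this
      linarith
    simp [this]
  have h4 := hd.unique ((hF.eq t ht x).const_mul s)
  have e3 : ∑ i, ∑ j, a t x i j * (s * pd i (fun y => pd j (u t) y) x) =
      s * ∑ i, ∑ j, a t x i j * pd i (fun y => pd j (u t) y) x := by
    simp only [mul_sum]
    exact sum_congr rfl fun i _ => sum_congr rfl fun j _ => by ring
  have e4 : ∑ k, B t x k * (s * pd k (u t) x) = s * ∑ k, B t x k * pd k (u t) x := by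
    rw [mul_sum]
    exact sum_congr rfl fun j _ => by ring
  have h5 : c ≤ a t x i₀ i₀ := by
    have := hF.ell t ht x (Pi.single i₀ 1)
    simpa [Pi.single_apply] using this
  have h6 := (abs_le.1 (hF.drift t ht x i₀)).2
  rw [e1, e3] at h3
  rw [e4] at e2
  obtain ⟨g, hgd⟩ : ∃ g, g = exp (l * x i₀) := ⟨_, rfl⟩
  have hg0 := hgd ▸ exp_pos _
  rw [← hgd] at e2 h3 hγ hd0
  have q1 := mul_le_mul_of_nonneg_right h5 (by positivity : 0 ≤ E * l * (l * g))
  have q2 := mul_le_mul_of_nonneg_right h6 (by positivity : 0 ≤ E * l * g)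
  have q3 := mul_lt_mul_of_pos_left hγ hE
  have q4 : c * (E * l * (l * g)) = (K + 1) * (E * l * g) := by rw [← hcl]; ring
  rw [mul_sub] at h4
  linarith

lemma ParFlow.le_barrier (hF : ParFlow c K a B u) (hc : 0 < c) (hK : 1 ≤ K) (i₀ : Fin n) (hδ : 0 ≤ δ) (hM0 : 0 < M)
    (hM : ∀ t, 0 < t → ∀ x, |u t x| ≤ M) (hR : ∀ t, 0 < t → ∀ x, R ≤ ‖x‖ → |u t x| ≤ δ) :
    ∃ γ A, 0 < γ ∧ 0 ≤ A ∧ ∀ s, |s| = 1 → ∀ t, 1 ≤ t → ∀ x, s * u t x ≤ δ + A * exp (-(γ * (t - 1))) := by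
  obtain ⟨l, hl⟩ : ∃ l, l = (K + 1) / c := ⟨_, rfl⟩
  have hl0 : 0 < l := hl ▸ (by positivity)
  obtain ⟨G, hG⟩ : ∃ G, G = exp (l * |R|) := ⟨_, rfl⟩
  have hG1 : 1 ≤ G := hG ▸ one_le_exp (by positivity)
  have hg : ∀ x : Eu n, ‖x‖ ≤ |R| → G⁻¹ ≤ exp (l * x i₀) ∧ exp (l * x i₀) ≤ G := fun x hx => by
    have h1 := abs_le.1 ((PiLp.norm_apply_le x i₀).trans hx)
    rw [hG, ← exp_neg]
    constructor <;> apply exp_le_exp.2 <;> nlinarith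
  obtain ⟨γ, hγ⟩ : ∃ γ, γ = l * G⁻¹ / (4 * G) := ⟨_, rfl⟩
  have hγ0 : 0 < γ := hγ ▸ (by positivity)
  refine ⟨γ, M * (2 * G), hγ0, by positivity, fun s hs t ht x => ?_⟩
  have hsu : ∀ t x, s * u t x ≤ |u t x| := fun t x => by
    have := le_abs_self (s * u t x)
    rwa [abs_mul, hs, one_mul] at this
  have hA0 : 0 ≤ M * (2 * G) * exp (-(γ * (t - 1))) := by positivity
  by_cases hx : |R| < ‖x‖
  · have := hR t (by linarith) x ((le_abs_self R).trans hx.le)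
    linarith [hsu t x]
  push Not at hx
  let W : SpT n → ℝ := fun p => s * u p.1 p.2 - M * exp (-(γ * (p.1 - 1))) * (2 * G - exp (l * p.2 i₀))
  suffices h : W (t, x) ≤ δ by
    have h1 : M * exp (-(γ * (t - 1))) * (2 * G - exp (l * x i₀)) ≤ M * exp (-(γ * (t - 1))) * (2 * G) :=
      mul_le_mul_of_nonneg_left (by linarith [exp_pos (l * x i₀)]) (by positivity)
    linarith
  by_contra! hpos
  have hWc : ContinuousOn W (Icc 1 t ×ˢ closedBall 0 |R|) := by
    have h1 : ContinuousOn (fun p : SpT n => u p.1 p.2) (Icc 1 t ×ˢ closedBall 0 |R|) :=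
      hF.smooth.continuousOn.mono fun p hp => ⟨lt_of_lt_of_le one_pos hp.1.1, mem_univ _⟩
    have h2 : Continuous fun p : SpT n => M * exp (-(γ * (p.1 - 1))) * (2 * G - exp (l * p.2 i₀)) := by fun_prop
    exact (continuousOn_const.mul h1).sub h2.continuousOn
  obtain ⟨⟨τ, y⟩, ⟨⟨hτ1, hτ2⟩, hy⟩, hmax⟩ := (isCompact_Icc.prod (isCompact_closedBall 0 |R|)).exists_isMaxOn
    ⟨(t, x), ⟨ht, le_rfl⟩, by simpa using hx⟩ hWc
  simp only [mem_closedBall, dist_zero_right] at hy hτ1 hτ2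
  have hmax' : ∀ r ∈ Icc 1 t, ∀ z : Eu n, ‖z‖ ≤ |R| → W (r, z) ≤ W (τ, y) := fun r hr z hz =>
    hmax (show (r, z) ∈ Icc 1 t ×ˢ closedBall 0 |R| from ⟨hr, by simpa using hz⟩)
  have hWp : δ < W (τ, y) := hpos.trans_le (hmax' t ⟨ht, le_rfl⟩ x hx)
  obtain ⟨hg1, hg2⟩ := hg y hy
  have hτ0 : 0 < τ := by linarith
  have hφ : M * exp (-(γ * (τ - 1))) * 1 ≤ M * exp (-(γ * (τ - 1))) * (2 * G - exp (l * y i₀)) :=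
    mul_le_mul_of_nonneg_left (by linarith) (by positivity)
  have hE : 0 < M * exp (-(γ * (τ - 1))) := by positivity
  have hτ : 1 < τ := by
    refine lt_of_le_of_ne hτ1 fun h => ?_
    rw [← h] at hWp hφ
    simp only [W, sub_self, mul_zero, neg_zero, exp_zero] at hWp hφ
    linarith [hsu 1 y, hM 1 one_pos y]
  have hyR : ‖y‖ < |R| := by
    refine lt_of_le_of_ne hy fun h => ?_
    have := hR τ hτ0 y ((le_abs_self R).trans h.ge)
    linarith [hsu τ y]
  have hd := (hF.eq τ hτ0 y).const_mul s
  refine hF.not_barrier_max hc i₀ (γ := γ) (P := 2 * G) (s := s) (x := y) hτ0 hl0 hE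
      (by rw [hl]; field_simp) ?_ ?_ hd ?_
  · have h1 : γ * (2 * G - exp (l * y i₀)) ≤ γ * (2 * G) := mul_le_mul_of_nonneg_left (by linarith [exp_pos (l * y i₀)]) hγ0.le
    have h2 : γ * (2 * G) = l * G⁻¹ / 2 := by rw [hγ]; field_simp; norm_num
    have h3 := mul_le_mul_of_nonneg_left hg1 hl0.le
    have h4 : 0 < l * G⁻¹ := by positivity
    linarith
  · filter_upwards [continuous_norm.continuousAt.eventually (gt_mem_nhds hyR)] with z hz
    exact hmax' τ ⟨hτ1, hτ2⟩ z hz.le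
  · have h1 : HasDerivAt (fun r => -(γ * (r - 1))) (-(γ * 1)) τ := (((hasDerivAt_id' τ).sub_const 1).const_mul γ).neg
    have h2 := deriv_nonneg_of_left_max (hd.sub ((h1.exp.const_mul M).mul_const (2 * G - exp (l * y i₀)))) hτ
      fun r hr => hmax' r ⟨hr.1, hr.2.trans hτ2⟩ y hy
    linarith

lemma ParFlow.tendsto_zero (hF : ParFlow c K a B u) (hc : 0 < c) (hK : 1 ≤ K) (i₀ : Fin n)
    (hM : ∀ t, 0 < t → ∀ x, |u t x| ≤ M) (hu : ∀ δ, 0 < δ → ∃ R, ∀ t, 0 < t → ∀ x, R ≤ ‖x‖ → |u t x| ≤ δ)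
    (hε : 0 < ε) : ∃ T, ∀ t, T ≤ t → ∀ x, |u t x| ≤ ε := by
  obtain ⟨R, hR⟩ := hu (ε / 2) (half_pos hε)
  obtain ⟨γ, A, hγ, hA, h⟩ := hF.le_barrier hc hK i₀ (half_pos hε).le (by positivity : 0 < |M| + 1)
    (fun t ht x => (hM t ht x).trans (by linarith [le_abs_self M])) hR
  have h1 : Tendsto (fun t => A * exp (-(γ * (t - 1)))) atTop (𝓝 (A * 0)) :=
    (tendsto_exp_neg_atTop_nhds_zero.comp ((tendsto_id.atTop_add tendsto_const_nhds).const_mul_atTop hγ)).const_mul A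
  rw [mul_zero] at h1
  obtain ⟨T, hT⟩ := eventually_atTop.1 (h1.eventually (ge_mem_nhds (half_pos hε)))
  refine ⟨max T 1, fun t ht x => ?_⟩
  have h2 := hT t ((le_max_left _ _).trans ht)
  have h3 := h 1 (by simp) t ((le_max_right _ _).trans ht) x
  have h4 := h (-1) (by simp) t ((le_max_right _ _).trans ht) x
  exact abs_le.2 ⟨by linarith, by linarith⟩

end TimeDecay

section Interpolation

/-- Landau's interpolation inequality. -/
lemma norm_fderiv_le_interpolation {E F : Type*} [NormedAddCommGroup E] [NormedSpace ℝ E] [NormedAddCommGroup F]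
    [NormedSpace ℝ F] {f : E → F} (hf : Differentiable ℝ f) {A : ℝ} (hh : 0 < h) (hA0 : 0 ≤ A) (hB0 : 0 ≤ B)
    (hA : ∀ x, ‖f x‖ ≤ A) (hB : ∀ x y, ‖fderiv ℝ f x - fderiv ℝ f y‖ ≤ B * ‖x - y‖) (x : E) :
    ‖fderiv ℝ f x‖ ≤ 2 * A / h + B * h := by
  refine ContinuousLinearMap.opNorm_le_of_unit_norm (by positivity) fun v hv => ?_
  have h1 := (convex_closedBall x h).norm_image_sub_le_of_norm_fderiv_le' (f := f) (φ := fderiv ℝ f x) (C := B * h)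
    (fun z _ => hf z) (fun z hz => (hB z x).trans (mul_le_mul_of_nonneg_left (by simpa [dist_eq_norm] using hz) hB0))
    (mem_closedBall_self hh.le) (y := x + h • v) (by simp [norm_smul, hv, abs_of_pos hh])
  rw [add_sub_cancel_left, norm_smul, hv, mul_one, norm_eq_abs, abs_of_pos hh, map_smul] at h1
  have h2 : h * ‖fderiv ℝ f x v‖ ≤ 2 * A + B * h * h := by
    have e : h • fderiv ℝ f x v = (f (x + h • v) - f x) - (f (x + h • v) - f x - h • fderiv ℝ f x v) := by abel
    have h3 : ‖h • fderiv ℝ f x v‖ = h * ‖fderiv ℝ f x v‖ := by rw [norm_smul, norm_eq_abs, abs_of_pos hh]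
    rw [← h3, e]
    have h4 := norm_sub_le (f (x + h • v) - f x) (f (x + h • v) - f x - h • fderiv ℝ f x v)
    have h5 := norm_sub_le (f (x + h • v)) (f x)
    linarith [hA (x + h • v), hA x]
  rw [← mul_le_mul_iff_right₀ hh]
  refine h2.trans (le_of_eq ?_)
  field_simp

lemma tendsto_iteratedFDeriv_zero (hs : ∀ t, 0 < t → ContDiff ℝ ∞ (u t))
    (h0 : ∀ ε, 0 < ε → ∃ T, ∀ t, T ≤ t → ∀ x, |u t x| ≤ ε)
    (hder : ∀ l : ℕ, 1 ≤ l → ∃ Cl, ∀ t, 1 ≤ t → ∀ x, ‖iteratedFDeriv ℝ l (u t) x‖ ≤ Cl) (m : ℕ) :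
    ∀ ε, 0 < ε → ∃ T, ∀ t, T ≤ t → ∀ x, ‖iteratedFDeriv ℝ m (u t) x‖ ≤ ε := by
  induction m with
  | zero => simpa only [norm_iteratedFDeriv_zero, norm_eq_abs] using h0
  | succ m ih =>
    intro ε hε
    obtain ⟨B, hB⟩ := hder (m + 2) (by omega)
    obtain ⟨h, hh⟩ : ∃ h, h = ε / (2 * (|B| + 1)) := ⟨_, rfl⟩
    have hh0 : 0 < h := hh ▸ (by positivity)
    obtain ⟨T, hT⟩ := ih (ε * h / 4) (by positivity)
    refine ⟨max T 1, fun t ht x => ?_⟩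
    have ht1 := (le_max_right _ _).trans ht
    have hsm := hs t (by linarith)
    have hd := hsm.differentiable_iteratedFDeriv (WithTop.coe_lt_coe.2 (ENat.natCast_lt_top m))
    have hd1 := hsm.differentiable_iteratedFDeriv (WithTop.coe_lt_coe.2 (ENat.natCast_lt_top (m + 1)))
    have := norm_fderiv_le_interpolation (B := |B| + 1) hd hh0 (by positivity) (by positivity) (hT t ((le_max_left _ _).trans ht))
      (fun y z => by
        have h1 := convex_univ.norm_image_sub_le_of_norm_fderiv_le (C := |B| + 1) (fun z _ => hd1 z) (fun z _ => by
          rw [norm_fderiv_iteratedFDeriv]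
          linarith [hB t ht1 z, le_abs_self B]) (mem_univ z) (mem_univ y)
        rwa [iteratedFDeriv_succ_eq_comp_left, ← dist_eq_norm, Function.comp_apply, Function.comp_apply,
          LinearIsometryEquiv.dist_map, dist_eq_norm] at h1) x
    rw [norm_fderiv_iteratedFDeriv] at this
    refine this.trans (le_of_eq ?_)
    rw [hh]
    field_simp
    ring

end Interpolation

section Assembly

lemma exists_tendsto_bound (hb : ∀ t, 0 < t → ∀ m, ∃ A, ∀ x, ‖iteratedFDeriv ℝ m (u t) x‖ ≤ A)
    (h0 : ∀ m ε, 0 < ε → ∃ T, ∀ t, T ≤ t → ∀ x, ‖iteratedFDeriv ℝ m (u t) x‖ ≤ ε) (l : ℕ) :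
    ∃ v : ℝ → ℝ, Tendsto v atTop (𝓝 0) ∧ ∀ t, 0 < t → ∀ m, m ≤ l → ∀ x, ‖iteratedFDeriv ℝ m (u t) x‖ ≤ v t := by
  let S : ℝ → Set ℝ := fun t => {A | ∀ m ≤ l, ∀ x, ‖iteratedFDeriv ℝ m (u t) x‖ ≤ A}
  have hS : ∀ t, 0 < t → ∀ m, m ≤ l → ∀ x, ‖iteratedFDeriv ℝ m (u t) x‖ ≤ sInf (S t) := fun t ht m hm x => by
    choose A hA using hb t ht
    refine le_csInf ⟨∑ m ∈ Finset.range (l + 1), |A m|, fun m hm x => ?_⟩ fun A hA => hA m hm x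
    exact ((hA m x).trans (le_abs_self _)).trans
      (single_le_sum (f := fun m => |A m|) (fun m _ => abs_nonneg _) (Finset.mem_range.2 (by omega)))
  refine ⟨fun t => sInf (S t), Metric.tendsto_atTop.2 fun ε hε => ?_, hS⟩
  choose T hT using fun m => h0 m (ε / 2) (half_pos hε)
  refine ⟨1 + ∑ m ∈ Finset.range (l + 1), |T m|, fun t ht => ?_⟩
  have hT0 : 0 ≤ ∑ m ∈ Finset.range (l + 1), |T m| := sum_nonneg fun m _ => abs_nonneg _
  have h1 : sInf (S t) ≤ ε / 2 := csInf_le ⟨0, fun A hA => (norm_nonneg _).trans (hA 0 (Nat.zero_le l) 0)⟩ fun m hm x => by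
    have := single_le_sum (f := fun m => |T m|) (fun m _ => abs_nonneg _) (Finset.mem_range.2 (Nat.lt_succ_of_le hm))
    exact hT m t (by linarith [le_abs_self (T m)]) x
  have h2 := (norm_nonneg _).trans (hS t (by linarith) 0 (Nat.zero_le l) 0)
  rw [dist_eq, sub_zero, abs_of_nonneg h2]
  linarith

lemma mcf_decay (hσ : IsAsympFlat σ R₀ C Ω) (hn : 0 < n)
    (hsmooth : ContDiffOn ℝ ∞ (fun p : SpT n => u p.1 p.2) (Ioi 0 ×ˢ univ))
    (hspace : ∃ κ : ℝ, 0 < κ ∧ ∀ t : ℝ, 0 < t → ∀ x, √(gradSq σ (u t) x) ≤ 1 - κ)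
    (heq : ∀ (x : Eu n) (t : ℝ), 0 < t → HasDerivAt (fun s => u s x) (mcfOp σ (u t) x) t)
    {b : Eu n → ℝ} (hbd : ∀ t, 0 < t → ∀ x, |u t x| ≤ b x) (hb0 : ∀ δ, 0 < δ → ∃ R, ∀ x, R ≤ ‖x‖ → b x ≤ δ)
    (hder : ∀ l : ℕ, 1 ≤ l → ∃ Cl, ∀ t, 1 ≤ t → ∀ x, ‖iteratedFDeriv ℝ l (u t) x‖ ≤ Cl) (l : ℕ) :
    ∃ v : ℝ → ℝ, Tendsto v atTop (𝓝 0) ∧ ∀ t, 0 < t → ∀ m, m ≤ l → ∀ x, ‖iteratedFDeriv ℝ m (u t) x‖ ≤ v t := by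
  obtain ⟨κ, hκ, hspace⟩ := hspace
  obtain ⟨c, K, hc, hK, hF⟩ := exists_flow hσ hsmooth hκ hspace heq
  have hu : ∀ δ, 0 < δ → ∃ R, ∀ t, 0 < t → ∀ x, R ≤ ‖x‖ → |u t x| ≤ δ := fun δ hδ => by
    obtain ⟨R, hR⟩ := hb0 δ hδ
    exact ⟨R, fun t ht x hx => (hbd t ht x).trans (hR x hx)⟩
  obtain ⟨M, hM⟩ : ∃ M, ∀ t, 0 < t → ∀ x, |u t x| ≤ M := by
    obtain ⟨R, hR⟩ := hu 1 one_pos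
    refine ⟨1 + (|b 0| + n * K * |R|), fun t ht x => ?_⟩
    rcases le_total R ‖x‖ with h | h
    · have : 0 ≤ |b 0| + n * K * |R| := by positivity
      linarith [hR t ht x h]
    · have h1 := lipschitz_of_pd (hF.smooth_slice ht) (fun i y => hF.grad t ht y i) x 0
      rw [sub_zero] at h1
      have h2 : n * K * ‖x‖ ≤ n * K * |R| := mul_le_mul_of_nonneg_left (h.trans (le_abs_self R)) (by positivity)
      have h3 := abs_sub_abs_le_abs_sub (u t x) (u t 0)
      linarith [(hbd t ht 0).trans (le_abs_self _)]
  exact exists_tendsto_bound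
    (fun t ht m => hF.exists_iteratedFDeriv_bound hσ hn hκ (fun t ht x => gradSq_le_of_sqrt hσ hκ (hspace t ht x)) hc hK hu hM hder ht m)
    (fun m => tendsto_iteratedFDeriv_zero (fun t ht => hF.smooth_slice ht)
      (fun ε hε => hF.tendsto_zero hc hK ⟨0, hn⟩ hM hu hε) hder m) l

end Assembly

end

/- STATEMENT 15: Convergence: a uniformly spacelike smooth solution of the graphical mean
curvature flow on an asymptotically flat ℝⁿ (n ≥ 3), trapped under a barrier b → 0 at
infinity and with uniformly bounded spatial derivatives of all orders on ℝⁿ × [1,∞),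
converges to 0 uniformly in every Cˡ-norm as t → ∞. -/
theorem stmt_15 (n : ℕ) (hn : 3 ≤ n)
    (σ : EuclideanSpace ℝ (Fin n) → Matrix (Fin n) (Fin n) ℝ) (R₀ C : ℝ) (ω : ℝ → ℝ)
    (hσ : IsAsympFlat σ R₀ C ω)
    (u : ℝ → EuclideanSpace ℝ (Fin n) → ℝ)
    -- u ∈ C⁰(ℝⁿ × [0,∞)) ∩ C^∞(ℝⁿ × (0,∞))
    (hcont : ContinuousOn (fun p : ℝ × EuclideanSpace ℝ (Fin n) => u p.1 p.2)
      (Set.Ici (0:ℝ) ×ˢ Set.univ))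
    (hsmooth : ContDiffOn ℝ (⊤ : ℕ∞) (fun p : ℝ × EuclideanSpace ℝ (Fin n) => u p.1 p.2)
      (Set.Ioi (0:ℝ) ×ˢ Set.univ))
    -- uniformly spacelike
    (hspace : ∃ κ : ℝ, 0 < κ ∧ ∀ t : ℝ, 0 < t →
      ∀ x, Real.sqrt (gradSq σ (u t) x) ≤ 1 - κ)
    -- the graphical mean curvature flow equation
    (heq : ∀ (x : EuclideanSpace ℝ (Fin n)) (t : ℝ), 0 < t →
      HasDerivAt (fun s => u s x) (mcfOp σ (u t) x) t)
    -- barrier: |u(x,t)| ≤ b(x) with b → 0 at infinity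
    (b : EuclideanSpace ℝ (Fin n) → ℝ) (hbpos : ∀ x, 0 < b x)
    (hbd : ∀ (t : ℝ), 0 < t → ∀ x, |u t x| ≤ b x)
    (hb0 : ∀ δ : ℝ, 0 < δ →
      ∃ Rδ : ℝ, ∀ x : EuclideanSpace ℝ (Fin n), Rδ ≤ ‖x‖ → b x ≤ δ)
    -- uniform bounds on all spatial derivatives for t ≥ 1
    (hder : ∀ l : ℕ, 1 ≤ l → ∃ Cl : ℝ, ∀ t : ℝ, 1 ≤ t →
      ∀ x, ‖iteratedFDeriv ℝ l (u t) x‖ ≤ Cl) :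
    ∀ l : ℕ, ∃ v : ℝ → ℝ,
      Filter.Tendsto v Filter.atTop (nhds 0) ∧
      ∀ t : ℝ, 0 < t → ∀ m : ℕ, m ≤ l →
        ∀ x, ‖iteratedFDeriv ℝ m (u t) x‖ ≤ v t :=
  fun l => mcf_decay hσ (by omega) hsmooth hspace heq hbd hb0 hder l
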